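/- For every ε > 0 there exists k_0 = k_0(ε) such that for all integers k ≥ k_0 and all integers n with 2 ≤ n < k the following hold. (i) If s ≥ (6+ε) k log k, then every system of two degree-k equations and one degree-n equation in s variables, with nonzero integer coefficients, in which every 2×2 minor of the degree-k coefficient matrix is nonzero, and which has a non-singular positive real solution and non-singular solutions in ℚ_p^s for all primes p, possesses a solution in positive integers. (ii) The same conclusion holds with s ≥ (8+ε) k log k for systems of two degree-k and two degree-n equations in which every 2×2 minor of each of the two coefficient matrices is nonzero. (iii) The same conclusion holds with s ≥ (4+ε) k log k + 2 n log n for systems of one degree-k and two degree-n equations in which every 2×2 minor of the degree-n coefficient matrix is nonzero. -/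

import Mathlib

open Finset Filter
open scoped BigOperators ComplexConjugate Topology

set_option linter.unusedSectionVars false

/-- The additive character `x ↦ exp (2πix)`. -/
noncomputable def ee (x : ℝ) : ℂ := Complex.exp (2 * Real.pi * x * Complex.I)

lemma ee_add (x y : ℝ) : ee (x + y) = ee x * ee y := by
  simp only [ee, ← Complex.exp_add]; congr 1; push_cast; ring

@[simp] lemma ee_zero : ee 0 = 1 := by simp [ee]

@[simp] lemma norm_ee (x : ℝ) : ‖ee x‖ = 1 := by
  have : (2 * Real.pi * x * Complex.I : ℂ) = ((2 * Real.pi * x : ℝ) : ℂ) * Complex.I := by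
    push_cast; ring
  rw [ee, this, Complex.norm_exp_ofReal_mul_I]

lemma ee_ne_zero (x : ℝ) : ee x ≠ 0 := Complex.exp_ne_zero _

lemma ee_neg (x : ℝ) : ee (-x) = conj (ee x) := by
  simp only [ee, ← Complex.exp_conj]
  congr 1
  have : conj (2 : ℂ) = 2 := Complex.conj_ofNat 2
  simp [this]

lemma ee_sum {β : Type*} (s : Finset β) (f : β → ℝ) :
    ee (∑ i ∈ s, f i) = ∏ i ∈ s, ee (f i) := by
  classical
  induction s using Finset.induction_on with
  | empty => simp
  | insert a s ha ih => rw [sum_insert ha, prod_insert ha, ee_add, ih]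

lemma ee_int (m : ℤ) : ee m = 1 := by
  rw [ee, Complex.exp_eq_one_iff]
  exact ⟨m, by push_cast; ring⟩

lemma ee_eq_one_iff (x : ℝ) : ee x = 1 ↔ ∃ m : ℤ, x = m := by
  constructor
  · intro h
    rw [ee, Complex.exp_eq_one_iff] at h
    obtain ⟨m, hm⟩ := h
    refine ⟨m, ?_⟩
    have hpi : (2 * Real.pi * Complex.I : ℂ) ≠ 0 := Complex.two_pi_I_ne_zero
    have : (x : ℂ) = m := by
      apply mul_right_cancel₀ hpi
      rw [← hm]; ring
    exact_mod_cast this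
  · rintro ⟨m, rfl⟩; exact ee_int m

lemma ee_add_int (x : ℝ) (m : ℤ) : ee (x + m) = ee x := by rw [ee_add, ee_int, mul_one]

lemma ee_nat_mul (x : ℝ) (m : ℕ) : ee (m * x) = ee x ^ m := by
  simp only [ee, ← Complex.exp_nat_mul]; congr 1; push_cast; ring

/-- The discrete torus: vectors with all coordinates in `{0, 1/N, …, (N-1)/N}`. -/
noncomputable def grid (ι : Type*) [Fintype ι] [DecidableEq ι] (N : ℕ) : Finset (ι → ℝ) :=
  Fintype.piFinset fun _ => (range N).image fun t : ℕ => (t : ℝ) / N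

/-- The pairing of a frequency vector with an integer vector. -/
def dot {ι : Type*} [Fintype ι] (α : ι → ℝ) (v : ι → ℤ) : ℝ := ∑ i, α i * v i

section dot
variable {ι : Type*} [Fintype ι]

lemma dot_add (α : ι → ℝ) (v w : ι → ℤ) : dot α (v + w) = dot α v + dot α w := by
  simp [dot, mul_add, sum_add_distrib]

lemma dot_neg (α : ι → ℝ) (v : ι → ℤ) : dot α (-v) = -dot α v := by
  simp [dot]

lemma dot_sub (α : ι → ℝ) (v w : ι → ℤ) : dot α (v - w) = dot α v - dot α w := by
  rw [sub_eq_add_neg, dot_add, dot_neg, sub_eq_add_neg]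

@[simp] lemma dot_zero (α : ι → ℝ) : dot α 0 = 0 := by simp [dot]

lemma dot_sum {β : Type*} (s : Finset β) (α : ι → ℝ) (v : β → ι → ℤ) :
    dot α (∑ b ∈ s, v b) = ∑ b ∈ s, dot α (v b) := by
  classical
  induction s using Finset.induction_on with
  | empty => simp
  | insert a s ha ih => rw [sum_insert ha, sum_insert ha, dot_add, ih]

end dot

/-- The exponential sum with phases `α · ψ z`, `z ∈ R`. -/
noncomputable def expS {ι β : Type*} [Fintype ι] (R : Finset β) (ψ : β → ι → ℤ) (α : ι → ℝ) : ℂ :=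
  ∑ z ∈ R, ee (dot α (ψ z))

section expS
variable {ι β γ : Type*} [Fintype ι]

lemma norm_expS_le (R : Finset β) (ψ : β → ι → ℤ) (α : ι → ℝ) : ‖expS R ψ α‖ ≤ #R := by
  refine (norm_sum_le _ _).trans ?_
  simp

lemma expS_mul (R : Finset β) (R' : Finset γ) (ψ : β → ι → ℤ) (ψ' : γ → ι → ℤ) (α : ι → ℝ) :
    expS R ψ α * expS R' ψ' α = expS (R ×ˢ R') (fun z => ψ z.1 + ψ' z.2) α := by
  simp only [expS, sum_mul_sum, sum_product, dot_add, ee_add]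

lemma conj_expS (R : Finset β) (ψ : β → ι → ℤ) (α : ι → ℝ) :
    conj (expS R ψ α) = expS R (fun z => -ψ z) α := by
  simp only [expS, map_sum, dot_neg, ee_neg]

lemma norm_sq_expS (R : Finset β) (ψ : β → ι → ℤ) (α : ι → ℝ) :
    ((‖expS R ψ α‖ ^ 2 : ℝ) : ℂ) = expS (R ×ˢ R) (fun z => ψ z.1 - ψ z.2) α := by
  have : ((‖expS R ψ α‖ ^ 2 : ℝ) : ℂ) = expS R ψ α * conj (expS R ψ α) := by
    rw [Complex.mul_conj, Complex.normSq_eq_norm_sq]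
  rw [this, conj_expS, expS_mul]
  simp only [sub_eq_add_neg]

lemma prod_expS {κ : Type*} [Fintype κ] [DecidableEq κ] (R : κ → Finset β)
    (ψ : κ → β → ι → ℤ) (α : ι → ℝ) :
    ∏ i, expS (R i) (ψ i) α = expS (Fintype.piFinset R) (fun z => ∑ i, ψ i (z i)) α := by
  simp only [expS, dot_sum, ee_sum]
  rw [prod_univ_sum]

lemma expS_pow (t : ℕ) (R : Finset β) (ψ : β → ι → ℤ) (α : ι → ℝ) :
    expS R ψ α ^ t =
      expS (Fintype.piFinset fun _ : Fin t => R) (fun z => ∑ i, ψ (z i)) α := by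
  rw [← prod_expS (fun _ : Fin t => R) (fun _ => ψ)]; simp

end expS

section average
variable {ι β γ : Type*} [Fintype ι] [DecidableEq ι]

lemma grid_nonempty {N : ℕ} (hN : 0 < N) : (grid ι N).Nonempty := by
  rw [grid, Fintype.piFinset_nonempty]
  intro _
  simpa using hN.ne'

lemma injective_div {N : ℕ} (hN : 0 < N) : Function.Injective fun t : ℕ => (t : ℝ) / N := by
  intro a b h
  have : (N : ℝ) ≠ 0 := by positivity
  have h2 : (a : ℝ) = b := by
    simpa [div_left_inj' this] using h
  exact_mod_cast h2

lemma card_grid {N : ℕ} (hN : 0 < N) : #(grid ι N) = N ^ Fintype.card ι := by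
  rw [grid, Fintype.card_piFinset]
  simp [card_image_of_injective _ (injective_div hN)]

lemma sum_range_ee {N : ℕ} (hN : 0 < N) (m : ℤ) :
    ∑ t ∈ range N, ee ((t : ℝ) / N * m) = if (N : ℤ) ∣ m then (N : ℂ) else 0 := by
  have hN' : (N : ℝ) ≠ 0 := by positivity
  have hterm : ∀ t : ℕ, ee ((t : ℝ) / N * m) = ee ((m : ℝ) / N) ^ t := by
    intro t; rw [← ee_nat_mul]; congr 1; ring
  simp only [hterm]
  split_ifs with h
  · obtain ⟨c, rfl⟩ := h
    have : ee (((N * c : ℤ) : ℝ) / N) = 1 := by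
      rw [ee_eq_one_iff]; exact ⟨c, by push_cast; field_simp⟩
    rw [this]; simp
  · have h1 : ee ((m : ℝ) / N) ≠ 1 := by
      rw [Ne, ee_eq_one_iff]
      rintro ⟨c, hc⟩
      apply h
      refine ⟨c, ?_⟩
      rw [div_eq_iff hN'] at hc
      have : (m : ℝ) = ((N * c : ℤ) : ℝ) := by rw [hc]; push_cast; ring
      exact_mod_cast this
    rw [geom_sum_eq h1]
    rw [← ee_nat_mul, show (N : ℝ) * (m / N) = ((m : ℤ) : ℝ) by field_simp, ee_int]
    simp

lemma expect_ee_dot {N : ℕ} (hN : 0 < N) (v : ι → ℤ) :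
    𝔼 α ∈ grid ι N, ee (dot α v) = if ∀ i, (N : ℤ) ∣ v i then 1 else 0 := by
  rw [expect_eq_sum_div_card, card_grid hN]
  have h1 : ∑ α ∈ grid ι N, ee (dot α v) = ∏ i, if (N : ℤ) ∣ v i then (N : ℂ) else 0 := by
    simp only [← sum_range_ee hN]
    have : ∀ i, ∑ t ∈ range N, ee ((t : ℝ) / N * v i) =
        ∑ a ∈ (range N).image (fun t : ℕ => (t : ℝ) / N), ee (a * v i) := by
      intro i
      rw [sum_image (fun a _ b _ h => injective_div hN h)]
    simp only [this, prod_univ_sum, grid, dot, ee_sum]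
  rw [h1]
  split_ifs with h
  · have hN' : (N : ℂ) ≠ 0 := by exact_mod_cast hN.ne'
    simp [h, hN']
  · push Not at h
    obtain ⟨i, hi⟩ := h
    rw [prod_eq_zero (mem_univ i) (by simp [hi])]
    simp

open Classical in
lemma expect_expS {N : ℕ} (hN : 0 < N) (R : Finset β) (ψ : β → ι → ℤ) :
    𝔼 α ∈ grid ι N, expS R ψ α = #{z ∈ R | ∀ i, (N : ℤ) ∣ ψ z i} := by
  simp only [expS]
  rw [expect_sum_comm]
  simp only [expect_ee_dot hN]
  simp [sum_boole]

/-- For all large `N` divisibility of the finitely many values by `N` means vanishing. -/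
lemma eventually_dvd_iff (R : Finset β) (ψ : β → ι → ℤ) :
    ∀ᶠ N : ℕ in atTop, 0 < N ∧ ∀ z ∈ R, (∀ i, (N : ℤ) ∣ ψ z i) ↔ ψ z = 0 := by
  obtain ⟨B, hB⟩ : ∃ B : ℕ, ∀ z ∈ R, ∀ i, (ψ z i).natAbs < B := by
    refine ⟨∑ z ∈ R, ∑ i, (ψ z i).natAbs + 1, fun z hz i => Nat.lt_succ_of_le ?_⟩
    calc (ψ z i).natAbs ≤ ∑ i, (ψ z i).natAbs :=
          single_le_sum (f := fun i => (ψ z i).natAbs) (fun _ _ => Nat.zero_le _) (mem_univ i)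
      _ ≤ _ := single_le_sum (f := fun z => ∑ i, (ψ z i).natAbs) (fun _ _ => Nat.zero_le _) hz
  filter_upwards [eventually_ge_atTop (B + 1)] with N hN
  refine ⟨by omega, fun z hz => ⟨fun h => ?_, fun h i => by simp [h]⟩⟩
  funext i
  have := hB z hz i
  have h2 := h i
  exact Int.eq_zero_of_abs_lt_dvd h2 (by rw [Int.abs_eq_natAbs]; omega)

open Classical in
lemma eventually_expect_expS (R : Finset β) (ψ : β → ι → ℤ) :
    ∀ᶠ N : ℕ in atTop, 𝔼 α ∈ grid ι N, expS R ψ α = #{z ∈ R | ψ z = 0} := by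
  filter_upwards [eventually_dvd_iff R ψ] with N hN
  rw [expect_expS hN.1, filter_congr hN.2]

open Classical in
/-- The number of solutions of `∑ (ψ x_i - ψ y_i) = 0` with `x_i, y_i ∈ R`, `i < t`. -/
noncomputable def mv (t : ℕ) (R : Finset β) (ψ : β → ι → ℤ) : ℕ :=
  #{z ∈ Fintype.piFinset fun _ : Fin t => R ×ˢ R | ∑ i, (ψ (z i).1 - ψ (z i).2) = 0}

lemma norm_pow_expS (t : ℕ) (R : Finset β) (ψ : β → ι → ℤ) (α : ι → ℝ) :
    ((‖expS R ψ α‖ ^ (2 * t) : ℝ) : ℂ) =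
      expS (Fintype.piFinset fun _ : Fin t => R ×ˢ R) (fun z => ∑ i, (ψ (z i).1 - ψ (z i).2)) α := by
  rw [← expS_pow t (R ×ˢ R) (fun z => ψ z.1 - ψ z.2), ← norm_sq_expS, pow_mul]; push_cast; rfl

lemma eventually_expect_norm_pow (t : ℕ) (R : Finset β) (ψ : β → ι → ℤ) :
    ∀ᶠ N : ℕ in atTop, 𝔼 α ∈ grid ι N, ‖expS R ψ α‖ ^ (2 * t) = mv t R ψ := by
  filter_upwards [eventually_expect_expS (Fintype.piFinset fun _ : Fin t => R ×ˢ R)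
    (fun z => ∑ i, (ψ (z i).1 - ψ (z i).2))] with N hN
  rw [mv, ← Complex.ofReal_inj, Complex.ofReal_natCast, ← hN]
  refine (map_expect Complex.ofRealHom _ _).trans ?_
  exact expect_congr rfl fun α _ => norm_pow_expS t R ψ α

open Classical in
/-- Solutions of a shifted system are at most as numerous as those of the unshifted one. -/
lemma card_shift_le (t : ℕ) (R : Finset β) (ψ : β → ι → ℤ) (h : ι → ℤ) :
    #{z ∈ Fintype.piFinset fun _ : Fin t => R ×ˢ R | ∑ i, (ψ (z i).1 - ψ (z i).2) = h} ≤
      mv t R ψ := by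
  have e1 := eventually_expect_expS (Fintype.piFinset fun _ : Fin t => R ×ˢ R)
    (fun z => ∑ i, (ψ (z i).1 - ψ (z i).2) - h)
  obtain ⟨N, h1, h2⟩ := (e1.and (eventually_expect_norm_pow t R ψ)).exists
  simp only [sub_eq_zero] at h1
  have : ‖𝔼 α ∈ grid ι N, expS (Fintype.piFinset fun _ : Fin t => R ×ˢ R)
    (fun z => ∑ i, (ψ (z i).1 - ψ (z i).2) - h) α‖ ≤
      𝔼 α ∈ grid ι N, ‖expS R ψ α‖ ^ (2 * t) := by
    refine RCLike.norm_expect_le (K := ℂ).trans (expect_le_expect fun α _ => le_of_eq ?_)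
    have h3 : expS (Fintype.piFinset fun _ : Fin t => R ×ˢ R)
        (fun z => ∑ i, (ψ (z i).1 - ψ (z i).2) - h) α =
        ((‖expS R ψ α‖ ^ (2 * t) : ℝ) : ℂ) * ee (-dot α h) := by
      rw [norm_pow_expS]
      simp only [expS, sum_mul, ← ee_add, sub_eq_add_neg, dot_add, dot_neg]
    rw [h3, norm_mul, norm_ee, mul_one, Complex.norm_real]
    exact abs_of_nonneg (by positivity)
  rw [h1, h2] at this
  simpa using this

end average

/-- The monomial vector `(x ^ d i)_i`. -/
def mono {ι : Type*} (d : ι → ℕ) (x : ℕ) : ι → ℤ := fun i => (x : ℤ) ^ d i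

section level
variable {ι : Type*} [Fintype ι] [DecidableEq ι]

lemma mono_mul (d : ι → ℕ) (q y : ℕ) (i : ι) : mono d (q * y) i = (q : ℤ) ^ d i * mono d y i := by
  simp [mono, mul_pow]

lemma mono_injective [Nonempty ι] {d : ι → ℕ} (hd : ∀ i, d i ≠ 0) :
    Function.Injective (mono d) := by
  intro x y h
  have h1 := congrFun h (Classical.arbitrary ι)
  simp only [mono] at h1
  simp_all

lemma mv_mono_mul (t : ℕ) (d : ι → ℕ) {q : ℕ} (hq : q ≠ 0) (A : Finset ℕ) :
    mv t A (fun y => mono d (q * y)) = mv t A (mono d) := by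
  unfold mv
  congr 1
  ext z
  simp only [mem_filter, and_congr_right_iff]
  intro _
  simp only [funext_iff, Finset.sum_apply, Pi.sub_apply, Pi.zero_apply, mono_mul, ← mul_sub,
    ← mul_sum, mul_eq_zero, pow_eq_zero_iff', Nat.cast_eq_zero, hq, false_and, false_or]

/-- The sum over residue classes `c` modulo `q` of the squared exponential sums over the part of
`A` in the class `c`. -/
noncomputable def classSum (d : ι → ℕ) (A : Finset ℕ) (q : ℕ) (α : ι → ℝ) : ℝ :=
  ∑ c ∈ range q, ‖expS {x ∈ A | x % q = c} (mono d) α‖ ^ 2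

/-- Pairs in `A` which agree modulo `q`. -/
def congrPairs (A : Finset ℕ) (q : ℕ) : Finset (ℕ × ℕ) := {z ∈ A ×ˢ A | z.1 % q = z.2 % q}

lemma classSum_nonneg (d : ι → ℕ) (A : Finset ℕ) (q : ℕ) (α : ι → ℝ) :
    0 ≤ classSum d A q α := sum_nonneg fun _ _ => by positivity

lemma classSum_eq (d : ι → ℕ) (A : Finset ℕ) {q : ℕ} (hq : q ≠ 0) (α : ι → ℝ) :
    (classSum d A q α : ℂ) = expS (congrPairs A q) (fun z => mono d z.1 - mono d z.2) α := by
  unfold classSum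
  rw [Complex.ofReal_sum]
  simp only [norm_sq_expS]
  unfold expS
  rw [← sum_fiberwise_of_maps_to (s := congrPairs A q) (t := range q) (g := fun z => z.1 % q)]
  · refine sum_congr rfl fun c _ => sum_congr ?_ fun _ _ => rfl
    ext z
    simp only [congrPairs, mem_product, mem_filter]
    constructor
    · rintro ⟨⟨h1, h2⟩, h3, h4⟩; exact ⟨⟨⟨h1, h3⟩, h2.trans h4.symm⟩, h2⟩
    · rintro ⟨⟨⟨h1, h3⟩, h4⟩, h2⟩; exact ⟨⟨h1, h2⟩, h3, h4 ▸ h2⟩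
  · intro z _
    exact mem_range.2 (Nat.mod_lt _ (pos_of_ne_zero hq))

lemma expect_ofReal_eq {N : ℕ} {F : (ι → ℝ) → ℝ} {G : (ι → ℝ) → ℂ} (h : ∀ α, (F α : ℂ) = G α) :
    ((𝔼 α ∈ grid ι N, F α : ℝ) : ℂ) = 𝔼 α ∈ grid ι N, G α :=
  (map_expect Complex.ofRealHom _ _).trans (expect_congr rfl fun α _ => h α)

lemma eventually_expect_eq_card {β : Type*} {F : (ι → ℝ) → ℝ} {R : Finset β} {ψ : β → ι → ℤ}
    [DecidablePred fun z => ψ z = 0] (h : ∀ α, (F α : ℂ) = expS R ψ α) :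
    ∀ᶠ N : ℕ in atTop, 𝔼 α ∈ grid ι N, F α = #{z ∈ R | ψ z = 0} := by
  filter_upwards [eventually_expect_expS R ψ] with N hN
  have := (expect_ofReal_eq (N := N) h).trans hN
  rw [← Complex.ofReal_inj, this, Complex.ofReal_natCast]
  congr!

/-- The average of `|f_q|^{2s} |F_q|^2`. -/
lemma eventually_expect_congruent (d : ι → ℕ) (s b : ℕ) {q : ℕ} (hq : q ≠ 0) (A A₁ : Finset ℕ)
    (T : Finset (Fin b → ℕ)) M (hT : T ⊆ Fintype.piFinset fun _ => A)
    (hM : ∀ x ∈ T, #{x' ∈ T | ∀ i, (q : ℤ) ^ d i ∣ (∑ j, mono d (x j)) i -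
      (∑ j, mono d (x' j)) i} ≤ M) :
    ∀ᶠ N : ℕ in atTop, 𝔼 α ∈ grid ι N, ‖expS A₁ (fun y => mono d (q * y)) α‖ ^ (2 * s) *
      ‖expS T (fun x => ∑ j, mono d (x j)) α‖ ^ 2 ≤ (#A : ℝ) ^ b * M * mv s A₁ (mono d) := by
  set R := Fintype.piFinset fun _ : Fin s => A₁ ×ˢ A₁
  set ψ : (Fin s → ℕ × ℕ) → ι → ℤ :=
    fun z => ∑ i, (mono d (q * (z i).1) - mono d (q * (z i).2)) with hψ
  set χ : (Fin b → ℕ) × (Fin b → ℕ) → ι → ℤ := fun x => (∑ j, mono d (x.1 j)) - ∑ j, mono d (x.2 j)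
  have key : #{w ∈ R ×ˢ (T ×ˢ T) | ψ w.1 + χ w.2 = 0} ≤ #A ^ b * M * mv s A₁ (mono d) := by
    set T2 := {x ∈ T ×ˢ T | ∀ i, (q : ℤ) ^ d i ∣ χ x i} with hT2
    have hT2c : #T2 ≤ #A ^ b * M := by
      have : #T2 ≤ ∑ x ∈ T, M := by
        rw [hT2, card_filter, sum_product]
        refine sum_le_sum fun x hx => ?_
        rw [← card_filter]
        exact hM x hx
      refine this.trans ?_
      rw [sum_const, smul_eq_mul]
      refine Nat.mul_le_mul_right _ ((card_le_card hT).trans ?_)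
      simp
    calc #{w ∈ R ×ˢ (T ×ˢ T) | ψ w.1 + χ w.2 = 0}
        ≤ ∑ x ∈ T2, #{z ∈ R | ψ z = -χ x} := by
          rw [← card_sigma]
          refine card_le_card_of_injOn (fun w => ⟨w.2, w.1⟩) ?_ ?_
          · rintro ⟨z, x⟩ hw
            simp only [coe_filter, mem_product, Set.mem_ofPred_eq] at hw
            obtain ⟨⟨hz, hx⟩, h0⟩ := hw
            have h1 := eq_neg_of_add_eq_zero_left h0
            simp only [coe_sigma, Set.mem_sigma_iff, mem_coe, mem_filter, hT2, mem_product]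
            refine ⟨⟨hx, fun i => ?_⟩, hz, h1⟩
            have h2 : χ x i = -ψ z i := by rw [h1]; simp
            rw [h2, hψ]
            simp only [Finset.sum_apply, Pi.sub_apply, mono_mul, ← mul_sub, ← mul_sum]
            exact (dvd_mul_right _ _).neg_right
          · rintro ⟨z, x⟩ _ ⟨z', x'⟩ _ h
            grind
      _ ≤ ∑ x ∈ T2, mv s A₁ (mono d) := by
          refine sum_le_sum fun x _ => ?_
          rw [← mv_mono_mul s d hq]
          exact card_shift_le s A₁ (fun y => mono d (q * y)) (-χ x)
      _ ≤ _ := by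
          rw [sum_const, smul_eq_mul]
          exact Nat.mul_le_mul_right _ hT2c
  have := eventually_expect_eq_card (R := R ×ˢ (T ×ˢ T)) (ψ := fun w => ψ w.1 + χ w.2)
    (F := fun α => ‖expS A₁ (fun y => mono d (q * y)) α‖ ^ (2 * s) *
      ‖expS T (fun x => ∑ j, mono d (x j)) α‖ ^ 2) (fun α => by
        rw [Complex.ofReal_mul, norm_pow_expS, norm_sq_expS, expS_mul])
  filter_upwards [this] with N hN
  rw [hN]
  exact_mod_cast key

/-- The average of `|f|^2 G_q^u`, summed over `q`. -/
lemma eventually_expect_classSum [Nonempty ι] {d : ι → ℕ} (hd : ∀ i, d i ≠ 0) (u C : ℕ)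
    (P A : Finset ℕ) (hP : ∀ q ∈ P, q ≠ 0)
    (hC : ∀ x ∈ A, ∀ y ∈ A, x ≠ y → #{q ∈ P | x % q = y % q} ≤ C) :
    ∀ᶠ N : ℕ in atTop, 𝔼 α ∈ grid ι N, ∑ q ∈ P, ‖expS A (mono d) α‖ ^ 2 * classSum d A q α ^ u ≤
      C * 𝔼 α ∈ grid ι N, ‖expS A (mono d) α‖ ^ (2 * (u + 1)) + #P * (#A : ℝ) ^ (u + 1) := by
  set D : ℕ × ℕ → ι → ℤ := fun z => mono d z.1 - mono d z.2 with hD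
  set ψ : (ℕ × ℕ) × (Fin u → ℕ × ℕ) → ι → ℤ := fun w => D w.1 + ∑ i, D (w.2 i) with hψ
  set R := fun q => (A ×ˢ A) ×ˢ Fintype.piFinset fun _ : Fin u => congrPairs A q
  set R' := (A ×ˢ A) ×ˢ Fintype.piFinset fun _ : Fin u => A ×ˢ A with hR'
  have hsub : ∀ q, R q ⊆ R' := fun q => product_subset_product_right
    (Fintype.piFinset_subset _ _ fun _ => filter_subset _ _)
  have h1 : ∀ q ∈ P, ∀ᶠ N : ℕ in atTop,
      𝔼 α ∈ grid ι N, ‖expS A (mono d) α‖ ^ 2 * classSum d A q α ^ u = #{w ∈ R q | ψ w = 0} := by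
    intro q hq
    apply eventually_expect_eq_card
    intro α
    rw [Complex.ofReal_mul, norm_sq_expS, Complex.ofReal_pow, classSum_eq d A (hP q hq), expS_pow,
      expS_mul]
  have h2 : ∀ᶠ N : ℕ in atTop,
      𝔼 α ∈ grid ι N, ‖expS A (mono d) α‖ ^ (2 * (u + 1)) = #{w ∈ R' | ψ w = 0} := by
    apply eventually_expect_eq_card
    intro α
    rw [show 2 * (u + 1) = 2 + 2 * u by ring, pow_add, Complex.ofReal_mul, norm_sq_expS,
      norm_pow_expS, expS_mul]
  have key : ∑ q ∈ P, #{w ∈ R q | ψ w = 0} ≤ C * #{w ∈ R' | ψ w = 0} + #P * #A ^ (u + 1) := by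
    set S := {w ∈ R' | ψ w = 0} with hS
    set S0 := {w ∈ S | ∀ i, (w.2 i).1 = (w.2 i).2} with hS0
    have hS0c : #S0 ≤ #A ^ (u + 1) := by
      have : #(A ×ˢ Fintype.piFinset fun _ : Fin u => A) = #A ^ (u + 1) := by simp [pow_succ']
      rw [← this]
      refine card_le_card_of_injOn (fun w => (w.1.1, fun i => (w.2 i).1)) ?_ ?_
      · intro w hw
        grind
      · have aux : ∀ w ∈ S0, w.1.1 = w.1.2 := by
          intro w hw
          rw [hS0, mem_filter, hS, mem_filter] at hw
          have h3 : ψ w = D w.1 := by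
            simp only [hψ, hD]
            rw [sum_eq_zero (fun i _ => by rw [hw.2 i, sub_self]), add_zero]
          have h4 := hw.1.2
          rw [h3] at h4
          exact mono_injective hd (sub_eq_zero.1 h4)
        intro w hw w' hw' h
        have e1 := aux w hw
        have e2 := aux w' hw'
        rw [mem_coe, hS0, mem_filter] at hw hw'
        simp only [Prod.mk.injEq, funext_iff] at h
        refine Prod.ext (Prod.ext h.1 (by rw [← e1, ← e2, h.1])) (funext fun i => ?_)
        exact Prod.ext (h.2 i) (by rw [← hw.2 i, ← hw'.2 i, h.2 i])
    calc ∑ q ∈ P, #{w ∈ R q | ψ w = 0}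
        = ∑ q ∈ P, ∑ w ∈ S, if w ∈ R q then 1 else 0 := by
          refine sum_congr rfl fun q _ => ?_
          rw [← card_filter]
          congr 1
          ext w
          simp only [hS, mem_filter]
          exact ⟨fun h => ⟨⟨hsub q h.1, h.2⟩, h.1⟩, fun h => ⟨h.2, h.1.2⟩⟩
      _ = ∑ w ∈ S, #{q ∈ P | w ∈ R q} := by rw [sum_comm]; simp only [card_filter]
      _ ≤ ∑ w ∈ S, (C + if (∀ i, (w.2 i).1 = (w.2 i).2) then #P else 0) := by
          refine sum_le_sum fun w hw => ?_
          split_ifs with h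
          · exact (card_filter_le _ _).trans (Nat.le_add_left _ _)
          · push Not at h
            obtain ⟨i, hi⟩ := h
            rw [hS, mem_filter, hR', mem_product, Fintype.mem_piFinset] at hw
            have hwi := mem_product.1 (hw.1.2 i)
            refine (card_le_card ?_).trans (hC _ hwi.1 _ hwi.2 hi)
            intro q hq
            rw [mem_filter] at hq ⊢
            refine ⟨hq.1, ?_⟩
            have := (mem_product.1 hq.2).2
            rw [Fintype.mem_piFinset] at this
            exact (mem_filter.1 (this i)).2
      _ ≤ _ := by
          rw [sum_add_distrib, sum_const, smul_eq_mul, mul_comm, ← sum_filter, sum_const,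
            smul_eq_mul, mul_comm (#_) (#P)]
          gcongr
  filter_upwards [(eventually_all_finset P).2 h1, h2] with N hN1 hN2
  rw [expect_sum_comm, sum_congr rfl hN1, hN2]
  exact_mod_cast key

/-- Replacing `G_q` by `|f|^2` increases the average of `|f_q|^2 G_q^u`. -/
lemma eventually_expect_classSum_le (d : ι → ℕ) (u : ℕ) (P A A₁ : Finset ℕ) (hP : ∀ q ∈ P, q ≠ 0) :
    ∀ᶠ N : ℕ in atTop,
      𝔼 α ∈ grid ι N, ∑ q ∈ P, ‖expS A₁ (fun y => mono d (q * y)) α‖ ^ 2 * classSum d A q α ^ u ≤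
      𝔼 α ∈ grid ι N, (∑ q ∈ P, ‖expS A₁ (fun y => mono d (q * y)) α‖ ^ 2) *
        ‖expS A (mono d) α‖ ^ (2 * u) := by
  have h1 : ∀ q ∈ P, ∀ᶠ N : ℕ in atTop,
      𝔼 α ∈ grid ι N, ‖expS A₁ (fun y => mono d (q * y)) α‖ ^ 2 * classSum d A q α ^ u ≤
      𝔼 α ∈ grid ι N, ‖expS A₁ (fun y => mono d (q * y)) α‖ ^ 2 *
        ‖expS A (mono d) α‖ ^ (2 * u) := by
    intro q hq
    have a1 := eventually_expect_eq_card (ι := ι)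
      (F := fun α => ‖expS A₁ (fun y => mono d (q * y)) α‖ ^ 2 * classSum d A q α ^ u) (fun α => by
        rw [Complex.ofReal_mul, norm_sq_expS, Complex.ofReal_pow, classSum_eq d A (hP q hq),
          expS_pow, expS_mul])
    have a2 := eventually_expect_eq_card (ι := ι)
      (F := fun α => ‖expS A₁ (fun y => mono d (q * y)) α‖ ^ 2 * ‖expS A (mono d) α‖ ^ (2 * u))
      (fun α => by rw [Complex.ofReal_mul, norm_sq_expS, norm_pow_expS, expS_mul])
    filter_upwards [a1, a2] with N b1 b2
    rw [b1, b2]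
    refine Nat.cast_le.2 (card_le_card (filter_subset_filter _ ?_))
    exact product_subset_product_right (Fintype.piFinset_subset _ _ fun _ => filter_subset _ _)
  filter_upwards [(eventually_all_finset P).2 h1] with N hN
  simp only [sum_mul]
  rw [expect_sum_comm, expect_sum_comm]
  exact sum_le_sum hN

/-- The pointwise inequality behind the recursion. -/
lemma level_pointwise (s b C : ℕ) (hb : 1 ≤ b) (hs : 1 ≤ s) {P : Finset ℕ} {F : ℝ}
    {f g G : ℕ → ℝ} {l : ℝ} (hl : 0 < l)
    (hF : 0 ≤ F) (hf : ∀ q ∈ P, 0 ≤ f q) (hG : ∀ q ∈ P, 0 ≤ G q) (hsum : F ≤ ∑ q ∈ P, f q)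
    (h : ∀ q ∈ P, F ^ b ≤ 2 * g q ∨ F ≤ C * f q ∨ F ^ 2 ≤ C * G q) :
    F ^ (2 * (s + b)) ≤ 4 * 4 ^ s * (#P : ℝ) ^ (2 * s - 1) * ∑ q ∈ P, f q ^ (2 * s) * g q ^ 2 +
      C ^ (2 * (s + b)) * ∑ q ∈ P, f q ^ (2 * (s + b)) +
      ∑ q ∈ P, (l * F ^ 2 + l⁻¹ * f q ^ 2) * (C * G q) ^ (s + b - 1) := by
  have n1 : 0 ≤ 4 * 4 ^ s * (#P : ℝ) ^ (2 * s - 1) * ∑ q ∈ P, f q ^ (2 * s) * g q ^ 2 :=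
    mul_nonneg (by positivity) (sum_nonneg fun q hq => by have := hf q hq; positivity)
  have n2 : 0 ≤ (C : ℝ) ^ (2 * (s + b)) * ∑ q ∈ P, f q ^ (2 * (s + b)) :=
    mul_nonneg (by positivity) (sum_nonneg fun q hq => by have := hf q hq; positivity)
  have n3' : ∀ q ∈ P, 0 ≤ (l * F ^ 2 + l⁻¹ * f q ^ 2) * (C * G q) ^ (s + b - 1) := by
    intro q hq; have := hG q hq; positivity
  have n3 := sum_nonneg n3'
  set P1 := {q ∈ P | F ^ b ≤ 2 * g q}
  set P2 := {q ∈ P | ¬ F ^ b ≤ 2 * g q}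
  have hsplit : ∑ q ∈ P1, f q + ∑ q ∈ P2, f q = ∑ q ∈ P, f q := sum_filter_add_sum_filter_not P _ f
  by_cases c1 : F ≤ 2 * ∑ q ∈ P1, f q
  · have hP1 : ∀ q ∈ P1, 0 ≤ f q := fun q hq => hf q (mem_filter.1 hq).1
    have e1 : F ^ (2 * s) ≤ 4 ^ s * ((#P : ℝ) ^ (2 * s - 1) * ∑ q ∈ P1, f q ^ (2 * s)) := by
      calc F ^ (2 * s) ≤ (2 * ∑ q ∈ P1, f q) ^ (2 * s) := pow_le_pow_left₀ hF c1 _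
        _ = 4 ^ s * (∑ q ∈ P1, f q) ^ (2 * s - 1 + 1) := by
          rw [mul_pow, pow_mul, show 2 * s - 1 + 1 = 2 * s by omega]; norm_num
        _ ≤ 4 ^ s * ((#P1 : ℝ) ^ (2 * s - 1) * ∑ q ∈ P1, f q ^ (2 * s - 1 + 1)) := by
          gcongr; exact pow_sum_le_card_mul_sum_pow hP1 _
        _ ≤ _ := by
          rw [show 2 * s - 1 + 1 = 2 * s by omega]
          have := sum_nonneg fun q hq => pow_nonneg (hP1 q hq) (2 * s)
          gcongr
          exact filter_subset _ _
    have e2 : F ^ (2 * (s + b)) ≤ 4 * 4 ^ s * (#P : ℝ) ^ (2 * s - 1) *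
        ∑ q ∈ P, f q ^ (2 * s) * g q ^ 2 := by
      calc F ^ (2 * (s + b)) = F ^ (2 * s) * F ^ (2 * b) := by rw [← pow_add]; ring
        _ ≤ 4 ^ s * ((#P : ℝ) ^ (2 * s - 1) * ∑ q ∈ P1, f q ^ (2 * s)) * F ^ (2 * b) := by gcongr
        _ = 4 ^ s * #P ^ (2 * s - 1) * ∑ q ∈ P1, f q ^ (2 * s) * F ^ (2 * b) := by
          rw [← sum_mul]; ring
        _ ≤ 4 ^ s * (#P : ℝ) ^ (2 * s - 1) * ∑ q ∈ P1, 4 * (f q ^ (2 * s) * g q ^ 2) := by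
          refine mul_le_mul_of_nonneg_left (sum_le_sum fun q hq => ?_) (by positivity)
          have h1 := (mem_filter.1 hq).2
          have h2 := hP1 q hq
          calc f q ^ (2 * s) * F ^ (2 * b) = f q ^ (2 * s) * (F ^ b) ^ 2 := by
                rw [← pow_mul, mul_comm b 2]
            _ ≤ f q ^ (2 * s) * (2 * g q) ^ 2 := by gcongr
            _ = _ := by ring
        _ ≤ 4 ^ s * (#P : ℝ) ^ (2 * s - 1) * ∑ q ∈ P, 4 * (f q ^ (2 * s) * g q ^ 2) := by
          refine mul_le_mul_of_nonneg_left ?_ (by positivity)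
          refine sum_le_sum_of_subset_of_nonneg (filter_subset _ _) fun q hq _ => ?_
          have := hf q hq; positivity
        _ = _ := by rw [← mul_sum]; ring
    linarith
  · have c2 : F ≤ 2 * ∑ q ∈ P2, f q := by linarith
    by_cases c3 : ∃ q ∈ P2, F ≤ C * f q
    · obtain ⟨q, hq, hqf⟩ := c3
      have hqP := (mem_filter.1 hq).1
      have : F ^ (2 * (s + b)) ≤ (C : ℝ) ^ (2 * (s + b)) * ∑ q ∈ P, f q ^ (2 * (s + b)) := by
        calc F ^ (2 * (s + b)) ≤ (C * f q) ^ (2 * (s + b)) := pow_le_pow_left₀ hF hqf _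
          _ = (C : ℝ) ^ (2 * (s + b)) * f q ^ (2 * (s + b)) := mul_pow _ _ _
          _ ≤ _ := by
            gcongr
            exact single_le_sum (f := fun q => f q ^ (2 * (s + b)))
              (fun q hq => pow_nonneg (hf q hq) _) hqP
      linarith
    · push Not at c3
      have : F ^ (2 * (s + b)) ≤
          ∑ q ∈ P, (l * F ^ 2 + l⁻¹ * f q ^ 2) * (C * G q) ^ (s + b - 1) := by
        calc F ^ (2 * (s + b)) = F * (F * (F ^ 2) ^ (s + b - 1)) := by
              rw [← pow_mul, ← pow_succ', ← pow_succ']; congr 1; omega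
          _ ≤ (2 * ∑ q ∈ P2, f q) * (F * (F ^ 2) ^ (s + b - 1)) := by gcongr
          _ = ∑ q ∈ P2, (2 * F * f q) * (F ^ 2) ^ (s + b - 1) := by
              rw [mul_sum, sum_mul]; exact sum_congr rfl fun _ _ => by ring
          _ ≤ ∑ q ∈ P2, (l * F ^ 2 + l⁻¹ * f q ^ 2) * (C * G q) ^ (s + b - 1) := by
              refine sum_le_sum fun q hq => ?_
              obtain ⟨hqP, hq2⟩ := mem_filter.1 hq
              have h1 : F ^ 2 ≤ C * G q := by grind
              have h2 : 2 * F * f q ≤ l * F ^ 2 + l⁻¹ * f q ^ 2 := by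
                have h3 : l * F ^ 2 + l⁻¹ * f q ^ 2 - 2 * F * f q = l⁻¹ * (l * F - f q) ^ 2 := by
                  field_simp; ring
                have : 0 ≤ l⁻¹ * (l * F - f q) ^ 2 := by positivity
                linarith
              have := hf q hqP
              gcongr
          _ ≤ _ := sum_le_sum_of_subset_of_nonneg (filter_subset _ _) fun q hq _ => n3' q hq
      linarith

lemma young_split {u : ℕ} {K X Y : ℝ} (hK : 0 < K) (hX : 0 ≤ X) (hY : 0 ≤ Y) :
    K * (X * Y ^ u) ≤ 4⁻¹ * Y ^ (u + 1) + K * (4 * K) ^ u * X ^ (u + 1) := by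
  rcases le_total (4 * K * X) Y with h | h
  · have : K * (X * Y ^ u) ≤ 4⁻¹ * Y ^ (u + 1) := by
      rw [pow_succ]; nlinarith [pow_nonneg hY u, mul_le_mul_of_nonneg_left h (pow_nonneg hY u)]
    have : 0 ≤ K * (4 * K) ^ u * X ^ (u + 1) := by positivity
    linarith
  · have : K * (X * Y ^ u) ≤ K * (X * (4 * K * X) ^ u) := by gcongr
    have e : K * (X * (4 * K * X) ^ u) = K * (4 * K) ^ u * X ^ (u + 1) := by
      rw [mul_pow, pow_succ]; ring
    have : 0 ≤ 4⁻¹ * Y ^ (u + 1) := by positivity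
    linarith

lemma level_arith {s b u p : ℕ} {J J₁ Js a m k c L K E₁ E₃ E₄ C : ℝ} (hs : 1 ≤ s) (hk : 0 ≤ k)
    (hc : 0 ≤ c) (hK : 0 ≤ K) (hL : 0 ≤ L) (hJ₁ : 0 ≤ J₁) (ha : 0 ≤ a) (hm : 0 ≤ m * Js)
    (main : J ≤ k * (p : ℝ) ^ (2 * s - 1) * E₁ + (c + K * p ^ u) * (p * J₁) + L * E₃ + E₄ +
      4⁻¹ * J) (h₁ : E₁ ≤ p * (a ^ b * m * Js)) (h₃ : E₃ ≤ C * J + p * a ^ (u + 1)) (h₄ : E₄ ≤ 0)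
    (hLC : L * C = 4⁻¹) (hL1 : L ≤ 1) :
    J ≤ 2 * (k + c + K + 1) * ((p : ℝ) ^ (2 * s) * a ^ b * m * Js + p ^ (u + 1) * J₁ +
      p * a ^ (u + 1)) := by
  have b7 : (p : ℝ) ^ (2 * s - 1) * p = p ^ (2 * s) := by rw [← pow_succ]; congr 1; omega
  have b1 := mul_le_mul_of_nonneg_left h₁ (show 0 ≤ k * p ^ (2 * s - 1) by positivity)
  have b3 := mul_le_mul_of_nonneg_left h₃ hL
  obtain ⟨X, hX⟩ : ∃ X, X = (p : ℝ) ^ (2 * s) * a ^ b * m * Js := ⟨_, rfl⟩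
  obtain ⟨Y, hY⟩ : ∃ Y, Y = p ^ (u + 1) * J₁ := ⟨_, rfl⟩
  obtain ⟨Z, hZ⟩ : ∃ Z, Z = p * a ^ (u + 1) := ⟨_, rfl⟩
  have hX0 : 0 ≤ X := by rw [hX, mul_assoc]; positivity
  have hY0 : 0 ≤ Y := by rw [hY]; positivity
  have hZ0 : 0 ≤ Z := by rw [hZ]; positivity
  have c1 : k * (p : ℝ) ^ (2 * s - 1) * (p * (a ^ b * m * Js)) = k * X := by rw [hX, ← b7]; ring
  have c2 : L * (C * J + Z) ≤ 4⁻¹ * J + Z := by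
    rw [mul_add, ← mul_assoc, hLC]; linarith [mul_le_of_le_one_left hZ0 hL1]
  have c3 : p * J₁ ≤ Y := by
    rw [hY]
    rcases eq_zero_or_pos p with h | h
    · simp [h]
    · have : (1 : ℝ) ≤ p := mod_cast h
      have := le_self_pow₀ this (Nat.succ_ne_zero u)
      gcongr
  have c4 : (c + K * (p : ℝ) ^ u) * (p * J₁) ≤ (c + K) * Y := by
    have : K * p ^ u * (p * J₁) = K * Y := by rw [hY, pow_succ]; ring
    rw [add_mul, this, add_mul]
    gcongr
  rw [← hX, ← hY, ← hZ]
  rw [← hZ] at b3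
  have : J ≤ 2 * (k * X + (c + K) * Y + Z) := by linarith
  refine this.trans (le_of_sub_nonneg ?_)
  have e : 2 * (k + c + K + 1) * (X + Y + Z) - 2 * (k * X + (c + K) * Y + Z) =
      2 * ((c + K + 1) * X + (k + 1) * Y + (k + c + K) * Z) := by ring
  rw [e]
  positivity

/-- The recursive inequality between mean values over `A = {q y : q ∈ P, y ∈ A₁}` and over
`A₁`. -/
theorem level_inequality [Nonempty ι] {d : ι → ℕ} (hd : ∀ i, d i ≠ 0) (b s C : ℕ) (hb : 1 ≤ b)
    (hs : 1 ≤ s) (hC1 : 1 ≤ C) :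
    ∃ K : ℝ, 0 < K ∧ ∀ (P A₁ A : Finset ℕ) (T : ℕ → Finset (Fin b → ℕ)) (M : ℕ),
      (∀ q ∈ P, q ≠ 0) → Set.InjOn (fun z : ℕ × ℕ => z.1 * z.2) (P ×ˢ A₁ : Finset (ℕ × ℕ)) →
      A = (P ×ˢ A₁).image (fun z => z.1 * z.2) → (∀ q ∈ P, T q ⊆ Fintype.piFinset fun _ => A) →
      (∀ q ∈ P, ∀ α : ι → ℝ, ‖expS A (mono d) α‖ ^ b ≤
          2 * ‖expS (T q) (fun x => ∑ j, mono d (x j)) α‖ ∨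
        ‖expS A (mono d) α‖ ≤ C * ‖expS A₁ (fun y => mono d (q * y)) α‖ ∨
        ‖expS A (mono d) α‖ ^ 2 ≤ C * classSum d A q α) →
      (∀ q ∈ P, ∀ x ∈ T q, #{x' ∈ T q | ∀ i, (q : ℤ) ^ d i ∣ (∑ j, mono d (x j)) i -
        (∑ j, mono d (x' j)) i} ≤ M) → (∀ x ∈ A, ∀ y ∈ A, x ≠ y → #{q ∈ P | x % q = y % q} ≤ C) →
      (mv (s + b) A (mono d) : ℝ) ≤ K * ((#P : ℝ) ^ (2 * s) * #A ^ b * M * mv s A₁ (mono d) +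
        #P ^ (s + b) * mv (s + b) A₁ (mono d) + #P * #A ^ (s + b)) := by
  obtain ⟨u, hu⟩ : ∃ u, s + b = u + 1 := ⟨s + b - 1, by omega⟩
  set l := (4 * (C : ℝ) ^ (u + 1))⁻¹ with hl
  have hC0 : 0 < C := mod_cast hC1
  have hl0 : 0 < l := by positivity
  set K1 := l⁻¹ * C ^ u with hK1
  have hK10 : 0 < K1 := by positivity
  set K2 := K1 * (4 * K1) ^ u with hK2
  have hK20 : 0 < K2 := by positivity
  refine ⟨2 * (4 * 4 ^ s + (C : ℝ) ^ (2 * (s + b)) + K2 + 1), by positivity, ?_⟩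
  intro P A₁ A T M hP hinj hA hT h1 h2 h3
  set F := fun α => ‖expS A (mono d) α‖ with hF
  set f := fun α q => ‖expS A₁ (fun y => mono d (q * y)) α‖
  set g := fun α q => ‖expS (T q) (fun x => ∑ j, mono d (x j)) α‖ with hg
  have hfsum : ∀ α, F α ≤ ∑ q ∈ P, f α q := by
    intro α
    have : expS A (mono d) α = ∑ q ∈ P, expS A₁ (fun y => mono d (q * y)) α := by
      simp only [expS]
      rw [hA, sum_image hinj, sum_product]
    rw [hF]; simp only [this]
    exact norm_sum_le _ _
  have hpt : ∀ α, F α ^ (2 * (u + 1)) ≤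
      4 * 4 ^ s * (#P : ℝ) ^ (2 * s - 1) * ∑ q ∈ P, f α q ^ (2 * s) * g α q ^ 2 +
      (C ^ (2 * (s + b)) + K2 * #P ^ u) * ∑ q ∈ P, f α q ^ (2 * (u + 1)) +
      l * C ^ u * ∑ q ∈ P, F α ^ 2 * classSum d A q α ^ u +
      K1 * (∑ q ∈ P, f α q ^ 2 * classSum d A q α ^ u - (∑ q ∈ P, f α q ^ 2) * F α ^ (2 * u)) +
      4⁻¹ * F α ^ (2 * (u + 1)) := by
    intro α
    have a1 := level_pointwise s b C hb hs (P := P) (F := F α) (f := f α) (g := g α)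
      (G := fun q => classSum d A q α) hl0 (norm_nonneg _) (fun _ _ => norm_nonneg _)
      (fun _ _ => classSum_nonneg _ _ _ _) (hfsum α) (fun q hq => h1 q hq α)
    rw [show s + b - 1 = u by omega] at a1
    have a2 : ∑ q ∈ P, (l * F α ^ 2 + l⁻¹ * f α q ^ 2) * (C * classSum d A q α) ^ u =
        l * C ^ u * ∑ q ∈ P, F α ^ 2 * classSum d A q α ^ u +
        K1 * ∑ q ∈ P, f α q ^ 2 * classSum d A q α ^ u := by
      rw [mul_sum, mul_sum, ← sum_add_distrib]
      refine sum_congr rfl fun q _ => ?_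
      rw [hK1, mul_pow]; ring
    have a3 := young_split (u := u) (K := K1) (X := ∑ q ∈ P, f α q ^ 2) (Y := F α ^ 2) hK10
      (sum_nonneg fun _ _ => by positivity) (by positivity)
    rw [← pow_mul, ← pow_mul, ← hK2] at a3
    have a4 : (∑ q ∈ P, f α q ^ 2) ^ (u + 1) ≤ (#P : ℝ) ^ u * ∑ q ∈ P, f α q ^ (2 * (u + 1)) := by
      refine (pow_sum_le_card_mul_sum_pow (fun _ _ => by positivity) _).trans_eq ?_
      simp only [← pow_mul]
    have a5 := mul_le_mul_of_nonneg_left a4 hK20.le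
    rw [hu] at a1
    rw [hu]
    rw [a2] at a1
    linarith
  have e1 := (eventually_all_finset P).2 fun q hq =>
      eventually_expect_congruent d s b (hP q hq) A A₁ (T q) M (hT q hq) (h2 q hq)
  have e2 : ∀ᶠ N : ℕ in atTop, ∀ q ∈ P, 𝔼 α ∈ grid ι N, f α q ^ (2 * (u + 1)) =
      mv (u + 1) A₁ (mono d) := (eventually_all_finset P).2 fun q hq => by
      rw [← mv_mono_mul (u + 1) d (hP q hq)]
      exact eventually_expect_norm_pow _ _ _
  have e3 := eventually_expect_classSum hd u C P A hP h3
  have e4 := eventually_expect_classSum_le d u P A A₁ hP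
  have e5 := eventually_expect_norm_pow (u + 1) A (mono d)
  obtain ⟨N, ⟨⟨⟨⟨e1, e2⟩, e3⟩, e4⟩, e5⟩⟩ := ((((e1.and e2).and e3).and e4).and e5).exists
  have main := expect_le_expect (s := grid ι N) fun α _ => hpt α
  simp only [expect_add_distrib, ← mul_expect, expect_sub_distrib] at main
  rw [e5] at main e3
  rw [expect_sum_comm, expect_sum_comm, sum_congr rfl e2] at main
  have e1' := sum_le_sum e1
  rw [sum_const, nsmul_eq_mul] at e1' main
  have b5 : l * C ^ u * C = 4⁻¹ := by rw [hl, pow_succ]; field_simp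
  have b6 : l * C ^ u ≤ 1 := by
    have : (1 : ℝ) ≤ C := by exact_mod_cast hC1
    have : 0 ≤ l * C ^ u := by positivity
    nlinarith
  rw [hu] at main ⊢
  exact level_arith hs (by positivity) (by positivity) hK20.le (by positivity) (Nat.cast_nonneg _)
    (Nat.cast_nonneg _) (by positivity) main e1' e3
        (mul_nonpos_of_nonneg_of_nonpos hK10.le (sub_nonpos.2 e4)) b5 b6

end level

section congruences

lemma card_le_of_congruent {S : Finset ℕ} {C m : ℕ} (h1 : ∀ x ∈ S, x < C * m)
    (h2 : ∀ x ∈ S, ∀ y ∈ S, (m : ℤ) ∣ (x : ℤ) - y) : #S ≤ C := by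
  rw [← card_range C]
  refine card_le_card_of_injOn (fun x => x / m) ?_ ?_
  · intro x hx
    simp only [coe_range, Set.mem_Iio]
    exact Nat.div_lt_of_lt_mul (by rw [mul_comm]; exact h1 x hx)
  · intro x hx y hy hxy
    have h3 : x % m = y % m :=
      (Nat.modEq_iff_dvd.2 (by simpa using h2 y hy x hx) : x ≡ y [MOD m])
    rw [← Nat.div_add_mod x m, ← Nat.div_add_mod y m, h3]
    simp only at hxy
    rw [hxy]

/-- The quotient `(x ^ k - y ^ k) / (x - y)` modulo a divisor of `x - y`. -/
lemma exists_pow_sub_pow (q x y : ℤ) (k : ℕ) (h : q ∣ x - y) :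
    ∃ S : ℤ, x ^ k - y ^ k = (x - y) * S ∧ q ∣ S - k * x ^ (k - 1) := by
  refine ⟨∑ i ∈ range k, x ^ i * y ^ (k - 1 - i), ?_, ?_⟩
  · rw [mul_comm]; exact (Commute.all x y).geom_sum₂_mul k |>.symm
  · have hxy : y ≡ x [ZMOD q] := (Int.modEq_iff_dvd.2 h)
    have : ∑ i ∈ range k, x ^ i * y ^ (k - 1 - i) ≡ ∑ i ∈ range k, x ^ (k - 1) [ZMOD q] := by
      refine Int.ModEq.sum fun i hi => ?_
      have := mem_range.1 hi
      have e : x ^ (k - 1) = x ^ i * x ^ (k - 1 - i) := by rw [← pow_add]; congr 1; omega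
      rw [e]
      exact (hxy.pow _).mul_left _
    rw [sum_const, card_range, nsmul_eq_mul] at this
    exact Int.modEq_iff_dvd.1 this.symm

lemma prime_dvd_cast {q k : ℕ} (hk : 0 < k) (hkq : k < q) :
    ¬ (q : ℤ) ∣ k := by
  intro h
  exact absurd (Nat.le_of_dvd hk (by exact_mod_cast h)) (by omega)

/-- Uniqueness in Hensel's lemma for `x ^ k`. -/
lemma pow_dvd_sub_of_pow {q : ℕ} (hq : q.Prime) {k l : ℕ} (hk : 0 < k) (hkq : k < q) {x y : ℤ}
    (hx : ¬ (q : ℤ) ∣ x) (hxy : (q : ℤ) ∣ x - y) (h : (q : ℤ) ^ l ∣ x ^ k - y ^ k) :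
    (q : ℤ) ^ l ∣ x - y := by
  obtain ⟨S, hS, hS2⟩ := exists_pow_sub_pow q x y k hxy
  have hqp : Prime (q : ℤ) := Nat.prime_iff_prime_int.1 hq
  have h1 : ¬ (q : ℤ) ∣ S := by
    intro hd
    have : (q : ℤ) ∣ k * x ^ (k - 1) := by
      have := dvd_sub hd hS2
      simpa using this
    rcases hqp.dvd_or_dvd this with h | h
    · exact prime_dvd_cast hk hkq h
    · exact hx (hqp.dvd_of_dvd_pow h)
  rw [hS] at h
  exact IsCoprime.dvd_of_dvd_mul_right
    (((Prime.coprime_iff_not_dvd hqp).2 h1).pow_left) h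

/-- Uniqueness in Hensel's lemma for the pair of equations of degrees `k` and `n`. -/
lemma pow_dvd_sub_of_pair {q : ℕ} (hq : q.Prime) {k n : ℕ} (hn : 0 < n) (hnk : n < k)
    (hkq : k < q) {x y : ℤ × ℤ} (hx1 : ¬ (q : ℤ) ∣ x.1) (hx2 : ¬ (q : ℤ) ∣ x.2)
    (hx : ¬ (q : ℤ) ∣ x.1 ^ (k - n) - x.2 ^ (k - n))
    (h1 : (q : ℤ) ∣ x.1 - y.1) (h2 : (q : ℤ) ∣ x.2 - y.2)
    (hk : (q : ℤ) ^ n ∣ (x.1 ^ k + x.2 ^ k) - (y.1 ^ k + y.2 ^ k))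
    (hn' : (q : ℤ) ^ n ∣ (x.1 ^ n + x.2 ^ n) - (y.1 ^ n + y.2 ^ n)) :
    (q : ℤ) ^ n ∣ x.1 - y.1 := by
  have hqp : Prime (q : ℤ) := Nat.prime_iff_prime_int.1 hq
  obtain ⟨S1, e1, d1⟩ := exists_pow_sub_pow q x.1 y.1 k h1
  obtain ⟨S2, e2, d2⟩ := exists_pow_sub_pow q x.2 y.2 k h2
  obtain ⟨R1, e3, d3⟩ := exists_pow_sub_pow q x.1 y.1 n h1
  obtain ⟨R2, e4, d4⟩ := exists_pow_sub_pow q x.2 y.2 n h2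
  have hdet : (q : ℤ) ^ n ∣ (x.1 - y.1) * (S1 * R2 - S2 * R1) := by
    have := dvd_sub (hk.mul_right R2) (hn'.mul_right S2)
    have e : ((x.1 ^ k + x.2 ^ k) - (y.1 ^ k + y.2 ^ k)) * R2 -
        ((x.1 ^ n + x.2 ^ n) - (y.1 ^ n + y.2 ^ n)) * S2 = (x.1 - y.1) * (S1 * R2 - S2 * R1) := by
      linear_combination R2 * (e1 + e2) - S2 * (e3 + e4)
    rwa [e] at this
  refine IsCoprime.dvd_of_dvd_mul_right
    (((Prime.coprime_iff_not_dvd hqp).2 fun hd => ?_).pow_left) hdet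
  obtain ⟨m, rfl⟩ : ∃ m, k = n + m := ⟨k - n, by omega⟩
  obtain ⟨l, rfl⟩ : ∃ l, n = l + 1 := ⟨n - 1, by omega⟩
  have e5 : ((l + 1 + m : ℕ) : ℤ) * (l + 1 : ℕ) * (x.1 * x.2) ^ l * (x.1 ^ m - x.2 ^ m) =
      (S1 * R2 - S2 * R1) -
      ((S1 - (l + 1 + m : ℕ) * x.1 ^ (l + 1 + m - 1)) * R2 +
        (l + 1 + m : ℕ) * x.1 ^ (l + 1 + m - 1) * (R2 - (l + 1 : ℕ) * x.2 ^ (l + 1 - 1))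
      - (S2 - (l + 1 + m : ℕ) * x.2 ^ (l + 1 + m - 1)) * R1 -
        (l + 1 + m : ℕ) * x.2 ^ (l + 1 + m - 1) * (R1 - (l + 1 : ℕ) * x.1 ^ (l + 1 - 1))) := by
    rw [show l + 1 + m - 1 = l + m by omega, show l + 1 - 1 = l by omega]
    ring
  have h6 : (q : ℤ) ∣ ((l + 1 + m : ℕ) : ℤ) * (l + 1 : ℕ) * (x.1 * x.2) ^ l *
      (x.1 ^ m - x.2 ^ m) := by
    rw [e5]
    exact dvd_sub hd (dvd_sub (dvd_sub (dvd_add (d1.mul_right _) (d4.mul_left _))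
      (d2.mul_right _)) (d3.mul_left _))
  rcases hqp.dvd_or_dvd h6 with h6 | h6
  · rcases hqp.dvd_or_dvd h6 with h6 | h6
    · rcases hqp.dvd_or_dvd h6 with h6 | h6
      · exact prime_dvd_cast (by omega) hkq h6
      · exact prime_dvd_cast (by omega) (by omega) h6
    · rcases hqp.dvd_or_dvd (hqp.dvd_of_dvd_pow h6) with h6 | h6
      · exact hx1 h6
      · exact hx2 h6
  · exact hx (by simpa using h6)

lemma card_pow_eq_le {F : Type*} [Field F] [Fintype F] [DecidableEq F] {n : ℕ} (hn : 0 < n)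
    (a : F) : #{y : F | y ^ n = a} ≤ n := by
  have : ({y : F | y ^ n = a} : Finset F) = (Polynomial.nthRoots n a).toFinset := by
    ext y; simp [Polynomial.mem_nthRoots hn]
  rw [this]
  exact (Multiset.toFinset_card_le _).trans (Polynomial.card_nthRoots n a)

open Polynomial in
lemma pair_polynomial_ne_zero {F : Type*} [Field F] {k n : ℕ} (hn : 0 < n) (hnk : n < k)
    (hk : (k : F) ≠ 0) {u v : F} (huv : ¬ (u = 0 ∧ v = 0)) :
    ((C u - X ^ k) ^ n - (C v - X ^ n) ^ k : F[X]) ≠ 0 := by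
  intro h
  apply huv
  have e1 : ((C u - X ^ k) ^ n : F[X]) = expand F k ((C u - X) ^ n) := by simp
  have e2 : ((C v - X ^ n) ^ k : F[X]) = expand F n ((C v - X) ^ k) := by simp
  rw [e1, e2, sub_eq_zero] at h
  have h0 := congrArg (fun p => coeff p 0) h
  have hn' := congrArg (fun p => coeff p n) h
  simp only [coeff_expand (show 0 < k by omega), coeff_expand hn] at h0 hn'
  rw [if_neg (fun hd => absurd (Nat.le_of_dvd hn hd) (by omega)), if_pos dvd_rfl,
    Nat.div_self hn] at hn'
  have hc : ((C v - X) ^ k : F[X]).coeff 1 = -(k * v ^ (k - 1)) := by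
    have := coeff_derivative ((C v - X) ^ k : F[X]) 0
    rw [zero_add, Nat.cast_zero, zero_add, mul_one] at this
    rw [← this, coeff_zero_eq_eval_zero, derivative_pow]
    simp
  rw [hc] at hn'
  have hv : v = 0 := by
    have : (k : F) * v ^ (k - 1) = 0 := by
      rw [eq_comm, neg_eq_zero] at hn'; exact hn'
    rcases mul_eq_zero.1 this with h | h
    · exact absurd h hk
    · exact eq_zero_of_pow_eq_zero h
  refine ⟨?_, hv⟩
  simp [coeff_zero_eq_eval_zero, hv, show k ≠ 0 by omega] at h0
  exact h0.1

lemma card_pair_le {F : Type*} [Field F] [Fintype F] [DecidableEq F] {k n : ℕ} (hn : 0 < n)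
    (hnk : n < k) (hk : (k : F) ≠ 0) (u v : F) :
    #{z : F × F | z.1 ≠ 0 ∧ z.2 ≠ 0 ∧ z.1 ^ (k - n) ≠ z.2 ^ (k - n) ∧ z.1 ^ k + z.2 ^ k = u ∧
      z.1 ^ n + z.2 ^ n = v} ≤ n * (2 * k * n) := by
  classical
  by_cases huv : u = 0 ∧ v = 0
  · rw [card_eq_zero.2]
    · simp
    · refine filter_eq_empty_iff.2 ?_
      rintro ⟨x, y⟩ _ ⟨hx, hy, hxy, hu, hv⟩
      simp only [huv.1, huv.2] at hx hy hxy hu hv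
      apply hxy
      have hx' : x ^ n ≠ 0 := pow_ne_zero _ hx
      apply mul_left_cancel₀ hx'
      have e1 : x ^ n * x ^ (k - n) = x ^ k := by rw [← pow_add]; congr 1; omega
      have e2 : y ^ n * y ^ (k - n) = y ^ k := by rw [← pow_add]; congr 1; omega
      linear_combination e1 + hu - y ^ (k - n) * hv + e2
  · set R : Polynomial F := (Polynomial.C u - Polynomial.X ^ k) ^ n -
      (Polynomial.C v - Polynomial.X ^ n) ^ k
    have hR : R ≠ 0 := pair_polynomial_ne_zero hn hnk hk huv
    have hdeg : R.natDegree ≤ 2 * k * n := by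
      refine (Polynomial.natDegree_sub_le _ _).trans (max_le ?_ ?_)
      · refine Polynomial.natDegree_pow_le.trans ?_
        have : (Polynomial.C u - Polynomial.X ^ k : Polynomial F).natDegree ≤ k :=
          (Polynomial.natDegree_sub_le _ _).trans (by simp)
        nlinarith
      · refine Polynomial.natDegree_pow_le.trans ?_
        have : (Polynomial.C v - Polynomial.X ^ n : Polynomial F).natDegree ≤ n :=
          (Polynomial.natDegree_sub_le _ _).trans (by simp)
        nlinarith
    set S : Finset (F × F) := {z : F × F | z.1 ≠ 0 ∧ z.2 ≠ 0 ∧ z.1 ^ (k - n) ≠ z.2 ^ (k - n) ∧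
      z.1 ^ k + z.2 ^ k = u ∧ z.1 ^ n + z.2 ^ n = v}
    have h1 : #(S.image Prod.fst) ≤ 2 * k * n := by
      refine le_trans ?_ ((Polynomial.card_roots' R).trans hdeg)
      refine le_trans (card_le_card ?_) (Multiset.toFinset_card_le _)
      intro x hx
      obtain ⟨z, hz, rfl⟩ := mem_image.1 hx
      obtain ⟨-, -, -, hu, hv⟩ := (mem_filter.1 hz).2
      rw [Multiset.mem_toFinset, Polynomial.mem_roots hR, Polynomial.IsRoot.def]
      simp only [R, Polynomial.eval_sub, Polynomial.eval_pow, Polynomial.eval_C,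
        Polynomial.eval_X, ← hu, ← hv]
      ring
    refine (card_le_mul_card_image S n fun x _ => ?_).trans (Nat.mul_le_mul_left _ h1)
    refine le_trans ?_ (card_pow_eq_le hn (v - x ^ n))
    refine card_le_card_of_injOn Prod.snd ?_ ?_
    · intro z hz
      simp only [coe_filter, Set.mem_ofPred_eq, S, mem_filter] at hz
      simp [← hz.1.2.2.2.2.2, ← hz.2]
    · intro z hz z' hz' h
      simp only [coe_filter, Set.mem_ofPred_eq] at hz hz'
      exact Prod.ext (hz.2.trans hz'.2.symm) h

end congruences

/-- The mean value recursion for a block of `b` equations of total defect `ν`: it bounds the mean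
values over `A = {q y : q ∈ P, y ∈ A₁}`, with `P` a set of primes of size about `Q`. -/
def LevelBlock {ι : Type} [Fintype ι] [DecidableEq ι] (d : ι → ℕ) (k b ν : ℕ) : Prop :=
  ∀ s : ℕ, 1 ≤ s → ∀ C : ℕ, ∃ K : ℝ, 0 < K ∧ ∃ Q₀ : ℕ, ∀ Q ≥ Q₀, ∀ P A₁ A : Finset ℕ,
    (∀ q ∈ P, q.Prime ∧ Q < q ∧ q ≤ 4 * Q) → A = (P ×ˢ A₁).image (fun z => z.1 * z.2) →
    (∀ x ∈ A, x < C * Q ^ k) → (∀ y ∈ A₁, ∀ q ∈ P, ¬ q ∣ y) →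
    (mv (s + b) A (mono d) : ℝ) ≤ K * ((#P : ℝ) ^ (2 * s) * (#A : ℝ) ^ b * (Q : ℝ) ^ ν *
        mv s A₁ (mono d) +
      (#P : ℝ) ^ (s + b) * mv (s + b) A₁ (mono d) + #P * (#A : ℝ) ^ (s + b))

section levelBlock

lemma card_prime_dvd_sub_le {P : Finset ℕ} {Q C k x y : ℕ}
    (hP : ∀ q ∈ P, q.Prime ∧ Q < q) (hQ : C ≤ Q) (hx : x < C * Q ^ k) (hy : y < C * Q ^ k)
    (hxy : x ≠ y) : #{q ∈ P | x % q = y % q} ≤ k := by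
  wlog hlt : y < x generalizing x y
  · have := this hy hx hxy.symm (by omega)
    simpa only [eq_comm] using this
  by_contra! hk
  set S := {q ∈ P | x % q = y % q}
  have h1 : ∏ q ∈ S, q ∣ x - y := by
    refine prod_primes_dvd _ (fun q hq => (hP q (mem_filter.1 hq).1).1.prime) fun q hq => ?_
    exact (Nat.modEq_iff_dvd' hlt.le).1 (mem_filter.1 hq).2.symm
  have h2 : Q ^ (k + 1) ≤ ∏ q ∈ S, q := by
    calc Q ^ (k + 1) ≤ Q ^ #S := by
          rcases eq_zero_or_pos Q with rfl | hQ0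
          · simp
          · exact Nat.pow_le_pow_right hQ0 hk
      _ = ∏ q ∈ S, Q := by simp
      _ ≤ _ := prod_le_prod' fun q hq => (hP q (mem_filter.1 hq).1).2.le
  have h3 := Nat.le_of_dvd (by omega) h1
  have h4 : C * Q ^ k ≤ Q ^ (k + 1) := by rw [pow_succ']; exact Nat.mul_le_mul_right _ hQ
  omega

lemma mul_injOn_of_not_dvd {P A₁ : Finset ℕ} (hP : ∀ q ∈ P, q.Prime)
    (hd : ∀ y ∈ A₁, ∀ q ∈ P, ¬ q ∣ y) :
    Set.InjOn (fun z : ℕ × ℕ => z.1 * z.2) (P ×ˢ A₁ : Finset (ℕ × ℕ)) := by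
  rintro ⟨q, y⟩ hz ⟨q', y'⟩ hz' h
  simp only [coe_product, Set.mem_prod, mem_coe] at hz hz' h
  have h1 := h ▸ dvd_mul_right q y
  have h2 : q = q' := by
    rcases (hP q hz.1).dvd_mul.1 h1 with h1 | h1
    · exact (Nat.prime_dvd_prime_iff_eq (hP q hz.1) (hP q' hz'.1)).1 h1
    · exact absurd h1 (hd y' hz'.2 q hz.1)
  subst h2
  rw [Nat.eq_of_mul_eq_mul_left (hP q hz.1).pos h]

lemma filter_dvd_image {P A₁ : Finset ℕ} (hP : ∀ q ∈ P, q.Prime)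
    (hd : ∀ y ∈ A₁, ∀ q ∈ P, ¬ q ∣ y) {q : ℕ} (hq : q ∈ P) :
    {x ∈ (P ×ˢ A₁).image (fun z => z.1 * z.2) | q ∣ x} = A₁.image fun y => q * y := by
  ext x
  simp only [mem_filter, mem_image, mem_product, Prod.exists]
  constructor
  · rintro ⟨⟨q', y, ⟨hq', hy⟩, rfl⟩, h⟩
    rcases (hP q hq).dvd_mul.1 h with h | h
    · rw [(Nat.prime_dvd_prime_iff_eq (hP q hq) (hP q' hq')).1 h]; exact ⟨y, hy, rfl⟩
    · exact absurd h (hd y hy q hq)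
  · rintro ⟨y, hy, rfl⟩
    exact ⟨⟨q, y, ⟨hq, hy⟩, rfl⟩, dvd_mul_right _ _⟩

lemma expS_filter_dvd {ι : Type*} [Fintype ι] {P A₁ A : Finset ℕ} (hP : ∀ q ∈ P, q.Prime)
    (hA : A = (P ×ˢ A₁).image (fun z => z.1 * z.2)) (d : ι → ℕ) (α : ι → ℝ)
    (hd : ∀ y ∈ A₁, ∀ q ∈ P, ¬ q ∣ y) {q : ℕ} (hq : q ∈ P) :
    expS {x ∈ A | q ∣ x} (mono d) α = expS A₁ (fun y => mono d (q * y)) α := by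
  unfold expS
  rw [hA, filter_dvd_image hP hd hq, sum_image]
  intro y _ y' _ h
  exact Nat.eq_of_mul_eq_mul_left (hP q hq).pos h

lemma expS_filter_add {ι : Type*} [Fintype ι] (A : Finset ℕ) (q : ℕ) (ψ : ℕ → ι → ℤ)
    (α : ι → ℝ) : expS A ψ α = expS {x ∈ A | ¬ q ∣ x} ψ α + expS {x ∈ A | q ∣ x} ψ α := by
  unfold expS
  rw [add_comm, sum_filter_add_sum_filter_not]

/-- The form of the level inequality used for both kinds of blocks. -/
lemma levelBlock_of {ι : Type} [Fintype ι] [DecidableEq ι] [Nonempty ι] {d : ι → ℕ} {k b ν C₀ : ℕ}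
    (hd : ∀ i, d i ≠ 0) (hb : 1 ≤ b)
    (h : ∀ C : ℕ, ∃ M₀ : ℕ, ∃ Q₀ : ℕ, ∀ Q ≥ Q₀, ∀ P A₁ A : Finset ℕ,
      (∀ q ∈ P, q.Prime ∧ Q < q ∧ q ≤ 4 * Q) → A = (P ×ˢ A₁).image (fun z => z.1 * z.2) →
      (∀ x ∈ A, x < C * Q ^ k) → (∀ y ∈ A₁, ∀ q ∈ P, ¬ q ∣ y) →
      ∃ T : ℕ → Finset (Fin b → ℕ), (∀ q ∈ P, T q ⊆ Fintype.piFinset fun _ => A) ∧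
      (∀ q ∈ P, ∀ α : ι → ℝ, ‖expS A (mono d) α‖ ^ b ≤
          2 * ‖expS (T q) (fun x => ∑ j, mono d (x j)) α‖ ∨
        ‖expS A (mono d) α‖ ≤ C₀ * ‖expS A₁ (fun y => mono d (q * y)) α‖ ∨
        ‖expS A (mono d) α‖ ^ 2 ≤ C₀ * classSum d A q α) ∧
      (∀ q ∈ P, ∀ x ∈ T q, #{x' ∈ T q | ∀ i, (q : ℤ) ^ d i ∣ (∑ j, mono d (x j)) i -
        (∑ j, mono d (x' j)) i} ≤ M₀ * Q ^ ν)) : LevelBlock d k b ν := by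
  intro s hs C
  obtain ⟨M₀, Q₀, h⟩ := h C
  obtain ⟨K, hK, hK'⟩ := level_inequality hd b s (C₀ + k + 1) hb hs (by omega)
  refine ⟨K * (M₀ + 1), by positivity, max Q₀ C, fun Q hQ P A₁ A hP hA hAb hA₁ => ?_⟩
  obtain ⟨T, hT, h1, h2⟩ := h Q (le_of_max_le_left hQ) P A₁ A hP hA hAb hA₁
  have hC : (C₀ : ℝ) ≤ (C₀ + k + 1 : ℕ) := by push_cast; linarith [(Nat.cast_nonneg k : (0:ℝ) ≤ k)]
  refine (hK' P A₁ A T (M₀ * Q ^ ν) (fun q hq => (hP q hq).1.ne_zero)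
    (mul_injOn_of_not_dvd (fun q hq => (hP q hq).1) hA₁) hA hT ?_ h2 ?_).trans ?_
  · intro q hq α
    rcases h1 q hq α with h | h | h
    · exact Or.inl h
    · exact Or.inr (Or.inl (h.trans (by gcongr)))
    · exact Or.inr (Or.inr (h.trans (mul_le_mul_of_nonneg_right hC (classSum_nonneg _ _ _ _))))
  · intro x hx y hy hxy
    refine (card_prime_dvd_sub_le (fun q hq => ⟨(hP q hq).1, (hP q hq).2.1⟩)
      (le_of_max_le_right hQ) (hAb x hx) (hAb y hy) hxy).trans (by omega)
  · rw [mul_assoc K]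
    refine mul_le_mul_of_nonneg_left ?_ hK.le
    push_cast
    set X := (#P : ℝ) ^ (2 * s) * #A ^ b * Q ^ ν * mv s A₁ (mono d)
    set Y := (#P : ℝ) ^ (s + b) * mv (s + b) A₁ (mono d)
    set Z := #P * (#A : ℝ) ^ (s + b)
    have hX : 0 ≤ X := by positivity
    have hY : 0 ≤ Y := by positivity
    have hZ : 0 ≤ Z := by positivity
    have e : (#P : ℝ) ^ (2 * s) * #A ^ b * (M₀ * Q ^ ν) * mv s A₁ (mono d) = M₀ * X := by
      simp only [X]; ring
    rw [e]
    have hM : (0 : ℝ) ≤ M₀ := Nat.cast_nonneg _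
    nlinarith [mul_nonneg hM hY, mul_nonneg hM hZ]

theorem levelBlock_single {d : ℕ} (hd : 0 < d) : LevelBlock (fun _ : Unit => d) d 1 0 := by
  refine levelBlock_of (C₀ := 2) (fun _ => hd.ne') le_rfl fun C => ⟨C * d, d, ?_⟩
  intro Q hQ P A₁ A hP hA hAb hA₁
  have hP' : ∀ q ∈ P, q.Prime := fun q hq => (hP q hq).1
  refine ⟨fun q => {z ∈ Fintype.piFinset (fun _ : Fin 1 => A) | ¬ q ∣ z 0},
    fun q _ => filter_subset _ _, ?_, ?_⟩
  · intro q hq α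
    have e1 : expS {z ∈ Fintype.piFinset (fun _ : Fin 1 => A) | ¬ q ∣ z 0}
        (fun x => ∑ j, mono (fun _ : Unit => d) (x j)) α =
        expS {x ∈ A | ¬ q ∣ x} (mono fun _ => d) α := by
      unfold expS
      refine sum_nbij' (fun z => z 0) (fun x _ => x) ?_ ?_ ?_ ?_ ?_
      · intro z hz; simpa using hz
      · intro x hx; simpa using hx
      · intro z _; ext i; fin_cases i; rfl
      · intro x _; rfl
      · intro z _; simp
    have e2 := expS_filter_add A q (mono fun _ : Unit => d) α
    rw [expS_filter_dvd hP' hA _ α hA₁ hq] at e2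
    rw [e1, pow_one]
    have h3 := norm_add_le (expS {x ∈ A | ¬ q ∣ x} (mono fun _ : Unit => d) α)
      (expS A₁ (fun y => mono (fun _ : Unit => d) (q * y)) α)
    grind
  · intro q hq x hx
    have : Fact q.Prime := ⟨hP' q hq⟩
    set S := {y ∈ A | ¬ q ∣ y ∧ (q : ℤ) ^ d ∣ (x 0) ^ d - y ^ d} with hS
    have h1 : #S ≤ C * d := by
      refine (card_le_mul_card_image (f := fun y : ℕ => (y : ZMod q)) S C fun z _ => ?_).trans
        (Nat.mul_le_mul_left _ ((card_le_card ?_).trans (card_pow_eq_le hd ((x 0 : ZMod q) ^ d))))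
      · refine card_le_of_congruent (m := q ^ d) ?_ ?_
        · intro y hy
          refine (hAb y (mem_filter.1 (mem_filter.1 hy).1).1).trans_le ?_
          exact Nat.mul_le_mul_left _ (Nat.pow_le_pow_left (hP q hq).2.1.le _)
        · intro y hy y' hy'
          rw [mem_filter, hS, mem_filter] at hy hy'
          refine pow_dvd_sub_of_pow (hP' q hq) hd (hQ.trans_lt (hP q hq).2.1) ?_ ?_ ?_
          · exact_mod_cast hy.1.2.1
          · rw [← ZMod.intCast_eq_intCast_iff_dvd_sub]
            push_cast
            rw [hy.2, hy'.2]
          · have := dvd_sub hy'.1.2.2 hy.1.2.2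
            rwa [sub_sub_sub_cancel_left] at this
      · intro z hz
        obtain ⟨y, hy, rfl⟩ := mem_image.1 hz
        have h := (mem_filter.1 hy).2.2
        simp only [mem_filter, mem_univ, true_and]
        have h2 := (ZMod.intCast_eq_intCast_iff_dvd_sub ((y : ℤ) ^ d) ((x 0) ^ d) q).2
          (dvd_trans (dvd_pow_self _ hd.ne') h)
        push_cast at h2
        exact h2
    rw [pow_zero, mul_one]
    refine (card_le_card_of_injOn (fun z => z 0) ?_ ?_).trans h1
    · intro z hz
      simp only [coe_filter, Set.mem_ofPred_eq, mem_filter, Fintype.mem_piFinset, mono,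
        Finset.sum_apply, Fin.sum_univ_one, Fin.isValue, forall_const] at hz
      grind
    · intro z _ z' _ h
      ext i; fin_cases i; exact h

/-- The degrees of a block of one equation of degree `k` and one of degree `n`. -/
def pairDeg (k n : ℕ) : Bool → ℕ := fun b => bif b then k else n

/-- The pairs of elements of `A` which are nonsingular modulo `q` for the pair of degrees
differing by `m`. -/
def pairSet (A : Finset ℕ) (m q : ℕ) : Finset (Fin 2 → ℕ) :=
  {z ∈ Fintype.piFinset (fun _ : Fin 2 => A) | ¬ q ∣ z 0 ∧ ¬ q ∣ z 1 ∧ ¬ z 0 ^ m ≡ z 1 ^ m [MOD q]}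

/-- The pairs of units modulo `q` with the same `m`-th power contribute little. -/
lemma norm_sum_singular_le {A : Finset ℕ} {m q : ℕ} (hq : q.Prime) (hm : 0 < m) (w : ℕ → ℂ) :
    ‖∑ z ∈ (A ×ˢ A) with ¬ q ∣ z.1 ∧ ¬ q ∣ z.2 ∧ z.1 ^ m ≡ z.2 ^ m [MOD q], w z.1 * w z.2‖ ≤
      m * ∑ c ∈ range q, ‖∑ x ∈ A with x % q = c, w x‖ ^ 2 := by
  have : Fact q.Prime := ⟨hq⟩
  set g := fun c => ∑ x ∈ A with x % q = c, w x with hg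
  set E := {z ∈ range q ×ˢ range q | ¬ q ∣ z.1 ∧ ¬ q ∣ z.2 ∧ z.1 ^ m ≡ z.2 ^ m [MOD q]} with hE
  have hcount : ∀ c, #{c' ∈ range q | c ^ m ≡ c' ^ m [MOD q]} ≤ m := by
    intro c
    refine le_trans (card_le_card_of_injOn (fun x : ℕ => (x : ZMod q)) ?_ ?_)
      (card_pow_eq_le hm ((c : ZMod q) ^ m))
    · intro c' hc'
      simp only [coe_filter, Set.mem_ofPred_eq] at hc'
      have := (ZMod.natCast_eq_natCast_iff _ _ _).2 hc'.2
      push_cast at this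
      simp [this]
    · intro a ha b hb h
      simp only [coe_filter, Set.mem_ofPred_eq, mem_range] at ha hb
      exact Nat.ModEq.eq_of_lt_of_lt ((ZMod.natCast_eq_natCast_iff _ _ _).1 h) ha.1 hb.1
  have e1 : ∑ z ∈ (A ×ˢ A) with ¬ q ∣ z.1 ∧ ¬ q ∣ z.2 ∧ z.1 ^ m ≡ z.2 ^ m [MOD q],
      w z.1 * w z.2 = ∑ c ∈ E, g c.1 * g c.2 := by
    rw [← sum_fiberwise_of_maps_to (t := E) (g := fun z => (z.1 % q, z.2 % q))]
    · refine sum_congr rfl fun c hc => ?_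
      rw [sum_mul_sum, ← sum_product']
      refine sum_congr ?_ fun _ _ => rfl
      obtain ⟨c1, c2⟩ := c
      have hc' := (mem_filter.1 hc).2
      ext ⟨x, y⟩
      simp only [mem_filter, mem_product, Prod.mk.injEq]
      constructor
      · simp_all
      · rintro ⟨⟨hx, rfl⟩, hy, rfl⟩
        refine ⟨⟨⟨hx, hy⟩, ?_, ?_, ?_⟩, rfl, rfl⟩
        · simpa [Nat.dvd_mod_iff] using hc'.1
        · simpa [Nat.dvd_mod_iff] using hc'.2.1
        · exact (((Nat.mod_modEq x q).pow m).symm.trans hc'.2.2).trans ((Nat.mod_modEq y q).pow m)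
    · rintro ⟨x, y⟩ hz
      simp only [mem_filter, mem_product] at hz
      simp only [hE, mem_filter, mem_product, mem_range]
      refine ⟨⟨Nat.mod_lt _ hq.pos, Nat.mod_lt _ hq.pos⟩, ?_, ?_, ?_⟩
      · simpa [Nat.dvd_mod_iff] using hz.2.1
      · simpa [Nat.dvd_mod_iff] using hz.2.2.1
      · exact (((Nat.mod_modEq x q).pow m).trans hz.2.2.2).trans ((Nat.mod_modEq y q).pow m).symm
  have hpair : ∀ (F : ℕ → ℝ), (∀ c, 0 ≤ F c) → ∑ z ∈ range q ×ˢ range q with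
      z.1 ^ m ≡ z.2 ^ m [MOD q], F z.1 ≤ m * ∑ c ∈ range q, F c := by
    intro F hF
    rw [sum_filter, sum_product, mul_sum]
    refine sum_le_sum fun c _ => ?_
    rw [← sum_filter]
    change ∑ a ∈ range q with c ^ m ≡ a ^ m [MOD q], F c ≤ _
    rw [sum_const, nsmul_eq_mul]
    exact mul_le_mul_of_nonneg_right (mod_cast hcount c) (hF c)
  have hswap : ∑ z ∈ range q ×ˢ range q with z.1 ^ m ≡ z.2 ^ m [MOD q], ‖g z.2‖ ^ 2 =
      ∑ z ∈ range q ×ˢ range q with z.1 ^ m ≡ z.2 ^ m [MOD q], ‖g z.1‖ ^ 2 := by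
    refine sum_nbij' Prod.swap Prod.swap ?_ ?_ ?_ ?_ ?_
    · intro z hz; simp only [mem_filter, mem_product] at hz ⊢
      exact ⟨⟨hz.1.2, hz.1.1⟩, hz.2.symm⟩
    · intro z hz; simp only [mem_filter, mem_product] at hz ⊢
      exact ⟨⟨hz.1.2, hz.1.1⟩, hz.2.symm⟩
    · intro z _; rfl
    · intro z _; rfl
    · intro z _; rfl
  rw [e1]
  calc ‖∑ c ∈ E, g c.1 * g c.2‖ ≤ ∑ c ∈ E, (‖g c.1‖ ^ 2 + ‖g c.2‖ ^ 2) / 2 := by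
        refine (norm_sum_le _ _).trans (sum_le_sum fun c _ => ?_)
        rw [norm_mul]
        nlinarith [sq_nonneg (‖g c.1‖ - ‖g c.2‖)]
    _ ≤ ∑ c ∈ range q ×ˢ range q with c.1 ^ m ≡ c.2 ^ m [MOD q],
        (‖g c.1‖ ^ 2 + ‖g c.2‖ ^ 2) / 2 := by
        refine sum_le_sum_of_subset_of_nonneg ?_ fun _ _ _ => by positivity
        grind
    _ = ∑ c ∈ range q ×ˢ range q with c.1 ^ m ≡ c.2 ^ m [MOD q], ‖g c.1‖ ^ 2 := by
        rw [← sum_div, sum_add_distrib, hswap]; ring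
    _ ≤ _ := hpair (fun c => ‖g c‖ ^ 2) fun _ => by positivity

lemma pairSet_trichotomy {ι : Type*} [Fintype ι] {P A₁ A : Finset ℕ} {m q : ℕ}
    (hP : ∀ q ∈ P, q.Prime) (hA : A = (P ×ˢ A₁).image (fun z => z.1 * z.2))
    (hA₁ : ∀ y ∈ A₁, ∀ q ∈ P, ¬ q ∣ y) (hm : 0 < m) (hq : q ∈ P) (d : ι → ℕ) (α : ι → ℝ) :
    ‖expS A (mono d) α‖ ^ 2 ≤ 2 * ‖expS (pairSet A m q) (fun x => ∑ j, mono d (x j)) α‖ ∨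
      ‖expS A (mono d) α‖ ≤ (2 * m + 6 : ℕ) * ‖expS A₁ (fun y => mono d (q * y)) α‖ ∨
      ‖expS A (mono d) α‖ ^ 2 ≤ (2 * m + 6 : ℕ) * classSum d A q α := by
  classical
  set w := fun x => ee (dot α (mono d x)) with hw
  set U := {x ∈ A | ¬ q ∣ x} with hU
  have e1 : expS (pairSet A m q) (fun x => ∑ j, mono d (x j)) α =
      ∑ z ∈ U ×ˢ U with ¬ z.1 ^ m ≡ z.2 ^ m [MOD q], w z.1 * w z.2 := by
    unfold expS
    refine sum_nbij' (fun z => (z 0, z 1)) (fun z => ![z.1, z.2]) ?_ ?_ ?_ ?_ ?_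
    · intro z hz
      simp only [pairSet, mem_filter, Fintype.mem_piFinset] at hz
      simp_all
    · intro z hz
      simp only [hU, mem_filter, mem_product] at hz
      simp only [pairSet, mem_filter, Fintype.mem_piFinset]
      simp_all
    · intro z _; ext i; fin_cases i <;> rfl
    · intro z _; rfl
    · intro z _; simp [hw, dot_add, ee_add]
  set f := expS A (mono d) α
  set h := expS A₁ (fun y => mono d (q * y)) α with hh
  set g := expS U (mono d) α
  have e2 : f = g + h := by
    rw [hh, ← expS_filter_dvd hP hA d α hA₁ hq]
    exact expS_filter_add A q _ α
  have e3 : g ^ 2 = (∑ z ∈ U ×ˢ U with z.1 ^ m ≡ z.2 ^ m [MOD q], w z.1 * w z.2) +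
      ∑ z ∈ U ×ˢ U with ¬ z.1 ^ m ≡ z.2 ^ m [MOD q], w z.1 * w z.2 := by
    rw [sum_filter_add_sum_filter_not, sum_product, ← sum_mul_sum, sq]
    rfl
  have e4 : (∑ z ∈ U ×ˢ U with z.1 ^ m ≡ z.2 ^ m [MOD q], w z.1 * w z.2) =
      ∑ z ∈ (A ×ˢ A) with ¬ q ∣ z.1 ∧ ¬ q ∣ z.2 ∧ z.1 ^ m ≡ z.2 ^ m [MOD q], w z.1 * w z.2 := by
    refine sum_congr ?_ fun _ _ => rfl
    grind
  have h5 := norm_sum_singular_le (A := A) (hP q hq) hm w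
  rw [← e4] at h5
  change _ ≤ m * classSum d A q α at h5
  rw [← e1] at e3
  set E := ∑ z ∈ U ×ˢ U with z.1 ^ m ≡ z.2 ^ m [MOD q], w z.1 * w z.2
  set F := expS (pairSet A m q) (fun x => ∑ j, mono d (x j)) α
  have e6 : f ^ 2 = F + E + 2 * f * h - h ^ 2 := by grind
  have h7 : ‖f‖ ^ 2 ≤ ‖F‖ + ‖E‖ + 2 * ‖f‖ * ‖h‖ + ‖h‖ ^ 2 := by
    have h8 := congrArg norm e6
    rw [norm_pow] at h8
    rw [h8]
    refine (norm_sub_le _ _).trans ?_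
    rw [norm_pow]
    have h9 := norm_add₃_le (a := F) (b := E) (c := 2 * f * h)
    have : ‖2 * f * h‖ = 2 * ‖f‖ * ‖h‖ := by simp
    linarith
  by_contra! hcon
  obtain ⟨c1, c2, c3⟩ := hcon
  push_cast at c2 c3
  have hh0 := norm_nonneg h
  have hG := classSum_nonneg d A q α
  have c4 : 6 * ‖h‖ < ‖f‖ := by nlinarith
  have c5 : (2 * m + 6) * (‖h‖ * ‖f‖) ≤ ‖f‖ ^ 2 := by nlinarith [norm_nonneg f]
  have c6 : ‖h‖ ^ 2 ≤ ‖f‖ * ‖h‖ / 6 := by nlinarith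
  nlinarith [mul_nonneg (Nat.cast_nonneg m) (mul_nonneg hh0 (norm_nonneg f))]

theorem levelBlock_pair {k n : ℕ} (hn : 0 < n) (hnk : n < k) :
    LevelBlock (pairDeg k n) k 2 (k - n) := by
  refine levelBlock_of (C₀ := 2 * (k - n) + 6) (fun i => ?_) (by norm_num)
    fun C => ⟨C * (C * 4 ^ (k - n)) * (n * (2 * k * n)), k, ?_⟩
  · cases i <;> simp only [pairDeg, cond_true, cond_false] <;> omega
  intro Q hQ P A₁ A hP hA hAb hA₁
  have hP' : ∀ q ∈ P, q.Prime := fun q hq => (hP q hq).1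
  refine ⟨fun q => pairSet A (k - n) q, fun q _ => filter_subset _ _, ?_, ?_⟩
  · intro q hq α
    exact pairSet_trichotomy hP' hA hA₁ (by omega) hq _ α
  · intro q hq x _
    have hqp := hP' q hq
    have : Fact q.Prime := ⟨hqp⟩
    have hkq := hQ.trans_lt (hP q hq).2.1
    have hkF : (k : ZMod q) ≠ 0 := by
      rw [Ne, ZMod.natCast_eq_zero_iff]
      exact fun h => absurd (Nat.le_of_dvd (by omega) h) (by omega)
    set u := (x 0 : ℤ) ^ k + (x 1) ^ k
    set v := (x 0) ^ n + (x 1) ^ n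
    have hset : ∀ z ∈ ({x' ∈ pairSet A (k - n) q | ∀ i, (q : ℤ) ^ pairDeg k n i ∣
        (∑ j, mono (pairDeg k n) (x j)) i - (∑ j, mono (pairDeg k n) (x' j)) i} :
        Finset (Fin 2 → ℕ)), z 0 ∈ A ∧ z 1 ∈ A ∧ ¬ q ∣ z 0 ∧ ¬ q ∣ z 1 ∧
        ¬ z 0 ^ (k - n) ≡ z 1 ^ (k - n) [MOD q] ∧ (q : ℤ) ^ k ∣ u - ((z 0) ^ k + (z 1) ^ k) ∧
        (q : ℤ) ^ n ∣ v - ((z 0) ^ n + (z 1) ^ n) := by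
      intro z hz
      simp only [pairSet, mem_filter, Fintype.mem_piFinset, mono, Finset.sum_apply,
        Fin.sum_univ_two] at hz
      exact ⟨hz.1.1 0, hz.1.1 1, hz.1.2.1, hz.1.2.2.1, hz.1.2.2.2, hz.2 true, hz.2 false⟩
    set S := {x' ∈ pairSet A (k - n) q | ∀ i, (q : ℤ) ^ pairDeg k n i ∣
        (∑ j, mono (pairDeg k n) (x j)) i - (∑ j, mono (pairDeg k n) (x' j)) i} with hS
    have hpow : C * Q ^ k ≤ C * (4 ^ (k - n) * Q ^ (k - n)) * q ^ n := by
      calc C * Q ^ k = C * (1 * Q ^ (k - n)) * Q ^ n := by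
            rw [one_mul, mul_assoc, ← pow_add]; congr 2; omega
        _ ≤ _ := by
            gcongr
            · exact Nat.one_le_pow _ _ (by norm_num)
            · exact (hP q hq).2.1.le
    have hbound : #S ≤ C * (C * (4 ^ (k - n) * Q ^ (k - n))) * (n * (2 * k * n)) := by
      refine (card_le_mul_card_image (f := fun z : Fin 2 → ℕ => ((z 0 : ZMod q), (z 1 : ZMod q)))
        S _ fun c _ => ?_).trans (Nat.mul_le_mul_left _ ((card_le_card ?_).trans
          (card_pair_le hn hnk hkF (u : ZMod q) (v : ZMod q))))
      · have hcong : ∀ z ∈ {z ∈ S | ((z 0 : ZMod q), (z 1 : ZMod q)) = c},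
            ∀ z' ∈ {z ∈ S | ((z 0 : ZMod q), (z 1 : ZMod q)) = c},
            (q : ℤ) ∣ (z 0) - z' 0 ∧ (q : ℤ) ∣ (z 1 : ℤ) - z' 1 := by
          intro z hz z' hz'
          have h1 := (mem_filter.1 hz).2.trans (mem_filter.1 hz').2.symm
          rw [Prod.mk.injEq] at h1
          constructor
          · rw [← ZMod.intCast_eq_intCast_iff_dvd_sub]; push_cast; exact h1.1.symm
          · rw [← ZMod.intCast_eq_intCast_iff_dvd_sub]; push_cast; exact h1.2.symm
        refine (card_le_mul_card_image (f := fun z : Fin 2 → ℕ => z 0) _ C fun a _ => ?_).trans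
          (Nat.mul_le_mul_left _ ?_)
        · refine (card_le_card_of_injOn (t := ({z ∈ {z ∈ S | ((z 0 : ZMod q), (z 1 : ZMod q)) = c} |
            z 0 = a}).image fun z => z 1) (fun z => z 1) ?_ ?_).trans
            (card_le_of_congruent (m := q ^ k) ?_ ?_)
          · intro z hz; grind
          · intro z hz z' hz' h
            simp only [coe_filter, Set.mem_ofPred_eq] at hz hz'
            ext i; fin_cases i
            · exact hz.2.trans hz'.2.symm
            · exact h
          · intro y hy
            obtain ⟨z, hz, rfl⟩ := mem_image.1 hy
            have := hset z (mem_filter.1 (mem_filter.1 hz).1).1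
            refine (hAb _ this.2.1).trans_le ?_
            exact Nat.mul_le_mul_left _ (Nat.pow_le_pow_left (hP q hq).2.1.le _)
          · intro y hy y' hy'
            obtain ⟨z, hz, rfl⟩ := mem_image.1 hy
            obtain ⟨z', hz', rfl⟩ := mem_image.1 hy'
            rw [mem_filter] at hz hz'
            have h1 := hset z (mem_filter.1 hz.1).1
            push_cast
            refine pow_dvd_sub_of_pow hqp (by omega) hkq ?_ (hcong z hz.1 z' hz'.1).2 ?_
            · exact_mod_cast h1.2.2.2.1
            · have h3 := dvd_sub (hset z' (mem_filter.1 hz'.1).1).2.2.2.2.2.1 h1.2.2.2.2.2.1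
              rw [hz.2, hz'.2] at h3
              rw [show u - ((a : ℤ) ^ k + (z' 1 : ℤ) ^ k) - (u - ((a : ℤ) ^ k + (z 1 : ℤ) ^ k)) =
                (z 1 : ℤ) ^ k - (z' 1 : ℤ) ^ k by ring] at h3
              exact h3
        · refine card_le_of_congruent (m := q ^ n) ?_ ?_
          · intro y hy
            obtain ⟨z, hz, rfl⟩ := mem_image.1 hy
            exact (hAb _ (hset z (mem_filter.1 hz).1).1).trans_le hpow
          · intro y hy y' hy'
            obtain ⟨z, hz, rfl⟩ := mem_image.1 hy
            obtain ⟨z', hz', rfl⟩ := mem_image.1 hy'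
            have h1 := hset z (mem_filter.1 hz).1
            have h2 := hset z' (mem_filter.1 hz').1
            push_cast
            refine pow_dvd_sub_of_pair (x := ((z 0 : ℤ), (z 1 : ℤ))) (y := ((z' 0 : ℤ), (z' 1 : ℤ)))
              hqp hn hnk hkq (show ¬ (q : ℤ) ∣ (z 0 : ℤ) by exact_mod_cast h1.2.2.1)
              (show ¬ (q : ℤ) ∣ (z 1 : ℤ) by exact_mod_cast h1.2.2.2.1) ?_
              (hcong z hz z' hz').1 (hcong z hz z' hz').2 ?_ ?_
            · intro h
              refine h1.2.2.2.2.1 ((Nat.modEq_iff_dvd.2 ?_).symm)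
              push_cast
              exact h
            · have h3 := dvd_sub h2.2.2.2.2.2.1 h1.2.2.2.2.2.1
              rw [sub_sub_sub_cancel_left] at h3
              exact dvd_trans (pow_dvd_pow _ hnk.le) h3
            · have h3 := dvd_sub h2.2.2.2.2.2.2 h1.2.2.2.2.2.2
              rwa [sub_sub_sub_cancel_left] at h3
      · intro c hc
        obtain ⟨z, hz, rfl⟩ := mem_image.1 hc
        obtain ⟨-, -, h1, h2, h3, h4, h5⟩ := hset z hz
        simp only [mem_filter, mem_univ, true_and]
        refine ⟨?_, ?_, ?_, ?_, ?_⟩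
        · rwa [Ne, ZMod.natCast_eq_zero_iff]
        · rwa [Ne, ZMod.natCast_eq_zero_iff]
        · intro h
          exact h3 ((ZMod.natCast_eq_natCast_iff _ _ _).1 (by push_cast; exact h))
        · have := (ZMod.intCast_eq_intCast_iff_dvd_sub _ _ q).2
            (dvd_trans (dvd_pow_self _ (by omega)) h4)
          push_cast at this
          exact this
        · have := (ZMod.intCast_eq_intCast_iff_dvd_sub _ _ q).2
            (dvd_trans (dvd_pow_self _ (by omega)) h5)
          push_cast at this
          exact this
    refine le_trans (le_of_eq ?_) (hbound.trans (le_of_eq ?_))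
    · rw [hS]; congr!
    · ring

end levelBlock

/-- The primes in `(Q, 4Q]`. -/
def primesIn (Q : ℕ) : Finset ℕ := {q ∈ Ioc Q (4 * Q) | q.Prime}

/-- Products `y₀ q₀ ⋯ q_{j-1}` with `q_i` a prime in `(Q i, 4 Q i]`. -/
def smooth (Q : ℕ → ℕ) (y₀ : ℕ) : ℕ → Finset ℕ
  | 0 => {y₀}
  | j + 1 => (primesIn (Q j) ×ˢ smooth Q y₀ j).image fun z => z.1 * z.2

section smooth

lemma mem_primesIn {Q q : ℕ} : q ∈ primesIn Q ↔ (Q < q ∧ q ≤ 4 * Q) ∧ q.Prime := by simp [primesIn]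

lemma card_primesIn_le (Q : ℕ) : #(primesIn Q) ≤ 3 * Q := by
  refine (card_filter_le _ _).trans ?_
  rw [Nat.card_Ioc]; omega

lemma theta_sub_le (Q : ℕ) : Chebyshev.theta ((4 * Q : ℕ) : ℝ) - Chebyshev.theta (Q : ℝ) ≤
      #(primesIn Q) * Real.log (4 * Q) := by
  have h1 : Chebyshev.theta ((4 * Q : ℕ) : ℝ) - Chebyshev.theta (Q : ℝ) =
      ∑ q ∈ primesIn Q, Real.log q := by
    unfold Chebyshev.theta
    rw [Nat.floor_natCast, Nat.floor_natCast, sub_eq_iff_eq_add, primesIn, sum_filter, sum_filter,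
      sum_filter, add_comm]
    rw [← sum_union]
    · congr 1
      grind
    · simp
  rw [h1, ← nsmul_eq_mul]
  refine sum_le_card_nsmul _ _ _ fun q hq => ?_
  have := mem_primesIn.1 hq
  refine Real.log_le_log (mod_cast this.2.pos) (mod_cast this.1.2)

lemma eventually_const_mul_rpow_le {a b : ℝ} (h : a < b) (C : ℝ) :
    ∀ᶠ x : ℝ in atTop, C * x ^ a ≤ x ^ b := by
  filter_upwards [(tendsto_rpow_atTop (sub_pos.2 h)).eventually_ge_atTop C, eventually_gt_atTop 0]
      with x hx hx0
  calc C * x ^ a ≤ x ^ (b - a) * x ^ a := by gcongr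
    _ = x ^ b := by rw [← Real.rpow_add hx0]; ring_nf

lemma eventually_rpow_le_card_primesIn {δ : ℝ} (hδ : 0 < δ) :
    ∀ᶠ Q : ℕ in atTop, (Q : ℝ) ^ (1 - δ) ≤ #(primesIn Q) := by
  set a := min (δ / 2) (1 / 4)
  have ha0 : 0 < a := by positivity
  have haδ : a ≤ δ / 2 := min_le_left _ _
  have ha4 : a ≤ 1 / 4 := min_le_right _ _
  have hlog : ∀ᶠ x : ℝ in atTop, Real.log (4 * x) ≤ x ^ a := by
    filter_upwards [eventually_const_mul_rpow_le (show a / 2 < a by linarith)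
      (4 ^ (a / 2) / (a / 2)), eventually_gt_atTop 0] with x hx hx0
    refine (Real.log_le_rpow_div (by positivity) (show 0 < a / 2 by linarith)).trans ?_
    rw [Real.mul_rpow (by norm_num) hx0.le]
    grind
  have hl2 := Real.log_two_gt_d9
  have key : ∀ᶠ x : ℝ in atTop, x ^ (1 - δ) * Real.log (4 * x) ≤
      2 * x * Real.log 2 - Real.log (4 * x + 1) - 4 * √x * Real.log (4 * x) := by
    filter_upwards [hlog, eventually_const_mul_rpow_le (show (1 : ℝ) - δ / 2 < 1 by linarith) 8,
      eventually_const_mul_rpow_le (show (3 / 4) < 1 by norm_num) 64,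
      eventually_ge_atTop 16] with x h1 h2 h3 h4
    have hx0 : 0 < x := by linarith
    rw [Real.rpow_one] at h2 h3
    have hx1 : 1 ≤ x := by linarith
    have h5 : Real.log (4 * x + 1) ≤ Real.log (4 * x) + 1 := by
      rw [show 4 * x + 1 = (4 * x) * (1 + 1 / (4 * x)) by field_simp,
        Real.log_mul (by positivity) (by positivity)]
      have : Real.log (1 + 1 / (4 * x)) ≤ 1 / (4 * x) := by
        have := Real.log_le_sub_one_of_pos (show 0 < 1 + 1 / (4 * x) by positivity)
        linarith
      have : 1 / (4 * x) ≤ 1 := by rw [div_le_one (by positivity)]; linarith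
      linarith
    have h6 : x ^ a ≤ x ^ (3 / 4 : ℝ) := Real.rpow_le_rpow_of_exponent_le hx1 (by linarith)
    have h7 : √x * x ^ a ≤ x ^ (3 / 4 : ℝ) := by
      rw [Real.sqrt_eq_rpow, ← Real.rpow_add hx0]
      exact Real.rpow_le_rpow_of_exponent_le hx1 (by linarith)
    have h8 : x ^ (1 - δ) * x ^ a ≤ x ^ (1 - δ / 2) := by
      rw [← Real.rpow_add hx0]
      exact Real.rpow_le_rpow_of_exponent_le hx1 (by linarith)
    have h9 : √x * Real.log (4 * x) ≤ √x * x ^ a := by gcongr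
    have h10 : x ^ (1 - δ) * Real.log (4 * x) ≤ x ^ (1 - δ) * x ^ a := by gcongr
    nlinarith
  filter_upwards [tendsto_natCast_atTop_atTop.eventually key, eventually_ge_atTop 1] with Q hQ hQ1
  have hQ1' : (1 : ℝ) ≤ Q := mod_cast hQ1
  have h1 := Chebyshev.theta_ge (4 * Q)
  have h2 := Chebyshev.theta_le_log4_mul_x (x := Q) (by positivity)
  have h3 := theta_sub_le Q
  have h4 : Real.log 4 = 2 * Real.log 2 := by
    rw [show (4 : ℝ) = 2 ^ 2 by norm_num, Real.log_pow]; norm_num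
  have h5 : √((4 * Q : ℕ) : ℝ) = 2 * √Q := by
    push_cast
    rw [Real.sqrt_mul (by norm_num), show (4 : ℝ) = 2 ^ 2 by norm_num, Real.sqrt_sq (by norm_num)]
  rw [h5] at h1
  rw [h4] at h2
  push_cast at h1 h3
  have h6 : (Q : ℝ) ^ (1 - δ) * Real.log (4 * Q) ≤ #(primesIn Q) * Real.log (4 * Q) := by
    refine hQ.trans (le_trans ?_ h3)
    linarith
  exact le_of_mul_le_mul_right h6 (Real.log_pos (by linarith))

lemma prime_le_of_dvd_smooth {Q : ℕ → ℕ} {y₀ v : ℕ} (hQ : ∀ j, j + 1 < v → 4 * Q j ≤ Q (j + 1))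
    (hy₀ : ∀ q : ℕ, q.Prime → q ∣ y₀ → q ≤ Q 0) {j : ℕ} (hj : j < v) {y : ℕ}
    (hy : y ∈ smooth Q y₀ j) {q : ℕ} (hq : q.Prime) (hqy : q ∣ y) : q ≤ Q j := by
  induction j generalizing y with
  | zero => rw [smooth, mem_singleton] at hy; subst hy; exact hy₀ q hq hqy
  | succ j ih =>
    simp only [smooth, mem_image, mem_product, Prod.exists] at hy
    obtain ⟨q', y', ⟨hq', hy'⟩, rfl⟩ := hy
    have h4 := hQ j hj
    rcases hq.dvd_mul.1 hqy with h | h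
    · have := mem_primesIn.1 hq'
      rw [(Nat.prime_dvd_prime_iff_eq hq this.2).1 h]
      omega
    · have := ih (by omega) hy' h
      omega

lemma lt_prime_of_dvd_smooth {Q : ℕ → ℕ} {y₀ B : ℕ} (j : ℕ) (hQ : ∀ i < j, B ≤ Q i)
    (hy₀ : ∀ q : ℕ, q.Prime → q ∣ y₀ → B < q) {y : ℕ}
    (hy : y ∈ smooth Q y₀ j) {q : ℕ} (hq : q.Prime) (hqy : q ∣ y) : B < q := by
  induction j generalizing y with
  | zero => rw [smooth, mem_singleton] at hy; subst hy; exact hy₀ q hq hqy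
  | succ j ih =>
    simp only [smooth, mem_image, mem_product, Prod.exists] at hy
    obtain ⟨q', y', ⟨hq', hy'⟩, rfl⟩ := hy
    rcases hq.dvd_mul.1 hqy with h | h
    · have := mem_primesIn.1 hq'
      rw [(Nat.prime_dvd_prime_iff_eq hq this.2).1 h]
      grind
    · grind

lemma smooth_bounds (Q : ℕ → ℕ) (y₀ j : ℕ) {y : ℕ} (hy : y ∈ smooth Q y₀ j) :
    y₀ * ∏ i ∈ range j, Q i ≤ y ∧ y ≤ 4 ^ j * (y₀ * ∏ i ∈ range j, Q i) := by
  induction j generalizing y with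
  | zero => rw [smooth, mem_singleton] at hy; subst hy; simp
  | succ j ih =>
    simp only [smooth, mem_image, mem_product, Prod.exists] at hy
    obtain ⟨q', y', ⟨hq', hy'⟩, rfl⟩ := hy
    have h1 := (mem_primesIn.1 hq').1
    have h2 := ih hy'
    rw [prod_range_succ]
    constructor
    · calc y₀ * ((∏ i ∈ range j, Q i) * Q j) = Q j * (y₀ * ∏ i ∈ range j, Q i) := by ring
        _ ≤ _ := Nat.mul_le_mul h1.1.le h2.1
    · calc q' * y' ≤ (4 * Q j) * (4 ^ j * (y₀ * ∏ i ∈ range j, Q i)) := Nat.mul_le_mul h1.2 h2.2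
        _ = _ := by ring

lemma smooth_not_dvd {Q : ℕ → ℕ} {y₀ v : ℕ} (hQ : ∀ j, j + 1 < v → 4 * Q j ≤ Q (j + 1))
    (hy₀ : ∀ q : ℕ, q.Prime → q ∣ y₀ → q ≤ Q 0) {j : ℕ} (hj : j < v) :
    ∀ y ∈ smooth Q y₀ j, ∀ q ∈ primesIn (Q j), ¬ q ∣ y := by
  intro y hy q hq h
  have h1 := mem_primesIn.1 hq
  exact absurd (prime_le_of_dvd_smooth hQ hy₀ hj hy h1.2 h) (by omega)

lemma card_smooth {Q : ℕ → ℕ} {y₀ v : ℕ} (hQ : ∀ j, j + 1 < v → 4 * Q j ≤ Q (j + 1))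
    (hy₀ : ∀ q : ℕ, q.Prime → q ∣ y₀ → q ≤ Q 0) {j : ℕ} (hj : j ≤ v) :
    #(smooth Q y₀ j) = ∏ i ∈ range j, #(primesIn (Q i)) := by
  induction j with
  | zero => simp [smooth]
  | succ j ih =>
    rw [prod_range_succ, ← ih (by omega), smooth, card_image_of_injOn, card_product, mul_comm]
    exact mul_injOn_of_not_dvd (fun q hq => (mem_primesIn.1 hq).2) (smooth_not_dvd hQ hy₀ hj)

lemma card_smooth_le (Q : ℕ → ℕ) (y₀ j : ℕ) : #(smooth Q y₀ j) ≤ 3 ^ j * ∏ i ∈ range j, Q i := by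
  induction j with
  | zero => simp [smooth]
  | succ j ih =>
    rw [prod_range_succ, smooth]
    refine card_image_le.trans ?_
    rw [card_product]
    calc _ ≤ (3 * Q j) * (3 ^ j * ∏ i ∈ range j, Q i) := Nat.mul_le_mul (card_primesIn_le _) ih
      _ = _ := by ring

section mv
variable {ι β : Type*} [Fintype ι] [DecidableEq ι]

lemma mv_mono {R R' : Finset β} (h : R ⊆ R') (t : ℕ) (ψ : β → ι → ℤ) : mv t R ψ ≤ mv t R' ψ := by
  unfold mv
  refine card_le_card fun z hz => ?_
  simp only [mem_filter, Fintype.mem_piFinset, mem_product] at hz ⊢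
  exact ⟨fun i => ⟨h (hz.1 i).1, h (hz.1 i).2⟩, hz.2⟩

lemma mv_add_le (s b : ℕ) (R : Finset β) (ψ : β → ι → ℤ) :
    (mv (s + b) R ψ : ℝ) ≤ (#R : ℝ) ^ (2 * b) * mv s R ψ := by
  obtain ⟨N, h1, h2⟩ := ((eventually_expect_norm_pow (s + b) R ψ).and
    (eventually_expect_norm_pow s R ψ)).exists
  rw [← h1, ← h2, mul_expect]
  refine expect_le_expect fun α _ => ?_
  rw [show 2 * (s + b) = 2 * b + 2 * s by ring, pow_add]
  gcongr
  exact norm_expS_le _ _ _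

end mv

/-- The mean value estimate over smooth numbers. -/
theorem mv_smooth {ι : Type} [Fintype ι] [DecidableEq ι] {d : ι → ℕ} {k b ν D t₀ : ℕ}
    (hLB : LevelBlock d k b ν) (hD : ν + D = k * b) (ht₀ : D + 1 ≤ t₀) (v : ℕ) :
    ∃ C : ℝ, 0 < C ∧ ∃ Q₀₀ : ℕ, ∀ (Q : ℕ → ℕ) (P₀ y₀), 1 ≤ P₀ → y₀ ≤ P₀ →
      (∀ q : ℕ, q.Prime → q ∣ y₀ → q ≤ Q 0) →
      (∀ j < v, Q₀₀ ≤ Q j ∧ Q j ^ k = P₀ * ∏ i ∈ range (j + 1), Q i) →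
      (∀ j, j + 1 < v → 4 * Q j ≤ Q (j + 1)) → (mv (t₀ + b * v) (smooth Q y₀ v) (mono d) : ℝ) ≤
        C * (P₀ * ∏ i ∈ range v, Q i : ℕ) ^ (2 * (t₀ + b * v) - D) * (P₀ : ℝ) ^ D := by
  induction v with
  | zero =>
    refine ⟨1, one_pos, 0, fun Q P₀ y₀ hP₀ _ _ _ _ => ?_⟩
    have h1 : mv (t₀ + b * 0) (smooth Q y₀ 0) (mono d) ≤ 1 := by
      unfold mv
      refine (card_filter_le _ _).trans ?_
      simp [smooth]
    calc (mv (t₀ + b * 0) (smooth Q y₀ 0) (mono d) : ℝ) ≤ 1 := mod_cast h1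
      _ ≤ _ := by
        rw [one_mul]
        have : (1 : ℝ) ≤ P₀ := mod_cast hP₀
        exact one_le_mul_of_one_le_of_one_le (one_le_pow₀ (by simpa using this)) (one_le_pow₀ this)
  | succ v ih =>
    obtain ⟨C, hC, Q₁, ih⟩ := ih
    set s := t₀ + b * v with hs
    obtain ⟨K, hK, Q₂, hLB⟩ := hLB s (by omega) (4 ^ (v + 1) + 1)
    refine ⟨K * (3 ^ (2 * s) * 3 ^ ((v + 1) * b) * C + 3 ^ (s + b) * 3 ^ (v * (2 * b)) * C +
      3 * 3 ^ ((v + 1) * (s + b))), by positivity, max (max Q₁ Q₂) 1, ?_⟩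
    intro Q P₀ y₀ hP₀ hy₀P hy₀ hQ hQ4
    have ih' := ih Q P₀ y₀ hP₀ hy₀P hy₀ (fun j hj => ⟨?_, (hQ j (by omega)).2⟩)
      (fun j hj => hQ4 j (by omega))
    swap
    · grind
    obtain ⟨hQv, hQk⟩ := hQ v (by omega)
    have hR : ∀ j ≤ v + 1, 1 ≤ ∏ i ∈ range j, Q i := fun j hj =>
      Nat.one_le_iff_ne_zero.2 (prod_ne_zero_iff.2 fun i hi => Nat.one_le_iff_ne_zero.1
        ((le_max_right _ _).trans (hQ i (by have := mem_range.1 hi; omega)).1))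
    have hmain := hLB (Q v) ((le_max_right _ _).trans ((le_max_left _ _).trans hQv)) (primesIn (Q
        v)) (smooth Q y₀ v) (smooth Q y₀ (v + 1))
      (fun q hq => ⟨(mem_primesIn.1 hq).2, (mem_primesIn.1 hq).1⟩) rfl ?_
      (smooth_not_dvd hQ4 hy₀ (by omega))
    swap
    · intro x hx
      refine ((smooth_bounds Q y₀ (v + 1) hx).2.trans
        (Nat.mul_le_mul_left _ (Nat.mul_le_mul_right _ hy₀P))).trans_lt ?_
      grind
    have e1 : t₀ + b * (v + 1) = s + b := by rw [hs]; ring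
    rw [e1]
    refine hmain.trans ?_
    have hpr : (#(primesIn (Q v)) : ℝ) ≤ 3 * Q v := by exact_mod_cast card_primesIn_le (Q v)
    set q : ℝ := (Q v : ℝ) with hq
    set R : ℝ := ((∏ i ∈ range v, Q i : ℕ) : ℝ) with hRdef
    set p : ℝ := (P₀ : ℝ) with hp
    have hq1 : 1 ≤ q := Nat.one_le_cast.2 ((le_max_right _ _).trans hQv)
    have hp1 : 1 ≤ p := Nat.one_le_cast.2 hP₀
    have hX : ((P₀ * ∏ i ∈ range (v + 1), Q i : ℕ) : ℝ) = p * R * q := by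
      rw [prod_range_succ]; grind
    have hX' : ((P₀ * ∏ i ∈ range v, Q i : ℕ) : ℝ) = p * R := by push_cast; simp [hp, hRdef]
    have hqk : q ^ k = p * R * q := by rw [← hX, ← hQk]; push_cast; rfl
    have hA : (#(smooth Q y₀ (v + 1)) : ℝ) ≤ 3 ^ (v + 1) * (p * R * q) := by
      have h1 : (#(smooth Q y₀ (v + 1)) : ℝ) ≤ 3 ^ (v + 1) * (∏ i ∈ range (v + 1), Q i : ℕ) := by
        exact_mod_cast card_smooth_le Q y₀ (v + 1)
      rw [← hX]
      refine h1.trans (mul_le_mul_of_nonneg_left ?_ (by positivity))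
      exact_mod_cast Nat.le_mul_of_pos_left _ hP₀
    have hA' : (#(smooth Q y₀ v) : ℝ) ≤ 3 ^ v * (p * R) := by
      have h1 : (#(smooth Q y₀ v) : ℝ) ≤ 3 ^ v * (∏ i ∈ range v, Q i : ℕ) := by
        exact_mod_cast card_smooth_le Q y₀ v
      rw [← hX']
      refine h1.trans (mul_le_mul_of_nonneg_left ?_ (by positivity))
      exact_mod_cast Nat.le_mul_of_pos_left _ hP₀
    rw [hX'] at ih'
    rw [hX]
    set J : ℝ := (mv s (smooth Q y₀ v) (mono d) : ℝ)
    set J' : ℝ := (mv (s + b) (smooth Q y₀ v) (mono d) : ℝ)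
    have hJ : 0 ≤ J := by positivity
    set Y : ℝ := (p * R * q) ^ (2 * (s + b) - D) * p ^ D with hY
    have hsD : D ≤ 2 * s := by omega
    obtain ⟨w, hw⟩ : ∃ w, 2 * s = D + w := ⟨2 * s - D, by omega⟩
    rw [show 2 * s - D = w by omega] at ih'
    have hY' : Y = (p * R * q) ^ (w + 2 * b) * p ^ D := by rw [hY]; congr 2; omega
    have hpR := one_le_mul_of_one_le_of_one_le hp1 (Nat.one_le_cast.2 (hR v (by omega)))
    have t1 : (#(primesIn (Q v)) : ℝ) ^ (2 * s) * (#(smooth Q y₀ (v + 1)) : ℝ) ^ b * q ^ ν * J ≤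
        3 ^ (2 * s) * 3 ^ ((v + 1) * b) * C * Y := by
      calc _ ≤ (3 * q) ^ (2 * s) * (3 ^ (v + 1) * (p * R * q)) ^ b * q ^ ν *
            (C * (p * R) ^ w * p ^ D) := by gcongr
        _ = 3 ^ (2 * s) * 3 ^ ((v + 1) * b) * C * ((p * R * q) ^ b * ((p * R) ^ w * q ^ w) *
            (q ^ (ν + D)) * p ^ D) := by
            rw [hw, mul_pow 3 q, mul_pow (3 ^ (v + 1)) (p * R * q), ← pow_mul 3, pow_add q D w,
              pow_add q ν D]
            ring
        _ = _ := by rw [hD, pow_mul q k b, hqk, ← mul_pow, hY', pow_add (p * R * q) w (2 * b)]; ring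
    have t2 : (#(primesIn (Q v)) : ℝ) ^ (s + b) * J' ≤ 3 ^ (s + b) * 3 ^ (v * (2 * b)) * C * Y := by
      calc _ ≤ (3 * q) ^ (s + b) * ((3 ^ v * (p * R)) ^ (2 * b) * (C * (p * R) ^ w * p ^ D)) := by
            gcongr
            refine (mv_add_le s b (smooth Q y₀ v) (mono d)).trans ?_
            gcongr
        _ = 3 ^ (s + b) * 3 ^ (v * (2 * b)) * C * ((p * R) ^ (w + 2 * b) * q ^ (s + b) * p ^ D) := by
            rw [mul_pow 3 q, mul_pow (3 ^ v) (p * R), ← pow_mul 3, pow_add]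
            ring
        _ ≤ 3 ^ (s + b) * 3 ^ (v * (2 * b)) * C *
            ((p * R) ^ (w + 2 * b) * q ^ (w + 2 * b) * p ^ D) := by
            refine mul_le_mul_of_nonneg_left (mul_le_mul_of_nonneg_right (mul_le_mul_of_nonneg_left
              (pow_le_pow_right₀ hq1 (by omega)) (by positivity)) (by positivity)) (by positivity)
        _ = _ := by rw [hY', ← mul_pow]
    have t3 : (#(primesIn (Q v)) : ℝ) * (#(smooth Q y₀ (v + 1)) : ℝ) ^ (s + b) ≤
        3 * 3 ^ ((v + 1) * (s + b)) * Y := by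
      calc _ ≤ (3 * q) * (3 ^ (v + 1) * (p * R * q)) ^ (s + b) := by gcongr
        _ = 3 * 3 ^ ((v + 1) * (s + b)) * (q * (p * R * q) ^ (s + b)) := by
            rw [mul_pow (3 ^ (v + 1)) (p * R * q), ← pow_mul 3]; ring
        _ ≤ 3 * 3 ^ ((v + 1) * (s + b)) * ((p * R * q) * (p * R * q) ^ (s + b)) := by
            gcongr
            exact le_mul_of_one_le_left (by linarith) hpR
        _ = 3 * 3 ^ ((v + 1) * (s + b)) * (p * R * q) ^ (1 + (s + b)) := by ring
        _ ≤ 3 * 3 ^ ((v + 1) * (s + b)) * (p * R * q) ^ (w + 2 * b) := by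
            exact mul_le_mul_of_nonneg_left (pow_le_pow_right₀
                (one_le_mul_of_one_le_of_one_le hpR hq1) (by omega)) (by positivity)
        _ ≤ _ := by
            rw [hY']
            gcongr
            exact le_mul_of_one_le_right (by positivity) (one_le_pow₀ hp1)
    calc _ ≤ K * (3 ^ (2 * s) * 3 ^ ((v + 1) * b) * C * Y + 3 ^ (s + b) * 3 ^ (v * (2 * b)) * C * Y +
        3 * 3 ^ ((v + 1) * (s + b)) * Y) := by gcongr
      _ = _ := by rw [hY]; ring

end smooth

section popular

lemma exists_popular {S : Finset ℕ} (hS : S.Nonempty) {W₀ : ℕ} (hW₀ : 0 < W₀) {η l E : ℝ}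
    (hη : 0 < η) (hl : 0 < l) (hE : ∀ x ∈ S, l ≤ x ∧ (x : ℝ) ≤ E * l) :
    ∃ S' ⊆ S, ∃ (X : ℝ) (r : ℕ), S'.Nonempty ∧ l ≤ X ∧ X ≤ E * l ∧
      (∀ x ∈ S', X ≤ x ∧ (x : ℝ) ≤ (1 + η) * X ∧ x % W₀ = r) ∧
      #S ≤ (W₀ * (⌊Real.logb (1 + η) E⌋₊ + 1)) * #S' := by
  have h1 : (1 : ℝ) < 1 + η := by linarith
  obtain ⟨x₀, hx₀⟩ := hS
  have hE1 : 1 ≤ E := by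
    have := (hE x₀ hx₀).1.trans (hE x₀ hx₀).2
    by_contra h
    nlinarith
  set g : ℕ → ℕ × ℕ := fun x => (x % W₀, ⌊Real.logb (1 + η) (x / l)⌋₊) with hg
  set Ω := range W₀ ×ˢ range (⌊Real.logb (1 + η) E⌋₊ + 1) with hΩ
  have hmaps : ∀ x ∈ S, g x ∈ Ω := by
    intro x hx
    simp only [hΩ, hg, mem_product, mem_range]
    refine ⟨Nat.mod_lt _ hW₀, Nat.lt_succ_of_le (Nat.floor_le_floor ?_)⟩
    have h2 := hE x hx
    refine Real.logb_le_logb_of_le h1 (div_pos (hl.trans_le h2.1) hl) ?_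
    rw [div_le_iff₀ hl]; exact h2.2
  have hΩne : Ω.Nonempty := ⟨_, hmaps x₀ hx₀⟩
  obtain ⟨ω, hω, hmax⟩ := exists_max_image Ω (fun ω => #{x ∈ S | g x = ω}) hΩne
  have hcard : #S ≤ (W₀ * (⌊Real.logb (1 + η) E⌋₊ + 1)) * #{x ∈ S | g x = ω} := by
    rw [card_eq_sum_card_fiberwise hmaps]
    refine (sum_le_card_nsmul _ _ _ hmax).trans ?_
    rw [smul_eq_mul, hΩ, card_product, card_range, card_range]
  have hne : ({x ∈ S | g x = ω} : Finset ℕ).Nonempty := by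
    rw [← card_pos]
    have := card_pos.2 ⟨x₀, hx₀⟩
    by_contra h
    rw [Nat.le_zero.1 (not_lt.1 h)] at hcard
    omega
  have hfl : ∀ x ∈ ({x ∈ S | g x = ω} : Finset ℕ), l * (1 + η) ^ ω.2 ≤ x ∧
      (x : ℝ) ≤ (1 + η) * (l * (1 + η) ^ ω.2) ∧ x % W₀ = ω.1 := by
    intro x hx
    obtain ⟨hx, hgx⟩ := mem_filter.1 hx
    have h2 := hE x hx
    have h3 : 1 ≤ (x : ℝ) / l := (one_le_div₀ hl).2 h2.1
    have h4 : 0 < (x : ℝ) / l := by linarith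
    have h5 : 0 ≤ Real.logb (1 + η) (x / l) := Real.logb_nonneg h1 h3
    have h6 := Nat.floor_le h5
    have h7 := Nat.lt_floor_add_one (Real.logb (1 + η) (x / l))
    rw [← hgx]
    refine ⟨?_, ?_, rfl⟩
    · rw [Real.le_logb_iff_rpow_le h1 h4, Real.rpow_natCast, le_div_iff₀ hl] at h6
      linarith
    · rw [Real.logb_lt_iff_lt_rpow h1 h4, div_lt_iff₀ hl] at h7
      refine h7.le.trans (le_of_eq ?_)
      rw [show ((⌊Real.logb (1 + η) (x / l)⌋₊ : ℝ) + 1) =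
        ((⌊Real.logb (1 + η) (x / l)⌋₊ + 1 : ℕ) : ℝ) by push_cast; rfl, Real.rpow_natCast, pow_succ]
      ring
  refine ⟨_, filter_subset _ S, l * (1 + η) ^ ω.2, ω.1, hne, ?_, ?_, hfl, hcard⟩
  · exact le_mul_of_one_le_right hl.le (one_le_pow₀ h1.le)
  · obtain ⟨x, hx⟩ := hne
    exact (hfl x hx).1.trans (hE x (mem_filter.1 hx).1).2

end popular

section goodSet

lemma ladder_exponent (m v : ℕ) {j : ℕ} (hj : j ≤ v) :
    m ^ v + ∑ i ∈ range j, m ^ (v - 1 - i) * (m + 1) ^ i = m ^ (v - j) * (m + 1) ^ j := by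
  induction j with
  | zero => simp
  | succ j ih =>
    rw [sum_range_succ, ← add_assoc, ih (by omega), show v - j = v - (j + 1) + 1 by omega,
      show v - 1 - j = v - (j + 1) by omega]
    ring

theorem exists_good_set {ι : Type} [Fintype ι] [DecidableEq ι] {d : ι → ℕ} {k b ν D t₀ : ℕ}
    (hLB : LevelBlock d k b ν) (hD : ν + D = k * b) (ht₀ : D + 1 ≤ t₀) (hk : 2 ≤ k) (v : ℕ)
    {Δ : ℝ} (hΔ : (D + 2 * (t₀ + b * v : ℕ)) * (((k : ℝ) - 1) / k) ^ v < Δ)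
    {W₀ : ℕ} (hW₀ : 0 < W₀) {η : ℝ} (hη : 0 < η) :
    ∃ c C : ℝ, 0 < c ∧ 0 < C ∧ ∃ Z₀ : ℕ, ∀ Z ≥ Z₀, ∃ (A : Finset ℕ) (X : ℝ) (r : ℕ),
      A.Nonempty ∧ c * (Z : ℝ) ^ k ^ v ≤ X ∧ X ≤ C * (Z : ℝ) ^ k ^ v ∧ r.Coprime W₀ ∧
      (∀ x ∈ A, X ≤ x ∧ (x : ℝ) ≤ (1 + η) * X ∧ x ≡ r [MOD W₀]) ∧
      (mv (t₀ + b * v) A (mono d) : ℝ) * ((Z : ℝ) ^ k ^ v) ^ D ≤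
        (#A : ℝ) ^ (2 * (t₀ + b * v)) * ((Z : ℝ) ^ k ^ v) ^ Δ := by
  obtain ⟨m, rfl⟩ : ∃ m, k = m + 1 := ⟨k - 1, by omega⟩
  have hm : 1 ≤ m := by omega
  obtain ⟨C₁, hC₁, Q₀₀, hmv⟩ := mv_smooth hLB hD ht₀ v
  set t := t₀ + b * v with ht
  have ht1 : 1 ≤ t := by omega
  set ρ : ℝ := (((m + 1 : ℕ) : ℝ) - 1) / (m + 1 : ℕ) with hρ
  set δ : ℝ := (Δ - (D + 2 * (t : ℕ)) * ρ ^ v) / (4 * t) with hδ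
  have htR : (0 : ℝ) < t := by exact_mod_cast ht1
  have hδ0 : 0 < δ := div_pos (by linarith) (by positivity)
  obtain ⟨Z₁, hZ₁⟩ := eventually_atTop.1 (eventually_rpow_le_card_primesIn hδ0)
  set E : ℝ := 4 ^ v * 2 ^ m ^ v with hE
  set N : ℕ := W₀ * (⌊Real.logb (1 + η) E⌋₊ + 1) with hN
  have hN0 : 0 < N := by positivity
  have hexp : (D + 2 * (t : ℕ)) * ρ ^ v + 2 * t * δ < Δ := by
    have : 2 * t * δ = (Δ - (D + 2 * (t : ℕ)) * ρ ^ v) / 2 := by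
      rw [hδ]; field_simp; ring
    rw [this]; linarith
  obtain ⟨Z₂, hZ₂⟩ := eventually_atTop.1 (eventually_const_mul_rpow_le hexp (C₁ * (N : ℝ) ^ (2 * t)))
  refine ⟨(2 ^ m ^ v)⁻¹, 4 ^ v, by positivity, by positivity,
    max (max Q₀₀ Z₁) (max (max ⌈Z₂⌉₊ (2 * W₀)) 4), fun Z hZ => ?_⟩
  simp only [ge_iff_le, max_le_iff] at hZ
  obtain ⟨⟨hZa, hZb⟩, ⟨hZc, hZd⟩, hZe⟩ := hZ
  have hZ0 : 0 < Z := by omega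
  obtain ⟨p, hp, hp1, hp2⟩ := Nat.exists_prime_lt_and_le_two_mul (Z / 2) (by omega)
  have hpZ : p ≤ Z := by omega
  have hpZ' : Z ≤ 2 * p := by omega
  set Q : ℕ → ℕ := fun j => Z ^ (m ^ (v - 1 - j) * (m + 1) ^ j) with hQ
  set P₀ : ℕ := Z ^ m ^ v with hP₀
  set y₀ : ℕ := p ^ m ^ v with hy₀
  have hZQ : ∀ j, Z ≤ Q j := fun j => Nat.le_self_pow (by positivity) Z
  have hprod : ∀ j ≤ v, P₀ * ∏ i ∈ range j, Q i = Z ^ (m ^ (v - j) * (m + 1) ^ j) := by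
    intro j hj
    rw [hP₀, hQ, prod_pow_eq_pow_sum, ← pow_add, ladder_exponent m v hj]
  have hP : P₀ * ∏ i ∈ range v, Q i = Z ^ (m + 1) ^ v := by rw [hprod v le_rfl]; simp
  have hQ4 : ∀ j, j + 1 < v → 4 * Q j ≤ Q (j + 1) := by
    intro j hj
    have h1 : m ^ (v - 1 - j) * (m + 1) ^ j + 1 ≤ m ^ (v - 1 - (j + 1)) * (m + 1) ^ (j + 1) := by
      rw [show v - 1 - j = v - 1 - (j + 1) + 1 by omega]
      have : 1 ≤ m ^ (v - 1 - (j + 1)) * (m + 1) ^ j := Nat.one_le_iff_ne_zero.2 (by positivity)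
      calc _ ≤ m ^ (v - 1 - (j + 1) + 1) * (m + 1) ^ j + m ^ (v - 1 - (j + 1)) * (m + 1) ^ j := by
            omega
        _ = _ := by ring
    calc 4 * Q j ≤ Z * Q j := Nat.mul_le_mul_right _ hZe
      _ = Z ^ (m ^ (v - 1 - j) * (m + 1) ^ j + 1) := by rw [pow_succ, mul_comm]
      _ ≤ _ := Nat.pow_le_pow_right hZ0 h1
  have hy₀P : y₀ ≤ P₀ := Nat.pow_le_pow_left hpZ _
  have hy₀q : ∀ q : ℕ, q.Prime → q ∣ y₀ → q = p := fun q hq hqy =>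
    (Nat.prime_dvd_prime_iff_eq hq hp).1 (hq.dvd_of_dvd_pow hqy)
  have hy₀' : ∀ q : ℕ, q.Prime → q ∣ y₀ → q ≤ Q 0 := fun q hq hqy => by
    rw [hy₀q q hq hqy]; exact hpZ.trans (hZQ 0)
  have hmv' := hmv Q P₀ y₀ (Nat.one_le_pow _ _ hZ0) hy₀P hy₀'
    (fun j hj => ⟨hZa.trans (hZQ j), by
      rw [hprod (j + 1) hj, hQ, ← pow_mul, show v - 1 - j = v - (j + 1) by omega]; ring⟩) hQ4
  set S := smooth Q y₀ v with hS
  rw [hP] at hmv'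
  set P : ℝ := (Z : ℝ) ^ (m + 1) ^ v with hPdef
  have hPcast : ((Z ^ (m + 1) ^ v : ℕ) : ℝ) = P := by push_cast; rfl
  rw [hPcast] at hmv'
  have hZR : (4 : ℝ) ≤ Z := by exact_mod_cast hZe
  have hP1 : 1 ≤ P := one_le_pow₀ (by linarith)
  have hP0 : 0 < P := by linarith
  have hSc : #S = ∏ i ∈ range v, #(primesIn (Q i)) := card_smooth hQ4 hy₀' le_rfl
  have hScard : P ^ (1 - δ) ≤ (P₀ : ℝ) * #S := by
    have h1 : ∏ i ∈ range v, (Q i : ℝ) ^ (1 - δ) ≤ (#S : ℝ) := by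
      rw [hSc]; push_cast
      exact prod_le_prod (fun i _ => by positivity) fun i _ => hZ₁ _ (hZb.trans (hZQ i))
    rw [Real.finsetProd_rpow _ _ (fun i _ => by positivity)] at h1
    have h2 : P = (P₀ : ℝ) * ∏ i ∈ range v, (Q i : ℝ) := by
      rw [← hPcast, ← hP]; push_cast; rfl
    have hP₀1 : (1 : ℝ) ≤ P₀ := by exact_mod_cast Nat.one_le_pow _ _ hZ0
    rw [h2, Real.mul_rpow (by positivity) (prod_nonneg fun i _ => by positivity)]
    refine mul_le_mul ?_ h1 (by positivity) (by positivity)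
    exact (Real.rpow_le_rpow_of_exponent_le hP₀1 (by linarith)).trans_eq (Real.rpow_one _)
  have hSne : S.Nonempty := by
    rw [← card_pos]
    by_contra h
    rw [Nat.le_zero.1 (not_lt.1 h)] at hScard
    have := Real.rpow_pos_of_pos hP0 (1 - δ)
    simp at hScard
    linarith
  set l : ℝ := (2 ^ m ^ v)⁻¹ * P with hl
  have hSb : ∀ x ∈ S, l ≤ x ∧ (x : ℝ) ≤ E * l := by
    intro x hx
    obtain ⟨h1, h2⟩ := smooth_bounds Q y₀ v hx
    have h3 : (Z ^ (m + 1) ^ v) ≤ 2 ^ m ^ v * x := by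
      calc Z ^ (m + 1) ^ v = P₀ * ∏ i ∈ range v, Q i := hP.symm
        _ ≤ (2 ^ m ^ v * y₀) * ∏ i ∈ range v, Q i := by
            refine Nat.mul_le_mul_right _ ?_
            rw [hP₀, hy₀, ← mul_pow]
            exact Nat.pow_le_pow_left hpZ' _
        _ = 2 ^ m ^ v * (y₀ * ∏ i ∈ range v, Q i) := by ring
        _ ≤ _ := Nat.mul_le_mul_left _ h1
    have h4 : x ≤ 4 ^ v * Z ^ (m + 1) ^ v := by
      refine h2.trans (Nat.mul_le_mul_left _ ?_)
      rw [← hP]; exact Nat.mul_le_mul_right _ hy₀P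
    constructor
    · rw [hl, inv_mul_le_iff₀ (by positivity), ← hPcast]; exact_mod_cast h3
    · have : E * l = 4 ^ v * P := by rw [hE, hl]; field_simp
      rw [this, ← hPcast]; exact_mod_cast h4
  obtain ⟨A, hAS, X, r, hA, hX1, hX2, hAx, hcard⟩ := exists_popular hSne hW₀ hη (by positivity) hSb
  refine ⟨A, X, r, hA, hX1, ?_, ?_, fun x hx => ⟨(hAx x hx).1, (hAx x hx).2.1, ?_⟩, ?_⟩
  · refine hX2.trans (le_of_eq ?_)
    rw [hE, hl]; field_simp
  · obtain ⟨x, hx⟩ := hA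
    rw [← (hAx x hx).2.2, Nat.Coprime, ← Nat.gcd_rec, ← Nat.coprime_iff_gcd_eq_one]
    refine Nat.Coprime.symm (Nat.coprime_of_dvd fun q hq hqx hqW => ?_)
    have h1 : W₀ < q := lt_prime_of_dvd_smooth (B := W₀) v (fun i _ => le_trans (by omega) (hZQ i))
      (fun q hq hqy => by rw [hy₀q q hq hqy]; omega) (hAS hx) hq hqx
    exact absurd (Nat.le_of_dvd hW₀ hqW) (by omega)
  · have := (hAx x hx).2.2
    rw [← this]; exact (Nat.mod_modEq x W₀).symm
  · have h1 : (mv t A (mono d) : ℝ) ≤ C₁ * P ^ (2 * t - D) * (P₀ : ℝ) ^ D :=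
      (Nat.cast_le.2 (mv_mono hAS t _)).trans hmv'
    have h2 : P ^ (1 - δ) ≤ (P₀ : ℝ) * N * #A := by
      refine hScard.trans ?_
      rw [mul_assoc]
      refine mul_le_mul_of_nonneg_left ?_ (by positivity)
      exact_mod_cast hcard
    have hZP : (Z : ℝ) ≤ P := le_self_pow₀ (by linarith) (by positivity)
    have h3 := hZ₂ P ((Nat.le_ceil _).trans ((Nat.cast_le.2 hZc).trans hZP))
    have hP₀ρ : (P₀ : ℝ) = P ^ (ρ ^ v) := by
      have h4 : (((m + 1) ^ v : ℕ) : ℝ) * ρ ^ v = (m ^ v : ℕ) := by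
        rw [hρ]; push_cast
        rw [add_sub_cancel_right, div_pow]
        field_simp
      rw [hPdef, ← Real.rpow_natCast (Z : ℝ) ((m + 1) ^ v), ← Real.rpow_mul (by positivity), h4,
        Real.rpow_natCast]
      push_cast [hP₀]; rfl
    have h5 : P ^ (2 * t) ≤ (P₀ : ℝ) ^ (2 * t) * (N : ℝ) ^ (2 * t) * (#A : ℝ) ^ (2 * t) *
        P ^ (2 * t * δ) := by
      have h6 := pow_le_pow_left₀ (by positivity) h2 (2 * t)
      rw [mul_pow, mul_pow] at h6
      calc P ^ (2 * t) = (P ^ (1 - δ)) ^ (2 * t) * P ^ (2 * t * δ) := by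
            rw [← Real.rpow_natCast, ← Real.rpow_natCast, ← Real.rpow_mul hP0.le,
              ← Real.rpow_add hP0]
            congr 1; push_cast; ring
        _ ≤ _ := by gcongr
    have hPpos : 0 < P ^ (2 * t * δ) := Real.rpow_pos_of_pos hP0 _
    calc (mv t A (mono d) : ℝ) * P ^ D ≤ C₁ * P ^ (2 * t - D) * (P₀ : ℝ) ^ D * P ^ D := by gcongr
      _ = C₁ * (P₀ : ℝ) ^ D * P ^ (2 * t) := by
          rw [show 2 * t = 2 * t - D + D by omega, pow_add P]
          simp only [Nat.add_sub_cancel]; ring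
      _ ≤ C₁ * (P₀ : ℝ) ^ D * ((P₀ : ℝ) ^ (2 * t) * (N : ℝ) ^ (2 * t) * (#A : ℝ) ^ (2 * t) *
        P ^ (2 * t * δ)) := by gcongr
      _ = (#A : ℝ) ^ (2 * t) * (C₁ * (N : ℝ) ^ (2 * t) * ((P₀ : ℝ) ^ (D + 2 * t) *
          P ^ (2 * t * δ))) := by ring
      _ = (#A : ℝ) ^ (2 * t) * (C₁ * (N : ℝ) ^ (2 * t) *
          P ^ ((D + 2 * (t : ℕ)) * ρ ^ v + 2 * t * δ)) := by
          rw [hP₀ρ, ← Real.rpow_natCast (P ^ ρ ^ v), ← Real.rpow_mul hP0.le, ← Real.rpow_add hP0]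
          congr 3; push_cast; ring
      _ ≤ _ := by gcongr

end goodSet

section multiplicative

lemma le_of_prime_power_bounds {I : Type*} {adm : I → ℕ → Prop} {F : I → ℕ → ℝ} {C β : ℝ} {p₀ : ℕ}
    (hC : 1 ≤ C) (hF : ∀ i q, 0 ≤ F i q) (h1 : ∀ i, F i 1 ≤ 1)
    (hmul : ∀ i a b, 0 < a → 0 < b → a.Coprime b → adm i (a * b) →
      ∃ i' i'', adm i' a ∧ adm i'' b ∧ F i (a * b) ≤ F i' a * F i'' b)
    (hpp : ∀ i p l, p.Prime → 0 < l → adm i (p ^ l) → F i (p ^ l) ≤ C * ((p ^ l : ℕ) : ℝ) ^ β)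
    (hbig : ∀ i p l, p.Prime → p₀ ≤ p → 0 < l → adm i (p ^ l) → F i (p ^ l) ≤ ((p ^ l : ℕ) : ℝ) ^ β)
    (i : I) {q : ℕ} (hq : 0 < q) (hi : adm i q) : F i q ≤ C ^ p₀ * (q : ℝ) ^ β := by
  have key : ∀ q : ℕ, 0 < q → ∀ i, adm i q →
      F i q ≤ C ^ #{p ∈ q.primeFactors | p < p₀} * (q : ℝ) ^ β := by
    intro q
    induction q using Nat.recOnPosPrimePosCoprime with
    | zero => intro h; omega
    | one => intro _ i _; simpa using h1 i
    | prime_pow p l hp hl =>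
      intro _ i hi
      rw [Nat.primeFactors_pow _ hl.ne', hp.primeFactors, filter_singleton]
      split_ifs with h
      · simpa using hpp i p l hp hl hi
      · simpa using hbig i p l hp (not_lt.1 h) hl hi
    | coprime a b ha hb hab iha ihb =>
      intro _ i hi
      obtain ⟨i', i'', hi', hi'', h⟩ := hmul i a b (by omega) (by omega) hab hi
      refine h.trans ((mul_le_mul (iha (by omega) i' hi') (ihb (by omega) i'' hi'') (hF _ _)
        (by positivity)).trans (le_of_eq ?_))
      rw [hab.primeFactors_mul, filter_union, card_union_of_disjoint
        (disjoint_filter_filter hab.disjoint_primeFactors), pow_add, Nat.cast_mul,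
        Real.mul_rpow (by positivity) (by positivity)]
      ring
  refine (key q hq i hi).trans (mul_le_mul_of_nonneg_right ?_ (by positivity))
  refine pow_le_pow_right₀ hC ?_
  calc _ ≤ #(range p₀) := card_le_card fun p hp => mem_range.2 (mem_filter.1 hp).2
    _ = p₀ := card_range _

end multiplicative

section kernel

/-- The number of solutions of `u ^ k = 1` among the units modulo `q`. -/
noncomputable def rootCount (k q : ℕ) : ℕ := Nat.card {u : (ZMod q)ˣ // u ^ k = 1}

lemma card_pow_eq_one_le_index {G : Type*} [CommGroup G] [Finite G] (H : Subgroup G) [IsCyclic H]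
    {k : ℕ} (hk : 0 < k) : Nat.card {u : G // u ^ k = 1} ≤ k * H.index := by
  classical
  have := Fintype.ofFinite G
  rw [Nat.card_eq_fintype_card, Fintype.card_subtype]
  refine (card_le_mul_card_image (f := fun u : G => (u : G ⧸ H)) _ k ?_).trans ?_
  · intro c _
    by_cases hne : (filter (fun u : G => (u : G ⧸ H) = c) (filter (fun u : G => u ^ k = 1) univ)).Nonempty
    · obtain ⟨g, hg⟩ := hne
      simp only [mem_filter, mem_univ, true_and] at hg
      refine le_trans ?_ (IsCyclic.card_pow_eq_one_le (α := H) hk)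
      have hinj : Function.Injective fun h : H => g * (h : G) :=
        fun a b hab => Subtype.ext (mul_left_cancel (a := g) hab)
      rw [← card_image_of_injective _ hinj]
      refine card_le_card fun u hu => ?_
      simp only [mem_filter, mem_univ, true_and] at hu
      have h1 : g⁻¹ * u ∈ H := by rw [← QuotientGroup.eq, hg.2, hu.2]
      simp only [mem_image, mem_filter, mem_univ, true_and]
      refine ⟨⟨_, h1⟩, ?_, mul_inv_cancel_left g u⟩
      ext
      simp [mul_pow, hg.1, hu.1]
    · rw [not_nonempty_iff_eq_empty.1 hne]; simp
  · refine Nat.mul_le_mul_left _ ?_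
    rw [Subgroup.index, Nat.card_eq_fintype_card]
    exact card_le_univ _

lemma rootCount_prime_pow_le {k p : ℕ} (hk : 0 < k) (hp : p.Prime) (l : ℕ) :
    rootCount k (p ^ l) ≤ 2 * k := by
  have : NeZero (p ^ l) := ⟨pow_ne_zero _ hp.ne_zero⟩
  by_cases hc : IsCyclic (ZMod (p ^ l))ˣ
  · have : IsCyclic (⊤ : Subgroup (ZMod (p ^ l))ˣ) := Subgroup.isCyclic _
    have := card_pow_eq_one_le_index (⊤ : Subgroup (ZMod (p ^ l))ˣ) hk
    rw [Subgroup.index_top] at this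
    unfold rootCount; omega
  · have hp2 : p = 2 := by
      by_contra h
      exact hc (ZMod.isCyclic_units_of_prime_pow p hp h l)
    subst hp2
    obtain ⟨n, rfl⟩ : ∃ n, l = n + 2 := by
      rcases l with _ | _ | n
      · exact absurd (by simpa using ZMod.isCyclic_units_one) hc
      · exact absurd (by simpa using ZMod.isCyclic_units_two) hc
      · exact ⟨n, rfl⟩
    obtain ⟨u, hu⟩ : ∃ u : (ZMod (2 ^ (n + 2)))ˣ, (u : ZMod (2 ^ (n + 2))) = 5 :=
      ⟨ZMod.unitOfCoprime 5 (Nat.Coprime.pow_right _ (by norm_num)), by simp⟩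
    have ho : orderOf u = 2 ^ n := by rw [← orderOf_units, hu, ZMod.orderOf_five]
    have h1 := (Subgroup.zpowers u).card_mul_index
    rw [Nat.card_zpowers, ho, Nat.card_eq_fintype_card, ZMod.card_units_eq_totient,
      Nat.totient_prime_pow Nat.prime_two (by omega)] at h1
    have h2 : (Subgroup.zpowers u).index = 2 := by
      refine Nat.eq_of_mul_eq_mul_left (show 0 < 2 ^ n by positivity) (h1.trans ?_)
      simp [pow_succ]
    have := card_pow_eq_one_le_index (Subgroup.zpowers u) hk
    rw [h2] at this
    unfold rootCount; omega

lemma rootCount_mul_le (k : ℕ) {a b : ℕ} (ha : 0 < a) (hb : 0 < b) (hab : a.Coprime b) :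
    rootCount k (a * b) ≤ rootCount k a * rootCount k b := by
  have : NeZero a := ⟨ha.ne'⟩
  have : NeZero b := ⟨hb.ne'⟩
  unfold rootCount
  rw [← Nat.card_prod]
  let e : (ZMod (a * b))ˣ ≃* (ZMod a)ˣ × (ZMod b)ˣ :=
    (Units.mapEquiv (ZMod.chineseRemainder hab).toMulEquiv).trans MulEquiv.prodUnits
  have he : ∀ u : (ZMod (a * b))ˣ, u ^ k = 1 → (e u).1 ^ k = 1 ∧ (e u).2 ^ k = 1 := by
    intro u hu
    have h1 : e u ^ k = 1 := by rw [← map_pow, hu, map_one]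
    exact ⟨congrArg Prod.fst h1, congrArg Prod.snd h1⟩
  refine Nat.card_le_card_of_injective
    (fun u => (⟨(e u.1).1, (he u.1 u.2).1⟩, ⟨(e u.1).2, (he u.1 u.2).2⟩)) fun u v huv => ?_
  simp only [Prod.mk.injEq, Subtype.mk.injEq] at huv
  exact Subtype.ext (e.injective (Prod.ext huv.1 huv.2))

lemma exists_rootCount_le {k : ℕ} (hk : 0 < k) {ε : ℝ} (hε : 0 < ε) :
    ∃ C : ℝ, 0 < C ∧ ∀ q : ℕ, 0 < q → (rootCount k q : ℝ) ≤ C * (q : ℝ) ^ ε := by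
  obtain ⟨p₀, hp₀⟩ := eventually_atTop.1
    (((tendsto_rpow_atTop hε).comp tendsto_natCast_atTop_atTop).eventually_ge_atTop (2 * k : ℝ))
  have hk1 : (1 : ℝ) ≤ k := by exact_mod_cast hk
  refine ⟨(2 * k : ℝ) ^ p₀, by positivity, fun q hq => ?_⟩
  have hR : ∀ p l : ℕ, p.Prime → (rootCount k (p ^ l) : ℝ) ≤ 2 * k := fun p l hp => by
    exact_mod_cast rootCount_prime_pow_le hk hp l
  refine le_of_prime_power_bounds (I := Unit) (adm := fun _ _ => True)
    (F := fun _ q => (rootCount k q : ℝ)) (by linarith) (fun _ _ => by positivity) (fun _ => ?_)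
    (fun _ a b ha hb hab _ => ⟨(), (), trivial, trivial, by
      exact_mod_cast rootCount_mul_le k ha hb hab⟩)
    (fun _ p l hp hl _ => ?_) (fun _ p l hp hp0 hl _ => ?_) () hq trivial
  · have : rootCount k 1 ≤ 1 := by
      unfold rootCount
      exact Finite.card_le_one_iff_subsingleton.2 inferInstance
    exact_mod_cast this
  · refine (hR p l hp).trans (le_mul_of_one_le_right (by positivity) (Real.one_le_rpow ?_ hε.le))
    exact_mod_cast Nat.one_le_pow _ _ hp.pos
  · refine ((hR p l hp).trans (hp₀ p hp0)).trans (Real.rpow_le_rpow (by positivity) ?_ hε.le)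
    exact_mod_cast Nat.le_self_pow hl.ne' p

lemma card_le_rootCount {k q : ℕ} {S : Finset ℕ} (hq : 0 < q)
    (hS : ∀ x ∈ S, x < q ∧ x.Coprime q) (h : ∀ x ∈ S, ∀ y ∈ S, x ^ k ≡ y ^ k [MOD q]) :
    #S ≤ rootCount k q := by
  have : NeZero q := ⟨hq.ne'⟩
  rcases S.eq_empty_or_nonempty with rfl | ⟨x₀, hx₀⟩
  · simp
  have key : ∀ x : S, (ZMod.unitOfCoprime x.1 (hS x.1 x.2).2 /
      ZMod.unitOfCoprime x₀ (hS x₀ hx₀).2) ^ k = 1 := by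
    intro x
    rw [div_pow, div_eq_one]
    ext
    simp only [Units.val_pow_eq_pow_val, ZMod.coe_unitOfCoprime]
    exact_mod_cast (ZMod.natCast_eq_natCast_iff _ _ _).2 (h x.1 x.2 x₀ hx₀)
  unfold rootCount
  rw [← Nat.card_eq_finsetCard S]
  refine Nat.card_le_card_of_injective (fun x : S => (⟨_, key x⟩ : {u : (ZMod q)ˣ // u ^ k = 1}))
    fun x y hxy => ?_
  simp only [Subtype.mk.injEq, div_left_inj] at hxy
  have h1 := congrArg (fun u : (ZMod q)ˣ => (u : ZMod q)) hxy
  simp only [ZMod.coe_unitOfCoprime] at h1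
  have h2 := (ZMod.natCast_eq_natCast_iff _ _ _).1 h1
  exact Subtype.ext (Nat.ModEq.eq_of_lt_of_lt h2 (hS _ x.2).1 (hS _ y.2).1)

lemma card_le_rootCount_mul {k q B : ℕ} {S : Finset ℕ} (hq : 0 < q)
    (hS : ∀ x ∈ S, x < B ∧ x.Coprime q) (h : ∀ x ∈ S, ∀ y ∈ S, x ^ k ≡ y ^ k [MOD q]) :
    #S ≤ (B / q + 1) * rootCount k q := by
  refine (card_le_mul_card_image (f := fun x => x % q) S (B / q + 1) ?_).trans
    (Nat.mul_le_mul_left _ (card_le_rootCount (k := k) hq ?_ ?_))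
  · intro c _
    refine (card_le_card_of_injOn (t := range (B / q + 1)) (fun x => x / q) ?_ ?_).trans_eq
      (card_range _)
    · intro x hx
      simp only [coe_filter, Set.mem_ofPred_eq] at hx
      simp only [coe_range, Set.mem_Iio]
      exact Nat.lt_succ_of_le (Nat.div_le_div_right (hS x hx.1).1.le)
    · intro x hx y hy hxy
      simp only [coe_filter, Set.mem_ofPred_eq] at hx hy
      simp only at hxy
      rw [← Nat.div_add_mod x q, ← Nat.div_add_mod y q, hxy, hx.2, hy.2]
  · simp only [mem_image]
    rintro _ ⟨x, hx, rfl⟩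
    exact ⟨Nat.mod_lt _ hq, by
      rw [Nat.Coprime, ← Nat.gcd_rec, Nat.gcd_comm]; exact (hS x hx).2⟩
  · simp only [mem_image]
    rintro _ ⟨x, hx, rfl⟩ _ ⟨y, hy, rfl⟩
    exact (((Nat.mod_modEq x q).pow k).trans (h x hx y hy)).trans ((Nat.mod_modEq y q).pow k).symm

end kernel

section bilinear

lemma norm_ee_sub_one (x : ℝ) : 4 * |x - round x| ≤ ‖ee x - 1‖ := by
  have h1 : ee x = ee (x - round x) := by
    have := ee_add_int (x - round x) (round x)
    rw [← this]; congr 1; ring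
  rw [h1]
  set y := x - round x with hy
  have hy2 : |y| ≤ 1 / 2 := abs_sub_round x
  have h2 : ee y = Complex.exp (Complex.I * ((2 * Real.pi * y : ℝ) : ℂ)) := by
    rw [ee]; congr 1; push_cast; ring
  rw [h2, Complex.norm_exp_I_mul_ofReal_sub_one, norm_mul, Real.norm_eq_abs, Real.norm_eq_abs,
    abs_of_pos (by norm_num : (0 : ℝ) < 2), show 2 * Real.pi * y / 2 = Real.pi * y by ring]
  have h3 : |Real.sin (Real.pi * y)| = Real.sin (Real.pi * |y|) := by
    rcases abs_cases y with ⟨h, h'⟩ | ⟨h, h'⟩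
    · rw [h, abs_of_nonneg]
      apply Real.sin_nonneg_of_nonneg_of_le_pi <;> nlinarith [Real.pi_pos, abs_le.1 hy2]
    · rw [h, mul_neg, Real.sin_neg, abs_of_nonpos]
      apply Real.sin_nonpos_of_nonpos_of_neg_pi_le <;> nlinarith [Real.pi_pos, abs_le.1 hy2]
  rw [h3]
  have h4 := Real.mul_le_sin (x := Real.pi * |y|) (by positivity)
    (by nlinarith [Real.pi_pos])
  have h5 : 2 / Real.pi * (Real.pi * |y|) = 2 * |y| := by
    field_simp
  rw [h5] at h4
  linarith

lemma ee_sub_one_mul_sum (x : ℝ) (T : ℕ) :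
    (ee x - 1) * ∑ a ∈ Icc (-(T : ℤ)) T, ee (x * a) = ee (x * (T + 1)) - ee (-(x * T)) := by
  induction T with
  | zero => simp
  | succ T ih =>
    have h : Icc (-((T + 1 : ℕ) : ℤ)) ((T + 1 : ℕ) : ℤ) =
        insert (-((T + 1 : ℕ) : ℤ)) (insert ((T + 1 : ℕ) : ℤ) (Icc (-(T : ℤ)) T)) := by
      ext a; simp only [mem_Icc, mem_insert]; push_cast; omega
    have e1 : ee (x * ((T : ℝ) + 1 + 1)) = ee x * ee (x * (T + 1)) := by
      rw [← ee_add]; congr 1; ring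
    have e2 : ee (-(x * T)) = ee x * ee (-(x * (T + 1))) := by
      rw [← ee_add]; congr 1; ring
    rw [h, sum_insert, sum_insert, mul_add, mul_add, ih]
    · push_cast
      rw [e1, e2, show x * (-((T : ℝ) + 1)) = -(x * (T + 1)) by ring]
      ring
    · simp
    · simp only [mem_Icc, mem_insert]; push_cast; omega

/-- A large Dirichlet kernel forces its argument to be close to an integer. -/
lemma exists_int_of_le_norm_sum {x c : ℝ} {T : ℕ} (hc : 0 < c)
    (h : c ≤ ‖∑ a ∈ Icc (-(T : ℤ)) T, ee (x * a)‖) : ∃ z : ℤ, |x - z| ≤ 1 / (2 * c) := by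
  refine ⟨round x, ?_⟩
  have h1 := congrArg norm (ee_sub_one_mul_sum x T)
  rw [norm_mul] at h1
  have h2 : ‖ee (x * (T + 1)) - ee (-(x * T))‖ ≤ 2 := by
    refine (norm_sub_le _ _).trans ?_
    rw [norm_ee, norm_ee]; norm_num
  have h3 := norm_ee_sub_one x
  rw [le_div_iff₀ (by positivity)]
  nlinarith [abs_nonneg (x - round x), norm_nonneg (ee x - 1)]

lemma norm_sum_Icc_le (x : ℝ) (T : ℕ) : ‖∑ a ∈ Icc (-(T : ℤ)) T, ee (x * a)‖ ≤ 2 * T + 1 := by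
  refine (norm_sum_le _ _).trans ?_
  simp only [norm_ee, sum_const, Int.card_Icc, nsmul_eq_mul, mul_one]
  have : ((T : ℤ) + 1 - -(T : ℤ)).toNat = 2 * T + 1 := by omega
  rw [this]; push_cast; rfl

variable {ι : Type*} [Fintype ι] [DecidableEq ι]

lemma sum_box_norm_sq (d : ι → ℕ) (T : ι → ℕ) (S : Finset ℕ) (α : ι → ℝ) :
    ∑ v ∈ Fintype.piFinset fun i => Icc (-(T i : ℤ)) (T i),
      ‖∑ m ∈ S, ee (dot α (mono d m * v))‖ ^ 2 ≤
    ∑ m ∈ S, ∑ m' ∈ S, ∏ i,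
      ‖∑ a ∈ Icc (-(T i : ℤ)) (T i), ee (α i * ((m : ℝ) ^ d i - (m' : ℝ) ^ d i) * a)‖ := by
  have key : ((∑ v ∈ Fintype.piFinset fun i => Icc (-(T i : ℤ)) (T i),
      ‖∑ m ∈ S, ee (dot α (mono d m * v))‖ ^ 2 : ℝ) : ℂ) =
      ∑ m ∈ S, ∑ m' ∈ S, ∏ i, ∑ a ∈ Icc (-(T i : ℤ)) (T i),
        ee (α i * ((m : ℝ) ^ d i - (m' : ℝ) ^ d i) * a) := by
    push_cast
    have h1 : ∀ v : ι → ℤ, ((‖∑ m ∈ S, ee (dot α (mono d m * v))‖ : ℂ)) ^ 2 =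
        ∑ m ∈ S, ∑ m' ∈ S, ∏ i, ee (α i * ((m : ℝ) ^ d i - (m' : ℝ) ^ d i) * v i) := by
      intro v
      rw [← Complex.mul_conj', map_sum, sum_mul_sum]
      refine sum_congr rfl fun m _ => sum_congr rfl fun m' _ => ?_
      rw [← ee_neg, ← ee_add, ← ee_sum]
      congr 1
      simp only [dot, ← sum_neg_distrib, ← sum_add_distrib, mono, Pi.mul_apply]
      refine sum_congr rfl fun i _ => ?_
      push_cast; ring
    rw [sum_congr rfl fun v _ => h1 v, sum_comm]
    refine sum_congr rfl fun m _ => ?_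
    rw [sum_comm]
    refine sum_congr rfl fun m' _ => ?_
    rw [prod_univ_sum]
  have h2 : ∑ v ∈ Fintype.piFinset fun i => Icc (-(T i : ℤ)) (T i),
      ‖∑ m ∈ S, ee (dot α (mono d m * v))‖ ^ 2 = ‖((∑ v ∈ Fintype.piFinset
        fun i => Icc (-(T i : ℤ)) (T i), ‖∑ m ∈ S, ee (dot α (mono d m * v))‖ ^ 2 : ℝ) : ℂ)‖ := by
    rw [Complex.norm_real, Real.norm_of_nonneg (sum_nonneg fun _ _ => by positivity)]
  rw [h2, key]
  refine (norm_sum_le _ _).trans (sum_le_sum fun m _ => (norm_sum_le _ _).trans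
    (sum_le_sum fun m' _ => ?_))
  rw [norm_prod]

/-- The bilinear inequality: a bilinear sum is controlled by a mean value and Dirichlet kernels. -/
lemma norm_bilinear_pow_le (d : ι → ℕ) {t B : ℕ} (ht : 1 ≤ t) (S A : Finset ℕ)
    (hB : ∀ y ∈ A, y ≤ B) (α : ι → ℝ) :
    ‖expS (S ×ˢ A) (fun z => mono d (z.1 * z.2)) α‖ ^ (4 * t) ≤
      (#S : ℝ) ^ (4 * t - 2) * (#A : ℝ) ^ (2 * t) * mv t A (mono d) *
      ∑ m ∈ S, ∑ m' ∈ S, ∏ i, ‖∑ a ∈ Icc (-((t * B ^ d i : ℕ) : ℤ)) ((t * B ^ d i : ℕ) : ℤ),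
        ee (α i * ((m : ℝ) ^ d i - (m' : ℝ) ^ d i) * a)‖ := by
  classical
  obtain ⟨u, rfl⟩ : ∃ u, t = u + 1 := ⟨t - 1, by omega⟩
  set t := u + 1 with htu
  let R := Fintype.piFinset fun _ : Fin t => A ×ˢ A
  let Φ : (Fin t → ℕ × ℕ) → ι → ℤ := fun z => ∑ i, (mono d (z i).1 - mono d (z i).2)
  let g : ℕ → ℂ := fun m => expS A (mono d) (fun i => (m : ℝ) ^ d i * α i)
  have hf : expS (S ×ˢ A) (fun z => mono d (z.1 * z.2)) α = ∑ m ∈ S, g m := by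
    simp only [expS, g]
    rw [sum_product]
    refine sum_congr rfl fun m _ => sum_congr rfl fun y _ => ?_
    congr 1
    simp only [dot, mono]
    refine sum_congr rfl fun i _ => ?_
    push_cast; ring
  have hg : ∀ m, ((‖g m‖ ^ (2 * t) : ℝ) : ℂ) = ∑ z ∈ R, ee (dot α (mono d m * Φ z)) := by
    intro m
    rw [norm_pow_expS]
    simp only [expS]
    refine sum_congr rfl fun z _ => ?_
    congr 1
    simp only [dot, mono, Φ, Pi.mul_apply]
    refine sum_congr rfl fun i _ => ?_
    push_cast; ring
  have hX : ∑ m ∈ S, ‖g m‖ ^ (2 * t) ≤ ∑ z ∈ R, ‖∑ m ∈ S, ee (dot α (mono d m * Φ z))‖ := by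
    have : ((∑ m ∈ S, ‖g m‖ ^ (2 * t) : ℝ) : ℂ) =
        ∑ z ∈ R, ∑ m ∈ S, ee (dot α (mono d m * Φ z)) := by
      rw [sum_comm]; push_cast
      refine sum_congr rfl fun m _ => ?_
      rw [← hg m]; push_cast; rfl
    have h2 : ∑ m ∈ S, ‖g m‖ ^ (2 * t) = ‖((∑ m ∈ S, ‖g m‖ ^ (2 * t) : ℝ) : ℂ)‖ := by
      rw [Complex.norm_real, Real.norm_of_nonneg (sum_nonneg fun _ _ => by positivity)]
    rw [h2, this]
    exact norm_sum_le _ _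
  have hRcard : (#R : ℝ) = (#A : ℝ) ^ (2 * t) := by
    simp only [R, Fintype.card_piFinset, card_product, prod_const, card_univ, Fintype.card_fin]
    push_cast; rw [← pow_two, ← pow_mul]
  let h : (ι → ℤ) → ℝ := fun v => ‖∑ m ∈ S, ee (dot α (mono d m * v))‖ ^ 2
  have hh : ∀ v, 0 ≤ h v := fun v => by positivity
  let T : ι → ℕ := fun i => t * B ^ d i
  let box : Finset (ι → ℤ) := Fintype.piFinset fun i => Icc (-(T i : ℤ)) (T i)
  have hbox : ∀ z ∈ R, Φ z ∈ box := by
    intro z hz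
    simp only [box, Fintype.mem_piFinset, mem_Icc]
    intro i
    rw [← abs_le]
    simp only [Φ, Finset.sum_apply, Pi.sub_apply, mono]
    refine (abs_sum_le_sum_abs _ _).trans ?_
    have : ∀ j ∈ (univ : Finset (Fin t)), |(((z j).1 : ℤ)) ^ d i - (((z j).2 : ℤ)) ^ d i| ≤
        ((B ^ d i : ℕ) : ℤ) := by
      intro j _
      have hz' := Fintype.mem_piFinset.1 hz j
      rw [mem_product] at hz'
      have h1 : (z j).1 ^ d i ≤ B ^ d i := Nat.pow_le_pow_left (hB _ hz'.1) _
      have h2 : (z j).2 ^ d i ≤ B ^ d i := Nat.pow_le_pow_left (hB _ hz'.2) _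
      zify at h1 h2
      have h3 : (0 : ℤ) ≤ ((z j).1 : ℤ) ^ d i := by positivity
      have h4 : (0 : ℤ) ≤ ((z j).2 : ℤ) ^ d i := by positivity
      rw [abs_le]; push_cast; constructor <;> linarith
    refine (sum_le_sum this).trans ?_
    simp only [sum_const, card_univ, Fintype.card_fin, nsmul_eq_mul, T]
    push_cast; rfl
  have hfib : ∑ z ∈ R, h (Φ z) ≤ (mv t A (mono d) : ℝ) * ∑ v ∈ box, h v := by
    rw [← sum_fiberwise_of_maps_to hbox, mul_sum]
    refine sum_le_sum fun v _ => ?_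
    rw [sum_congr rfl fun z hz => by rw [(mem_filter.1 hz).2], sum_const, nsmul_eq_mul]
    refine mul_le_mul_of_nonneg_right ?_ (hh v)
    have h1 := card_shift_le t A (mono d) v
    refine Nat.cast_le.2 (le_trans (le_of_eq ?_) h1)
    congr 1
  have h1 : ‖expS (S ×ˢ A) (fun z => mono d (z.1 * z.2)) α‖ ^ (2 * t) ≤
      (#S : ℝ) ^ (2 * t - 1) * ∑ m ∈ S, ‖g m‖ ^ (2 * t) := by
    rw [hf]
    have h2 : ‖∑ m ∈ S, g m‖ ^ (2 * t) ≤ (∑ m ∈ S, ‖g m‖) ^ (2 * t) :=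
      pow_le_pow_left₀ (norm_nonneg _) (norm_sum_le _ _) _
    refine h2.trans ?_
    have h3 := pow_sum_le_card_mul_sum_pow (s := S) (f := fun m => ‖g m‖)
      (fun _ _ => norm_nonneg _) (2 * t - 1)
    rwa [show 2 * t - 1 + 1 = 2 * t by omega] at h3
  have h4 : (∑ z ∈ R, ‖∑ m ∈ S, ee (dot α (mono d m * Φ z))‖) ^ 2 ≤
      (#A : ℝ) ^ (2 * t) * ∑ z ∈ R, h (Φ z) := by
    rw [← hRcard]
    exact sq_sum_le_card_mul_sum_sq
  have h0 : 0 ≤ ∑ m ∈ S, ‖g m‖ ^ (2 * t) := sum_nonneg fun _ _ => by positivity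
  calc ‖expS (S ×ˢ A) (fun z => mono d (z.1 * z.2)) α‖ ^ (4 * t)
      = (‖expS (S ×ˢ A) (fun z => mono d (z.1 * z.2)) α‖ ^ (2 * t)) ^ 2 := by
        rw [← pow_mul]; congr 1; ring
    _ ≤ ((#S : ℝ) ^ (2 * t - 1) * ∑ m ∈ S, ‖g m‖ ^ (2 * t)) ^ 2 :=
        pow_le_pow_left₀ (by positivity) h1 _
    _ = (#S : ℝ) ^ (4 * t - 2) * (∑ m ∈ S, ‖g m‖ ^ (2 * t)) ^ 2 := by
        rw [mul_pow, ← pow_mul]; congr 2; omega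
    _ ≤ (#S : ℝ) ^ (4 * t - 2) * (∑ z ∈ R, ‖∑ m ∈ S, ee (dot α (mono d m * Φ z))‖) ^ 2 := by
        gcongr
    _ ≤ (#S : ℝ) ^ (4 * t - 2) * ((#A : ℝ) ^ (2 * t) *
          ((mv t A (mono d) : ℝ) * ∑ v ∈ box, h v)) := by
        gcongr; exact h4.trans (by gcongr)
    _ ≤ (#S : ℝ) ^ (4 * t - 2) * ((#A : ℝ) ^ (2 * t) * ((mv t A (mono d) : ℝ) *
          ∑ m ∈ S, ∑ m' ∈ S, ∏ i, ‖∑ a ∈ Icc (-(T i : ℤ)) (T i),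
            ee (α i * ((m : ℝ) ^ d i - (m' : ℝ) ^ d i) * a)‖)) := by
        gcongr; exact sum_box_norm_sq d T S α
    _ = _ := by simp only [T]; ring

end bilinear

section approximation

lemma mul_pow_le_abs_pow_sub_pow {d : ℕ} (hd : 0 < d) {M x y : ℝ} (hM : 0 ≤ M) (hx : M ≤ x)
    (hy : M ≤ y) : |x - y| * M ^ (d - 1) ≤ |x ^ d - y ^ d| := by
  wlog h : y ≤ x generalizing x y
  · grind
  obtain ⟨e, rfl⟩ : ∃ e, d = e + 1 := ⟨d - 1, by omega⟩
  have hy0 := hM.trans hy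
  have h1 : y ^ e ≤ x ^ e := pow_le_pow_left₀ hy0 h _
  have h2 : M ^ e ≤ x ^ e := pow_le_pow_left₀ hM hx _
  rw [abs_of_nonneg (sub_nonneg.2 h),
    abs_of_nonneg (sub_nonneg.2 (pow_le_pow_left₀ hy0 h _)), Nat.add_sub_cancel, pow_succ, pow_succ]
  nlinarith [mul_le_mul_of_nonneg_left h2 (sub_nonneg.2 h), mul_le_mul_of_nonneg_right h1 hy0]

/-- If `γ (m ^ d - m' ^ d)` is very close to an integer for many primes `m ≍ M`, then `γ` is close
to a fraction with small denominator. -/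
lemma eventually_exists_rational_approx {d : ℕ} (hd : 0 < d) {τ : ℝ} (hτ : 0 < τ) (hτ4 : τ ≤ 1 / 4) :
    ∀ᶠ M : ℕ in atTop, ∀ S ⊆ primesIn M, ∀ m' ∈ primesIn M, (M : ℝ) ^ (1 - τ) ≤ #S →
      ∀ γ κ : ℝ, κ ≤ 1 / (8 * (4 * M) ^ d) → (∀ m ∈ S, ∃ z : ℤ, |γ * (m ^ d - m' ^ d) - z| ≤ κ) →
      ∃ q : ℕ, 0 < q ∧ q ≤ (M : ℝ) ^ (3 * τ) ∧ ∃ a : ℤ, |γ - a / q| ≤ κ * M ^ (2 * τ - d) := by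
  have hdR : 1 ≤ d := mod_cast hd
  obtain ⟨C, hC, hroot⟩ := exists_rootCount_le hd (ε := τ / (4 * d)) (by positivity)
  set C₁ := (4 * 4 ^ d : ℝ) ^ (τ / (4 * d)) with hC₁
  have e1 := tendsto_natCast_atTop_atTop.eventually
    (eventually_const_mul_rpow_le (show 1 - 3 * τ + τ / 4 < 1 - τ by linarith) (2 * (6 * (C * C₁))))
  have e2 := tendsto_natCast_atTop_atTop.eventually
    (eventually_const_mul_rpow_le (show 1 - 2 * τ < 1 - τ by linarith) 4)
  have e3 := tendsto_natCast_atTop_atTop.eventually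
    (eventually_const_mul_rpow_le (show (0 : ℝ) < 1 - τ by linarith) 8)
  filter_upwards [e1, e2, e3, eventually_ge_atTop 1] with M h1 h2 h3 hM1 S hS m' hm' hcard γ κ hκ hz
  have hM : (1 : ℝ) ≤ M := mod_cast hM1
  have hM0 : (0 : ℝ) < M := by linarith
  rw [Real.rpow_zero, mul_one] at h3
  set H := (4 * M) ^ d with hH
  have hH0 : 0 < H := by positivity
  have hHR : ((4 * M : ℝ)) ^ d = (H : ℝ) := by rw [hH]; push_cast; rfl
  have hH0R : (0 : ℝ) < H := mod_cast hH0
  rw [hHR] at hκ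
  obtain ⟨r, hr, hrden⟩ := Real.exists_rat_abs_sub_le_and_den_le γ (n := 4 * H) (by omega)
  set q := r.den with hq
  have hq0 := r.den_pos
  have hq0R : (0 : ℝ) < q := mod_cast hq0
  have hrq : (r : ℝ) = (r.num : ℝ) / q := by
    rw [hq]; exact_mod_cast congrArg (Rat.cast : ℚ → ℝ) (Rat.num_div_den r).symm
  have hmem : ∀ m ∈ primesIn M, (M : ℝ) ≤ m ∧ (m : ℝ) ^ d ≤ H := by
    intro m hm
    have := (mem_primesIn.1 hm).1
    refine ⟨by exact_mod_cast this.1.le, ?_⟩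
    rw [hH]; exact_mod_cast Nat.pow_le_pow_left this.2 d
  have habs : ∀ m ∈ S, |(m : ℝ) ^ d - (m' : ℝ) ^ d| ≤ H := by
    intro m hm
    have a1 := hmem m (hS hm)
    have a2 := hmem m' hm'
    have a3 : (0 : ℝ) ≤ (m : ℝ) ^ d := by positivity
    have a4 : (0 : ℝ) ≤ (m' : ℝ) ^ d := by positivity
    rw [abs_le]; constructor <;> linarith
  have hint : ∀ m ∈ S, ∃ z : ℤ, |γ * ((m : ℝ) ^ d - (m' : ℝ) ^ d) - z| ≤ κ ∧
      r.num * ((m : ℤ) ^ d - (m' : ℤ) ^ d) = q * z := by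
    intro m hm
    obtain ⟨z, hz⟩ := hz m hm
    refine ⟨z, hz, ?_⟩
    have hlt : |((r.num * ((m : ℤ) ^ d - (m' : ℤ) ^ d) - q * z : ℤ) : ℝ)| < 1 := by
      push_cast
      set h : ℝ := (m : ℝ) ^ d - (m' : ℝ) ^ d with hh
      have e : (r.num : ℝ) * h - q * z = q * ((γ * h - z) - (γ - r) * h) := by
        rw [hrq]; field_simp; ring
      rw [e, abs_mul, abs_of_pos hq0R]
      have b1 : |γ * h - z - (γ - r) * h| ≤ κ + 1 / (((4 * H : ℕ) : ℝ) + 1) / q * H := by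
        refine (abs_sub _ _).trans ?_
        rw [abs_mul]
        refine add_le_add hz (mul_le_mul ?_ (habs m hm) (abs_nonneg _) (by positivity))
        rw [div_div]; exact hr
      calc (q : ℝ) * |γ * h - z - (γ - r) * h|
          ≤ q * (κ + 1 / (((4 * H : ℕ) : ℝ) + 1) / q * H) := by gcongr
        _ = q * κ + H / (((4 * H : ℕ) : ℝ) + 1) := by field_simp
        _ ≤ (4 * H) * (1 / (8 * H)) + H / (4 * H : ℝ) := by
          refine add_le_add (mul_le_mul
              (by exact_mod_cast hrden) hκ ((abs_nonneg _).trans hz) (by positivity)) ?_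
          push_cast; gcongr; linarith
        _ < 1 := by field_simp; norm_num
    rw [← Int.cast_abs, ← Int.cast_one, Int.cast_lt] at hlt
    have := Int.abs_lt_one_iff.1 hlt
    linarith
  have hdvd : ∀ m ∈ S, (q : ℤ) ∣ (m : ℤ) ^ d - (m' : ℤ) ^ d := by
    intro m hm
    obtain ⟨z, -, hz⟩ := hint m hm
    have hcop : IsCoprime (q : ℤ) r.num := by
      rw [Int.isCoprime_iff_gcd_eq_one, Int.gcd_comm]
      simpa [Int.gcd] using r.reduced
    exact hcop.dvd_of_dvd_mul_left ⟨z, hz⟩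
  have hqM : (q : ℝ) ≤ (M : ℝ) ^ (3 * τ) := by
    by_contra hcon
    push Not at hcon
    have hcnt : #(S.erase m') ≤ ((4 * M + 1) / q + 1) * rootCount d q := by
      refine card_le_rootCount_mul hq0 (fun x hx => ?_) fun x hx y hy => ?_
      · have hx' := mem_primesIn.1 (hS (mem_of_mem_erase hx))
        refine ⟨by omega, (Nat.Prime.coprime_iff_not_dvd hx'.2).2 fun hxq => ?_⟩
        have d2 : (x : ℤ) ∣ (m' : ℤ) ^ d := by
          have := dvd_sub (dvd_pow_self (x : ℤ) hd.ne')
              ((Int.natCast_dvd_natCast.2 hxq).trans (hdvd x (mem_of_mem_erase hx)))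
          simpa using this
        exact ne_of_mem_erase hx ((Nat.prime_dvd_prime_iff_eq hx'.2 (mem_primesIn.1 hm').2).1
            (hx'.2.dvd_of_dvd_pow (by exact_mod_cast d2)))
      · rw [← Int.natCast_modEq_iff]
        refine (Int.modEq_iff_dvd.2 ?_)
        push_cast
        have := dvd_sub (hdvd y (mem_of_mem_erase hy)) (hdvd x (mem_of_mem_erase hx))
        simpa using this
    have hS1 : (#S : ℝ) ≤ #(S.erase m') + 1 := by
      exact_mod_cast (by have := pred_card_le_card_erase (s := S) (a := m'); omega)
    have hrt : (rootCount d q : ℝ) ≤ C * (C₁ * (M : ℝ) ^ (τ / 4)) := by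
      refine (hroot q hq0).trans (mul_le_mul_of_nonneg_left ?_ hC.le)
      have : (q : ℝ) ≤ (4 * 4 ^ d) * (M : ℝ) ^ (d : ℝ) := by
        rw [Real.rpow_natCast, mul_assoc, ← mul_pow, hHR]; exact_mod_cast hrden
      refine (Real.rpow_le_rpow hq0R.le this (by positivity)).trans (le_of_eq ?_)
      rw [Real.mul_rpow (by positivity) (by positivity), ← Real.rpow_mul hM0.le, hC₁]
      congr 2
      field_simp
    have hdiv : ((((4 * M + 1) / q + 1 : ℕ)) : ℝ) ≤ 6 * (M : ℝ) ^ (1 - 3 * τ) := by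
      push_cast
      have hle : (((4 * M + 1) / q : ℕ) : ℝ) ≤ 5 * (M : ℝ) ^ (1 - 3 * τ) := by
        refine Nat.cast_div_le.trans ?_
        rw [Real.rpow_sub hM0, Real.rpow_one]
        push_cast
        calc (4 * (M : ℝ) + 1) / q ≤ (5 * M) / (M : ℝ) ^ (3 * τ) := by gcongr; linarith
          _ = _ := by ring
      have : 1 ≤ (M : ℝ) ^ (1 - 3 * τ) := Real.one_le_rpow hM (by linarith)
      linarith
    have hfin : (#(S.erase m') : ℝ) ≤ 6 * (C * C₁) * (M : ℝ) ^ (1 - 3 * τ + τ / 4) := by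
      calc (#(S.erase m') : ℝ) ≤ (((4 * M + 1) / q + 1 : ℕ) : ℝ) * rootCount d q := by
            exact_mod_cast hcnt
        _ ≤ 6 * (M : ℝ) ^ (1 - 3 * τ) * (C * (C₁ * (M : ℝ) ^ (τ / 4))) := by gcongr
        _ = _ := by rw [Real.rpow_add hM0]; ring
    linarith
  refine ⟨q, hq0, hqM, r.num, ?_⟩
  obtain ⟨m, hm, hfar⟩ : ∃ m ∈ S, (M : ℝ) ^ (1 - 2 * τ) ≤ |(m : ℝ) - m'| := by
    by_contra hcon
    push Not at hcon
    set x : ℕ := ⌈(M : ℝ) ^ (1 - 2 * τ)⌉₊ with hx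
    have hsub : S ⊆ Ioo (m' - x) (m' + x) ∪ {m' - x} := by
      intro m hm
      have h5 := (hcon m hm).trans_le (Nat.le_ceil _)
      rw [← hx, abs_lt] at h5
      have h6 : m < m' + x := by
        have : (m : ℝ) < m' + x := by linarith
        exact_mod_cast this
      have h7 : m' < m + x := by
        have : (m' : ℝ) < m + x := by linarith
        exact_mod_cast this
      simp only [mem_union, mem_Ioo, mem_singleton]; omega
    have h8 := (card_le_card hsub).trans (card_union_le _ _)
    rw [Nat.card_Ioo, card_singleton] at h8
    have h9 : #S ≤ 2 * x := by
      have hx1 : 0 < x := Nat.ceil_pos.2 (by positivity)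
      omega
    have h10 : (x : ℝ) < (M : ℝ) ^ (1 - 2 * τ) + 1 := Nat.ceil_lt_add_one (by positivity)
    have h11 : (#S : ℝ) ≤ 2 * x := by exact_mod_cast h9
    linarith
  obtain ⟨z, hz1, hz2⟩ := hint m hm
  have hz3 : (r.num : ℝ) * ((m : ℝ) ^ d - (m' : ℝ) ^ d) = q * z := by exact_mod_cast hz2
  have h6 : |γ - r.num / q| * |(m : ℝ) ^ d - (m' : ℝ) ^ d| ≤ κ := by
    rw [← abs_mul]
    have : (γ - r.num / q) * ((m : ℝ) ^ d - (m' : ℝ) ^ d) =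
        γ * ((m : ℝ) ^ d - (m' : ℝ) ^ d) - z := by rw [sub_mul, div_mul_eq_mul_div, hz3]; field_simp
    rw [this]; exact hz1
  have h7 : (M : ℝ) ^ (d - 2 * τ) ≤ |(m : ℝ) ^ d - (m' : ℝ) ^ d| := by
    refine le_trans ?_ (mul_pow_le_abs_pow_sub_pow hd hM0.le (hmem m (hS hm)).1 (hmem m' hm').1)
    calc (M : ℝ) ^ (d - 2 * τ) = (M : ℝ) ^ (1 - 2 * τ) * (M : ℝ) ^ ((d - 1 : ℕ) : ℝ) := by
          rw [← Real.rpow_add hM0, Nat.cast_sub hd]; congr 1; push_cast; ring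
      _ ≤ |(m : ℝ) - m'| * (M : ℝ) ^ (d - 1) := by rw [Real.rpow_natCast]; gcongr
  rw [show 2 * τ - (d : ℝ) = -(d - 2 * τ) by ring, Real.rpow_neg hM0.le, ← div_eq_mul_inv,
    le_div_iff₀ (by positivity)]
  exact le_trans (by gcongr) h6

variable {ι : Type*} [Fintype ι] [DecidableEq ι]

/-- A bilinear sum over (primes) × (good set) is large only near rationals of small denominator. -/
theorem eventually_approx_of_large {d : ι → ℕ} (hd : ∀ i, 0 < d i) {t E : ℕ} (ht : 1 ≤ t)
    (hE : 1 ≤ E) {τ σ Δ : ℝ} (hτ : 0 < τ) (hτ4 : τ ≤ 1 / 4) (hω0 : 0 ≤ 16 * t * σ + 3 * Δ)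
    (hω : 16 * t * σ + 3 * Δ < τ / 4) :
    ∀ᶠ M : ℕ in atTop, ∀ S ⊆ primesIn M, ∀ A : Finset ℕ, A.Nonempty →
      (M : ℝ) ^ (1 - τ / 4) ≤ #S → (∀ y ∈ A, y ≤ E * M ^ 3) →
      (mv t A (mono d) : ℝ) * (M ^ 3) ^ (∑ i, d i) ≤ #A ^ (2 * t) * (M ^ 3) ^ Δ →
      ∀ α : ι → ℝ, #S * #A * (M ^ 4) ^ (-σ) ≤ ‖expS (S ×ˢ A) (fun z => mono d (z.1 * z.2)) α‖ →
      ∀ i, ∃ q : ℕ, 0 < q ∧ (q : ℝ) ≤ M ^ (3 * τ) ∧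
        ∃ a : ℤ, |α i - a / q| ≤ M ^ (4 * τ - 4 * d i) := by
  set ω := 16 * t * σ + 3 * Δ with hωdef
  have htR : (1 : ℝ) ≤ t := mod_cast ht
  have hER : 1 ≤ E := mod_cast hE
  have main : ∀ j : ι, ∀ᶠ M : ℕ in atTop, ∀ S ⊆ primesIn M, ∀ A : Finset ℕ, A.Nonempty →
      (M : ℝ) ^ (1 - τ / 4) ≤ #S → (∀ y ∈ A, y ≤ E * M ^ 3) →
      (mv t A (mono d) : ℝ) * (M ^ 3) ^ (∑ i, d i) ≤ #A ^ (2 * t) * (M ^ 3) ^ Δ →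
      ∀ α : ι → ℝ, #S * #A * (M ^ 4) ^ (-σ) ≤ ‖expS (S ×ˢ A) (fun z => mono d (z.1 * z.2)) α‖ →
      ∃ q : ℕ, 0 < q ∧ (q : ℝ) ≤ M ^ (3 * τ) ∧ ∃ a : ℤ, |α j - a / q| ≤ M ^ (4 * τ - 4 * d j) := by
    intro j
    have hdj : (1 : ℝ) ≤ d j := mod_cast hd j
    set G := ∏ i ∈ univ.erase j, (3 * t * E ^ d i : ℝ) with hG
    have hG0 : 0 < G := prod_pos fun i _ => by positivity
    set Tj : ℝ := 3 * t * E ^ d j with hTj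
    have hTj0 : 0 < Tj := by positivity
    have e1 := tendsto_natCast_atTop_atTop.eventually
      (eventually_const_mul_rpow_le (show 1 - τ < 1 - τ / 4 - ω by linarith) (2 * G * Tj))
    have e2 := tendsto_natCast_atTop_atTop.eventually
      (eventually_const_mul_rpow_le (show ω - 3 * d j < -(d j : ℝ) by linarith) (G * (8 * 4 ^ d j)))
    have e3 := tendsto_natCast_atTop_atTop.eventually (eventually_const_mul_rpow_le
        (show ω - 3 * d j + (2 * τ - d j) < 4 * τ - 4 * d j by linarith) G)
    filter_upwards [e1, e2, e3, eventually_exists_rational_approx (hd j) hτ hτ4,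
      eventually_ge_atTop 1] with M h1 h2 h3 hrat hM1 S hS A hA hcard hB hmv α hlarge
    have hM : (1 : ℝ) ≤ M := by exact_mod_cast hM1
    have hM0 : (0 : ℝ) < M := by linarith
    have hA0 : 0 < #A := by exact_mod_cast hA.card_pos
    have hS0 := lt_of_lt_of_le (by positivity) hcard
    set T : ι → ℕ := fun i => t * (E * M ^ 3) ^ d i with hT
    let D : ι → ℕ → ℕ → ℝ := fun i m m' => ‖∑ a ∈ Icc (-(T i : ℤ)) (T i),
        ee (α i * ((m : ℝ) ^ d i - m' ^ d i) * a)‖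
    have hT3 : ∀ i, (2 * T i + 1) ≤ 3 * t * E ^ d i * (M : ℝ) ^ (3 * d i) := by
      intro i
      have : 1 ≤ T i := Nat.succ_le_of_lt (by positivity)
      have hTi : (1 : ℝ) ≤ T i := by exact_mod_cast this
      have hTi2 : (T i) = t * E ^ d i * (M : ℝ) ^ (3 * d i) := by
        simp only [hT]; push_cast; rw [mul_pow, ← pow_mul]; ring
      linarith
    have hD : ∀ i m m', D i m m' ≤ 3 * t * E ^ d i * (M : ℝ) ^ (3 * d i) :=
      fun i m m' => (norm_sum_Icc_le _ _).trans (hT3 i)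
    have hD0 : ∀ i m m', 0 ≤ D i m m' := fun i m m' => norm_nonneg _
    have hsum : ∑ m ∈ S, ∑ m' ∈ S, ∏ i, D i m m' ≤
        G * (M : ℝ) ^ (3 * ∑ i ∈ univ.erase j, d i) * ∑ m' ∈ S, ∑ m ∈ S, D j m m' := by
      rw [sum_comm, mul_sum]
      refine sum_le_sum fun m' _ => ?_
      rw [mul_sum]
      refine sum_le_sum fun m _ => ?_
      rw [← prod_erase_mul univ _ (mem_univ j), hG, mul_sum, ← prod_pow_eq_pow_sum,
        ← prod_mul_distrib]
      refine mul_le_mul_of_nonneg_right (prod_le_prod (fun i _ => hD0 _ _ _) fun i _ => hD _ _ _)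
        (hD0 _ _ _)
    have key : (#S : ℝ) ^ 2 * M ^ (3 * d j - ω) ≤ G * ∑ m' ∈ S, ∑ m ∈ S, D j m m' := by
      set X₀ := ∑ m' ∈ S, ∑ m ∈ S, D j m m' with hX0def
      set D' := ∑ i ∈ univ.erase j, d i with hD'
      have a1 : ((#S : ℝ) * #A * (M ^ 4) ^ (-σ)) ^ (4 * t) ≤
          #S ^ (4 * t - 2) * #A ^ (2 * t) * mv t A (mono d) * (G * M ^ (3 * D') * X₀) := by
        refine (pow_le_pow_left₀ (by positivity) hlarge _).trans
            ((norm_bilinear_pow_le d ht S A hB α).trans ?_)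
        gcongr
      have hpow : (#S : ℝ) ^ (4 * t) = #S ^ (4 * t - 2) * #S ^ 2 := by
        rw [← pow_add]; congr 1; omega
      have hMσ : (((M : ℝ) ^ 4) ^ (-σ)) ^ (4 * t) = M ^ (-(16 * t * σ)) := by
        rw [← Real.rpow_natCast M 4, ← Real.rpow_mul hM0.le, ← Real.rpow_natCast,
          ← Real.rpow_mul hM0.le]; congr 1; push_cast; ring
      rw [mul_pow, mul_pow, hMσ, hpow] at a1
      have hmv' : (mv t A (mono d) : ℝ) * (M : ℝ) ^ (3 * D') ≤
          #A ^ (2 * t) * M ^ (3 * Δ - 3 * d j) := by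
        have hx : (M ^ 3) ^ (∑ i, d i) = M ^ (3 * D') * (M : ℝ) ^ (3 * d j) := by
          rw [← pow_mul, ← pow_add, (sum_erase_add univ d (mem_univ j)).symm]; congr 1; ring
        have hy : ((M : ℝ) ^ 3) ^ Δ = M ^ (3 * Δ) := by
          rw [← Real.rpow_natCast M 3, ← Real.rpow_mul hM0.le]; norm_num
        rw [hx, hy] at hmv
        have hz : (M : ℝ) ^ (3 * Δ - 3 * d j) * M ^ (3 * d j) = M ^ (3 * Δ) := by
          rw [← Real.rpow_natCast M (3 * d j), ← Real.rpow_add hM0]; congr 1; push_cast; ring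
        refine le_of_mul_le_mul_right ?_ (show 0 < (M : ℝ) ^ (3 * d j) by positivity)
        rw [mul_assoc, mul_assoc, hz]; exact hmv
      have hX0 : 0 ≤ X₀ := sum_nonneg fun _ _ => sum_nonneg fun _ _ => hD0 _ _ _
      have hAA : (#A : ℝ) ^ (4 * t) = #A ^ (2 * t) * #A ^ (2 * t) := by
        rw [← pow_add]; congr 1; omega
      have a2 : (#S : ℝ) ^ 2 * M ^ (-(16 * t * σ)) ≤ G * X₀ * M ^ (3 * Δ - 3 * d j) := by
        refine le_of_mul_le_mul_left ?_
          (show (0 : ℝ) < #S ^ (4 * t - 2) * #A ^ (4 * t) by positivity)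
        calc #S ^ (4 * t - 2) * #A ^ (4 * t) * (#S ^ 2 * M ^ (-(16 * t * σ)))
            = #S ^ (4 * t - 2) * #S ^ 2 * #A ^ (4 * t) * (M : ℝ) ^ (-(16 * t * σ)) := by ring
          _ ≤ _ := a1
          _ = (#S : ℝ) ^ (4 * t - 2) * #A ^ (2 * t) * (G * X₀) *
              (mv t A (mono d) * M ^ (3 * D')) := by ring
          _ ≤ #S ^ (4 * t - 2) * #A ^ (2 * t) * (G * X₀) *
              (#A ^ (2 * t) * M ^ (3 * Δ - 3 * d j)) := by gcongr
          _ = _ := by rw [hAA]; ring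
      refine le_of_mul_le_mul_right ?_ (show (0 : ℝ) < M ^ (3 * Δ - 3 * d j) by positivity)
      refine le_trans (le_of_eq ?_) a2
      rw [mul_assoc, ← Real.rpow_add hM0]
      congr 2
      rw [hωdef]; ring
    obtain ⟨m', hm', hsel⟩ : ∃ m' ∈ S, (#S : ℝ) * M ^ (3 * d j - ω) ≤ G * ∑ m ∈ S, D j m m' := by
      by_contra hcon
      push Not at hcon
      have := sum_lt_sum_of_nonempty (card_pos.1 (by exact_mod_cast hS0)) hcon
      rw [← mul_sum, sum_const, nsmul_eq_mul] at this
      linarith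
    set c : ℝ := (M : ℝ) ^ (3 * d j - ω) / (2 * G) with hc
    let S₁ : Finset ℕ := {m ∈ S | c ≤ D j m m'}
    have hsplit : ∑ m ∈ S, D j m m' ≤ #S * c + #S₁ * (Tj * (M : ℝ) ^ (3 * d j)) := by
      rw [← sum_filter_add_sum_filter_not S (fun m => c ≤ D j m m'), add_comm]
      refine add_le_add ?_ ?_
      · refine (sum_le_card_nsmul _ _ c fun m hm => ?_).trans ?_
        · exact (not_le.1 (mem_filter.1 hm).2).le
        · rw [nsmul_eq_mul]; gcongr; exact filter_subset _ _
      · refine (sum_le_card_nsmul _ _ _ fun m _ => hD j m m').trans ?_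
        rw [nsmul_eq_mul]
    have hGc : G * (#S * c) = #S * (M : ℝ) ^ (3 * d j - ω) / 2 := by rw [hc]; field_simp
    have hS₁ : (M : ℝ) ^ (1 - τ) ≤ #S₁ := by
      have b1 : #S * M ^ (3 * d j - ω) ≤ 2 * G * Tj * #S₁ * M ^ (3 * d j) := by
        nlinarith [mul_le_mul_of_nonneg_left hsplit hG0.le]
      have b2 : (M : ℝ) ^ (3 * d j - ω) = M ^ (3 * d j) * M ^ (-ω) := by
        rw [← Real.rpow_natCast, ← Real.rpow_add hM0]; congr 1; push_cast; ring
      have b3 : (#S : ℝ) * M ^ (-ω) ≤ 2 * G * Tj * #S₁ := by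
        refine le_of_mul_le_mul_right ?_ (show 0 < (M : ℝ) ^ (3 * d j) by positivity)
        calc _ = #S * (M : ℝ) ^ (3 * d j - ω) := by rw [b2]; ring
          _ ≤ _ := b1
      have b4 : (M : ℝ) ^ (1 - τ / 4 - ω) ≤ #S * (M : ℝ) ^ (-ω) := by
        rw [show 1 - τ / 4 - ω = (1 - τ / 4) + -ω by ring, Real.rpow_add hM0]; gcongr
      refine le_of_mul_le_mul_left ?_ (show (0 : ℝ) < 2 * G * Tj by positivity)
      exact h1.trans (b4.trans b3)
    have hκ : 1 / (2 * c) = G * (M : ℝ) ^ (ω - 3 * d j) := by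
      rw [hc, show ω - 3 * d j = -(3 * d j - ω) by ring, Real.rpow_neg hM0.le]; field_simp
    obtain ⟨q, hq0, hq, a, ha⟩ := hrat S₁ ((filter_subset _ _).trans hS) m' (hS hm') hS₁ (α j)
      (1 / (2 * c)) (by
        rw [hκ, le_div_iff₀ (by positivity), mul_pow]
        have b5 : (M : ℝ) ^ (-(d j : ℝ)) * (M : ℝ) ^ d j = 1 := by
          rw [← Real.rpow_natCast, ← Real.rpow_add hM0]; simp
        calc _ = G * (8 * 4 ^ d j) * (M : ℝ) ^ (ω - 3 * d j) * (M : ℝ) ^ d j := by ring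
          _ ≤ (M : ℝ) ^ (-(d j : ℝ)) * (M : ℝ) ^ d j := by gcongr
          _ = 1 := b5) fun m hm => exists_int_of_le_norm_sum (by positivity) (mem_filter.1 hm).2
    refine ⟨q, hq0, hq, a, ha.trans ?_⟩
    rw [hκ, mul_assoc, ← Real.rpow_add hM0]
    exact h3
  filter_upwards [eventually_all.2 main] with M h S hS A hA h1 h2 h3 α h4 i
  exact h i S hS A hA h1 h2 h3 α h4

end approximation

section fourth_moment

variable {F : Type*} [Field F] [Fintype F] [DecidableEq F]

lemma card_singular_pairs_le {m : ℕ} (hm : 0 < m) :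
    #{z : F × F | ¬ (z.1 ≠ 0 ∧ z.2 ≠ 0 ∧ z.1 ^ m ≠ z.2 ^ m)} ≤ (m + 2) * Fintype.card F := by
  have h : ({z : F × F | ¬ (z.1 ≠ 0 ∧ z.2 ≠ 0 ∧ z.1 ^ m ≠ z.2 ^ m)} : Finset (F × F)) ⊆
      univ.biUnion fun y : F => (insert 0 (univ.filter fun x : F => x ^ m = y ^ m)).image (fun x => (x, y)) ∪
        {(y, 0)} := by
    rintro ⟨x, y⟩ hz
    simp only [mem_filter, mem_univ, true_and, not_and_or, not_not] at hz
    simp only [mem_biUnion, mem_univ, true_and, mem_union, mem_image, mem_insert, mem_filter,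
      mem_singleton, Prod.mk.injEq]
    grind
  refine (card_le_card h).trans (card_biUnion_le.trans ((sum_le_card_nsmul _ _ (m + 1 + 1)
    fun y _ => ?_).trans_eq (by rw [card_univ, smul_eq_mul, mul_comm])))
  refine (card_union_le _ _).trans (add_le_add (card_image_le.trans ((card_insert_le _ _).trans
    (Nat.succ_le_succ (card_pow_eq_le hm _)))) (card_singleton _).le)

lemma card_pair_energy_le {k n : ℕ} (hn : 0 < n) (hnk : n < k) (hk : (k : F) ≠ 0) :
    #{w : (F × F) × (F × F) | w.1.1 ^ k + w.1.2 ^ k = w.2.1 ^ k + w.2.2 ^ k ∧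
      w.1.1 ^ n + w.1.2 ^ n = w.2.1 ^ n + w.2.2 ^ n} ≤
      (2 * (n * (2 * k * n)) + (k + 2) ^ 2) * Fintype.card F ^ 2 := by
  set q := Fintype.card F
  set c := n * (2 * k * n)
  let G : F × F → Prop := fun z => z.1 ≠ 0 ∧ z.2 ≠ 0 ∧ z.1 ^ (k - n) ≠ z.2 ^ (k - n)
  have hF2 : #(univ : Finset (F × F)) = q ^ 2 := by rw [card_univ, Fintype.card_prod, sq]
  let E : Finset ((F × F) × (F × F)) := {w | w.1.1 ^ k + w.1.2 ^ k = w.2.1 ^ k + w.2.2 ^ k ∧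
      w.1.1 ^ n + w.1.2 ^ n = w.2.1 ^ n + w.2.2 ^ n}
  have h1 : #{w ∈ E | G w.1} ≤ c * q ^ 2 := by
    rw [← hF2]
    refine card_le_mul_card_image_of_maps_to (f := Prod.snd) (fun _ _ => mem_univ _) c fun b _ => ?_
    refine (card_le_card_of_injOn Prod.fst ?_ ?_).trans
      (card_pair_le hn hnk hk (b.1 ^ k + b.2 ^ k) (b.1 ^ n + b.2 ^ n))
    · rintro ⟨z, b'⟩ hz
      grind
    · rintro ⟨z, b1⟩ hz ⟨z', b2⟩ hz' h
      simp_all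
  have h2 : #{w ∈ E | G w.2} ≤ c * q ^ 2 := by
    refine (card_le_card_of_injOn Prod.swap ?_ (Prod.swap_injective.injOn)).trans h1
    rintro ⟨z, b'⟩ hz
    grind
  have h3 : #{w ∈ E | ¬ G w.1 ∧ ¬ G w.2} ≤ (k + 2) ^ 2 * q ^ 2 := by
    have hs : #{z : F × F | ¬ G z} ≤ (k + 2) * q :=
      (card_singular_pairs_le (by omega)).trans (Nat.mul_le_mul_right _ (by omega))
    calc _ ≤ #((univ.filter fun z => ¬ G z) ×ˢ (univ.filter fun z => ¬ G z)) := by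
          refine card_le_card fun w hw => ?_
          simp_all
      _ ≤ ((k + 2) * q) * ((k + 2) * q) := by rw [card_product]; exact Nat.mul_le_mul hs hs
      _ = _ := by ring
  have h4 : E ⊆ {w ∈ E | G w.1} ∪ ({w ∈ E | G w.2} ∪ {w ∈ E | ¬ G w.1 ∧ ¬ G w.2}) := by grind
  refine (card_le_card h4).trans ((card_union_le _ _).trans ?_)
  grind

end fourth_moment

section complete_sums

/-- The complete exponential sum `∑_{x mod q} e((A x^k + B x^n)/q)`. -/
noncomputable def polySum (k n q : ℕ) (A B : ℤ) : ℂ :=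
  ∑ x ∈ range q, ee (((A * (x : ℤ) ^ k + B * (x : ℤ) ^ n : ℤ) : ℝ) / q)

lemma ee_div_congr {q : ℕ} {a b : ℤ} (h : a ≡ b [ZMOD q]) : ee ((a : ℝ) / q) = ee (b / q) := by
  rcases eq_zero_or_pos q with rfl | hq
  · simp
  obtain ⟨c, hc⟩ := Int.modEq_iff_dvd.1 h
  have : (b : ℝ) / q = a / q + c := by
    have hq' : q ≠ 0 := by positivity
    rw [eq_add_of_sub_eq hc]; push_cast; field_simp; ring
  rw [this, ee_add_int]

lemma poly_congr {m A B x y : ℤ} (k n : ℕ) (h : x ≡ y [ZMOD m]) :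
    A * x ^ k + B * x ^ n ≡ A * y ^ k + B * y ^ n [ZMOD m] :=
  ((h.pow k).mul_left A).add ((h.pow n).mul_left B)

lemma norm_polySum_le (k n q : ℕ) (A B : ℤ) : ‖polySum k n q A B‖ ≤ q := by
  refine (norm_sum_le _ _).trans ?_
  simp

lemma polySum_one (k n : ℕ) (A B : ℤ) : ‖polySum k n 1 A B‖ ≤ 1 := by
  simpa using norm_polySum_le k n 1 A B

lemma sum_range_mul_eq {R : Type*} [AddCommMonoid R] (f : ℕ → R) (a b : ℕ) :
    ∑ u ∈ range (a * b), f u = ∑ y ∈ range a, ∑ z ∈ range b, f (y + a * z) := by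
  induction b with
  | zero => simp
  | succ b ih =>
    rw [mul_add, mul_one, sum_range_add, ih, ← sum_add_distrib]
    refine sum_congr rfl fun y _ => ?_
    rw [sum_range_succ, add_comm y]

/-- A sum of a `q`-periodic function over `q * b` consecutive integers. -/
lemma sum_range_periodic {R : Type*} [AddCommMonoid R] (f : ℕ → R) (a b : ℕ)
    (hf : ∀ y z, f (y + a * z) = f y) : ∑ u ∈ range (a * b), f u = b • ∑ y ∈ range a, f y := by
  rw [sum_range_mul_eq, smul_sum]
  simp_all

lemma polySum_mul (k n : ℕ) (hk : 0 < k) (hn : 0 < n) {a b : ℕ} (ha : 0 < a) (hb : 0 < b)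
    (hab : a.Coprime b) (A B : ℤ) :
    polySum k n (a * b) A B = polySum k n a (A * b ^ (k - 1)) (B * b ^ (n - 1)) *
      polySum k n b (A * a ^ (k - 1)) (B * a ^ (n - 1)) := by
  have haR : (a : ℝ) ≠ 0 := by positivity
  have hbR : b ≠ 0 := by positivity
  let g : ℕ × ℕ → ℕ := fun z => (z.1 * b + z.2 * a) % (a * b)
  have hinj : Set.InjOn g (range a ×ˢ range b : Finset (ℕ × ℕ)) := by
    rintro ⟨x, y⟩ hz ⟨x', y'⟩ hz' h
    simp only [coe_product, Set.mem_prod, mem_coe, mem_range] at hz hz'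
    have h1 : x * b + y * a ≡ x' * b + y' * a [MOD a * b] := h
    have e1 : ∀ u v : ℕ, u * b + v * a ≡ u * b [MOD a] := fun u v => by simp [Nat.ModEq]
    have e2 : ∀ u v : ℕ, u * b + v * a ≡ v * a [MOD b] := fun u v => by simp [Nat.ModEq]
    have h2 := Nat.ModEq.cancel_right_of_coprime hab
      (((e1 x y).symm.trans (h1.of_mul_right b)).trans (e1 x' y'))
    have h3 := Nat.ModEq.cancel_right_of_coprime hab.symm
      (((e2 x y).symm.trans (h1.of_mul_left a)).trans (e2 x' y'))
    rw [Prod.mk.injEq]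
    exact ⟨Nat.ModEq.eq_of_lt_of_lt h2 hz.1 hz'.1, Nat.ModEq.eq_of_lt_of_lt h3 hz.2 hz'.2⟩
  have himg : (range a ×ˢ range b).image g = range (a * b) := by
    refine eq_of_subset_of_card_le (image_subset_iff.2 fun z _ => ?_) ?_
    · exact mem_range.2 (Nat.mod_lt _ (mul_pos ha hb))
    · rw [card_image_of_injOn hinj]; simp
  simp only [polySum]
  rw [← himg, sum_image hinj, sum_mul_sum, ← sum_product']
  refine sum_congr rfl ?_
  · rintro ⟨x, y⟩ _
    rw [← ee_add]
    obtain ⟨k', rfl⟩ : ∃ k', k = k' + 1 := ⟨k - 1, by omega⟩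
    obtain ⟨n', rfl⟩ : ∃ n', n = n' + 1 := ⟨n - 1, by omega⟩
    have hpow : ∀ j : ℕ, ((x : ℤ) * b + y * a) ^ (j + 1) ≡
        (x * b) ^ (j + 1) + (y * a) ^ (j + 1) [ZMOD ((a * b : ℕ) : ℤ)] := by
      intro j
      push_cast
      refine (Int.modEq_and_modEq_iff_modEq_mul (by simpa using hab)).1 ⟨?_, ?_⟩
      · have e1 : (x : ℤ) * b + y * a ≡ x * b [ZMOD a] := by simp [Int.ModEq]
        exact (e1.pow (j + 1)).trans (by simpa using ((Int.ModEq.refl ((x * b : ℤ) ^ (j + 1))).add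
            (Int.modEq_zero_iff_dvd.2 ((dvd_mul_left _ _).trans (dvd_pow_self _ (by omega))))).symm)
      · have e1 : x * b + y * a ≡ y * a [ZMOD b] := by simp [Int.ModEq]
        exact (e1.pow (j + 1)).trans (by simpa using ((Int.modEq_zero_iff_dvd.2 ((dvd_mul_left _
            _).trans (dvd_pow_self _ (by omega)))).add (Int.ModEq.refl ((y * a : ℤ) ^ (j + 1)))).symm)
    have hmod : (((x * b + y * a) % (a * b) : ℕ) : ℤ) ≡ x * b + y * a [ZMOD ((a * b : ℕ) : ℤ)] := by
      push_cast; exact Int.mod_modEq _ _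
    have hfin := (poly_congr (A := A) (B := B) (k' + 1) (n' + 1) hmod).trans
      (((hpow k').mul_left A).add ((hpow n').mul_left B))
    rw [ee_div_congr hfin]
    congr 1
    push_cast
    field_simp
    ring

end complete_sums

section prime_modulus

lemma image_mul_mod_range {p u : ℕ} (hp : 0 < p) (hu : u.Coprime p) :
    Set.InjOn (fun x => u * x % p) (range p) ∧ (range p).image (fun x => u * x % p) = range p := by
  have hinj : Set.InjOn (fun x => u * x % p) (range p) := by
    intro x hx y hy h
    simp only [coe_range, Set.mem_Iio] at hx hy
    exact Nat.ModEq.eq_of_lt_of_lt (Nat.ModEq.cancel_left_of_coprime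
      (by rwa [Nat.gcd_comm]) (show u * x ≡ u * y [MOD p] from h)) hx hy
  refine ⟨hinj, eq_of_subset_of_card_le (image_subset_iff.2 fun z _ => ?_) ?_⟩
  · exact mem_range.2 (Nat.mod_lt _ hp)
  · rw [card_image_of_injOn hinj]

lemma polySum_scale (k n : ℕ) {p u : ℕ} (hp : 0 < p) (hu : u.Coprime p) (A B : ℤ) :
    polySum k n p (A * (u : ℤ) ^ k) (B * (u : ℤ) ^ n) = polySum k n p A B := by
  obtain ⟨hinj, himg⟩ := image_mul_mod_range hp hu
  conv_rhs => rw [polySum, ← himg, sum_image hinj]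
  rw [polySum]
  refine sum_congr rfl fun x _ => ee_div_congr ?_
  have : ((u * x % p : ℕ) : ℤ) ≡ u * x [ZMOD p] := by push_cast; exact Int.mod_modEq _ _
  refine Int.ModEq.trans ?_ (poly_congr (A := A) (B := B) k n this).symm
  rw [mul_pow, mul_pow, mul_assoc, mul_assoc]

lemma card_energy_mod_le {k n p : ℕ} (hp : p.Prime) (hn : 0 < n) (hnk : n < k) (hkp : k < p) :
    (open Classical in #{z ∈ Fintype.piFinset fun _ : Fin 2 => range p ×ˢ range p |
      ∀ i, (p : ℤ) ∣ (∑ j, (mono (pairDeg k n) (z j).1 - mono (pairDeg k n) (z j).2)) i}) ≤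
      (2 * (n * (2 * k * n)) + (k + 2) ^ 2) * p ^ 2 := by
  classical
  have : Fact p.Prime := ⟨hp⟩
  have hk : (k : ZMod p) ≠ 0 := by
    rw [Ne, ZMod.natCast_eq_zero_iff]
    exact fun h => absurd (Nat.le_of_dvd (by omega) h) (by omega)
  have h := card_pair_energy_le (F := ZMod p) hn hnk hk
  rw [ZMod.card] at h
  refine le_trans (card_le_card_of_injOn (fun z => (((((z 0).1 : ℕ) : ZMod p), (((z 1).1 : ℕ) : ZMod p)),
    ((((z 0).2 : ℕ) : ZMod p), (((z 1).2 : ℕ) : ZMod p)))) ?_ ?_) h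
  · intro z hz
    simp only [coe_filter, Set.mem_ofPred_eq] at hz
    simp only [coe_filter, mem_univ, true_and, Set.mem_ofPred_eq]
    have h1 := hz.2 true
    have h2 := hz.2 false
    rw [← ZMod.intCast_zmod_eq_zero_iff_dvd] at h1 h2
    simp only [Fin.sum_univ_two, Pi.add_apply, Pi.sub_apply, mono, pairDeg, cond_true,
      cond_false] at h1 h2
    push_cast at h1 h2
    constructor
    · linear_combination h1
    · linear_combination h2
  · intro z hz w hw h
    simp only [coe_filter, Set.mem_ofPred_eq, Fintype.mem_piFinset, mem_product, mem_range] at hz hw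
    simp only [Prod.mk.injEq, ZMod.natCast_eq_natCast_iff] at h
    have e : ∀ a b : ℕ, a < p → b < p → a ≡ b [MOD p] → a = b := fun a b ha hb h =>
      Nat.ModEq.eq_of_lt_of_lt h ha hb
    funext j
    fin_cases j
    · exact Prod.ext (e _ _ (hz.1 0).1 (hw.1 0).1 h.1.1) (e _ _ (hz.1 0).2 (hw.1 0).2 h.2.1)
    · exact Prod.ext (e _ _ (hz.1 1).1 (hw.1 1).1 h.1.2) (e _ _ (hz.1 1).2 (hw.1 1).2 h.2.2)

/-- Mordell's bound for binomial exponential sums to a prime modulus. -/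
lemma polySum_prime_pow_four_le {k n p : ℕ} (hp : p.Prime) (hn : 0 < n) (hnk : n < k) (hkp : k < p)
    {A B : ℤ} (hAB : ¬ ((p : ℤ) ∣ A ∧ (p : ℤ) ∣ B)) :
    ‖polySum k n p A B‖ ^ 4 ≤ 2 * k * (2 * (n * (2 * k * n)) + (k + 2) ^ 2 : ℕ) * (p : ℝ) ^ 3 := by
  classical
  set C₀ : ℕ := 2 * (n * (2 * k * n)) + (k + 2) ^ 2 with hC₀
  have hpF : Fact p.Prime := ⟨hp⟩
  have hp0 := hp.pos
  have hpR : (0 : ℝ) < p := by exact_mod_cast hp0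
  let co : Bool → ℤ := fun b => bif b then A else B
  let d := pairDeg k n
  let α : ℕ → Bool → ℝ := fun u b => (((co b * (u : ℤ) ^ d b) % p).toNat : ℝ) / p
  have hα : ∀ u b, α u b = (((co b * (u : ℤ) ^ d b) % p : ℤ) : ℝ) / p := by
    intro u b
    have : (((co b * (u : ℤ) ^ d b) % p).toNat : ℤ) = (co b * (u : ℤ) ^ d b) % p :=
      Int.toNat_of_nonneg (Int.emod_nonneg _ (by positivity))
    simp only [α]; congr 1; exact_mod_cast this
  have hgrid : ∀ u, α u ∈ grid Bool p := by
    intro u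
    refine Fintype.mem_piFinset.2 fun b => mem_image.2 ⟨_, mem_range.2 ?_, rfl⟩
    have := Int.emod_lt_of_pos (co b * (u : ℤ) ^ d b) (by positivity : (0 : ℤ) < p)
    have h2 := Int.emod_nonneg (co b * (u : ℤ) ^ d b) (by positivity : (p : ℤ) ≠ 0)
    omega
  let G : (Bool → ℝ) → ℝ := fun α => ‖expS (range p) (mono d) α‖ ^ (2 * 2)
  have hG : ∀ u ∈ Ico 1 p, G (α u) = ‖polySum k n p A B‖ ^ 4 := by
    intro u hu
    rw [mem_Ico] at hu
    have hcop : u.Coprime p :=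
      ((Nat.Prime.coprime_iff_not_dvd hp).2 (Nat.not_dvd_of_pos_of_lt hu.1 hu.2)).symm
    simp only [G]
    rw [← polySum_scale k n hp0 hcop A B]
    congr 2
    simp only [expS, polySum]
    refine sum_congr rfl fun x _ => ?_
    have : dot (α u) (mono d x) = (((co true * (u : ℤ) ^ d true) % p * (x : ℤ) ^ k +
        (co false * (u : ℤ) ^ d false) % p * (x : ℤ) ^ n : ℤ) : ℝ) / p := by
      simp only [dot, Fintype.sum_bool, hα, mono]
      push_cast
      simp only [d, pairDeg, cond_true, cond_false]
      ring
    rw [this]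
    exact ee_div_congr (((Int.mod_modEq _ _).mul_right _).add ((Int.mod_modEq _ _).mul_right _))
  have hfib : ∀ g ∈ grid Bool p, #{u ∈ Ico 1 p | α u = g} ≤ k := by
    intro g _
    have key : ∀ b : Bool, ¬ (p : ℤ) ∣ co b → 0 < d b → d b ≤ k → #{u ∈ Ico 1 p | α u = g} ≤ k := by
      intro b hb hd hdk
      rcases ({u ∈ Ico 1 p | α u = g}).eq_empty_or_nonempty with h0 | ⟨u₀, hu₀⟩
      · simp [h0]
      refine (card_le_card_of_injOn (fun u : ℕ => (u : ZMod p)) ?_ ?_).trans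
        ((card_pow_eq_le hd ((u₀ : ZMod p) ^ d b)).trans hdk)
      · intro u hu
        simp only [coe_filter, Set.mem_ofPred_eq, mem_univ, true_and]
        have h1 := (mem_filter.1 hu).2.trans (mem_filter.1 hu₀).2.symm
        have h2 := congrFun h1 b
        rw [hα, hα, div_left_inj' hpR.ne', Int.cast_inj] at h2
        have h3 := (ZMod.intCast_eq_intCast_iff _ _ _).2 h2
        push_cast at h3
        refine mul_left_cancel₀ ?_ h3
        rwa [Ne, ZMod.intCast_zmod_eq_zero_iff_dvd]
      · intro u hu v hv h
        have h1 := mem_Ico.1 (mem_filter.1 hu).1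
        have h2 := mem_Ico.1 (mem_filter.1 hv).1
        exact Nat.ModEq.eq_of_lt_of_lt ((ZMod.natCast_eq_natCast_iff _ _ _).1 h) h1.2 h2.2
    by_cases hA : (p : ℤ) ∣ A
    · exact key false (fun h => hAB ⟨hA, h⟩) hn hnk.le
    · exact key true hA (by simp only [d, pairDeg, cond_true]; omega) le_rfl
  have hsum : ∑ u ∈ Ico 1 p, G (α u) ≤ k * ∑ g ∈ grid Bool p, G g := by
    rw [← sum_fiberwise_of_maps_to (fun u _ => hgrid u), mul_sum]
    refine sum_le_sum fun g hg => ?_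
    rw [sum_congr rfl fun u hu => by rw [(mem_filter.1 hu).2], sum_const, nsmul_eq_mul]
    exact mul_le_mul_of_nonneg_right (by exact_mod_cast hfib g hg) (by positivity)
  have hmom : 𝔼 g ∈ grid Bool p, G g ≤ C₀ * (p : ℝ) ^ 2 := by
    have h1 := expect_ofReal_eq (N := p) (F := G) (fun α => norm_pow_expS 2 (range p) (mono d) α)
    rw [expect_expS hp0] at h1
    rw [← Complex.ofReal_natCast, Complex.ofReal_inj] at h1
    rw [h1]
    have h2 : ((_ : ℕ) : ℝ) ≤ ((C₀ * p ^ 2 : ℕ) : ℝ) :=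
      Nat.cast_le.2 (card_energy_mod_le hp hn hnk hkp)
    push_cast at h2
    convert h2
  rw [expect_eq_sum_div_card, card_grid hp0, div_le_iff₀ (by positivity)] at hmom
  rw [sum_congr rfl hG, sum_const, Nat.card_Ico, nsmul_eq_mul] at hsum
  have hp2 : (p : ℝ) ≤ 2 * ((p - 1 : ℕ) : ℝ) := by
    have : p ≤ 2 * (p - 1) := by have := hp.two_le; omega
    exact_mod_cast this
  simp only [Fintype.card_bool] at hmom
  push_cast at hmom
  refine le_of_mul_le_mul_left ?_ hpR
  calc (p : ℝ) * ‖polySum k n p A B‖ ^ 4 ≤ 2 * (((p - 1 : ℕ) : ℝ) * ‖polySum k n p A B‖ ^ 4) := by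
        rw [← mul_assoc]; gcongr
    _ ≤ 2 * (k * (C₀ * (p : ℝ) ^ 2 * (p : ℝ) ^ 2)) := by
        exact mul_le_mul_of_nonneg_left (hsum.trans (mul_le_mul_of_nonneg_left hmom (by positivity)))
          (by norm_num)
    _ = _ := by ring

end prime_modulus

section prime_powers

variable {k n : ℕ}

/-- The part of `polySum` to a prime power modulus over arguments prime to the modulus. -/
noncomputable def unitSum (k n p l : ℕ) (A B : ℤ) : ℂ :=
  ∑ x ∈ (range (p ^ l)).filter fun x => ¬ p ∣ x,
    ee (((A * (x : ℤ) ^ k + B * (x : ℤ) ^ n : ℤ) : ℝ) / (p ^ l : ℕ))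

lemma exists_pow_add (y w : ℤ) (k : ℕ) : ∃ c, (y + w) ^ k = y ^ k + k * y ^ (k - 1) * w + c * w ^ 2 :=
  ⟨_, (Polynomial.powAddExpansion y w k).2⟩

lemma norm_unitSum_le {p h j : ℕ} (hp : p.Prime) (hh : 0 < h) (hjh : j ≤ h) (A B : ℤ) :
    ‖unitSum k n p (h + j) A B‖ ≤ (p : ℝ) ^ j * #{y ∈ range (p ^ h) | ¬ p ∣ y ∧
      ((p ^ j : ℕ) : ℤ) ∣ k * A * (y : ℤ) ^ (k - 1) + n * B * (y : ℤ) ^ (n - 1)} := by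
  have hp0 : (p : ℝ) ≠ 0 := by exact_mod_cast hp.ne_zero
  have key : ∀ y z : ℕ, ee (((A * ((y + p ^ h * z : ℕ) : ℤ) ^ k + B * ((y + p ^ h * z : ℕ) : ℤ) ^ n : ℤ) : ℝ)
      / (p ^ (h + j) : ℕ)) = ee (((A * (y : ℤ) ^ k + B * (y : ℤ) ^ n : ℤ) : ℝ) / (p ^ (h + j) : ℕ)) *
      ee ((z : ℝ) / (p ^ j : ℕ) *
        ((k * A * (y : ℤ) ^ (k - 1) + n * B * (y : ℤ) ^ (n - 1) : ℤ) : ℝ)) := by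
    intro y z
    obtain ⟨c₁, hc₁⟩ := exists_pow_add y (p ^ h * z) k
    obtain ⟨c₂, hc₂⟩ := exists_pow_add y (p ^ h * z) n
    rw [← ee_add]
    have h1 : ((A * (y : ℤ) ^ k + B * (y : ℤ) ^ n : ℤ) : ℝ) / (p ^ (h + j) : ℕ) + (z : ℝ) / (p ^ j : ℕ) *
        ((k * A * (y : ℤ) ^ (k - 1) + n * B * (y : ℤ) ^ (n - 1) : ℤ) : ℝ) =
        ((A * (y : ℤ) ^ k + B * (y : ℤ) ^ n + p ^ h * z *
          (k * A * (y : ℤ) ^ (k - 1) + n * B * (y : ℤ) ^ (n - 1)) : ℤ) : ℝ) / (p ^ (h + j) : ℕ) := by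
      push_cast
      rw [pow_add]
      field_simp
    rw [h1]
    refine ee_div_congr (Int.modEq_iff_dvd.2 ?_)
    push_cast
    rw [hc₁, hc₂, pow_add]
    obtain ⟨r, rfl⟩ := Nat.exists_eq_add_of_le hjh
    refine ⟨-(A * c₁ + B * c₂) * p ^ r * z ^ 2, ?_⟩
    ring
  have hsum : unitSum k n p (h + j) A B = ∑ y ∈ range (p ^ h), if ¬ p ∣ y then
      ee (((A * (y : ℤ) ^ k + B * (y : ℤ) ^ n : ℤ) : ℝ) / (p ^ (h + j) : ℕ)) *
      (if ((p ^ j : ℕ) : ℤ) ∣ k * A * (y : ℤ) ^ (k - 1) + n * B * (y : ℤ) ^ (n - 1) then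
        ((p ^ j : ℕ) : ℂ) else 0) else 0 := by
    rw [unitSum, sum_filter]
    conv_lhs => rw [show p ^ (h + j) = p ^ h * p ^ j from pow_add _ _ _]
    rw [sum_range_mul_eq]
    refine sum_congr rfl fun y _ => ?_
    have hd : ∀ z, p ∣ y + p ^ h * z ↔ p ∣ y := fun z =>
      (Nat.dvd_add_iff_left ((dvd_pow_self p hh.ne').mul_right z)).symm
    simp only [hd]
    split_ifs with h1 h2
    · simp
    · rw [← pow_add, sum_congr rfl fun z _ => key y z, ← mul_sum,
        sum_range_ee (pow_pos hp.pos j), if_pos h2]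
    · rw [← pow_add, sum_congr rfl fun z _ => key y z, ← mul_sum,
        sum_range_ee (pow_pos hp.pos j), if_neg h2, mul_zero]
  rw [hsum, ← sum_filter]
  refine (norm_sum_le _ _).trans ?_
  rw [← filter_filter, card_filter]
  push_cast
  rw [mul_sum]
  refine sum_le_sum fun y _ => ?_
  rw [norm_mul, norm_ee, one_mul]
  split_ifs <;> simp

lemma card_critical_le {p h j : ℕ} (hp : p.Prime) (hn : 0 < n) (hnk : n < k) (hh : 0 < h)
    (hjh : j ≤ h) {A B : ℤ} (hAB : ¬ ((p : ℤ) ∣ A ∧ (p : ℤ) ∣ B)) :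
    #{y ∈ range (p ^ h) | ¬ p ∣ y ∧
      ((p ^ j : ℕ) : ℤ) ∣ k * A * (y : ℤ) ^ (k - 1) + n * B * (y : ℤ) ^ (n - 1)} ≤
      4 * k ^ 2 * p ^ (h - j) := by
  set S := (range (p ^ h)).filter fun y => ¬ p ∣ y ∧
      ((p ^ j : ℕ) : ℤ) ∣ k * A * (y : ℤ) ^ (k - 1) + n * B * (y : ℤ) ^ (n - 1) with hS
  rcases S.eq_empty_or_nonempty with h0 | ⟨y₀, hy₀⟩
  · simp [h0]
  have hpZ : Prime (p : ℤ) := Nat.prime_iff_prime_int.1 hp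
  have hdvd : ∀ y ∈ S, ((p ^ j : ℕ) : ℤ) ∣ k * A * (y : ℤ) ^ (k - n) + n * B := by
    intro y hy
    obtain ⟨-, h1, h2⟩ := mem_filter.1 hy
    have hc : IsCoprime ((p ^ j : ℕ) : ℤ) ((y : ℤ) ^ (n - 1)) := by
      push_cast
      refine IsCoprime.pow ((Nat.isCoprime_iff_coprime).2 ((Nat.Prime.coprime_iff_not_dvd hp).2 h1))
    refine hc.dvd_of_dvd_mul_right ?_
    refine h2.trans (dvd_of_eq ?_)
    rw [show k - 1 = (k - n) + (n - 1) by omega, pow_add]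
    ring
  obtain ⟨w, hwj, hw⟩ : ∃ w ≤ j, Int.gcd (k * A) ((p ^ j : ℕ) : ℤ) = p ^ w := by
    refine (Nat.dvd_prime_pow hp).1 ?_
    exact_mod_cast Int.gcd_dvd_right (k * A) ((p ^ j : ℕ) : ℤ)
  have hwA : ((p ^ w : ℕ) : ℤ) ∣ k * A := hw ▸ Int.gcd_dvd_left _ _
  have hwB : ((p ^ w : ℕ) : ℤ) ∣ n * B := by
    have h1 : ((p ^ w : ℕ) : ℤ) ∣ ((p ^ j : ℕ) : ℤ) := by exact_mod_cast pow_dvd_pow p hwj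
    exact (dvd_add_right (hwA.mul_right _)).1 (h1.trans (hdvd y₀ hy₀))
  have hwk : p ^ w ≤ k := by
    have aux : ∀ (m : ℕ) (X : ℤ), 0 < m → ¬ (p : ℤ) ∣ X → ((p ^ w : ℕ) : ℤ) ∣ m * X → p ^ w ≤ m := by
      intro m X hm hX hd
      have hc : IsCoprime ((p ^ w : ℕ) : ℤ) X := by
        push_cast
        exact IsCoprime.pow_left ((Prime.coprime_iff_not_dvd hpZ).2 hX)
      exact Nat.le_of_dvd hm (by exact_mod_cast hc.dvd_of_dvd_mul_right hd)
    by_cases hA : (p : ℤ) ∣ A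
    · exact (aux n B hn (fun h => hAB ⟨hA, h⟩) hwB).trans hnk.le
    · exact aux k A (by omega) hA hwA
  have hcong : ∀ x ∈ S, ∀ y ∈ S, x ^ (k - n) ≡ y ^ (k - n) [MOD p ^ (j - w)] := by
    intro x hx y hy
    rw [Nat.modEq_iff_dvd]
    have h1 : ((p ^ j : ℕ) : ℤ) ∣ k * A * ((y : ℤ) ^ (k - n) - (x : ℤ) ^ (k - n)) := by
      have := dvd_sub (hdvd y hy) (hdvd x hx)
      ring_nf at this ⊢
      exact this
    obtain ⟨a', b', hab, ha, hb⟩ := Int.exists_gcd_one (m := k * A) (n := ((p ^ j : ℕ) : ℤ))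
      (Int.gcd_pos_of_ne_zero_right _ (by exact_mod_cast (pow_pos hp.pos j).ne'))
    rw [hw] at ha hb
    have hw0 : ((p ^ w : ℕ) : ℤ) ≠ 0 := by exact_mod_cast (pow_pos hp.pos w).ne'
    have h2 : b' ∣ (y : ℤ) ^ (k - n) - (x : ℤ) ^ (k - n) := by
      refine (Int.isCoprime_iff_gcd_eq_one.2 hab).symm.dvd_of_dvd_mul_left ?_
      refine Int.dvd_of_mul_dvd_mul_left hw0 ?_
      rw [ha, hb] at h1
      refine (dvd_of_eq (mul_comm _ _)).trans (h1.trans (dvd_of_eq (by ring)))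
    have h3 : b' = ((p ^ (j - w) : ℕ) : ℤ) := by
      refine mul_right_cancel₀ hw0 (hb.symm.trans ?_)
      rw [← Nat.cast_mul, ← pow_add, Nat.sub_add_cancel hwj]
    rw [h3] at h2
    exact_mod_cast h2
  have hcard := card_le_rootCount_mul (q := p ^ (j - w)) (B := p ^ h) (S := S) (k := k - n)
    (pow_pos hp.pos _) (fun x hx => ⟨mem_range.1 (mem_filter.1 hx).1,
      ((Nat.coprime_comm.1 ((Nat.Prime.coprime_iff_not_dvd hp).2 (mem_filter.1 hx).2.1)).pow_right _)⟩) hcong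
  refine hcard.trans ?_
  have hr := rootCount_prime_pow_le (k := k - n) (by omega) hp (j - w)
  rw [Nat.pow_div (by omega) hp.pos, show h - (j - w) = (h - j) + w by omega, pow_add]
  have h1 : 1 ≤ p ^ (h - j) := Nat.one_le_pow _ _ hp.pos
  calc (p ^ (h - j) * p ^ w + 1) * rootCount (k - n) (p ^ (j - w))
      ≤ (p ^ (h - j) * k + p ^ (h - j) * k) * (2 * k) := by
        refine Nat.mul_le_mul (Nat.add_le_add (Nat.mul_le_mul_left _ hwk) ?_) (hr.trans (by omega))
        exact Nat.one_le_iff_ne_zero.2 (Nat.mul_ne_zero (by omega) (by omega))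
    _ = _ := by ring

/-- The constant in the bounds for `unitSum`. -/
def unitConst (k n : ℕ) : ℕ := 2 * k * (2 * (n * (2 * k * n)) + (k + 2) ^ 2) + 1 + k + 4 * k ^ 2

lemma norm_unitSum_le_rpow {p l : ℕ} (hp : p.Prime) (hn : 0 < n) (hnk : n < k) (hl : 0 < l)
    {A B : ℤ} (hAB : ¬ ((p : ℤ) ∣ A ∧ (p : ℤ) ∣ B)) :
    ‖unitSum k n p l A B‖ ≤ unitConst k n * (p : ℝ) ^ ((3 / 4 : ℝ) * l) := by
  have hp1 : (1 : ℝ) ≤ p := by exact_mod_cast hp.one_le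
  have hpow : (1 : ℝ) ≤ (p : ℝ) ^ ((3 / 4 : ℝ) * l) := Real.one_le_rpow hp1 (by positivity)
  rcases eq_or_lt_of_le (Nat.succ_le_of_lt hl) with h1 | h2
  · obtain rfl : l = 1 := h1.symm
    rcases le_or_gt p k with hpk | hpk
    · have h3 : ‖unitSum k n p 1 A B‖ ≤ k := by
        refine (norm_sum_le _ _).trans ?_
        simp only [norm_ee, sum_const, nsmul_eq_mul, mul_one]
        refine Nat.cast_le.2 ((card_filter_le _ _).trans ?_)
        rw [card_range, pow_one]; exact hpk
      refine h3.trans ?_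
      have : (k : ℝ) ≤ unitConst k n := Nat.cast_le.2 (by unfold unitConst; omega)
      nlinarith [this, hpow, (Nat.cast_nonneg (α := ℝ) k)]
    · have h3 := polySum_prime_pow_four_le hp hn hnk hpk hAB
      set C₀ : ℕ := 2 * (n * (2 * k * n)) + (k + 2) ^ 2 with hC₀
      have h4 : unitSum k n p 1 A B = polySum k n p A B - 1 := by
        have h5 : (range (p ^ 1)).filter (fun x => ¬ p ∣ x) = (range p).erase 0 := by
          ext x
          simp only [mem_filter, mem_range, mem_erase, pow_one]
          constructor
          · rintro ⟨hx, hd⟩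
            exact ⟨fun h => hd (h ▸ dvd_zero _), hx⟩
          · rintro ⟨hx, hd⟩
            exact ⟨hd, fun h => absurd (Nat.le_of_dvd (by omega) h) (by omega)⟩
        rw [unitSum, h5, polySum, ← add_sum_erase _ _ (mem_range.2 hp.pos)]
        have hk0 : k ≠ 0 := by omega
        simp [ee_zero, hn.ne', hk0]
      have h5 : ‖polySum k n p A B‖ ≤ (2 * k * C₀ : ℕ) * (p : ℝ) ^ ((3 / 4 : ℝ) * (1 : ℕ)) := by
        have hC1 : (1 : ℝ) ≤ (2 * k * C₀ : ℕ) := by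
          refine Nat.one_le_cast.2 (Nat.one_le_iff_ne_zero.2 ?_)
          have : 0 < C₀ := by positivity
          have : 0 < k := by omega
          positivity
        refine le_of_pow_le_pow_left₀ (n := 4) (by norm_num) (by positivity) (h3.trans ?_)
        rw [mul_pow, ← Real.rpow_natCast ((p : ℝ) ^ _) 4, ← Real.rpow_mul (by positivity)]
        rw [show (3 / 4 : ℝ) * (1 : ℕ) * (4 : ℕ) = (3 : ℕ) by norm_num, Real.rpow_natCast]
        have := le_self_pow₀ hC1 (n := 4) (by norm_num)
        refine mul_le_mul_of_nonneg_right (le_trans (le_of_eq ?_) this) (by positivity)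
        push_cast; ring
      rw [h4]
      refine (norm_sub_le _ _).trans ?_
      rw [norm_one]
      have h6 : ((2 * k * C₀ : ℕ) : ℝ) + 1 ≤ unitConst k n := by
        have : 2 * k * C₀ + 1 ≤ unitConst k n := by
          rw [show unitConst k n = 2 * k * C₀ + 1 + k + 4 * k ^ 2 from rfl]; omega
        exact_mod_cast this
      nlinarith [h5, h6, hpow]
  · have h2' : 2 ≤ l := h2
    have h3 := norm_unitSum_le (k := k) (n := n) hp (h := l - l / 2) (j := l / 2) (by omega) (by omega) A B
    rw [show l - l / 2 + l / 2 = l by omega] at h3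
    have h4 := card_critical_le hp hn hnk (h := l - l / 2) (j := l / 2) (by omega) (by omega) hAB
    refine h3.trans ?_
    calc (p : ℝ) ^ (l / 2) * _ ≤ (p : ℝ) ^ (l / 2) * ((4 * k ^ 2 * p ^ (l - l / 2 - l / 2) : ℕ) : ℝ) :=
          mul_le_mul_of_nonneg_left (Nat.cast_le.2 h4) (by positivity)
      _ = (4 * k ^ 2 : ℕ) * (p : ℝ) ^ (l - l / 2) := by
          rw [show (p : ℝ) ^ (l - l / 2) = (p : ℝ) ^ (l / 2) * (p : ℝ) ^ (l - l / 2 - l / 2) by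
            rw [← pow_add]; congr 1; omega]
          push_cast; ring
      _ ≤ unitConst k n * (p : ℝ) ^ ((3 / 4 : ℝ) * l) := by
          refine mul_le_mul (Nat.cast_le.2 (by unfold unitConst; omega)) ?_ (by positivity) (by positivity)
          rw [← Real.rpow_natCast]
          refine Real.rpow_le_rpow_of_exponent_le hp1 ?_
          have h5 : 4 * (l - l / 2) ≤ 3 * l := by omega
          have h6 : (4 : ℝ) * (l - l / 2 : ℕ) ≤ 3 * l := by exact_mod_cast h5
          linarith

end prime_powers

section complete_sums

variable {k n : ℕ}

lemma polySum_eq_unitSum_add {p l : ℕ} (hp : p.Prime) (hl : 0 < l) (A B : ℤ) :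
    polySum k n (p ^ l) A B = unitSum k n p l A B + ∑ y ∈ range (p ^ (l - 1)),
      ee (((A * (p : ℤ) ^ k * (y : ℤ) ^ k + B * (p : ℤ) ^ n * (y : ℤ) ^ n : ℤ) : ℝ) / (p ^ l : ℕ)) := by
  rw [polySum, ← sum_filter_not_add_sum_filter _ (fun x => p ∣ x), unitSum]
  congr 1
  symm
  refine sum_bij' (fun y _ => p * y) (fun x _ => x / p) ?_ ?_ ?_ ?_ ?_
  · intro y hy
    refine mem_filter.2 ⟨mem_range.2 ?_, dvd_mul_right _ _⟩
    calc p * y < p * p ^ (l - 1) := Nat.mul_lt_mul_of_pos_left (mem_range.1 hy) hp.pos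
      _ = p ^ l := by rw [← pow_succ', Nat.sub_add_cancel hl]
  · intro x hx
    obtain ⟨h1, h2⟩ := mem_filter.1 hx
    refine mem_range.2 (Nat.div_lt_of_lt_mul ?_)
    rw [← pow_succ', Nat.sub_add_cancel hl]
    exact mem_range.1 h1
  · intro y _
    exact Nat.mul_div_cancel_left _ hp.pos
  · intro x hx
    exact Nat.mul_div_cancel' (mem_filter.1 hx).2
  · intro y _
    congr 3
    push_cast
    ring

lemma exists_divided_coefficients {p : ℕ} (hp : p.Prime) (hn : 0 < n) (hnk : n < k) {A B : ℤ}
    (hAB : ¬ ((p : ℤ) ∣ A ∧ (p : ℤ) ∣ B)) :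
    ∃ e A' B', 0 < e ∧ e ≤ k ∧ A * (p : ℤ) ^ k = (p : ℤ) ^ e * A' ∧ B * (p : ℤ) ^ n = (p : ℤ) ^ e * B' ∧
      ¬ ((p : ℤ) ∣ A' ∧ (p : ℤ) ∣ B') := by
  classical
  have hp0 : (p : ℤ) ≠ 0 := by exact_mod_cast hp.ne_zero
  let Q : ℕ → Prop := fun e => (p : ℤ) ^ e ∣ A * (p : ℤ) ^ k ∧ (p : ℤ) ^ e ∣ B * (p : ℤ) ^ n
  have hQn : Q n := ⟨(pow_dvd_pow _ hnk.le).mul_left _, dvd_mul_left _ _⟩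
  have hQ : Q (Nat.findGreatest Q k) := Nat.findGreatest_spec hnk.le hQn
  have hge : n ≤ Nat.findGreatest Q k := Nat.le_findGreatest hnk.le hQn
  have hle := Nat.findGreatest_le (P := Q) k
  obtain ⟨⟨A', hA'⟩, B', hB'⟩ := id hQ
  refine ⟨Nat.findGreatest Q k, A', B', by omega, hle, hA', hB', ?_⟩
  rintro ⟨h1, h2⟩
  have hs : Q (Nat.findGreatest Q k + 1) := by
    constructor
    · exact ((dvd_of_eq (pow_succ _ _)).trans (mul_dvd_mul_left _ h1)).trans (dvd_of_eq hA'.symm)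
    · exact ((dvd_of_eq (pow_succ _ _)).trans (mul_dvd_mul_left _ h2)).trans (dvd_of_eq hB'.symm)
  rcases Nat.lt_or_ge (Nat.findGreatest Q k) k with h | h
  · exact Nat.findGreatest_is_greatest (Nat.lt_succ_self _) h hs
  · have he : Nat.findGreatest Q k = k := le_antisymm hle h
    rw [he] at hs
    refine hAB ⟨?_, ?_⟩
    · have := hs.1
      rw [pow_succ, mul_comm A] at this
      exact (mul_dvd_mul_iff_left (pow_ne_zero k hp0)).1 this
    · have := hs.2
      rw [show k + 1 = n + (k - n + 1) by omega, pow_add, mul_comm B] at this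
      exact (dvd_pow_self _ (by omega)).trans ((mul_dvd_mul_iff_left (pow_ne_zero n hp0)).1 this)

lemma polySum_prime_pow_le {p : ℕ} (hp : p.Prime) (hn : 0 < n) (hnk : n < k) {K : ℝ} (hK : 1 ≤ K)
    (hKp : unitConst k n * (p : ℝ) ^ (-(1 / 8) : ℝ) + K * (p : ℝ) ^ (-(3 / 4) : ℝ) ≤ K) (l : ℕ) :
    ∀ A B : ℤ, 0 < l → ¬ ((p : ℤ) ∣ A ∧ (p : ℤ) ∣ B) →
      ‖polySum k n (p ^ l) A B‖ ≤ K * (p : ℝ) ^ (l * (1 - 1 / (4 * k)) : ℝ) := by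
  induction l using Nat.strong_induction_on with
  | _ l ih =>
  intro A B hl hAB
  have hp1 : (1 : ℝ) ≤ p := by exact_mod_cast hp.one_le
  have hp0 : (0 : ℝ) < p := by linarith
  have hk2 : (2 : ℝ) ≤ k := by exact_mod_cast (by omega : 2 ≤ k)
  have hlR : (1 : ℝ) ≤ l := by exact_mod_cast hl
  set β : ℝ := 1 - 1 / (4 * k) with hβ
  have hβ1 : 1 / (4 * (k : ℝ)) ≤ 1 / 8 := by
    apply one_div_le_one_div_of_le <;> linarith
  have hβ2 : ∀ e : ℕ, e ≤ k → (e : ℝ) * (1 / (4 * k)) ≤ 1 / 4 := by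
    intro e he
    have : (e : ℝ) ≤ k := by exact_mod_cast he
    rw [mul_one_div, div_le_div_iff₀ (by linarith) (by norm_num)]
    linarith
  have hU := norm_unitSum_le_rpow hp hn hnk hl hAB
  have hU' : ‖unitSum k n p l A B‖ ≤ (p : ℝ) ^ (l * β) * (unitConst k n * (p : ℝ) ^ (-(1 / 8) : ℝ)) := by
    refine hU.trans ?_
    rw [mul_left_comm, ← Real.rpow_add hp0]
    refine mul_le_mul_of_nonneg_left (Real.rpow_le_rpow_of_exponent_le hp1 ?_) (by positivity)
    rw [hβ]
    nlinarith
  obtain ⟨e, A', B', he0, hek, hA', hB', hAB'⟩ := exists_divided_coefficients hp hn hnk hAB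
  have hV : ‖∑ y ∈ range (p ^ (l - 1)),
      ee (((A * (p : ℤ) ^ k * (y : ℤ) ^ k + B * (p : ℤ) ^ n * (y : ℤ) ^ n : ℤ) : ℝ) / (p ^ l : ℕ))‖ ≤
      (p : ℝ) ^ (l * β) * (K * (p : ℝ) ^ (-(3 / 4) : ℝ)) := by
    rcases le_or_gt l e with hle | hgt
    · refine (norm_sum_le _ _).trans ?_
      simp only [norm_ee, sum_const, card_range, nsmul_eq_mul, mul_one]
      rw [mul_left_comm, ← Real.rpow_add hp0]
      push_cast
      rw [← Real.rpow_natCast, Nat.cast_sub hl]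
      refine le_trans (Real.rpow_le_rpow_of_exponent_le hp1 ?_) (le_mul_of_one_le_left (by positivity) hK)
      have := hβ2 l (hle.trans hek)
      rw [hβ]
      push_cast
      linarith
    · have h1 : ∀ y : ℕ, ee (((A * (p : ℤ) ^ k * (y : ℤ) ^ k + B * (p : ℤ) ^ n * (y : ℤ) ^ n : ℤ) : ℝ) /
          (p ^ l : ℕ)) = ee (((A' * (y : ℤ) ^ k + B' * (y : ℤ) ^ n : ℤ) : ℝ) / (p ^ (l - e) : ℕ)) := by
        intro y
        congr 1
        rw [hA', hB']
        obtain ⟨m, rfl⟩ := Nat.exists_eq_add_of_le hgt.le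
        rw [Nat.add_sub_cancel_left]
        push_cast
        rw [pow_add]
        field_simp
      rw [sum_congr rfl fun y _ => h1 y, show p ^ (l - 1) = p ^ (l - e) * p ^ (e - 1) by
        rw [← pow_add]; congr 1; omega, sum_range_periodic, nsmul_eq_mul, norm_mul, Complex.norm_natCast]
      · have h2 := ih (l - e) (by omega) A' B' (by omega) hAB'
        rw [polySum] at h2
        calc ((p ^ (e - 1) : ℕ) : ℝ) * _ ≤ ((p ^ (e - 1) : ℕ) : ℝ) * (K * (p : ℝ) ^ ((l - e : ℕ) * β)) :=
              mul_le_mul_of_nonneg_left h2 (by positivity)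
          _ = K * (p : ℝ) ^ ((e - 1 : ℝ) + (l - e) * β) := by
              have h3 : ((e - 1 : ℕ) : ℝ) = (e : ℝ) - 1 := by rw [Nat.cast_sub he0, Nat.cast_succ, Nat.cast_zero, zero_add]
              rw [Real.rpow_add hp0, Nat.cast_sub hgt.le, ← h3, Real.rpow_natCast]
              push_cast; ring
          _ ≤ K * (p : ℝ) ^ (l * β + -(3 / 4)) := by
              refine mul_le_mul_of_nonneg_left (Real.rpow_le_rpow_of_exponent_le hp1 ?_) (by linarith)
              have := hβ2 e hek
              rw [hβ]
              linarith
          _ = _ := by rw [Real.rpow_add hp0]; ring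
      · intro y z
        refine ee_div_congr (poly_congr k n ?_)
        push_cast
        exact Int.modEq_iff_dvd.2 ⟨-z, by ring⟩
  rw [polySum_eq_unitSum_add hp hl]
  calc _ ≤ _ := norm_add_le _ _
    _ ≤ (p : ℝ) ^ (l * β) * (unitConst k n * (p : ℝ) ^ (-(1 / 8) : ℝ) + K * (p : ℝ) ^ (-(3 / 4) : ℝ)) := by
        rw [mul_add]; exact add_le_add hU' hV
    _ ≤ (p : ℝ) ^ (l * β) * K := by gcongr
    _ = _ := mul_comm _ _

/-- A power saving for complete binomial exponential sums. -/
theorem exists_polySum_le (hn : 0 < n) (hnk : n < k) : ∃ C : ℝ, 1 ≤ C ∧ ∀ q : ℕ, 0 < q → ∀ A B : ℤ,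
    (∀ p : ℕ, p.Prime → p ∣ q → ¬ ((p : ℤ) ∣ A ∧ (p : ℤ) ∣ B)) →
    ‖polySum k n q A B‖ ≤ C * (q : ℝ) ^ (1 - 1 / (4 * k) : ℝ) := by
  set C₁ : ℕ := unitConst k n with hC₁
  have hC1 : (1 : ℝ) ≤ C₁ := Nat.one_le_cast.2 (by rw [hC₁, unitConst]; omega)
  have hpow : ∀ p l : ℕ, ((p ^ l : ℕ) : ℝ) ^ (1 - 1 / (4 * k) : ℝ) =
      (p : ℝ) ^ (l * (1 - 1 / (4 * k)) : ℝ) := by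
    intro p l
    rw [Real.rpow_mul (by positivity), Real.rpow_natCast]
    push_cast; rfl
  refine ⟨(4 * C₁ : ℝ) ^ ((C₁ + 1) ^ 8), one_le_pow₀ (by linarith), fun q hq A B hAB =>
    le_of_prime_power_bounds (I := ℤ × ℤ) (F := fun i q => ‖polySum k n q i.1 i.2‖)
      (adm := fun i q => ∀ p : ℕ, p.Prime → p ∣ q → ¬ ((p : ℤ) ∣ i.1 ∧ (p : ℤ) ∣ i.2))
      (by linarith) (fun _ _ => norm_nonneg _) (fun i => polySum_one k n i.1 i.2)
      ?_ ?_ ?_ (A, B) hq hAB⟩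
  · intro i a b ha hb hab hi
    have aux : ∀ a b : ℕ, a.Coprime b → (∀ p : ℕ, p.Prime → p ∣ a → ¬ ((p : ℤ) ∣ i.1 ∧ (p : ℤ) ∣ i.2)) →
        ∀ p : ℕ, p.Prime → p ∣ a → ¬ ((p : ℤ) ∣ i.1 * (b : ℤ) ^ (k - 1) ∧ (p : ℤ) ∣ i.2 * (b : ℤ) ^ (n - 1)) := by
      intro a b hab hi p hp hpa h
      have hc : ∀ m, IsCoprime (p : ℤ) ((b : ℤ) ^ m) := fun m =>
        IsCoprime.pow_right (Nat.isCoprime_iff_coprime.2 (Nat.Coprime.coprime_dvd_left hpa hab))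
      exact hi p hp hpa ⟨(hc _).dvd_of_dvd_mul_right h.1, (hc _).dvd_of_dvd_mul_right h.2⟩
    refine ⟨(i.1 * (b : ℤ) ^ (k - 1), i.2 * (b : ℤ) ^ (n - 1)),
      (i.1 * (a : ℤ) ^ (k - 1), i.2 * (a : ℤ) ^ (n - 1)),
      aux a b hab fun p hp hpa => hi p hp (hpa.mul_right b),
      aux b a hab.symm fun p hp hpb => hi p hp (hpb.mul_left a), ?_⟩
    rw [polySum_mul k n (by omega) hn ha hb hab, norm_mul]
  · intro i p l hp hl hi
    rw [hpow]
    refine polySum_prime_pow_le hp hn hnk (by linarith) ?_ l i.1 i.2 hl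
      (hi p hp (dvd_pow_self p hl.ne'))
    have hp2 : (2 : ℝ) ≤ p := by exact_mod_cast hp.two_le
    have h1 : (p : ℝ) ^ (-(1 / 8) : ℝ) ≤ 1 :=
      Real.rpow_le_one_of_one_le_of_nonpos (by linarith) (by norm_num)
    have h2 : (p : ℝ) ^ (-(3 / 4) : ℝ) ≤ 3 / 4 := by
      refine (Real.rpow_le_rpow_of_exponent_le (z := -(1 / 8) * 4) (by linarith) (by norm_num)).trans ?_
      have h3 : (p : ℝ) ^ (-(1 / 8) * 4 : ℝ) = (√p)⁻¹ := by
        rw [Real.sqrt_eq_rpow, ← Real.rpow_neg (by linarith)]; norm_num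
      rw [h3, inv_le_comm₀ (by positivity) (by norm_num)]
      exact Real.le_sqrt_of_sq_le (by norm_num; linarith)
    nlinarith
  · intro i p l hp hpC hl hi
    rw [hpow, ← one_mul ((p : ℝ) ^ _)]
    refine polySum_prime_pow_le hp hn hnk le_rfl ?_ l i.1 i.2 hl (hi p hp (dvd_pow_self p hl.ne'))
    have hpC' : ((C₁ : ℝ) + 1) ^ 8 ≤ p := by exact_mod_cast hpC
    have hp1 : (1 : ℝ) ≤ p := by exact_mod_cast hp.one_le
    have h1 : (p : ℝ) ^ (-(3 / 4) : ℝ) ≤ (p : ℝ) ^ (-(1 / 8) : ℝ) :=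
      Real.rpow_le_rpow_of_exponent_le hp1 (by norm_num)
    have h2 : (p : ℝ) ^ (-(1 / 8) : ℝ) ≤ ((C₁ : ℝ) + 1)⁻¹ := by
      refine (Real.rpow_le_rpow_of_nonpos (by positivity) hpC' (by norm_num)).trans (le_of_eq ?_)
      rw [← Real.rpow_natCast, ← Real.rpow_mul (by positivity), ← Real.rpow_neg_one]
      norm_num
    calc (C₁ : ℝ) * (p : ℝ) ^ (-(1 / 8) : ℝ) + 1 * (p : ℝ) ^ (-(3 / 4) : ℝ)
        ≤ ((C₁ : ℝ) + 1) * (p : ℝ) ^ (-(1 / 8) : ℝ) := by linarith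
      _ ≤ ((C₁ : ℝ) + 1) * ((C₁ : ℝ) + 1)⁻¹ := by gcongr
      _ = 1 := mul_inv_cancel₀ (by positivity)

end complete_sums

section smooth_sums

lemma norm_ee_sub_ee_le (x y : ℝ) : ‖ee x - ee y‖ ≤ 2 * Real.pi * |x - y| := by
  have h1 : ee x - ee y = ee y * (Complex.exp (Complex.I * (2 * Real.pi * (x - y) : ℝ)) - 1) := by
    rw [mul_sub, mul_one, ee, ee, ← Complex.exp_add]
    congr 2
    push_cast; ring
  rw [h1, norm_mul, norm_ee, one_mul]
  refine Real.norm_exp_I_mul_ofReal_sub_one_le.trans_eq ?_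
  rw [Real.norm_eq_abs, abs_mul, abs_of_pos (by positivity : 0 < 2 * Real.pi)]

lemma norm_sum_range_ee_le {x : ℝ} (hx0 : x ≠ 0) (hx : |x| ≤ 1 / 2) (N : ℕ) :
    ‖∑ h ∈ range N, ee (x * h)‖ ≤ 1 / (2 * |x|) := by
  have h0 : 4 * |x| ≤ ‖ee x - 1‖ := by
    rcases eq_or_lt_of_le hx with h | h
    · rcases abs_eq (by norm_num : (0 : ℝ) ≤ 1 / 2) |>.1 h with rfl | rfl
      · have := norm_ee_sub_one (1 / 2)
        have h2 : |(1 / 2 : ℝ) - round (1 / 2 : ℝ)| = 1 / 2 := by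
          rw [round_eq]; norm_num
        rw [h2] at this
        rw [h]; exact this
      · have := norm_ee_sub_one (-(1 / 2))
        have h2 : |(-(1 / 2) : ℝ) - round (-(1 / 2) : ℝ)| = 1 / 2 := by
          rw [round_eq]; norm_num
        rw [h2] at this
        rw [h]; exact this
    · have := norm_ee_sub_one x
      have h2 : round x = 0 := round_eq_zero_iff.2 ⟨(abs_lt.1 h).1.le, (abs_lt.1 h).2⟩
      rwa [h2, Int.cast_zero, sub_zero] at this
  have hpow : ∀ h : ℕ, ee (x * h) = ee x ^ h := by
    intro h
    rw [mul_comm, ← ee_nat_mul]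
  have hpos : 0 < |x| := abs_pos.2 hx0
  have hne : ee x ≠ 1 := by
    intro h
    rw [h, sub_self, norm_zero] at h0
    linarith
  simp only [hpow]
  rw [geom_sum_eq hne, norm_div, div_le_div_iff₀ (by linarith) (by linarith)]
  have h2 : ‖ee x ^ N - 1‖ ≤ 2 := by
    refine (norm_sub_le _ _).trans ?_
    rw [norm_pow, norm_ee, one_pow, norm_one]; norm_num
  nlinarith

lemma norm_sum_sub_blocks_le {F : ℕ → ℂ} (hF : ∀ x, ‖F x‖ ≤ 1) (N : ℕ) {H : ℕ} (hH : 0 < H) :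
    ‖∑ x ∈ range N, F x - ∑ b ∈ range (N / H), ∑ h ∈ range H, F (H * b + h)‖ ≤ H := by
  have h1 : ∑ b ∈ range (N / H), ∑ h ∈ range H, F (H * b + h) = ∑ x ∈ range (H * (N / H)), F x := by
    rw [sum_range_mul_eq, sum_comm]
    exact sum_congr rfl fun y _ => sum_congr rfl fun z _ => by rw [add_comm]
  rw [h1]
  conv_lhs => rw [← Nat.div_add_mod N H]
  rw [sum_range_add, Nat.div_add_mod, add_sub_cancel_left]
  refine (norm_sum_le _ _).trans ((sum_le_sum fun x _ => hF _).trans ?_)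
  rw [sum_const, card_range, nsmul_eq_mul, mul_one]
  exact_mod_cast (Nat.mod_lt N hH).le

lemma pow_add_sub_bounds {x h X : ℝ} (hx : 0 ≤ x) (hh : 0 ≤ h) (hX : x + h ≤ X) (k : ℕ) :
    0 ≤ (x + h) ^ k - x ^ k ∧ X * ((x + h) ^ k - x ^ k) ≤ k * h * X ^ k ∧
    0 ≤ (x + h) ^ k - x ^ k - k * x ^ (k - 1) * h ∧
    X ^ 2 * ((x + h) ^ k - x ^ k - k * x ^ (k - 1) * h) ≤ k ^ 2 * h ^ 2 * X ^ k := by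
  have hX0 : 0 ≤ X := by linarith
  have hxX : x ≤ X := by linarith
  induction k with
  | zero => simp
  | succ k ih =>
    obtain ⟨h1, h2, h3, h4⟩ := ih
    have hxk : x ^ k ≤ X ^ k := pow_le_pow_left₀ hx hxX k
    have e1 : (x + h) ^ (k + 1) - x ^ (k + 1) = (x + h) * ((x + h) ^ k - x ^ k) + h * x ^ k := by ring
    have e2 : (x + h) ^ (k + 1) - x ^ (k + 1) - ((k + 1 : ℕ) : ℝ) * x ^ (k + 1 - 1) * h =
        (x + h) * ((x + h) ^ k - x ^ k - k * x ^ (k - 1) * h) + k * x ^ (k - 1) * h ^ 2 := by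
      rcases Nat.eq_zero_or_pos k with rfl | hk
      · simp
      · obtain ⟨j, rfl⟩ : ∃ j, k = j + 1 := ⟨k - 1, by omega⟩
        push_cast [Nat.add_sub_cancel]
        ring
    have e3 : X ^ 2 * (k * x ^ (k - 1) * h ^ 2) ≤ k * h ^ 2 * X ^ (k + 1) := by
      rcases Nat.eq_zero_or_pos k with rfl | hk
      · simp
      · obtain ⟨j, rfl⟩ : ∃ j, k = j + 1 := ⟨k - 1, by omega⟩
        have : x ^ j ≤ X ^ j := pow_le_pow_left₀ hx hxX j
        calc X ^ 2 * (((j + 1 : ℕ) : ℝ) * x ^ (j + 1 - 1) * h ^ 2)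
            ≤ X ^ 2 * (((j + 1 : ℕ) : ℝ) * X ^ j * h ^ 2) := by
              rw [Nat.add_sub_cancel]; gcongr
          _ = _ := by ring
    refine ⟨?_, ?_, ?_, ?_⟩
    · rw [e1]; positivity
    · rw [e1]
      calc X * ((x + h) * ((x + h) ^ k - x ^ k) + h * x ^ k)
          = (x + h) * (X * ((x + h) ^ k - x ^ k)) + X * h * x ^ k := by ring
        _ ≤ X * (k * h * X ^ k) + X * h * X ^ k := by
            have h5 : 0 ≤ X * ((x + h) ^ k - x ^ k) := by positivity
            gcongr
        _ = _ := by push_cast; ring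
    · rw [e2]; positivity
    · rw [e2]
      calc X ^ 2 * ((x + h) * ((x + h) ^ k - x ^ k - k * x ^ (k - 1) * h) + k * x ^ (k - 1) * h ^ 2)
          = (x + h) * (X ^ 2 * ((x + h) ^ k - x ^ k - k * x ^ (k - 1) * h)) +
            X ^ 2 * (k * x ^ (k - 1) * h ^ 2) := by ring
        _ ≤ X * (k ^ 2 * h ^ 2 * X ^ k) + k * h ^ 2 * X ^ (k + 1) := by
            have h5 : 0 ≤ X ^ 2 * ((x + h) ^ k - x ^ k - k * x ^ (k - 1) * h) := by positivity
            exact add_le_add (mul_le_mul hX h4 h5 hX0) e3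
        _ = (k ^ 2 + k) * h ^ 2 * X ^ (k + 1) := by ring
        _ ≤ _ := by
            have : (k : ℝ) ^ 2 + k ≤ ((k + 1 : ℕ) : ℝ) ^ 2 := by push_cast; nlinarith [(Nat.cast_nonneg k : (0 : ℝ) ≤ k)]
            gcongr

variable {k n : ℕ}

lemma abs_phase_sub_le (hnk : n < k) {x h X lam mu : ℝ} (hx : 0 ≤ x) (hh : 0 ≤ h) (hX : x + h ≤ X)
    (hX0 : 0 < X) :
    |(lam * (x + h) ^ k + mu * (x + h) ^ n) - (lam * x ^ k + mu * x ^ n)| ≤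
      k * (|lam| * X ^ k + |mu| * X ^ n) * (h / X) ∧
    |(lam * (x + h) ^ k + mu * (x + h) ^ n) - (lam * x ^ k + mu * x ^ n) -
      (k * lam * x ^ (k - 1) + n * mu * x ^ (n - 1)) * h| ≤
      k ^ 2 * (|lam| * X ^ k + |mu| * X ^ n) * (h / X) ^ 2 := by
  obtain ⟨a1, a2, a3, a4⟩ := pow_add_sub_bounds hx hh hX k
  obtain ⟨b1, b2, b3, b4⟩ := pow_add_sub_bounds hx hh hX n
  have hnk' : (n : ℝ) ≤ k := by exact_mod_cast hnk.le
  constructor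
  · have e : (lam * (x + h) ^ k + mu * (x + h) ^ n) - (lam * x ^ k + mu * x ^ n) =
      lam * ((x + h) ^ k - x ^ k) + mu * ((x + h) ^ n - x ^ n) := by ring
    rw [e]
    refine (abs_add_le _ _).trans ?_
    rw [abs_mul, abs_mul, abs_of_nonneg a1, abs_of_nonneg b1]
    have a5 : (x + h) ^ k - x ^ k ≤ k * X ^ k * (h / X) := by
      rw [← mul_div_assoc, le_div_iff₀ hX0]; linarith
    have b5 : (x + h) ^ n - x ^ n ≤ k * X ^ n * (h / X) := by
      refine le_trans (b := n * X ^ n * (h / X)) ?_ (by gcongr)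
      rw [← mul_div_assoc, le_div_iff₀ hX0]; linarith
    calc _ ≤ |lam| * (k * X ^ k * (h / X)) + |mu| * (k * X ^ n * (h / X)) := by gcongr
      _ = _ := by ring
  · have e : (lam * (x + h) ^ k + mu * (x + h) ^ n) - (lam * x ^ k + mu * x ^ n) -
      (k * lam * x ^ (k - 1) + n * mu * x ^ (n - 1)) * h =
      lam * ((x + h) ^ k - x ^ k - k * x ^ (k - 1) * h) +
      mu * ((x + h) ^ n - x ^ n - n * x ^ (n - 1) * h) := by ring
    rw [e]
    refine (abs_add_le _ _).trans ?_
    rw [abs_mul, abs_mul, abs_of_nonneg a3, abs_of_nonneg b3]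
    have a5 : (x + h) ^ k - x ^ k - k * x ^ (k - 1) * h ≤ k ^ 2 * X ^ k * (h / X) ^ 2 := by
      rw [div_pow, ← mul_div_assoc, le_div_iff₀ (by positivity)]; linarith
    have b5 : (x + h) ^ n - x ^ n - n * x ^ (n - 1) * h ≤ k ^ 2 * X ^ n * (h / X) ^ 2 := by
      refine le_trans (b := n ^ 2 * X ^ n * (h / X) ^ 2) ?_ (by gcongr)
      rw [div_pow, ← mul_div_assoc, le_div_iff₀ (by positivity)]; linarith
    calc _ ≤ |lam| * (k ^ 2 * X ^ k * (h / X) ^ 2) + |mu| * (k ^ 2 * X ^ n * (h / X) ^ 2) := by gcongr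
      _ = _ := by ring

lemma abs_sub_le_of_small_derivative (hn : 0 < n) (hnk : n < k) {c X x y lam mu w : ℝ} (hc : 0 < c)
    (hc1 : c ≤ 1) (hX : 0 < X) (hx : c * X ≤ x) (hx1 : x ≤ X) (hy : c * X ≤ y) (hw : 2 / c ^ k ≤ w)
    (hL : |lam| * X ^ k + |mu| * X ^ n = w ^ 6)
    (hx' : |k * lam * x ^ (k - 1) + n * mu * x ^ (n - 1)| * X < w ^ 5)
    (hy' : |k * lam * y ^ (k - 1) + n * mu * y ^ (n - 1)| * X < w ^ 5) :
    |x - y| ≤ 4 * (k + 1) / c ^ k * (X / w) := by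
  have hk0 : 0 < k := by omega
  have hw0 : 0 < w := lt_of_lt_of_le (by positivity) hw
  have hcX : 0 < c * X := by positivity
  have key : ∀ x, c * X ≤ x → |k * lam * x ^ (k - 1) + n * mu * x ^ (n - 1)| * X < w ^ 5 →
      |k * lam * x ^ (k - n) + n * mu| * X ^ n * c ^ (n - 1) ≤ w ^ 5 := by
    intro x hx h
    have e : k * lam * x ^ (k - 1) + n * mu * x ^ (n - 1) =
        (k * lam * x ^ (k - n) + n * mu) * x ^ (n - 1) := by
      rw [show k - 1 = (k - n) + (n - 1) by omega, pow_add]; ring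
    rw [e, abs_mul, abs_of_nonneg (by have := hcX.trans_le hx; positivity : 0 ≤ x ^ (n - 1))] at h
    refine le_trans ?_ h.le
    have h2 := pow_le_pow_left₀ hcX.le hx (n - 1)
    calc |k * lam * x ^ (k - n) + n * mu| * X ^ n * c ^ (n - 1)
        = |k * lam * x ^ (k - n) + n * mu| * (c * X) ^ (n - 1) * X := by
          rw [mul_pow]
          obtain ⟨j, rfl⟩ : ∃ j, n = j + 1 := ⟨n - 1, by omega⟩
          rw [Nat.add_sub_cancel]; ring
      _ ≤ _ := by gcongr
  have kx := key x hx hx'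
  have ky := key y hy hy'
  have hcn : c ^ k ≤ c ^ (n - 1) := pow_le_pow_of_le_one hc.le hc1 (by omega)
  have hw2 : 2 ≤ w * c ^ k := by rwa [div_le_iff₀ (by positivity)] at hw
  have hsmall : |k * lam * x ^ (k - n) + n * mu| * X ^ n ≤ w ^ 6 / 2 := by
    have h1 : |k * lam * x ^ (k - n) + n * mu| * X ^ n * c ^ k ≤ w ^ 5 :=
      (mul_le_mul_of_nonneg_left hcn (by positivity)).trans kx
    have h3 : w ^ 5 * 2 ≤ w ^ 5 * (w * c ^ k) := by gcongr
    have hck : 0 < c ^ k := by positivity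
    nlinarith
  have hlam : w ^ 6 ≤ 2 * (k + 1) * (|lam| * X ^ k) := by
    have hk1 : (k : ℝ) * |lam| * x ^ (k - n) * X ^ n ≤ k * (|lam| * X ^ k) := by
      have hx0 : 0 ≤ x := hcX.le.trans hx
      have : x ^ (k - n) * X ^ n ≤ X ^ k := by
        calc x ^ (k - n) * X ^ n ≤ X ^ (k - n) * X ^ n := by gcongr
          _ = X ^ k := by rw [← pow_add]; congr 1; omega
      calc (k : ℝ) * |lam| * x ^ (k - n) * X ^ n = k * |lam| * (x ^ (k - n) * X ^ n) := by ring
        _ ≤ k * |lam| * X ^ k := by gcongr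
        _ = _ := by ring
    have hx0 : 0 ≤ x := hcX.le.trans hx
    have h1 : |mu| * X ^ n ≤ |k * lam * x ^ (k - n) + n * mu| * X ^ n +
        (k : ℝ) * |lam| * x ^ (k - n) * X ^ n := by
      have h2 : |(n : ℝ) * mu| ≤ |k * lam * x ^ (k - n) + n * mu| + |k * lam * x ^ (k - n)| := by
        have := abs_sub (k * lam * x ^ (k - n) + n * mu) (k * lam * x ^ (k - n))
        rwa [add_sub_cancel_left] at this
      rw [abs_mul, abs_mul, abs_mul, Nat.abs_cast, Nat.abs_cast, abs_of_nonneg (by positivity : 0 ≤ x ^ (k - n))] at h2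
      have h3 : |mu| ≤ n * |mu| := by
        have : (1 : ℝ) ≤ n := by exact_mod_cast hn
        nlinarith [abs_nonneg mu]
      rw [← add_mul]
      have := h3.trans h2
      gcongr
    nlinarith
  have hdiff : k * |lam| * |x ^ (k - n) - y ^ (k - n)| * X ^ n * c ^ (n - 1) ≤ 2 * w ^ 5 := by
    have e : k * |lam| * |x ^ (k - n) - y ^ (k - n)| =
        |(k * lam * x ^ (k - n) + n * mu) - (k * lam * y ^ (k - n) + n * mu)| := by
      rw [show (k * lam * x ^ (k - n) + n * mu) - (k * lam * y ^ (k - n) + n * mu) =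
        k * lam * (x ^ (k - n) - y ^ (k - n)) by ring, abs_mul, abs_mul, Nat.abs_cast]
    rw [e]
    have := abs_sub (k * lam * x ^ (k - n) + n * mu) (k * lam * y ^ (k - n) + n * mu)
    calc _ ≤ (|k * lam * x ^ (k - n) + n * mu| + |k * lam * y ^ (k - n) + n * mu|) * X ^ n * c ^ (n - 1) := by
          gcongr
      _ ≤ _ := by linarith
  have hpow := mul_pow_le_abs_pow_sub_pow (d := k - n) (by omega) hcX.le hx hy
  have hk1R : (1 : ℝ) ≤ k := by exact_mod_cast hk0
  have hfin : |x - y| * (|lam| * X ^ k) * c ^ k ≤ 2 * w ^ 5 * X := by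
    have hcc : c ^ k ≤ c ^ (k - n - 1) * c ^ (n - 1) := by
      rw [← pow_add]; exact pow_le_pow_of_le_one hc.le hc1 (by omega)
    have eX : X ^ k = X ^ (k - n - 1) * X ^ n * X := by
      rw [← pow_add, ← pow_succ]; congr 1; omega
    calc |x - y| * (|lam| * X ^ k) * c ^ k ≤ |x - y| * (|lam| * X ^ k) * (c ^ (k - n - 1) * c ^ (n - 1)) := by
          gcongr
      _ = |lam| * (|x - y| * (c * X) ^ (k - n - 1)) * X ^ n * c ^ (n - 1) * X := by
          rw [eX, mul_pow]; ring
      _ ≤ |lam| * |x ^ (k - n) - y ^ (k - n)| * X ^ n * c ^ (n - 1) * X := by gcongr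
      _ ≤ (k * |lam|) * |x ^ (k - n) - y ^ (k - n)| * X ^ n * c ^ (n - 1) * X := by
          gcongr
          exact le_mul_of_one_le_left (abs_nonneg _) hk1R
      _ ≤ 2 * w ^ 5 * X := by gcongr
  rw [div_mul_div_comm, le_div_iff₀ (by positivity)]
  have h7 : |x - y| * w ^ 6 * c ^ k ≤ 4 * (k + 1) * w ^ 5 * X := by
    calc |x - y| * w ^ 6 * c ^ k ≤ |x - y| * (2 * (k + 1) * (|lam| * X ^ k)) * c ^ k := by gcongr
      _ = 2 * (k + 1) * (|x - y| * (|lam| * X ^ k) * c ^ k) := by ring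
      _ ≤ 2 * (k + 1) * (2 * w ^ 5 * X) := by gcongr
      _ = _ := by ring
  refine le_of_mul_le_mul_right ?_ (by positivity : 0 < w ^ 5)
  calc |x - y| * (c ^ k * w) * w ^ 5 = |x - y| * w ^ 6 * c ^ k := by ring
    _ ≤ _ := h7
    _ = _ := by ring

end smooth_sums

lemma sum_range_add_of_periodic {f : ℕ → ℂ} {q : ℕ} (hf : ∀ x, f (x + q) = f x) (c : ℕ) :
    ∑ h ∈ range q, f (c + h) = ∑ h ∈ range q, f h := by
  induction c with
  | zero => simp
  | succ c ih =>
    rw [← ih]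
    have h1 := sum_range_succ (fun h => f (c + h)) q
    rw [sum_range_succ' (fun h => f (c + h)) q, hf c] at h1
    grind

lemma norm_expSum_le_aux {k n : ℕ} (hn : 0 < n) (hnk : n < k) {c : ℝ} (hc : 0 < c) (hc1 : c ≤ 1)
    {X : ℝ} (hX : 0 < X) {l N : ℕ} (hl : c * X ≤ l) (hlN : (l : ℝ) + N ≤ X) {lam mu w : ℝ}
    (hw : 2 / c ^ k + 2 * k ≤ w) (hL : |lam| * X ^ k + |mu| * X ^ n = w ^ 6) (hwX : w ^ 12 ≤ X) :
    ‖∑ x ∈ range N, ee (lam * ((l : ℝ) + x) ^ k + mu * (l + x) ^ n)‖ ≤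
      (8 * Real.pi * k ^ 2 + 4 * (k + 1) / c ^ k + 5) * (X / w) := by
  have hk1 : (1 : ℝ) ≤ k := mod_cast (by omega : 1 ≤ k)
  have hck : 0 < 2 / c ^ k := by positivity
  have hw2 : 2 * (k : ℝ) ≤ w := by linarith
  have hw1 : 1 ≤ w := by linarith
  have hw0 : 0 < w := by linarith
  set f := fun x => lam * x ^ k + mu * x ^ n
  set θ := fun x => k * lam * x ^ (k - 1) + n * mu * x ^ (n - 1)
  set H := ⌈X / w ^ 4⌉₊
  have hXw : 1 ≤ X / w ^ 4 := by
    rw [le_div_iff₀ (by positivity), one_mul]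
    exact (pow_le_pow_right₀ hw1 (by norm_num)).trans hwX
  have hH1 : X / w ^ 4 ≤ H := Nat.le_ceil _
  have hH2 : (H : ℝ) ≤ 2 * (X / w ^ 4) := by
    have := Nat.ceil_lt_add_one (by positivity : 0 ≤ X / w ^ 4)
    linarith
  have hH0 : (0 : ℝ) < H := by linarith
  have hH0' : 0 < H := mod_cast hH0
  have hHw : (H : ℝ) ≤ 2 * (X / w) := hH2.trans (by gcongr; exact le_self_pow₀ hw1 (by norm_num))
  have hblock : ∀ b ∈ range (N / H), ∀ h ∈ range H, (l + (H * b : ℕ)) + h ≤ X := by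
    intro b hb h hh
    rw [mem_range] at hb hh
    have h1 : H * b + h ≤ N := by
      have := Nat.mul_le_mul_left H (Nat.succ_le_of_lt hb)
      have h2 := Nat.mul_div_le N H
      linarith
    have : ((H * b : ℕ) : ℝ) + h ≤ N := mod_cast h1
    linarith
  have hx1 : ∀ b ∈ range (N / H), ((l : ℝ) + (H * b : ℕ)) ≤ X := fun b hb => by
    simpa using hblock b hb 0 (mem_range.2 hH0')
  have hlb : ∀ b : ℕ, c * X ≤ (l : ℝ) + (H * b : ℕ) := fun b =>
    hl.trans (le_add_of_nonneg_right (Nat.cast_nonneg _))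
  set S := fun b => ∑ h ∈ range H, ee (f (l + (H * b + h : ℕ))) with hS
  have htriv : ∀ b, ‖S b‖ ≤ H := fun b => by
    refine (norm_sum_le _ _).trans ?_
    simp [norm_ee]
  have hgood : ∀ b ∈ range (N / H), w ^ 5 ≤ |θ (l + (H * b : ℕ))| * X →
      ‖S b‖ ≤ H * (8 * Real.pi * k ^ 2 / w ^ 2) + X / (2 * w ^ 5) := by
    intro b hb hbθ
    set x0 : ℝ := l + (H * b : ℕ) with hx0
    have hx0' : 0 ≤ x0 := by positivity
    have hθ0 : θ x0 ≠ 0 := by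
      intro h0
      rw [h0, abs_zero, zero_mul] at hbθ
      exact absurd hbθ (not_le.2 (by positivity))
    have hθX : |θ x0| * X ≤ k * w ^ 6 := by
      have h1 : ∀ m : ℕ, 0 < m → x0 ^ (m - 1) * X ≤ X ^ m := fun m hm => by
        conv_rhs => rw [← Nat.sub_add_cancel hm, pow_succ]
        gcongr
        exact hx1 b hb
      have hnk' : (n : ℝ) ≤ k := by exact_mod_cast hnk.le
      calc |θ x0| * X ≤ (k * |lam| * x0 ^ (k - 1) + n * |mu| * x0 ^ (n - 1)) * X := by
            gcongr
            refine (abs_add_le _ _).trans (le_of_eq ?_)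
            simp only [abs_mul, Nat.abs_cast, abs_pow, abs_of_nonneg hx0']
        _ = k * |lam| * (x0 ^ (k - 1) * X) + n * |mu| * (x0 ^ (n - 1) * X) := by ring
        _ ≤ k * |lam| * X ^ k + k * |mu| * X ^ n := by
            gcongr
            · exact h1 k (by omega)
            · exact h1 n hn
        _ = k * w ^ 6 := by rw [← hL]; ring
    have hθ2 : |θ x0| ≤ 1 / 2 := by
      have h1 : (k : ℝ) * w ^ 6 * 2 ≤ X := by
        refine le_trans ?_ hwX
        calc (k : ℝ) * w ^ 6 * 2 = (2 * k) * w ^ 6 := by ring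
          _ ≤ w ^ 6 * w ^ 6 := by gcongr; exact hw2.trans (le_self_pow₀ hw1 (by norm_num))
          _ = w ^ 12 := by ring
      have : |θ x0| * X * 2 ≤ X := (by linarith : _ ≤ k * w ^ 6 * 2).trans h1
      nlinarith
    have hlin : ‖∑ h ∈ range H, ee (f x0 + θ x0 * h)‖ ≤ X / (2 * w ^ 5) := by
      simp_rw [ee_add, ← mul_sum]
      rw [norm_mul, norm_ee, one_mul]
      refine (norm_sum_range_ee_le hθ0 hθ2 H).trans ?_
      rw [div_le_div_iff₀ (by positivity) (by positivity)]
      linarith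
    have hdiff : ‖S b - ∑ h ∈ range H, ee (f x0 + θ x0 * h)‖ ≤ H * (8 * Real.pi * k ^ 2 / w ^ 2) := by
      rw [hS, ← sum_sub_distrib]
      refine (norm_sum_le _ _).trans ((sum_le_sum fun h hh => ?_).trans_eq (by
        rw [sum_const, card_range, nsmul_eq_mul]))
      refine (norm_ee_sub_ee_le _ _).trans ?_
      have h2 := (abs_phase_sub_le hnk hx0' (Nat.cast_nonneg h) (hblock b hb h hh) hX
        (lam := lam) (mu := mu)).2
      rw [hL] at h2
      have e1 : f (l + (H * b + h : ℕ)) - (f x0 + θ x0 * h) =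
          (lam * (x0 + h) ^ k + mu * (x0 + h) ^ n) - (lam * x0 ^ k + mu * x0 ^ n) -
          (k * lam * x0 ^ (k - 1) + n * mu * x0 ^ (n - 1)) * h := by grind
      rw [e1]
      have h3 : (h : ℝ) / X ≤ 2 / w ^ 4 := by
        rw [div_le_iff₀ hX]
        have : (h : ℝ) ≤ H := by exact_mod_cast (Finset.mem_range.1 hh).le
        grind
      calc _ ≤ 2 * Real.pi * (k ^ 2 * w ^ 6 * (2 / w ^ 4) ^ 2) := by
            refine mul_le_mul_of_nonneg_left (h2.trans ?_) (by positivity)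
            gcongr
        _ = _ := by field_simp; ring
    calc ‖S b‖ = ‖(S b - ∑ h ∈ range H, ee (f x0 + θ x0 * h)) +
          ∑ h ∈ range H, ee (f x0 + θ x0 * h)‖ := by rw [sub_add_cancel]
      _ ≤ _ := (norm_add_le _ _).trans (add_le_add hdiff hlin)
  set bad := (range (N / H)).filter fun b => |θ (l + (H * b : ℕ))| * X < w ^ 5 with hbad
  have hbadcard : (#bad : ℝ) * H ≤ 4 * (k + 1) / c ^ k * (X / w) + H := by
    rcases bad.eq_empty_or_nonempty with h0 | hne
    · rw [h0]; simp; positivity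
    · set b0 := bad.min' hne with hb0
      set b1 := bad.max' hne with hb1
      have m1 := mem_filter.1 (bad.max'_mem hne)
      have hc2 : #bad ≤ b1 - b0 + 1 := by
        have : bad ⊆ Icc b0 b1 := fun b hb => mem_Icc.2 ⟨min'_le _ _ hb, le_max' _ _ hb⟩
        have h2 := card_le_card this
        rw [Nat.card_Icc] at h2
        omega
      have h3 := abs_sub_le_of_small_derivative hn hnk hc hc1 hX (hlb b1) (hx1 b1 m1.1) (hlb b0)
        (by linarith) hL m1.2 (mem_filter.1 (bad.min'_mem hne)).2
      have h4 : ((b1 : ℝ) - b0) * H ≤ 4 * (k + 1) / c ^ k * (X / w) := by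
        refine le_trans (le_of_eq ?_) ((le_abs_self _).trans h3)
        push_cast; ring
      have h5 : (#bad : ℝ) ≤ b1 - b0 + 1 := by
        have : #bad ≤ ((b1 - b0 + 1 : ℕ) : ℝ) := by exact_mod_cast hc2
        rwa [Nat.cast_add, Nat.cast_sub (min'_le _ _ (bad.max'_mem hne)), Nat.cast_one] at this
      nlinarith
  have hnum : ((N / H : ℕ) : ℝ) * H ≤ X := by
    have h1 : ((N / H : ℕ) : ℝ) * H ≤ N := by exact_mod_cast Nat.div_mul_le_self N H
    linarith
  have hnum' : ((N / H : ℕ) : ℝ) ≤ w ^ 4 := by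
    by_contra hcon
    push Not at hcon
    have : X < ((N / H : ℕ) : ℝ) * H := by
      calc X = w ^ 4 * (X / w ^ 4) := by field_simp
        _ ≤ w ^ 4 * H := by gcongr
        _ < _ := by gcongr
    linarith
  have hgoodsum : ∑ b ∈ (range (N / H)).filter (fun b => ¬ |θ (l + (H * b : ℕ))| * X < w ^ 5), ‖S b‖ ≤
      8 * Real.pi * k ^ 2 * (X / w) + X / w := by
    calc _ ≤ ∑ b ∈ (range (N / H)).filter (fun b => ¬ |θ (l + (H * b : ℕ))| * X < w ^ 5),
          (H * (8 * Real.pi * k ^ 2 / w ^ 2) + X / (2 * w ^ 5)) :=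
          sum_le_sum fun b hb => hgood b (mem_filter.1 hb).1 (not_lt.1 (mem_filter.1 hb).2)
      _ ≤ ∑ b ∈ range (N / H), (H * (8 * Real.pi * k ^ 2 / w ^ 2) + X / (2 * w ^ 5)) :=
          sum_le_sum_of_subset_of_nonneg (filter_subset _ _) fun _ _ _ => by positivity
      _ = (((N / H : ℕ) : ℝ) * H) * (8 * Real.pi * k ^ 2 / w ^ 2) +
          ((N / H : ℕ) : ℝ) * (X / (2 * w ^ 5)) := by rw [sum_const, card_range, nsmul_eq_mul]; ring
      _ ≤ X * (8 * Real.pi * k ^ 2 / w ^ 1) + w ^ 4 * (X / (1 * w ^ 5)) := by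
          refine add_le_add (mul_le_mul hnum ?_ (by positivity) hX.le) (mul_le_mul hnum' ?_
            (by positivity) (by positivity))
          · gcongr
            · norm_num
          · gcongr
            norm_num
      _ = _ := by field_simp
  have hbadsum : ∑ b ∈ bad, ‖S b‖ ≤ 4 * (k + 1) / c ^ k * (X / w) + H := by
    refine (sum_le_sum fun b _ => htriv b).trans ?_
    rw [sum_const, nsmul_eq_mul]
    exact hbadcard
  have htot : ‖∑ b ∈ range (N / H), S b‖ ≤ (4 * (k + 1) / c ^ k * (X / w) + H) +
      (8 * Real.pi * k ^ 2 * (X / w) + X / w) := by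
    refine (norm_sum_le _ _).trans ?_
    rw [← sum_filter_add_sum_filter_not (range (N / H)) fun b => |θ (l + (H * b : ℕ))| * X < w ^ 5]
    exact add_le_add hbadsum hgoodsum
  have hrem := norm_sum_sub_blocks_le (F := fun x => ee (f (l + (x : ℕ)))) (fun x => (norm_ee _).le) N hH0'
  calc _ = ‖(∑ x ∈ range N, ee (f (l + x)) - ∑ b ∈ range (N / H), S b) +
        ∑ b ∈ range (N / H), S b‖ := by rw [sub_add_cancel]
    _ ≤ H + ((4 * (k + 1) / c ^ k * (X / w) + H) + (8 * Real.pi * k ^ 2 * (X / w) + X / w)) :=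
        (norm_add_le _ _).trans (add_le_add hrem htot)
    _ ≤ _ := by linarith

lemma exists_norm_expSum_le {k n : ℕ} (hn : 0 < n) (hnk : n < k) {c : ℝ} (hc : 0 < c) (hc1 : c ≤ 1) :
    ∃ C : ℝ, 1 ≤ C ∧ ∀ X : ℝ, 1 ≤ X → ∀ l N : ℕ, c * X ≤ l → (l : ℝ) + N ≤ X → ∀ lam mu : ℝ,
      (1 + (|lam| * X ^ k + |mu| * X ^ n)) ^ 2 ≤ X →
      ‖∑ x ∈ range N, ee (lam * ((l : ℝ) + x) ^ k + mu * (l + x) ^ n)‖ ≤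
        C * X * (1 + (|lam| * X ^ k + |mu| * X ^ n)) ^ (-(1 / 6) : ℝ) := by
  set w0 := 2 / c ^ k + 2 * k
  set C' : ℝ := 8 * Real.pi * k ^ 2 + 4 * (k + 1) / c ^ k + 5 with hC'
  have hk1 : (1 : ℝ) ≤ k := mod_cast (by omega : 1 ≤ k)
  have hck : 0 < 2 / c ^ k := by positivity
  have hw01 : 1 ≤ w0 := by linarith
  have hC'0 : 5 ≤ C' := by
    have : 0 ≤ 8 * Real.pi * k ^ 2 + 4 * (k + 1) / c ^ k := by positivity
    linarith
  refine ⟨2 * (C' + w0), by linarith, fun X hX l N hl hlN lam mu hΛ => ?_⟩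
  set Λ := |lam| * X ^ k + |mu| * X ^ n
  have hΛ0 : 0 ≤ Λ := by positivity
  have hroot : ∀ w : ℝ, 1 ≤ w → Λ ≤ w ^ 6 → 1 / (2 * w) ≤ (1 + Λ) ^ (-(1 / 6) : ℝ) := by
    intro w hw hwΛ
    have h1 : 1 + Λ ≤ (2 * w) ^ 6 := by
      have : 1 ≤ w ^ 6 := one_le_pow₀ hw
      rw [mul_pow]; linarith
    rw [Real.rpow_neg (by positivity), one_div]
    gcongr
    calc (1 + Λ) ^ (1 / 6 : ℝ) ≤ ((2 * w) ^ 6) ^ (1 / 6 : ℝ) := by gcongr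
      _ = 2 * w := by rw [← Real.rpow_natCast, ← Real.rpow_mul (by positivity)]; norm_num
  rcases le_total Λ (w0 ^ 6) with h | h
  · have h1 : ‖∑ x ∈ range N, ee (lam * ((l : ℝ) + x) ^ k + mu * (l + x) ^ n)‖ ≤ X := by
      refine (norm_sum_le _ _).trans ?_
      simp only [norm_ee, sum_const, card_range, nsmul_eq_mul, mul_one]
      linarith
    refine h1.trans ?_
    calc X = 2 * w0 * X * (1 / (2 * w0)) := by field_simp
      _ ≤ 2 * (C' + w0) * X * (1 + Λ) ^ (-(1 / 6) : ℝ) := by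
        gcongr
        · linarith
        · exact hroot w0 hw01 h
  · set w := Λ ^ (1 / 6 : ℝ) with hw
    have hw6 : w ^ 6 = Λ := by rw [hw, ← Real.rpow_natCast, ← Real.rpow_mul hΛ0]; norm_num
    have hww : w0 ≤ w := by
      refine le_of_pow_le_pow_left₀ (n := 6) (by norm_num) (by positivity) ?_
      rwa [hw6]
    have h12 : w ^ 12 ≤ X := by
      calc w ^ 12 = (w ^ 6) ^ 2 := by ring
        _ ≤ (1 + Λ) ^ 2 := by rw [hw6]; gcongr; linarith
        _ ≤ X := hΛ
    refine (norm_expSum_le_aux hn hnk hc hc1 (by linarith) hl hlN hww (by rw [hw6]) h12).trans ?_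
    calc C' * (X / w) = 2 * C' * X * (1 / (2 * w)) := by field_simp
      _ ≤ 2 * (C' + w0) * X * (1 + Λ) ^ (-(1 / 6) : ℝ) := by
        gcongr
        · linarith
        · exact hroot w (hw01.trans hww) hw6.ge

lemma norm_expSum_rational_le {k n : ℕ} (hnk : n < k) {X : ℝ} (hX : 0 < X) {l N : ℕ}
    (hlN : (l : ℝ) + N ≤ X) {q : ℕ} (hq : 0 < q) (A B : ℤ) (lam mu) :
    ‖∑ x ∈ range N, ee ((A / q + lam) * (l + x) ^ k + (B / q + mu) * (l + x) ^ n)‖ ≤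
      ‖polySum k n q A B‖ / q * ‖∑ x ∈ range N, ee (lam * (l + x) ^ k + mu * (l + x) ^ n)‖ +
      (4 * Real.pi * k * (|lam| * X ^ k + |mu| * X ^ n) * q + 2 * q) := by
  set Λ := |lam| * X ^ k + |mu| * X ^ n
  have hq0' : (q : ℂ) ≠ 0 := mod_cast hq.ne'
  have hΛ0 : 0 ≤ Λ := by positivity
  set g : ℕ → ℝ := fun x => lam * ((l : ℝ) + x) ^ k + mu * (l + x) ^ n with hg
  set F := fun x => ee ((A / q + lam) * ((l : ℝ) + x) ^ k + (B / q + mu) * (l + x) ^ n) with hF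
  set p : ℕ → ℂ := fun x => ee (((A * (x : ℤ) ^ k + B * x ^ n : ℤ) : ℝ) / q) with hp
  have hFp : ∀ x : ℕ, F x = p (l + x) * ee (g x) := by
    intro x
    rw [hp, hg, ← ee_add, hF]
    push_cast
    field_simp
    ring_nf
  have hper : ∀ b : ℕ, ∑ h ∈ range q, p (l + (q * b + h)) = polySum k n q A B := by
    intro b
    have := sum_range_add_of_periodic (f := p) (q := q) (fun x => by
      refine ee_div_congr (poly_congr k n ?_); simp) (l + q * b)
    simp_rw [← add_assoc, this]
    rfl
  have hlip : ∀ b ∈ range (N / q), ∀ h ∈ range q,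
      ‖ee (g (q * b + h)) - ee (g (q * b))‖ ≤ 2 * Real.pi * (k * Λ * (q / X)) := by
    intro b hb h hh
    rw [mem_range] at hb hh
    have h1 : q * b + h ≤ N := by
      have := Nat.mul_le_mul_left q (Nat.succ_le_of_lt hb)
      have h2 := Nat.mul_div_le N q
      linarith
    have h1' : ((q * b : ℕ) : ℝ) + h ≤ N := by exact_mod_cast h1
    refine (norm_ee_sub_ee_le _ _).trans ?_
    gcongr
    have h2 := (abs_phase_sub_le hnk (x := l + (q * b : ℕ)) (by positivity) (Nat.cast_nonneg h)
      (by linarith : ((l : ℝ) + (q * b : ℕ)) + h ≤ X) hX (lam := lam) (mu := mu)).1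
    have e1 : g (q * b + h) - g (q * b) = (lam * ((l + (q * b : ℕ) : ℝ) + h) ^ k +
        mu * ((l + (q * b : ℕ) : ℝ) + h) ^ n) -
        (lam * (l + (q * b : ℕ) : ℝ) ^ k + mu * (l + (q * b : ℕ) : ℝ) ^ n) := by
      simp only [hg]; push_cast; ring
    rw [e1]
    refine h2.trans ?_
    gcongr
  set T : ℂ := ∑ b ∈ range (N / q), ee (g (q * b)) with hT
  have hcount : ((N / q : ℕ) : ℝ) * q * (2 * Real.pi * (k * Λ * (q / X))) ≤ 2 * Real.pi * k * Λ * q := by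
    have h1 : ((N / q : ℕ) : ℝ) * q ≤ X := by
      have h1 : ((N / q : ℕ) : ℝ) * q ≤ N := by exact_mod_cast Nat.div_mul_le_self N q
      linarith
    calc _ ≤ X * (2 * Real.pi * (k * Λ * (q / X))) := by gcongr
      _ = _ := by field_simp
  have hgen : ∀ (c : ℕ → ℂ), (∀ x, ‖c x‖ ≤ 1) → ∀ s : ℂ, (∀ b, ∑ h ∈ range q, c (q * b + h) = s) →
      ‖∑ x ∈ range N, c x * ee (g x) - s * T‖ ≤ 2 * Real.pi * k * Λ * q + q := by
    intro c hc s hs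
    have h1 := norm_sum_sub_blocks_le (F := fun x => c x * ee (g x)) (fun x => by
      rw [norm_mul, norm_ee, mul_one]; exact hc x) N hq
    have h2 : ‖∑ b ∈ range (N / q), ∑ h ∈ range q, c (q * b + h) * ee (g (q * b + h)) - s * T‖ ≤
        2 * Real.pi * k * Λ * q := by
      have e : s * T = ∑ b ∈ range (N / q), ∑ h ∈ range q, c (q * b + h) * ee (g (q * b)) := by
        rw [hT, mul_sum]
        refine sum_congr rfl fun b _ => ?_
        rw [← hs b, sum_mul]
      rw [e, ← sum_sub_distrib]
      refine (norm_sum_le _ _).trans (le_trans (sum_le_sum (g := fun _ =>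
        (q : ℝ) * (2 * Real.pi * (k * Λ * (q / X)))) fun b hb => ?_) ?_)
      · rw [← sum_sub_distrib]
        refine (norm_sum_le _ _).trans ((sum_le_sum (g := fun _ => 2 * Real.pi * (k * Λ * (q / X)))
          fun h hh => ?_).trans_eq (by simp))
        rw [← mul_sub, norm_mul]
        exact (mul_le_of_le_one_left (norm_nonneg _) (hc _)).trans (hlip b hb h hh)
      · rw [sum_const, card_range, nsmul_eq_mul, ← mul_assoc]
        exact hcount
    calc _ = ‖(∑ x ∈ range N, c x * ee (g x) - ∑ b ∈ range (N / q), ∑ h ∈ range q,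
          c (q * b + h) * ee (g (q * b + h))) + (∑ b ∈ range (N / q), ∑ h ∈ range q,
          c (q * b + h) * ee (g (q * b + h)) - s * T)‖ := by rw [sub_add_sub_cancel]
      _ ≤ q + 2 * Real.pi * k * Λ * q := (norm_add_le _ _).trans (add_le_add h1 h2)
      _ = _ := add_comm _ _
  have hA := hgen (fun x => p (l + x)) (fun x => (norm_ee _).le) _ hper
  have hB := hgen (fun _ => 1) (fun x => by simp) q (fun b => by simp)
  simp only [one_mul] at hB
  set G : ℂ := ∑ x ∈ range N, ee (g x) with hG
  set s : ℂ := polySum k n q A B with hs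
  have hsq : ‖s‖ / q ≤ 1 := by rw [div_le_one (mod_cast hq)]; exact norm_polySum_le _ _ _ _ _
  have e : ∑ x ∈ range N, F x = (∑ x ∈ range N, p (l + x) * ee (g x) - s * T) -
      s / q * (G - q * T) + s / q * G := by
    simp_rw [hFp]
    field_simp
    ring
  have hE : 0 ≤ 2 * Real.pi * k * Λ * q + q := by positivity
  calc ‖∑ x ∈ range N, F x‖ ≤ ‖∑ x ∈ range N, p (l + x) * ee (g x) - s * T‖ +
        ‖s / q * (G - q * T)‖ + ‖s / q * G‖ := by
        rw [e]
        exact (norm_add_le _ _).trans (add_le_add (norm_sub_le _ _) le_rfl)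
    _ ≤ (2 * Real.pi * k * Λ * q + q) + 1 * (2 * Real.pi * k * Λ * q + q) + ‖s‖ / q * ‖G‖ := by
        rw [norm_mul, norm_mul, norm_div, Complex.norm_natCast]
        gcongr
    _ = _ := by ring

lemma exists_norm_weylSum_le {k n : ℕ} (hn : 0 < n) (hnk : n < k) {c : ℝ} (hc : 0 < c) (hc1 : c ≤ 1) :
    ∃ C : ℝ, 1 ≤ C ∧ ∀ X : ℝ, 1 ≤ X → ∀ l N : ℕ, c * X ≤ l → (l : ℝ) + N ≤ X → ∀ q : ℕ, 0 < q →
      ∀ A B : ℤ, (∀ p : ℕ, p.Prime → p ∣ q → ¬((p : ℤ) ∣ A ∧ (p : ℤ) ∣ B)) → ∀ lam mu : ℝ,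
      (q * (1 + (|lam| * X ^ k + |mu| * X ^ n))) ^ 2 ≤ X →
      ‖∑ x ∈ range N, ee ((A / q + lam) * ((l : ℝ) + x) ^ k + (B / q + mu) * (l + x) ^ n)‖ ≤
        C * X * (q * (1 + (|lam| * X ^ k + |mu| * X ^ n))) ^ (-(1 / (4 * k)) : ℝ) := by
  obtain ⟨C₁, hC₁, h₁⟩ := exists_polySum_le hn hnk
  obtain ⟨C₂, hC₂, h₂⟩ := exists_norm_expSum_le hn hnk hc hc1
  have hk2 : (2 : ℝ) ≤ k := mod_cast (by omega : 2 ≤ k)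
  have hpos : 0 ≤ 4 * Real.pi * k := by positivity
  refine ⟨C₁ * C₂ + (4 * Real.pi * k + 2), by nlinarith, fun X hX l N hl hlN q hq A B hAB lam mu hQ => ?_⟩
  set Λ := |lam| * X ^ k + |mu| * X ^ n
  have hΛ0 : 0 ≤ Λ := by positivity
  have hq1 : (1 : ℝ) ≤ q := mod_cast hq
  have hQ1 : 1 ≤ q * (1 + Λ) := by nlinarith
  set e : ℝ := -(1 / (4 * k)) with he
  have he0 : e ≤ 0 := by rw [he]; simp
  have he1 : -1 ≤ e := by rw [he, neg_le_neg_iff, div_le_one (by positivity)]; linarith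
  have hΛX : (1 + Λ) ^ 2 ≤ X := by
    refine le_trans ?_ hQ
    gcongr
    nlinarith
  have hmain := h₁ q hq A B hAB
  refine (norm_expSum_rational_le hnk (by linarith) hlN hq A B lam mu).trans ?_
  have hA : ‖polySum k n q A B‖ / q ≤ C₁ * (q : ℝ) ^ e := by
    rw [div_le_iff₀ (by linarith), mul_assoc, ← Real.rpow_add_one (by linarith)]
    grind
  have hB : (1 + Λ) ^ (-(1 / 6) : ℝ) ≤ (1 + Λ) ^ e := by
    refine Real.rpow_le_rpow_of_exponent_le (by linarith) ?_
    rw [he, neg_le_neg_iff]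
    gcongr
    linarith
  have hE : (q : ℝ) * (1 + Λ) ≤ X * (q * (1 + Λ)) ^ e := by
    calc q * (1 + Λ) ≤ X * (q * (1 + Λ)) ^ (-1 : ℝ) := by
          rw [Real.rpow_neg_one, ← div_eq_mul_inv, le_div_iff₀ (by linarith), ← sq]; exact hQ
      _ ≤ _ := by gcongr
  calc _ ≤ (C₁ * (q : ℝ) ^ e) * (C₂ * X * (1 + Λ) ^ e) +
        (4 * Real.pi * k + 2) * (q * (1 + Λ)) := by
        refine add_le_add (mul_le_mul hA
            ((h₂ X hX l N hl hlN lam mu hΛX).trans (by gcongr)) (norm_nonneg _) (by positivity)) ?_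
        have : 0 ≤ 4 * Real.pi * k * q + 2 * q * Λ := by positivity
        linarith
    _ ≤ (C₁ * (q : ℝ) ^ e) * (C₂ * X * (1 + Λ) ^ e) +
        (4 * Real.pi * k + 2) * (X * (q * (1 + Λ)) ^ e) := by gcongr
    _ = (C₁ * C₂) * X * ((q : ℝ) ^ e * (1 + Λ) ^ e) +
        (4 * Real.pi * k + 2) * (X * (q * (1 + Λ)) ^ e) := by ring
    _ = _ := by rw [(Real.mul_rpow (by linarith) (by linarith)).symm]; ring

lemma prod_le_pow_of_pairwise {J : Type*} [DecidableEq J] {x : J → ℝ} {T : ℝ} (hx : ∀ j, 0 ≤ x j) :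
    ∀ (m : ℕ) (s : Finset J), (∀ j ∈ s, x j ≤ 1) → (∀ j ∈ s, ∀ j' ∈ s, j ≠ j' → x j * x j' ≤ T) →
      2 * m ≤ #s → ∏ j ∈ s, x j ≤ T ^ m := by
  intro m
  induction m with
  | zero => exact fun s h1 _ _ => by simpa using prod_le_one (fun j _ => hx j) h1
  | succ m ih =>
    intro s h1 hT hs
    obtain ⟨j, hj⟩ : s.Nonempty := card_pos.1 (by omega)
    obtain ⟨j', hj'⟩ : (s.erase j).Nonempty := card_pos.1 (by rw [card_erase_of_mem hj]; omega)
    have hj's := mem_of_mem_erase hj'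
    rw [← mul_prod_erase s x hj, ← mul_prod_erase _ x hj', ← mul_assoc, pow_succ']
    have hle := hT j hj j' hj's (ne_of_mem_erase hj').symm
    refine mul_le_mul hle (ih _ (fun i hi => h1 i ?_) (fun i hi i' hi' => hT i ?_ i' ?_) ?_)
      (prod_nonneg fun i _ => hx i) ((mul_nonneg (hx _) (hx _)).trans hle)
    · exact mem_of_mem_erase (mem_of_mem_erase hi)
    · exact mem_of_mem_erase (mem_of_mem_erase hi)
    · exact mem_of_mem_erase (mem_of_mem_erase hi')
    · rw [card_erase_of_mem hj', card_erase_of_mem hj]; omega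

/-- The fractions `b i / q` have no common factor to cancel. -/
def ReducedFrac {ι : Type*} (q : ℕ) (b : ι → ℤ) : Prop := ∀ h : ℕ, h ∣ q → (∀ i, (h : ℤ) ∣ b i) → h = 1

lemma exists_reducedFrac {ι : Type*} {q : ℕ} (hq : 0 < q) (a : ι → ℤ) :
    ∃ q₁ : ℕ, 0 < q₁ ∧ q₁ ∣ q ∧ ∃ b : ι → ℤ, (∀ i, a i * q₁ = b i * q) ∧ ReducedFrac q₁ b := by
  classical
  have hex : ∃ q₁ : ℕ, 0 < q₁ ∧ q₁ ∣ q ∧ ∃ b : ι → ℤ, ∀ i, a i * q₁ = b i * q :=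
    ⟨q, hq, dvd_rfl, a, fun _ => rfl⟩
  obtain ⟨h0, h1, b, hb⟩ := Nat.find_spec hex
  refine ⟨Nat.find hex, h0, h1, b, hb, fun h hdvd hh => ?_⟩
  obtain ⟨q₂, hq₂⟩ := hdvd
  choose b' hb' using hh
  have hpos : 0 < h := Nat.pos_of_mul_pos_right (hq₂ ▸ h0)
  have hq₂0 : 0 < q₂ := Nat.pos_of_mul_pos_left (hq₂ ▸ h0)
  have hmin := Nat.find_min' hex (m := q₂) ⟨hq₂0, (Dvd.intro_left h hq₂.symm).trans h1, b', fun i => by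
    have := hb i
    rw [hb' i, hq₂, Nat.cast_mul] at this
    have hne : (h : ℤ) ≠ 0 := by exact_mod_cast hpos.ne'
    refine mul_left_cancel₀ hne ?_
    linarith⟩
  rw [hq₂] at hmin
  by_contra hne
  have : 2 ≤ h := by omega
  nlinarith

lemma ReducedFrac.dvd {ι : Type*} {q : ℕ} {b : ι → ℤ} (hb : ReducedFrac q b) (hq : 0 < q) {m : ℤ}
    (hm : ∀ i, (q : ℤ) ∣ m * b i) : (q : ℤ) ∣ m := by
  have hg0 : 0 < Int.gcd q m := Int.gcd_pos_of_ne_zero_left _ (by exact_mod_cast hq.ne')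
  obtain ⟨q', m', hcop, e1, e2⟩ := Int.exists_gcd_one hg0
  set g := Int.gcd q m
  have hg : (g : ℤ) ≠ 0 := by exact_mod_cast hg0.ne'
  have hq' : ∀ i, q' ∣ b i := fun i => by
    have h1 := hm i
    rw [e1, e2] at h1
    have h2 : q' ∣ m' * b i := by
      rw [show m' * g * b i = m' * b i * g by ring] at h1
      exact Int.dvd_of_mul_dvd_mul_right hg h1
    exact Int.dvd_of_dvd_mul_right_of_gcd_one h2 hcop
  have h1 : q'.natAbs = 1 := hb _ (by
    rw [← Int.natCast_dvd_natCast, Int.natAbs_dvd]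
    exact Dvd.intro _ e1.symm) fun i => by rw [Int.natAbs_dvd]; exact hq' i
  rw [e1, e2]
  refine mul_dvd_mul_right ?_ _
  exact (Int.natAbs_dvd.1 (by rw [h1]; exact_mod_cast one_dvd _))

section
variable {ι : Type*} [Fintype ι] [DecidableEq ι]

/-- The combination `∑ wᵢ vᵢ` over the indices in one class. -/
def comb {R : Type*} [CommRing R] (cls : ι → Bool) (b : Bool) (w : ι → R) (v : ι → ℤ) : R :=
  ∑ i with cls i = b, w i * (v i : R)

lemma comb_intCast (cls : ι → Bool) (b : Bool) (w v : ι → ℤ) :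
    ((comb cls b w v : ℤ) : ℝ) = comb cls b (fun i => (w i : ℝ)) v := by
  simp [comb]

lemma comb_add {R : Type*} [CommRing R] (cls : ι → Bool) (b : Bool) (w w' : ι → R) (v : ι → ℤ) :
    comb cls b (w + w') v = comb cls b w v + comb cls b w' v := by
  simp [comb, add_mul, sum_add_distrib]

lemma comb_smul {R : Type*} [CommRing R] (cls : ι → Bool) (b : Bool) (c : R) (w : ι → R) (v : ι → ℤ) :
    comb cls b (fun i => c * w i) v = c * comb cls b w v := by
  simp [comb, mul_sum, mul_assoc]

lemma dot_pairDeg (k n : ℕ) (cls : ι → Bool) (α : ι → ℝ) (v : ι → ℤ) (x : ℕ) :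
    dot α (fun i => v i * (x : ℤ) ^ pairDeg k n (cls i)) =
      comb cls true α v * (x : ℝ) ^ k + comb cls false α v * (x : ℝ) ^ n := by
  rw [dot, comb, comb, ← sum_filter_add_sum_filter_not univ (fun i => cls i = true), sum_mul, sum_mul]
  simp only [Bool.not_eq_true]
  congr 1 <;> refine sum_congr rfl fun i hi => ?_ <;>
    rw [(mem_filter.1 hi).2] <;> simp [pairDeg, mul_assoc]

lemma abs_comb_le {C : ℝ} (cls : ι → Bool) (b : Bool) (w : ι → ℝ) {v : ι → ℤ} (hv : ∀ i, |(v i : ℝ)| ≤ C)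
    (y : ι → ℝ) (hy : ∀ i, 0 ≤ y i) {z : ℝ} (hz : ∀ i, cls i = b → z = y i) :
    |comb cls b w v| * z ≤ C * ∑ i with cls i = b, |w i| * y i := by
  rw [mul_sum, comb]
  rcases (univ.filter fun i => cls i = b).eq_empty_or_nonempty with h0 | ⟨i, hi⟩
  · rw [h0]; simp
  · have hz0 : 0 ≤ z := hz i (mem_filter.1 hi).2 ▸ hy i
    refine (mul_le_mul_of_nonneg_right (abs_sum_le_sum_abs _ _) hz0).trans ?_
    rw [sum_mul]
    refine sum_le_sum fun i hi => ?_
    rw [hz i (mem_filter.1 hi).2, abs_mul]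
    have := mul_le_mul_of_nonneg_left (hv i) (mul_nonneg (abs_nonneg (w i)) (hy i))
    linarith

/-- Two coefficient columns from which each coordinate can be recovered, with bounded multipliers. -/
def PairIndep (cls : ι → Bool) (C : ℝ) (v v' : ι → ℤ) : Prop :=
  ∀ i, ∃ m u u' : ℤ, m ≠ 0 ∧ |(m : ℝ)| ≤ C ∧ |(u : ℝ)| ≤ C ∧ |(u' : ℝ)| ≤ C ∧
    ∀ i', cls i' = cls i → u * v i' + u' * v' i' = if i' = i then m else 0

lemma comb_pair {R : Type*} [CommRing R] {cls : ι → Bool} {i : ι} {m u u' : ℤ} {v v' : ι → ℤ}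
    (h : ∀ i', cls i' = cls i → u * v i' + u' * v' i' = if i' = i then m else 0) (w : ι → R) :
    u * comb cls (cls i) w v + u' * comb cls (cls i) w v' = m * w i := by
  rw [comb, comb, mul_sum, mul_sum, ← sum_add_distrib]
  have : ∀ i' ∈ univ.filter (fun i' => cls i' = cls i),
      (u : R) * (w i' * v i') + u' * (w i' * v' i') = if i' = i then m * w i else 0 := fun i' hi' => by
    have h1 := congrArg (Int.cast : ℤ → R) (h i' (mem_filter.1 hi').2)
    push_cast at h1
    rw [show (u : R) * (w i' * v i') + u' * (w i' * v' i') = (u * v i' + u' * v' i') * w i' by ring, h1]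
    split_ifs with hii
    · rw [hii]
    · rw [zero_mul]
  rw [sum_congr rfl this, sum_ite_eq']
  simp

end

section
variable {ι : Type*} [Fintype ι] [DecidableEq ι]

/-- The contribution of a variable with coefficient column `v` to the system. -/
def colMap (k n : ℕ) (cls : ι → Bool) (v : ι → ℤ) (x : ℕ) : ι → ℤ :=
  fun i => v i * (x : ℤ) ^ pairDeg k n (cls i)

/-- The distance of `α` from `a / q`, in the metric adapted to the box of size `P`. -/
noncomputable def arcDist (k n : ℕ) (cls : ι → Bool) (P : ℝ) (α : ι → ℝ) (q : ℕ) (a : ι → ℤ) : ℝ :=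
  ∑ i, |α i - a i / q| * P ^ pairDeg k n (cls i)

lemma arcDist_nonneg {k n : ℕ} {cls : ι → Bool} {P : ℝ} (hP : 0 ≤ P) (α : ι → ℝ) (q : ℕ) (a : ι → ℤ) :
    0 ≤ arcDist k n cls P α q a := sum_nonneg fun _ _ => by positivity

lemma colDist_le {k n : ℕ} {cls : ι → Bool} {P C : ℝ} (hP : 0 ≤ P) {v : ι → ℤ}
    (hv : ∀ i, |(v i : ℝ)| ≤ C) (lam : ι → ℝ) :
    |comb cls true lam v| * P ^ k + |comb cls false lam v| * P ^ n ≤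
      C * ∑ i, |lam i| * P ^ pairDeg k n (cls i) := by
  rw [← sum_filter_add_sum_filter_not univ (fun i => cls i = true), mul_add]
  simp only [Bool.not_eq_true]
  refine add_le_add (abs_comb_le cls true lam hv _ (fun i => by positivity) fun i hi => ?_)
    (abs_comb_le cls false lam hv _ (fun i => by positivity) fun i hi => ?_) <;> simp [hi, pairDeg]

lemma pow_le_colDist {k n : ℕ} {cls : ι → Bool} {P : ℝ} (hP : 0 ≤ P) (v : ι → ℤ) (lam : ι → ℝ) (i : ι) :
    |comb cls (cls i) lam v| * P ^ pairDeg k n (cls i) ≤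
      |comb cls true lam v| * P ^ k + |comb cls false lam v| * P ^ n := by
  cases h : cls i
  · simp only [pairDeg, cond_false]
    exact le_add_of_nonneg_left (by positivity)
  · simp only [pairDeg, cond_true]
    exact le_add_of_nonneg_right (by positivity)

lemma PairIndep.arc_le {k n : ℕ} {cls : ι → Bool} {C : ℝ} {v v' : ι → ℤ} (h : PairIndep cls C v v')
    (hC : 1 ≤ C) {P : ℝ} (hP : 0 ≤ P) {q q₁ q₁' : ℕ} (hq : 0 < q) (hq₁ : 0 < q₁) (hq₁' : 0 < q₁')
    {a : ι → ℤ} (ha : ReducedFrac q a) {A A' : Bool → ℤ} (hA : ∀ b, comb cls b a v * q₁ = A b * q)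
    (hA' : ∀ b, comb cls b a v' * q₁' = A' b * q) (lam : ι → ℝ) :
    (q : ℝ) * (1 + ∑ i, |lam i| * P ^ pairDeg k n (cls i)) ≤
      C ^ Fintype.card ι * (1 + Fintype.card ι * C) *
      ((q₁ * (1 + (|comb cls true lam v| * P ^ k + |comb cls false lam v| * P ^ n))) *
      (q₁' * (1 + (|comb cls true lam v'| * P ^ k + |comb cls false lam v'| * P ^ n)))) := by
  choose m u u' hm hmC huC hu'C hh using h
  set L := |comb cls true lam v| * P ^ k + |comb cls false lam v| * P ^ n with hL
  set L' := |comb cls true lam v'| * P ^ k + |comb cls false lam v'| * P ^ n with hL'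
  have hL0 : 0 ≤ L := by positivity
  have hL'0 : 0 ≤ L' := by positivity
  have hqle : (q : ℝ) ≤ C ^ Fintype.card ι * (q₁ * q₁') := by
    have hdvd : (q : ℤ) ∣ (∏ i, m i) * (q₁ * q₁') := by
      refine ha.dvd hq fun i => ?_
      have h1 := comb_pair (hh i) a
      simp only [Int.cast_id] at h1
      have h2 : (q : ℤ) ∣ m i * (q₁ * q₁') * a i := by
        refine ⟨u i * A (cls i) * q₁' + u' i * A' (cls i) * q₁, ?_⟩
        calc m i * (q₁ * q₁') * a i = (m i * a i) * (q₁ * q₁') := by ring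
          _ = u i * q₁' * (comb cls (cls i) a v * q₁) + u' i * q₁ * (comb cls (cls i) a v' * q₁') := by
              rw [← h1]; ring
          _ = _ := by rw [hA, hA']; ring
      refine h2.trans (mul_dvd_mul_right (mul_dvd_mul_right (dvd_prod_of_mem m (mem_univ i)) _) _)
    have hne : (∏ i, m i) * ((q₁ : ℤ) * q₁') ≠ 0 := by
      refine mul_ne_zero (prod_ne_zero_iff.2 fun i _ => hm i) ?_
      exact_mod_cast (Nat.mul_pos hq₁ hq₁').ne'
    have h1 := Int.le_of_dvd (abs_pos.2 hne) ((dvd_abs _ _).2 hdvd)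
    have h2 : (q : ℝ) ≤ |∏ i, (m i : ℝ)| * (q₁ * q₁') := by
      have : ((q : ℤ) : ℝ) ≤ ((|(∏ i, m i) * ((q₁ : ℤ) * q₁')| : ℤ) : ℝ) := by exact_mod_cast h1
      push_cast at this
      rwa [abs_mul, abs_of_nonneg (by positivity : (0 : ℝ) ≤ q₁ * q₁')] at this
    refine h2.trans ?_
    gcongr
    rw [abs_prod]
    refine (prod_le_prod (fun _ _ => abs_nonneg _) fun i _ => hmC i).trans ?_
    simp [prod_const]
  have hlam : ∀ i, |lam i| * P ^ pairDeg k n (cls i) ≤ C * (L + L') := by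
    intro i
    have h1 := comb_pair (hh i) lam
    have hm1 : (1 : ℝ) ≤ |(m i : ℝ)| := by exact_mod_cast Int.one_le_abs (hm i)
    have hp := pow_le_colDist (k := k) (n := n) (cls := cls) hP v lam i
    have hp' := pow_le_colDist (k := k) (n := n) (cls := cls) hP v' lam i
    set p := P ^ pairDeg k n (cls i)
    have hp0 : 0 ≤ p := by positivity
    calc |lam i| * p ≤ |(m i : ℝ)| * |lam i| * p := by
          gcongr; exact le_mul_of_one_le_left (abs_nonneg _) hm1
      _ = |u i * comb cls (cls i) lam v + u' i * comb cls (cls i) lam v'| * p := by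
          rw [h1, abs_mul]
      _ ≤ (C * |comb cls (cls i) lam v| + C * |comb cls (cls i) lam v'|) * p := by
          gcongr
          refine (abs_add_le _ _).trans ?_
          rw [abs_mul, abs_mul]
          gcongr
          · exact huC i
          · exact hu'C i
      _ = C * (|comb cls (cls i) lam v| * p + |comb cls (cls i) lam v'| * p) := by ring
      _ ≤ _ := by gcongr
  have hsum : ∑ i, |lam i| * P ^ pairDeg k n (cls i) ≤ Fintype.card ι * C * (L + L') := by
    refine (sum_le_sum fun i _ => hlam i).trans ?_
    rw [sum_const, card_univ, nsmul_eq_mul, mul_assoc]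
  have hr : 0 ≤ (Fintype.card ι : ℝ) * C := by positivity
  calc _ ≤ (C ^ Fintype.card ι * (q₁ * q₁')) * (1 + Fintype.card ι * C * (L + L')) := by gcongr
    _ ≤ (C ^ Fintype.card ι * (q₁ * q₁')) * ((1 + Fintype.card ι * C) * ((1 + L) * (1 + L'))) := by
        gcongr
        have : 0 ≤ Fintype.card ι * C * (L * L') := by positivity
        have : 0 ≤ L * L' := by positivity
        nlinarith
    _ = _ := by ring

lemma exists_prod_full_le {k n : ℕ} (hn : 0 < n) (hnk : n < k) {c : ℝ} (hc : 0 < c) (hc1 : c ≤ 1)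
    {J : Type*} [Fintype J] [DecidableEq J] (cls : ι → Bool) {C₀ : ℝ} (hC₀ : 1 ≤ C₀) {a : J → ι → ℤ}
    (ha : ∀ j i, |(a j i : ℝ)| ≤ C₀) (hpair : ∀ j j', j ≠ j' → PairIndep cls C₀ (a j) (a j')) {m : ℕ}
    (hm : 2 * m ≤ Fintype.card J) :
    ∃ C : ℝ, 1 ≤ C ∧ ∀ P : ℝ, 1 ≤ P → ∀ l u : J → ℕ, (∀ j, c * P ≤ l j) → (∀ j, l j ≤ u j) →
      (∀ j, (u j : ℝ) ≤ P) → ∀ q : ℕ, 0 < q → ∀ b : ι → ℤ, ReducedFrac q b → ∀ α : ι → ℝ,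
      (q * (1 + C₀ * arcDist k n cls P α q b)) ^ 2 ≤ P →
      ∏ j, ‖expS (Ico (l j) (u j)) (colMap k n cls (a j)) α‖ ≤
        C * P ^ Fintype.card J * (q * (1 + arcDist k n cls P α q b)) ^ (-(m / (4 * k)) : ℝ) := by
  obtain ⟨C₁, hC₁, h₁⟩ := exists_norm_weylSum_le hn hnk hc hc1
  set D : ℝ := C₀ ^ Fintype.card ι * (1 + Fintype.card ι * C₀) with hD
  have hD1 : 1 ≤ D := by
    have h1 : 1 ≤ C₀ ^ Fintype.card ι := one_le_pow₀ hC₀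
    have : 0 ≤ (Fintype.card ι : ℝ) * C₀ := by positivity
    nlinarith
  set e : ℝ := -(1 / (4 * k)) with he
  have he0 : e ≤ 0 := by rw [he]; simp only [Left.neg_nonpos_iff]; positivity
  set C₂ : ℝ := C₁ * C₁ * D ^ (-e) with hC₂
  have hC₂1 : 1 ≤ C₂ := by
    have : 1 ≤ D ^ (-e) := Real.one_le_rpow hD1 (by linarith)
    have : 1 ≤ C₁ * C₁ := by nlinarith
    nlinarith
  refine ⟨C₂ ^ m, one_le_pow₀ hC₂1, fun P hP l u hl hlu hu q hq b hb α hQ => ?_⟩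
  have hP0 : 0 < P := by linarith
  have hq0 : (1 : ℝ) ≤ q := by exact_mod_cast hq
  set Λ := arcDist k n cls P α q b with hΛ
  have hΛ0 : 0 ≤ Λ := arcDist_nonneg hP0.le α q b
  set lam : ι → ℝ := fun i => α i - b i / q with hlam
  have hcol : ∀ j, ∃ q₁ : ℕ, 0 < q₁ ∧ ∃ A : Bool → ℤ, (∀ s, comb cls s b (a j) * q₁ = A s * q) ∧
      ‖expS (Ico (l j) (u j)) (colMap k n cls (a j)) α‖ ≤ C₁ * P * (q₁ * (1 +
        (|comb cls true lam (a j)| * P ^ k + |comb cls false lam (a j)| * P ^ n))) ^ e := by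
    intro j
    obtain ⟨q₁, hq₁, hdvd, A, hA, hred⟩ := exists_reducedFrac hq fun s => comb cls s b (a j)
    refine ⟨q₁, hq₁, A, hA, ?_⟩
    have hq₁0 : (0 : ℝ) < q₁ := by exact_mod_cast hq₁
    have hq₁q : (q₁ : ℝ) ≤ q := by exact_mod_cast Nat.le_of_dvd hq hdvd
    have hLle := colDist_le (k := k) (n := n) (cls := cls) hP0.le (ha j) lam
    have h2 := h₁ P hP (l j) (u j - l j) (hl j) (by
      rw [Nat.cast_sub (hlu j)]; linarith [hu j]) q₁ hq₁ (A true) (A false) (fun p hp hpq hpA => by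
        have h3 := hred p hpq (fun s => by cases s; exacts [hpA.2, hpA.1])
        exact hp.one_lt.ne' h3) (comb cls true lam (a j)) (comb cls false lam (a j)) (by
        refine le_trans ?_ hQ
        gcongr
        exact hLle)
    refine le_trans (le_of_eq ?_) h2
    congr 1
    rw [expS, sum_Ico_eq_sum_range]
    refine sum_congr rfl fun x _ => ?_
    have hcomb : ∀ s, comb cls s α (a j) = A s / q₁ + comb cls s lam (a j) := by
      intro s
      have e1 : α = (fun i => (1 / q : ℝ) * ((b i : ℤ) : ℝ)) + lam := by
        funext i; simp only [hlam, Pi.add_apply]; ring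
      have e2 : ((comb cls s b (a j) : ℤ) : ℝ) * q₁ = A s * q := by exact_mod_cast hA s
      rw [comb_intCast] at e2
      conv_lhs => rw [e1]
      rw [comb_add, comb_smul]
      congr 1
      field_simp
      linarith
    unfold colMap
    rw [dot_pairDeg, hcomb, hcomb]
    push_cast
    rfl
  choose q₁ hq₁ A hA hbd using hcol
  set x : J → ℝ := fun j => ‖expS (Ico (l j) (u j)) (colMap k n cls (a j)) α‖ / P with hx
  have hx1 : ∀ j ∈ (univ : Finset J), x j ≤ 1 := fun j _ => by
    rw [hx, div_le_one hP0]
    refine (norm_expS_le _ _ _).trans ?_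
    rw [Nat.card_Ico, Nat.cast_sub (hlu j)]
    have : (0 : ℝ) ≤ l j := Nat.cast_nonneg _
    linarith [hu j]
  have hpairs : ∀ j ∈ (univ : Finset J), ∀ j' ∈ (univ : Finset J), j ≠ j' →
      x j * x j' ≤ C₂ * (q * (1 + Λ)) ^ e := by
    intro j _ j' _ hjj
    have h3 := (hpair j j' hjj).arc_le (k := k) (n := n) hC₀ hP0.le hq (hq₁ j) (hq₁ j') hb (hA j) (hA j') lam
    set Q := (q₁ j : ℝ) * (1 + (|comb cls true lam (a j)| * P ^ k + |comb cls false lam (a j)| * P ^ n))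
      with hQ1
    set Q' := (q₁ j' : ℝ) * (1 + (|comb cls true lam (a j')| * P ^ k +
      |comb cls false lam (a j')| * P ^ n)) with hQ2
    have hq1 : (0 : ℝ) < q₁ j := by exact_mod_cast hq₁ j
    have hq2 : (0 : ℝ) < q₁ j' := by exact_mod_cast hq₁ j'
    have hQ0 : 0 < Q := by positivity
    have hQ'0 : 0 < Q' := by positivity
    have hxj : ∀ j, x j ≤ C₁ * (q₁ j * (1 + (|comb cls true lam (a j)| * P ^ k +
        |comb cls false lam (a j)| * P ^ n))) ^ e := fun j => by
      rw [hx, div_le_iff₀ hP0]; linarith [hbd j]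
    have h4 : (Q * Q') ^ e ≤ D ^ (-e) * (q * (1 + Λ)) ^ e := by
      have h5 : (D * (Q * Q')) ^ e ≤ (q * (1 + Λ)) ^ e :=
        Real.rpow_le_rpow_of_nonpos (by positivity) h3 he0
      rw [Real.mul_rpow (by linarith) (by positivity)] at h5
      calc (Q * Q') ^ e = D ^ (-e) * (D ^ e * (Q * Q') ^ e) := by
            have h6 : D ^ (-e) * D ^ e = 1 := by rw [← Real.rpow_add (by linarith)]; simp
            rw [← mul_assoc (D ^ (-e)), h6, one_mul]
        _ ≤ _ := by gcongr
    calc x j * x j' ≤ (C₁ * Q ^ e) * (C₁ * Q' ^ e) :=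
          mul_le_mul (hxj j) (hxj j') (by positivity) (by positivity)
      _ = C₁ * C₁ * (Q * Q') ^ e := by rw [Real.mul_rpow hQ0.le hQ'0.le]; ring
      _ ≤ C₁ * C₁ * (D ^ (-e) * (q * (1 + Λ)) ^ e) := by gcongr
      _ = _ := by rw [hC₂]; ring
  have hprod := prod_le_pow_of_pairwise (fun j => by positivity) m univ hx1 hpairs (by rwa [card_univ])
  have e1 : ∏ j, ‖expS (Ico (l j) (u j)) (colMap k n cls (a j)) α‖ = P ^ Fintype.card J * ∏ j, x j := by
    rw [hx, prod_div_distrib, prod_const, card_univ]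
    field_simp
  have hQ0 : 0 ≤ (q : ℝ) * (1 + Λ) := by positivity
  have e2 : ((q * (1 + Λ)) ^ e) ^ m = (q * (1 + Λ)) ^ (-(m / (4 * k)) : ℝ) := by
    rw [← Real.rpow_natCast, ← Real.rpow_mul hQ0, he]
    congr 1; ring
  rw [e1]
  calc P ^ Fintype.card J * ∏ j, x j ≤ P ^ Fintype.card J * (C₂ * (q * (1 + Λ)) ^ e) ^ m := by gcongr
    _ = C₂ ^ m * P ^ Fintype.card J * ((q * (1 + Λ)) ^ e) ^ m := by rw [mul_pow]; ring
    _ = _ := by rw [e2]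

end

lemma inv_sq_le_telescope {h : ℝ} (h0 : 0 < h) (h1 : h ≤ 1) (x : ℝ) :
    h * ((1 + |x|) ^ 2)⁻¹ ≤ 2 * ((x + h) / (1 + |x + h|) - x / (1 + |x|)) := by
  have key : ∀ y : ℝ, 0 ≤ y → h * ((1 + y) ^ 2)⁻¹ ≤ 2 * ((y + h) / (1 + (y + h)) - y / (1 + y)) ∧
      h * ((1 + (y + h)) ^ 2)⁻¹ ≤ 2 * ((y + h) / (1 + (y + h)) - y / (1 + y)) := fun y hy => by
    have e : (y + h) / (1 + (y + h)) - y / (1 + y) = h * ((1 + (y + h)) * (1 + y))⁻¹ := by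
      field_simp; ring
    rw [e, ← mul_assoc, mul_comm 2 h, mul_assoc]
    constructor <;> refine mul_le_mul_of_nonneg_left ?_ h0.le <;>
      rw [← div_eq_mul_inv, inv_eq_one_div, div_le_div_iff₀ (by positivity) (by positivity)] <;> nlinarith
  rcases le_total 0 x with hx | hx
  · rw [abs_of_nonneg hx, abs_of_nonneg (by linarith)]
    exact (key x hx).1
  · rcases le_total (x + h) 0 with hx' | hx'
    · rw [abs_of_nonpos hx, abs_of_nonpos hx']
      have := (key (-(x + h)) (by linarith)).2
      rw [show -(x + h) + h = -x by ring] at this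
      refine this.trans_eq ?_
      rw [neg_div, neg_div]; ring
    · rw [abs_of_nonpos hx, abs_of_nonneg hx']
      have e1 : (x + h) / 2 ≤ (x + h) / (1 + (x + h)) :=
        div_le_div_of_nonneg_left hx' (by positivity) (by linarith)
      have e2 : -x / 2 ≤ -x / (1 + -x) :=
        div_le_div_of_nonneg_left (by linarith) (by linarith) (by linarith)
      have e3 : ((1 + -x) ^ 2)⁻¹ ≤ 1 := inv_le_one_of_one_le₀ (by nlinarith)
      rw [neg_div (1 + -x) x] at e2
      nlinarith

lemma sum_inv_sq_le {N : ℕ} {R : ℝ} (hR : 0 < R) (hN : R ≤ N) (θ : ℝ) :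
    ∑ t ∈ range N, ((1 + |(t : ℝ) / N - θ| * R) ^ 2)⁻¹ ≤ 4 * N / R := by
  have hN0 : (0 : ℝ) < N := hR.trans_le hN
  set h := R / N with hh
  have h0 : 0 < h := by positivity
  have h1 : h ≤ 1 := div_le_one_of_le₀ hN hN0.le
  set F : ℕ → ℝ := fun t => 2 * ((h * t - R * θ) / (1 + |h * t - R * θ|)) with hF
  have hF1 : ∀ t, |F t| ≤ 2 := fun t => by
    rw [hF]; simp only
    rw [abs_mul, abs_div, abs_two, abs_of_pos (a := 1 + |h * t - R * θ|) (by positivity)]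
    have : |h * t - R * θ| / (1 + |h * t - R * θ|) ≤ 1 := div_le_one_of_le₀ (by linarith) (by positivity)
    linarith
  have hstep : ∀ t ∈ range N, ((1 + |(t : ℝ) / N - θ| * R) ^ 2)⁻¹ ≤ h⁻¹ * (F (t + 1) - F t) := fun t _ => by
    have e : |(t : ℝ) / N - θ| * R = |h * t - R * θ| := by
      rw [← abs_of_pos hR, ← abs_mul, abs_of_pos hR, hh]; congr 1; ring
    have := inv_sq_le_telescope h0 h1 (h * t - R * θ)
    rw [e, inv_mul_eq_div, le_div_iff₀ h0, mul_comm]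
    refine this.trans_eq ?_
    simp only [hF]
    rw [show h * t - R * θ + h = h * ((t + 1 : ℕ) : ℝ) - R * θ by push_cast; ring]
    ring
  refine (sum_le_sum hstep).trans ?_
  rw [← mul_sum, sum_range_sub, hh, inv_div, mul_comm 4 (N : ℝ), mul_div_right_comm]
  refine mul_le_mul_of_nonneg_left ?_ (by positivity)
  linarith [abs_le.1 (hF1 N), abs_le.1 (hF1 0)]

variable {ι : Type*} [Fintype ι] [DecidableEq ι]

lemma sum_grid_prod_le {N : ℕ} {R : ι → ℝ} (hR : ∀ i, 1 ≤ R i) (hN : ∀ i, R i ≤ N) (hN0 : 0 < N)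
    (θ : ι → ℝ) : ∑ α ∈ grid ι N, ∏ i, ((1 + |α i - θ i| * R i) ^ 2)⁻¹ ≤
      4 ^ Fintype.card ι * N ^ Fintype.card ι / ∏ i, R i := by
  rw [grid, ← prod_univ_sum (fun _ => (range N).image fun t : ℕ => (t : ℝ) / N)
    fun i x => ((1 + |x - θ i| * R i) ^ 2)⁻¹, ← mul_pow, Fintype.card, ← prod_const, ← prod_div_distrib]
  refine prod_le_prod (fun i _ => sum_nonneg fun _ _ => by positivity) fun i _ => ?_
  rw [sum_image fun _ _ _ _ h => injective_div hN0 h]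
  exact sum_inv_sq_le (zero_lt_one.trans_le (hR i)) (hN i) (θ i)

lemma sum_Icc_inv_sq_le (Q : ℕ) : ∑ q ∈ Icc 1 Q, ((q : ℝ) ^ 2)⁻¹ ≤ 2 - 1 / (Q : ℝ) := by
  induction Q with
  | zero => norm_num
  | succ Q ih =>
    rw [sum_Icc_succ_top (by lia)]
    rcases Q.eq_zero_or_pos with rfl | hQ
    · norm_num
    have hQ' : (0 : ℝ) < Q := by exact_mod_cast hQ
    have : (((Q + 1 : ℕ) : ℝ) ^ 2)⁻¹ ≤ 1 / (Q : ℝ) - 1 / ((Q + 1 : ℕ) : ℝ) := by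
      push_cast
      rw [div_sub_div _ _ (by positivity) (by positivity), inv_eq_one_div,
        div_le_div_iff₀ (by positivity) (by positivity)]
      nlinarith
    linarith

lemma expect_grid_le {N Q : ℕ} {R : ι → ℝ} (hR : ∀ i, 1 ≤ R i) (hN : ∀ i, R i ≤ N) (hN0 : 0 < N)
    {G : (ι → ℝ) → ℝ} (hG : ∀ α, G α ≤ 0 ∨ ∃ q : ℕ, 0 < q ∧ q ≤ Q ∧ ∃ b : ι → ℤ,
      (∀ i, |α i - b i / q| ≤ 1) ∧
      G α ≤ ((q * (1 + ∑ i, |α i - b i / q| * R i)) ^ (2 * Fintype.card ι + 2))⁻¹) :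
    𝔼 α ∈ grid ι N, G α ≤ 2 * 16 ^ Fintype.card ι / ∏ i, R i := by
  set r := Fintype.card ι with hr
  have hR0 : ∀ i, 0 < R i := fun i => zero_lt_one.trans_le (hR i)
  set B : ℕ → Finset (ι → ℤ) := fun q => Fintype.piFinset fun _ => Icc (-(q : ℤ)) (2 * q) with hB
  have hcardB : ∀ q : ℕ, 0 < q → (#(B q) : ℝ) ≤ 4 ^ r * q ^ r := fun q hq => by
    rw [hB, Fintype.card_piFinset, prod_const, Int.card_Icc, ← mul_pow, Finset.card_univ, ← hr]
    push_cast
    refine pow_le_pow_left₀ (by positivity) ?_ r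
    have : ((2 * (q : ℤ) + 1 - -(q : ℤ)).toNat) ≤ 4 * q := by lia
    exact_mod_cast this
  have hpt : ∀ α ∈ grid ι N, G α ≤ ∑ q ∈ Icc 1 Q, ∑ b ∈ B q, ((q : ℝ) ^ (2 * r + 2))⁻¹ *
      ∏ i, ((1 + |α i - b i / q| * R i) ^ 2)⁻¹ := fun α hα => by
    have hnn : ∀ (q : ℕ) (b : ι → ℤ), (0 : ℝ) ≤ ((q : ℝ) ^ (2 * r + 2))⁻¹ *
      ∏ i, ((1 + |α i - b i / q| * R i) ^ 2)⁻¹ := fun q b => by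
      have : ∀ i ∈ univ, 0 ≤ ((1 + |α i - b i / q| * R i) ^ 2)⁻¹ := fun i _ => by positivity
      have := prod_nonneg this
      positivity
    rcases hG α with h0 | ⟨q, hq, hqQ, b, hb, hle⟩
    · exact h0.trans (sum_nonneg fun q _ => sum_nonneg fun b _ => hnn q b)
    · have hq' : (0 : ℝ) < q := by exact_mod_cast hq
      have hbB : b ∈ B q := Fintype.mem_piFinset.2 fun i => by
        obtain ⟨t, ht, hta⟩ := mem_image.1 (Fintype.mem_piFinset.1 hα i)
        have h1 : 0 ≤ α i := hta ▸ by positivity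
        have h2 : α i ≤ 1 := hta ▸ div_le_one_of_le₀ (by exact_mod_cast (mem_range.1 ht).le) (by positivity)
        have h3 := abs_le.1 (hb i)
        have h4 : (b i : ℝ) / q ≤ 2 := by linarith
        have h5 : -1 ≤ (b i : ℝ) / q := by linarith
        rw [div_le_iff₀ hq'] at h4
        rw [le_div_iff₀ hq'] at h5
        rw [mem_Icc]
        constructor
        · have : (((-(q : ℤ)) : ℤ) : ℝ) ≤ b i := by push_cast; linarith
          exact_mod_cast this
        · exact_mod_cast h4
      refine hle.trans (le_trans ?_ ((single_le_sum (f := fun b : ι → ℤ => ((q : ℝ) ^ (2 * r + 2))⁻¹ *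
        ∏ i, ((1 + |α i - b i / q| * R i) ^ 2)⁻¹) (fun b _ => hnn q b) hbB).trans
        (single_le_sum (f := fun q : ℕ => ∑ b ∈ B q, ((q : ℝ) ^ (2 * r + 2))⁻¹ *
        ∏ i, ((1 + |α i - b i / q| * R i) ^ 2)⁻¹) (fun q _ => sum_nonneg fun b _ => hnn q b)
        (mem_Icc.2 ⟨hq, hqQ⟩))))
      rw [mul_pow, mul_inv, prod_inv_distrib]
      refine mul_le_mul_of_nonneg_left ?_ (by positivity)
      have hX : ∀ i, |α i - b i / q| * R i ≤ ∑ i, |α i - b i / q| * R i := fun i =>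
        single_le_sum (f := fun i => |α i - b i / q| * R i)
          (fun i _ => mul_nonneg (abs_nonneg _) (hR0 i).le) (mem_univ i)
      have hX0 : 0 ≤ ∑ i, |α i - b i / q| * R i :=
        sum_nonneg fun i _ => mul_nonneg (abs_nonneg _) (hR0 i).le
      have hone : ∀ i, 0 < 1 + |α i - b i / q| * R i := fun i => by
        have := hR0 i; positivity
      refine inv_anti₀ (prod_pos fun i _ => pow_pos (hone i) 2) ?_
      rw [prod_pow]
      calc (∏ i, (1 + |α i - b i / q| * R i)) ^ 2 ≤ ((1 + ∑ i, |α i - b i / q| * R i) ^ r) ^ 2 := by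
            refine pow_le_pow_left₀ (prod_nonneg fun i _ => (hone i).le) ?_ 2
            rw [hr, Fintype.card, ← prod_const]
            exact prod_le_prod (fun i _ => (hone i).le) fun i _ => by linarith [hX i]
        _ ≤ _ := by
            rw [← pow_mul]; exact pow_le_pow_right₀ (by linarith) (by lia)
  have hN' : (0 : ℝ) < N := by exact_mod_cast hN0
  have hPR : 0 < ∏ i, R i := prod_pos fun i _ => hR0 i
  rw [expect_eq_sum_div_card, card_grid hN0]
  push_cast
  rw [div_le_iff₀ (by positivity), ← hr]
  calc ∑ α ∈ grid ι N, G α ≤ _ := sum_le_sum hpt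
    _ = ∑ q ∈ Icc 1 Q, ∑ b ∈ B q, ((q : ℝ) ^ (2 * r + 2))⁻¹ *
        ∑ α ∈ grid ι N, ∏ i, ((1 + |α i - b i / q| * R i) ^ 2)⁻¹ := by
        rw [sum_comm]; refine sum_congr rfl fun q _ => ?_
        rw [sum_comm]; exact sum_congr rfl fun b _ => (mul_sum ..).symm
    _ ≤ ∑ q ∈ Icc 1 Q, ((q : ℝ) ^ 2)⁻¹ * (16 ^ r * N ^ r / ∏ i, R i) := by
        refine sum_le_sum fun q hq => ?_
        have hq0 : 0 < q := (mem_Icc.1 hq).1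
        have hq1 : (1 : ℝ) ≤ q := by exact_mod_cast hq0
        calc _ ≤ ∑ b ∈ B q, ((q : ℝ) ^ (2 * r + 2))⁻¹ * (4 ^ r * N ^ r / ∏ i, R i) :=
              sum_le_sum fun b _ => mul_le_mul_of_nonneg_left (sum_grid_prod_le hR hN hN0 _) (by positivity)
          _ = #(B q) * (((q : ℝ) ^ (2 * r + 2))⁻¹ * (4 ^ r * N ^ r / ∏ i, R i)) := by
              rw [sum_const, nsmul_eq_mul]
          _ ≤ (4 ^ r * q ^ r) * (((q : ℝ) ^ (2 * r + 2))⁻¹ * (4 ^ r * N ^ r / ∏ i, R i)) :=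
              mul_le_mul_of_nonneg_right (hcardB q hq0) (by positivity)
          _ = ((q : ℝ) ^ (r + 2))⁻¹ * (16 ^ r * N ^ r / ∏ i, R i) := by
              rw [show 2 * r + 2 = r + (r + 2) by ring, pow_add (q : ℝ) r (r + 2),
                show (16 : ℝ) = 4 * 4 by norm_num, mul_pow]
              field_simp
          _ ≤ _ := mul_le_mul_of_nonneg_right (inv_anti₀ (by positivity)
              (pow_le_pow_right₀ hq1 (by lia))) (by positivity)
    _ ≤ 2 * (16 ^ r * N ^ r / ∏ i, R i) := by
        rw [← sum_mul]
        refine mul_le_mul_of_nonneg_right ?_ (by positivity)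
        have := sum_Icc_inv_sq_le Q
        have : (0 : ℝ) ≤ 1 / (Q : ℝ) := by positivity
        linarith
    _ = _ := by ring

variable {ι : Type*} [Fintype ι] [DecidableEq ι]

noncomputable def boxAt (L : ι → ℕ) : Finset (ι → ℤ) := Fintype.piFinset fun i => Icc (-(L i : ℤ)) (L i)

lemma boxAt_card_pos (L : ι → ℕ) : 0 < #(boxAt L) :=
  card_pos.2 ⟨0, Fintype.mem_piFinset.2 fun i => mem_Icc.2 (by simp)⟩

/-- The normalised exponential sum over multiples of `N₀` in a box. -/
noncomputable def boxAvg (N₀ : ℕ) (L : ι → ℕ) (α : ι → ℝ) : ℂ :=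
  expS (boxAt L) (fun g i => (N₀ : ℤ) * g i) α / #(boxAt L)

lemma norm_boxAvg_le (N₀ : ℕ) (L : ι → ℕ) (α : ι → ℝ) : ‖boxAvg N₀ L α‖ ≤ 1 := by
  rw [boxAvg, norm_div, Complex.norm_natCast]
  exact div_le_one_of_le₀ (norm_expS_le _ _ _) (by positivity)

lemma norm_boxAvg_sub_one_le {N₀ q : ℕ} (hq : 0 < q) (hqN : q ∣ N₀) {L : ι → ℕ} {τ : ℝ} {R : ι → ℝ}
    (hL : ∀ i, (N₀ : ℝ) * L i ≤ τ * R i) (α : ι → ℝ) (b : ι → ℤ) :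
    ‖boxAvg N₀ L α - 1‖ ≤ 2 * Real.pi * (τ * ∑ i, |α i - b i / q| * R i) := by
  have hV : (0 : ℝ) < #(boxAt L) := by exact_mod_cast boxAt_card_pos L
  have hq' : (q : ℝ) ≠ 0 := by exact_mod_cast hq.ne'
  obtain ⟨h, rfl⟩ := hqN
  have hpt : ∀ g ∈ boxAt L, ‖ee (dot α fun i => ((q * h : ℕ) : ℤ) * g i) - 1‖ ≤
      2 * Real.pi * (τ * ∑ i, |α i - b i / q| * R i) := fun g hg => by
    have e : dot α (fun i => ((q * h : ℕ) : ℤ) * g i) =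
        (∑ i, (α i - b i / q) * ((q * h : ℕ) * g i)) + ((∑ i, b i * h * g i : ℤ) : ℝ) := by
      rw [dot]; push_cast
      rw [← sum_add_distrib]
      refine sum_congr rfl fun i _ => ?_
      field_simp; ring
    rw [e, ee_add_int, ← ee_zero]
    refine (norm_ee_sub_ee_le _ _).trans (mul_le_mul_of_nonneg_left ?_ (by positivity))
    rw [sub_zero, mul_sum]
    refine (abs_sum_le_sum_abs _ _).trans (sum_le_sum fun i _ => ?_)
    have hgi : |(g i : ℝ)| ≤ L i := by
      have := mem_Icc.1 (Fintype.mem_piFinset.1 hg i)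
      rw [abs_le]; exact ⟨by exact_mod_cast this.1, by exact_mod_cast this.2⟩
    rw [abs_mul, abs_mul, Nat.abs_cast]
    calc |α i - b i / q| * ((q * h : ℕ) * |(g i : ℝ)|) ≤ |α i - b i / q| * ((q * h : ℕ) * L i) := by gcongr
      _ ≤ |α i - b i / q| * (τ * R i) := mul_le_mul_of_nonneg_left (hL i) (abs_nonneg _)
      _ = _ := by ring
  have : boxAvg (q * h) L α - 1 =
      (∑ g ∈ boxAt L, (ee (dot α fun i => ((q * h : ℕ) : ℤ) * g i) - 1)) / #(boxAt L) := by
    rw [boxAvg, expS, sum_sub_distrib, sum_const, nsmul_eq_mul, mul_one, sub_div, div_self]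
    exact_mod_cast hV.ne'
  rw [this, norm_div, Complex.norm_natCast, div_le_iff₀ hV]
  refine (norm_sum_le _ _).trans ((sum_le_sum hpt).trans_eq ?_)
  rw [sum_const, nsmul_eq_mul, mul_comm]

lemma card_near_le {β : Type*} (R : Finset β) (Φ : β → ι → ℤ) {N₀ : ℕ} (L : ι → ℕ) {E : ℝ}
    (hE : ∀ᶠ N : ℕ in atTop, 𝔼 α ∈ grid ι N, ‖expS R Φ α‖ * ‖boxAvg N₀ L α - 1‖ ≤ E) :
    (#(R.filter fun z => ∀ i, (N₀ : ℤ) ∣ Φ z i ∧ |Φ z i| ≤ N₀ * L i) : ℝ) ≤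
      #(boxAt L) * (#(R.filter fun z => Φ z = 0) + E) := by
  classical
  have hV : (0 : ℝ) < #(boxAt L) := by exact_mod_cast boxAt_card_pos L
  obtain ⟨N, hN, h1, h2⟩ := (hE.and ((eventually_expect_expS R Φ).and
    (eventually_expect_expS (R ×ˢ boxAt L) fun z => Φ z.1 + fun i => (N₀ : ℤ) * z.2 i))).exists
  have hle : (#(R.filter fun z => ∀ i, (N₀ : ℤ) ∣ Φ z i ∧ |Φ z i| ≤ N₀ * L i) : ℝ) ≤
      #((R ×ˢ boxAt L).filter fun z => (Φ z.1 + fun i => (N₀ : ℤ) * z.2 i) = 0) := by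
    refine Nat.cast_le.2 (card_le_card_of_surjOn Prod.fst fun z hz => ?_)
    rw [mem_coe, mem_filter] at hz
    choose g hg using fun i => (hz.2 i).1
    have hg' : ∀ i, |Φ z i| ≤ N₀ * L i → ∃ g' : ℤ, Φ z i = N₀ * g' ∧ |g'| ≤ L i := fun i h => by
      rcases N₀.eq_zero_or_pos with rfl | h0
      · exact ⟨0, by simpa using hg i, by simp⟩
      · refine ⟨g i, hg i, ?_⟩
        rw [hg i, abs_mul, Nat.abs_cast] at h
        exact le_of_mul_le_mul_left h (by exact_mod_cast h0)
    choose g' h1 h2 using fun i => hg' i (hz.2 i).2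
    refine ⟨(z, -g'), ?_, rfl⟩
    rw [mem_coe, mem_filter, mem_product]
    refine ⟨⟨hz.1, Fintype.mem_piFinset.2 fun i => ?_⟩, funext fun i => ?_⟩
    · have := abs_le.1 (h2 i); rw [mem_Icc]; simp only [Pi.neg_apply]; lia
    · simp [h1 i]
  refine hle.trans ?_
  have e1 : (((#((R ×ˢ boxAt L).filter fun z => (Φ z.1 + fun i => (N₀ : ℤ) * z.2 i) = 0) : ℝ) /
      #(boxAt L) - #(R.filter fun z => Φ z = 0) : ℝ) : ℂ) =
      𝔼 α ∈ grid ι N, expS R Φ α * (boxAvg N₀ L α - 1) := by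
    push_cast
    rw [← h1, ← h2]
    simp only [mul_sub, mul_one, expect_sub_distrib, boxAvg, ← mul_div_assoc, expS_mul]
    rw [expect_div]
  have e2 : (#((R ×ˢ boxAt L).filter fun z => (Φ z.1 + fun i => (N₀ : ℤ) * z.2 i) = 0) : ℝ) /
      #(boxAt L) - #(R.filter fun z => Φ z = 0) ≤ E := by
    refine (le_abs_self _).trans ?_
    rw [← Real.norm_eq_abs, ← Complex.norm_real, e1]
    refine (RCLike.norm_expect_le (K := ℂ)).trans ?_
    simp only [norm_mul]
    linarith
  rw [sub_le_iff_le_add', div_le_iff₀ hV] at e2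
  linarith

/-- `α` lies on an arc about a fraction with denominator and distance small in terms of `P`. -/
def MajorAt (k n : ℕ) (cls : ι → Bool) (C₀ P : ℝ) (α : ι → ℝ) : Prop :=
  ∃ q : ℕ, 0 < q ∧ ∃ b : ι → ℤ, ReducedFrac q b ∧ (q * (1 + C₀ * arcDist k n cls P α q b)) ^ 2 ≤ P

open Classical in
lemma exists_card_near_le {k n : ℕ} (hn : 0 < n) (hnk : n < k) {c : ℝ} (hc : 0 < c) (hc1 : c ≤ 1)
    {J : Type*} [Fintype J] [DecidableEq J] (cls : ι → Bool) {C₀ : ℝ} (hC₀ : 1 ≤ C₀) {a : J → ι → ℤ}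
    (ha : ∀ j i, |(a j i : ℝ)| ≤ C₀) (hpair : ∀ j j', j ≠ j' → PairIndep cls C₀ (a j) (a j'))
    (hJ : 8 * k * (2 * Fintype.card ι + 3) ≤ Fintype.card J) :
    ∃ C : ℝ, 1 ≤ C ∧ ∀ P : ℝ, 1 ≤ P → ∀ l u : J → ℕ, (∀ j, c * P ≤ l j) → (∀ j, l j ≤ u j) →
      (∀ j, (u j : ℝ) ≤ P) → ∀ {β : Type} (Ro : Finset β) (ψ : β → ι → ℤ) (K N₀ : ℕ), 0 < K →
      (∀ q, 0 < q → q ≤ K → q ∣ N₀) → ∀ (L : ι → ℕ) (τ : ℝ), 0 ≤ τ →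
      (∀ i, (N₀ : ℝ) * L i ≤ τ * P ^ pairDeg k n (cls i)) → ∀ E : ℝ,
      (∀ᶠ N : ℕ in atTop, 𝔼 α ∈ grid ι N, (if MajorAt k n cls C₀ P α then 0 else
        (∏ j, ‖expS (Ico (l j) (u j)) (colMap k n cls (a j)) α‖) * ‖expS Ro ψ α‖) ≤ E) →
      (#(((Fintype.piFinset fun j => Ico (l j) (u j)) ×ˢ Ro).filter fun z => ∀ i,
        (N₀ : ℤ) ∣ (∑ j, colMap k n cls (a j) (z.1 j) + ψ z.2) i ∧
        |(∑ j, colMap k n cls (a j) (z.1 j) + ψ z.2) i| ≤ N₀ * L i) : ℝ) ≤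
      #(boxAt L) * (#(((Fintype.piFinset fun j => Ico (l j) (u j)) ×ˢ Ro).filter fun z =>
        ∑ j, colMap k n cls (a j) (z.1 j) + ψ z.2 = 0) + (2 * E +
        C * (1 / K + K * τ) * (#Ro * P ^ Fintype.card J / ∏ i, P ^ pairDeg k n (cls i)))) := by
  set r := Fintype.card ι with hr
  have hk0 : 0 < k := hn.trans hnk
  obtain ⟨C₁, hC₁, h₁⟩ := exists_prod_full_le hn hnk hc hc1 cls hC₀ ha hpair (m := 4 * k * (2 * r + 3))
    (by linarith)
  refine ⟨2 * 16 ^ r * (C₁ * (2 * Real.pi)), ?_, ?_⟩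
  · have : (1 : ℝ) ≤ 16 ^ r := one_le_pow₀ (by norm_num)
    nlinarith [Real.pi_gt_three, mul_le_mul this hC₁ zero_le_one (by positivity)]
  intro P hP l u hl hlu hu β Ro ψ K N₀ hK hN₀ L τ hτ hL E hE
  rcases Ro.eq_empty_or_nonempty with rfl | hRo
  · obtain ⟨N, hN⟩ := hE.exists
    have : (0 : ℝ) ≤ E := by simpa [expS] using hN
    simp only [product_empty, filter_empty, card_empty, Nat.cast_zero, zero_mul, zero_div, mul_zero]
    positivity
  have hRo0 : (0 : ℝ) < #Ro := by exact_mod_cast hRo.card_pos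
  have hK0 : (0 : ℝ) < K := by exact_mod_cast hK
  set R : ι → ℝ := fun i => P ^ pairDeg k n (cls i) with hR
  set T : ℝ := 1 / K + K * τ with hT
  have hT0 : 0 < T := by positivity
  set X : ℝ := C₁ * (2 * Real.pi) * T * (#Ro * P ^ Fintype.card J) with hX
  have hX0 : 0 < X := by positivity
  refine card_near_le _ _ L ?_
  obtain ⟨N₁, hN₁⟩ := exists_nat_gt (P ^ k)
  filter_upwards [hE, eventually_ge_atTop N₁, eventually_gt_atTop 0] with N hEN hN hN0
  have hR1 : ∀ i, 1 ≤ R i := fun i => one_le_pow₀ hP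
  have hRN : ∀ i, R i ≤ N := fun i => by
    have : pairDeg k n (cls i) ≤ k := by cases h : cls i <;> simp [pairDeg, hnk.le]
    exact (pow_le_pow_right₀ hP this).trans (hN₁.le.trans (by exact_mod_cast hN))
  set W : (ι → ℝ) → ℝ := fun α =>
    (∏ j, ‖expS (Ico (l j) (u j)) (colMap k n cls (a j)) α‖) * ‖expS Ro ψ α‖ with hW
  have hW0 : ∀ α, 0 ≤ W α := fun α => mul_nonneg (prod_nonneg fun _ _ => norm_nonneg _) (norm_nonneg _)
  have hWeq : ∀ α, ‖expS ((Fintype.piFinset fun j => Ico (l j) (u j)) ×ˢ Ro)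
      (fun z => ∑ j, colMap k n cls (a j) (z.1 j) + ψ z.2) α‖ = W α := fun α => by
    simp only [hW]; rw [← norm_prod, prod_expS, ← norm_mul, expS_mul]
  have hκ2 : ∀ α, ‖boxAvg N₀ L α - 1‖ ≤ 2 := fun α => by
    refine (norm_sub_le _ _).trans ?_
    have := norm_boxAvg_le N₀ L α
    rw [norm_one]; linarith
  set G : (ι → ℝ) → ℝ := fun α =>
    if MajorAt k n cls C₀ P α then W α * ‖boxAvg N₀ L α - 1‖ / X else 0 with hG
  have hGle : 𝔼 α ∈ grid ι N, G α ≤ 2 * 16 ^ r / ∏ i, R i := by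
    refine expect_grid_le (Q := ⌊P⌋₊) hR1 hRN hN0 fun α => ?_
    by_cases hα : MajorAt k n cls C₀ P α
    swap
    · exact Or.inl (by simp [hG, hα])
    right
    obtain ⟨q, hq, b, hb, hqP⟩ := hα
    have hα : MajorAt k n cls C₀ P α := ⟨q, hq, b, hb, hqP⟩
    have hΛ0 : 0 ≤ arcDist k n cls P α q b := arcDist_nonneg (by linarith) α q b
    set Λ := arcDist k n cls P α q b with hΛ
    have hq1 : (1 : ℝ) ≤ q := by exact_mod_cast hq
    have hΛC : Λ ≤ C₀ * Λ := le_mul_of_one_le_left hΛ0 hC₀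
    have hy1 : (q : ℝ) ≤ q * (1 + Λ) := le_mul_of_one_le_right (by linarith) (by linarith)
    have hyΛ : 1 + Λ ≤ q * (1 + Λ) := le_mul_of_one_le_left (by linarith) hq1
    set y := (q : ℝ) * (1 + Λ) with hy
    have hy0 : 0 < y := by linarith
    have hyP : y ^ 2 ≤ P := le_trans (pow_le_pow_left₀ hy0.le
      (mul_le_mul_of_nonneg_left (by linarith) (by linarith)) 2) hqP
    refine ⟨q, hq, Nat.le_floor (by nlinarith), b, fun i => ?_, ?_⟩
    · have h1 : |α i - b i / q| * R i ≤ Λ := single_le_sum (f := fun i => |α i - b i / q| * R i)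
        (fun i _ => by positivity) (mem_univ i)
      have hPR : P ≤ R i := by
        refine le_self_pow₀ hP ?_
        cases h : cls i <;> simp [pairDeg] <;> lia
      by_contra! hcon
      nlinarith
    · change _ ≤ (y ^ (2 * r + 2))⁻¹
      rw [hG]; simp only [if_pos hα]
      rw [div_le_iff₀ hX0]
      have hb1 : W α ≤ C₁ * P ^ Fintype.card J * (y ^ (2 * r + 3))⁻¹ * #Ro := by
        refine mul_le_mul ?_ (norm_expS_le _ _ _) (norm_nonneg _) (by positivity)
        refine (h₁ P hP l u hl hlu hu q hq b hb α hqP).trans_eq ?_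
        congr 1
        rw [Real.rpow_neg hy0.le, ← Real.rpow_natCast]
        congr 2
        push_cast
        field_simp
      have hb2 : ‖boxAvg N₀ L α - 1‖ ≤ 2 * Real.pi * T * y := by
        by_cases hyK : y ≤ K
        · refine (norm_boxAvg_sub_one_le hq (hN₀ q hq (by exact_mod_cast hy1.trans hyK)) hL α b).trans ?_
          rw [mul_assoc (2 * Real.pi) T y]
          refine mul_le_mul_of_nonneg_left ?_ (by positivity)
          change τ * Λ ≤ T * y
          have : K * τ ≤ T := by rw [hT]; linarith [show (0 : ℝ) ≤ 1 / K by positivity]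
          have hK1 : (1 : ℝ) ≤ K := by exact_mod_cast hK
          have : τ ≤ T := le_trans (le_mul_of_one_le_left hτ hK1) this
          exact mul_le_mul this (by linarith) hΛ0 hT0.le
        · refine (hκ2 α).trans ?_
          have : 1 / K ≤ T := by rw [hT]; linarith [show (0 : ℝ) ≤ K * τ by positivity]
          have h3 : 1 ≤ T * y := by
            refine le_trans ?_ (mul_le_mul this (not_le.1 hyK).le hK0.le hT0.le)
            rw [one_div_mul_cancel hK0.ne']
          nlinarith [Real.pi_gt_three]
      refine (mul_le_mul hb1 hb2 (norm_nonneg _) (by positivity)).trans_eq ?_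
      rw [hX, show 2 * r + 3 = 2 * r + 2 + 1 by ring, pow_succ y (2 * r + 2)]
      field_simp
  calc 𝔼 α ∈ grid ι N, _ ≤ 𝔼 α ∈ grid ι N, (2 * (if MajorAt k n cls C₀ P α then 0 else W α) + X * G α) := by
        refine expect_le_expect fun α _ => ?_
        rw [hWeq]
        by_cases hα : MajorAt k n cls C₀ P α
        · simp only [hG, if_pos hα, mul_zero, zero_add]
          rw [mul_div_cancel₀ (_ : ℝ) hX0.ne']
        · simp only [hG, if_neg hα, mul_zero, add_zero]
          rw [mul_comm]; exact mul_le_mul_of_nonneg_right (hκ2 α) (hW0 α)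
    _ = 2 * 𝔼 α ∈ grid ι N, (if MajorAt k n cls C₀ P α then 0 else W α) + X * 𝔼 α ∈ grid ι N, G α := by
        rw [expect_add_distrib, mul_expect, mul_expect]
    _ ≤ 2 * E + X * (2 * 16 ^ r / ∏ i, R i) :=
        add_le_add (by linarith) (mul_le_mul_of_nonneg_left hGle hX0.le)
    _ = _ := by rw [hX]; ring

variable {ι : Type*} [Fintype ι] [DecidableEq ι]

lemma dot_colMap_mul (k n : ℕ) (cls : ι → Bool) (α : ι → ℝ) (v : ι → ℤ) (x : ℕ) :
    dot α (colMap k n cls v x) = dot (fun b => comb cls b α v) (mono (pairDeg k n) x) := by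
  refine (dot_pairDeg k n cls α v x).trans ?_
  rw [dot, Fintype.sum_bool]
  simp [mono, pairDeg]

lemma exists_reducedFrac_of_approx {α e : ι → ℝ} {Q : ℝ} (hQ : 0 ≤ Q)
    (h : ∀ i, ∃ q : ℕ, 0 < q ∧ (q : ℝ) ≤ Q ∧ ∃ A : ℤ, |α i - A / q| ≤ e i) :
    ∃ q : ℕ, 0 < q ∧ (q : ℝ) ≤ Q ^ Fintype.card ι ∧ ∃ b : ι → ℤ, ReducedFrac q b ∧
      ∀ i, |α i - b i / q| ≤ e i := by
  choose q hq hqQ A hA using h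
  have hprod : 0 < ∏ i, q i := prod_pos fun i _ => hq i
  obtain ⟨q₁, hq₁, hdvd, b, hb, hred⟩ := exists_reducedFrac hprod fun i => A i * ∏ i' ∈ univ.erase i, (q i' : ℤ)
  refine ⟨q₁, hq₁, ?_, b, hred, fun i => ?_⟩
  · have h1 : (q₁ : ℝ) ≤ ((∏ i, q i : ℕ) : ℝ) := by exact_mod_cast Nat.le_of_dvd hprod hdvd
    refine h1.trans ?_
    push_cast
    rw [Fintype.card, ← prod_const]
    exact prod_le_prod (fun _ _ => by positivity) fun i _ => hqQ i
  · have h1 : (A i : ℝ) / q i = b i / q₁ := by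
      have h2 := hb i
      have h3 : (∏ i, (q i : ℤ)) = q i * ∏ i' ∈ univ.erase i, (q i' : ℤ) := (mul_prod_erase _ _ (mem_univ i)).symm
      push_cast at h2
      rw [h3] at h2
      have h4 : (∏ i' ∈ univ.erase i, (q i' : ℤ)) ≠ 0 :=
        prod_ne_zero_iff.2 fun i' _ => by exact_mod_cast (hq i').ne'
      have h5 : A i * q₁ = b i * q i := mul_left_cancel₀ h4 (by linarith)
      rw [div_eq_div_iff (by exact_mod_cast (hq i).ne') (by exact_mod_cast hq₁.ne')]
      exact_mod_cast h5
    rw [← h1]; exact hA i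

lemma eventually_mul_le_of_not_majorAt {k n : ℕ} (hn : 0 < n) (hnk : n < k) (cls : ι → Bool)
    (hι : Fintype.card ι ≤ 4) {C₀ C₁ : ℝ} (hC₀ : 1 ≤ C₀) (hC₁ : 1 ≤ C₁) {t E : ℕ} (ht : 1 ≤ t)
    (hE : 1 ≤ E) {σ Δ : ℝ} (hω0 : 0 ≤ 16 * t * σ + 3 * Δ) (hω : 16 * t * σ + 3 * Δ < 1 / 80) :
    ∀ᶠ M : ℕ in atTop, ∀ S ⊆ primesIn M, ∀ A : Finset ℕ, A.Nonempty →
      (M : ℝ) ^ (79 / 80 : ℝ) ≤ #S → (∀ y ∈ A, y ≤ E * M ^ 3) →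
      (mv t A (mono (pairDeg k n)) : ℝ) * ((M : ℝ) ^ 3) ^ (k + n) ≤
        (#A : ℝ) ^ (2 * t) * ((M : ℝ) ^ 3) ^ Δ →
      ∀ P : ℝ, 1 ≤ P → (M : ℝ) ^ 4 ≤ C₁ * P → P ≤ C₁ * M ^ 4 → ∀ v v' : ι → ℤ, PairIndep cls C₀ v v' →
      ∀ α : ι → ℝ, ¬ MajorAt k n cls C₀ P α →
        (‖expS (S ×ˢ A) (fun z => colMap k n cls v (z.1 * z.2)) α‖ / (#S * #A)) *
        (‖expS (S ×ˢ A) (fun z => colMap k n cls v' (z.1 * z.2)) α‖ / (#S * #A)) ≤ ((M : ℝ) ^ 4) ^ (-σ) := by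
  have hd : ∀ b, 0 < pairDeg k n b := fun b => by cases b <;> simp [pairDeg] <;> lia
  set C₂ : ℝ := 8 * C₀ * C₁ ^ k with hC₂
  set C₃ : ℝ := C₀ ^ 4 * (2 * C₀ * C₂) with hC₃
  have hC₂1 : 1 ≤ C₂ := by
    have : (1 : ℝ) ≤ C₁ ^ k := one_le_pow₀ hC₁
    nlinarith
  filter_upwards [eventually_approx_of_large (d := pairDeg k n) hd ht hE (τ := 1 / 20) (by norm_num)
    (by norm_num) hω0 (by linarith), eventually_ge_atTop 1, (eventually_const_mul_rpow_le
    (show (2.8 : ℝ) < 4 by norm_num) (C₁ * C₃ ^ 2)).natCast_atTop] with M hM hM1 hMC S hS A hA hSM hAE hmv P hP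
    hMP hPM v v' hvv α hα
  have hM1' : (1 : ℝ) ≤ M := by exact_mod_cast hM1
  have hM0 : (0 : ℝ) < M := by linarith
  have hSA : (0 : ℝ) < #S * #A := by
    have : (0 : ℝ) < #A := by exact_mod_cast hA.card_pos
    have : (0 : ℝ) < #S := lt_of_lt_of_le (by positivity) hSM
    positivity
  have hle1 : ∀ w, ‖expS (S ×ˢ A) (fun z => colMap k n cls w (z.1 * z.2)) α‖ / (#S * #A) ≤ 1 := fun w =>
    div_le_one_of_le₀ ((norm_expS_le _ _ _).trans (by rw [card_product]; push_cast; exact le_rfl)) hSA.le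
  have hlarge : ∀ w, ((M : ℝ) ^ 4) ^ (-σ) ≤
      ‖expS (S ×ˢ A) (fun z => colMap k n cls w (z.1 * z.2)) α‖ / (#S * #A) →
      ∀ b, ∃ q : ℕ, 0 < q ∧ (q : ℝ) ≤ (M : ℝ) ^ (0.15 : ℝ) ∧
        ∃ a : ℤ, |comb cls b α w - a / q| ≤ (M : ℝ) ^ (0.2 - 4 * pairDeg k n b : ℝ) := fun w hw b => by
    rw [le_div_iff₀ hSA] at hw
    obtain ⟨q, hq, hqM, a, ha⟩ := hM S hS A hA (le_of_eq_of_le (by norm_num) hSM) hAE (by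
      simpa [Fintype.sum_bool, pairDeg] using hmv)
      (fun b => comb cls b α w) (by
        rw [mul_comm]
        refine hw.trans_eq ?_
        simp only [expS, dot_colMap_mul]) b
    exact ⟨q, hq, hqM.trans_eq (by norm_num), a, ha.trans_eq (by norm_num)⟩
  have h0 : ∀ w, 0 ≤ ‖expS (S ×ˢ A) (fun z => colMap k n cls w (z.1 * z.2)) α‖ / (#S * #A) :=
    fun w => by positivity
  by_contra! hcon
  have hv := hlarge v (hcon.le.trans (mul_le_of_le_one_right (h0 _) (hle1 v')))
  have hv' := hlarge v' (hcon.le.trans (mul_le_of_le_one_left (h0 _) (hle1 v)))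
  refine hα ?_
  obtain ⟨q, hq, hqQ, b, hb, hαb⟩ := exists_reducedFrac_of_approx (α := α)
    (e := fun i => 2 * C₀ * (M : ℝ) ^ (0.2 - 4 * pairDeg k n (cls i) : ℝ)) (Q := C₀ * (M : ℝ) ^ (0.3 : ℝ))
    (by positivity) fun i => by
    obtain ⟨m, u, u', hm, hmC, hu, hu', hh⟩ := hvv i
    have hpair := comb_pair hh α
    obtain ⟨q, hq, hqM, a, ha⟩ := hv (cls i)
    obtain ⟨q', hq', hqM', a', ha'⟩ := hv' (cls i)
    set x := comb cls (cls i) α v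
    set x' := comb cls (cls i) α v'
    have hm0 : (m : ℝ) ≠ 0 := by exact_mod_cast hm
    have hm1 : (1 : ℝ) ≤ |(m : ℝ)| := by exact_mod_cast Int.one_le_abs hm
    have hq0 : (q : ℝ) ≠ 0 := by exact_mod_cast hq.ne'
    have hq0' : (q' : ℝ) ≠ 0 := by exact_mod_cast hq'.ne'
    have hMM : (M : ℝ) ^ (0.15 : ℝ) * (M : ℝ) ^ (0.15 : ℝ) = (M : ℝ) ^ (0.3 : ℝ) := by
      rw [← Real.rpow_add hM0]; norm_num
    refine ⟨m.natAbs * (q * q'), Nat.mul_pos (Int.natAbs_pos.2 hm) (Nat.mul_pos hq hq'), ?_,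
      m.sign * (u * a * q' + u' * a' * q), ?_⟩
    · push_cast [Nat.cast_natAbs]
      rw [← hMM]
      gcongr
    · have e1 : (((m.sign * (u * a * q' + u' * a' * q) : ℤ)) : ℝ) / ((m.natAbs * (q * q') : ℕ) : ℝ) =
          (u * (a / q) + u' * (a' / q')) / m := by
        have hs : (m : ℝ) = m.sign * |(m : ℝ)| := by exact_mod_cast (Int.sign_mul_abs m).symm
        have hs2 : (m.sign : ℝ) * m.sign = 1 := by
          rcases lt_or_gt_of_ne hm with h | h
          · rw [Int.sign_eq_neg_one_of_neg h]; norm_num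
          · rw [Int.sign_eq_one_of_pos h]; norm_num
        have hab : |(m : ℝ)| = m.sign * m := by
          conv_rhs => rw [hs]
          rw [← mul_assoc, hs2, one_mul]
        push_cast [Nat.cast_natAbs]
        rw [hab]
        have hs0 : (m.sign : ℝ) ≠ 0 := fun h => by simp [h] at hs2
        field_simp
      have e2 : α i - (u * (a / q) + u' * (a' / q')) / m = (u * (x - a / q) + u' * (x' - a' / q')) / m := by
        rw [eq_div_iff hm0, sub_mul, div_mul_cancel₀ _ hm0, mul_comm (α i), ← hpair]; ring
      rw [e1, e2, abs_div]
      refine (div_le_self (abs_nonneg _) hm1).trans ((abs_add_le _ _).trans ?_)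
      rw [abs_mul, abs_mul]
      calc _ ≤ C₀ * (M : ℝ) ^ (0.2 - 4 * pairDeg k n (cls i) : ℝ) +
            C₀ * (M : ℝ) ^ (0.2 - 4 * pairDeg k n (cls i) : ℝ) := by gcongr
        _ = _ := by ring
  refine ⟨q, hq, b, hb, ?_⟩
  have hM2 : (1 : ℝ) ≤ (M : ℝ) ^ (0.2 : ℝ) := Real.one_le_rpow hM1' (by norm_num)
  have hΛ : arcDist k n cls P α q b ≤ C₂ * (M : ℝ) ^ (0.2 : ℝ) := by
    have hi : ∀ i ∈ univ, |α i - b i / q| * P ^ pairDeg k n (cls i) ≤ 2 * C₀ * C₁ ^ k * (M : ℝ) ^ (0.2 : ℝ) :=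
      fun i _ => by
      have hdk : pairDeg k n (cls i) ≤ k := by cases h : cls i <;> simp [pairDeg, hnk.le]
      calc _ ≤ (2 * C₀ * (M : ℝ) ^ (0.2 - 4 * pairDeg k n (cls i) : ℝ)) *
            (C₁ * M ^ 4) ^ pairDeg k n (cls i) := by
            gcongr
            exact hαb i
        _ = 2 * C₀ * C₁ ^ pairDeg k n (cls i) * ((M : ℝ) ^ (0.2 - 4 * pairDeg k n (cls i) : ℝ) *
            (M : ℝ) ^ ((4 * pairDeg k n (cls i) : ℕ) : ℝ)) := by
            rw [Real.rpow_natCast, mul_pow, ← pow_mul]; ring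
        _ = 2 * C₀ * C₁ ^ pairDeg k n (cls i) * (M : ℝ) ^ (0.2 : ℝ) := by
            rw [← Real.rpow_add hM0]; push_cast; ring_nf
        _ ≤ _ := by gcongr
    refine (sum_le_sum hi).trans ?_
    rw [sum_const, card_univ, nsmul_eq_mul, hC₂]
    have : (Fintype.card ι : ℝ) ≤ 4 := by exact_mod_cast hι
    calc _ ≤ 4 * (2 * C₀ * C₁ ^ k * (M : ℝ) ^ (0.2 : ℝ)) := by gcongr
      _ = _ := by ring
  have hq4 : (q : ℝ) ≤ C₀ ^ 4 * (M : ℝ) ^ (1.2 : ℝ) := by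
    have h1 : 1 ≤ C₀ * (M : ℝ) ^ (0.3 : ℝ) := by
      have : (1 : ℝ) ≤ (M : ℝ) ^ (0.3 : ℝ) := Real.one_le_rpow hM1' (by norm_num)
      nlinarith
    refine hqQ.trans ((pow_le_pow_right₀ h1 hι).trans_eq ?_)
    rw [mul_pow, ← Real.rpow_natCast ((M : ℝ) ^ (0.3 : ℝ)), ← Real.rpow_mul hM0.le]; norm_num
  have hqΛ : q * (1 + C₀ * arcDist k n cls P α q b) ≤ C₃ * (M : ℝ) ^ (1.4 : ℝ) := by
    calc q * (1 + C₀ * arcDist k n cls P α q b) ≤ (C₀ ^ 4 * (M : ℝ) ^ (1.2 : ℝ)) *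
          (C₀ * C₂ * (M : ℝ) ^ (0.2 : ℝ) + C₀ * (C₂ * (M : ℝ) ^ (0.2 : ℝ))) := by
          gcongr
          · exact add_nonneg zero_le_one (mul_nonneg (by linarith) (arcDist_nonneg (by linarith) α q b))
          · nlinarith [mul_le_mul hC₀ (mul_le_mul hC₂1 hM2 zero_le_one (by linarith)) (by norm_num) (by linarith)]
      _ = C₃ * ((M : ℝ) ^ (1.2 : ℝ) * (M : ℝ) ^ (0.2 : ℝ)) := by rw [hC₃]; ring
      _ = _ := by rw [← Real.rpow_add hM0]; norm_num
  have hfin : (q * (1 + C₀ * arcDist k n cls P α q b)) ^ 2 ≤ C₃ ^ 2 * (M : ℝ) ^ (2.8 : ℝ) := by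
    refine (pow_le_pow_left₀ (mul_nonneg (by positivity) (add_nonneg zero_le_one (mul_nonneg (by linarith)
      (arcDist_nonneg (by linarith) α q b)))) hqΛ 2).trans_eq ?_
    rw [mul_pow, ← Real.rpow_natCast ((M : ℝ) ^ (1.4 : ℝ)), ← Real.rpow_mul hM0.le]; norm_num
  refine hfin.trans ?_
  have h5 : C₁ * (C₃ ^ 2 * (M : ℝ) ^ (2.8 : ℝ)) ≤ C₁ * P := by
    refine le_trans ?_ (le_trans hMC ?_)
    · rw [mul_assoc]
    · exact_mod_cast hMP
  exact le_of_mul_le_mul_left h5 (by linarith)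

lemma prod_le_sum_pow {J : Type*} [Fintype J] [Nonempty J] {x : J → ℝ} (hx : ∀ j, 0 ≤ x j) :
    ∏ j, x j ≤ ∑ j, x j ^ Fintype.card J := by
  obtain ⟨j₀, -, h⟩ := exists_max_image univ x univ_nonempty
  refine (prod_le_prod (fun j _ => hx j) fun j hj => h j hj).trans ?_
  rw [prod_const]
  exact single_le_sum (f := fun j => x j ^ Fintype.card J) (fun j _ => pow_nonneg (hx j) _) (mem_univ j₀)

lemma eventually_expect_mean_le {ι₂ : Type*} [Fintype ι₂] [DecidableEq ι₂] {k n : ℕ} {cls : ι → Bool}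
    {v v' : ι → ℤ} (hv : ∀ i, v i ≠ 0) (hcls : Function.Surjective cls) {e : ι₂ → Bool}
    (he : ∀ x, ∀ X Y : ℤ, (∀ i, cls i = e x → v i * X + v' i * Y = 0) → Y = 0) (t t' : ℕ) (A A' : Finset ℕ) :
    ∀ᶠ N : ℕ in atTop, 𝔼 α ∈ grid ι N, ‖expS A (colMap k n cls v) α‖ ^ (2 * t) *
      ‖expS A' (colMap k n cls v') α‖ ^ (2 * t') ≤
      mv t A (mono (pairDeg k n)) * mv t' A' (mono fun x => pairDeg k n (e x)) := by
  classical
  set R := Fintype.piFinset fun _ : Fin t => A ×ˢ A with hR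
  set R' := Fintype.piFinset fun _ : Fin t' => A' ×ˢ A' with hR'
  have hcol : ∀ (s : ℕ) (w : ι → ℤ) (z : Fin s → ℕ × ℕ) (i : ι),
      (∑ x, (colMap k n cls w (z x).1 - colMap k n cls w (z x).2)) i =
      w i * (∑ x, (mono (pairDeg k n) (z x).1 - mono (pairDeg k n) (z x).2)) (cls i) := fun s w z i => by
    simp only [Finset.sum_apply, Pi.sub_apply, colMap, mono, mul_sum, mul_sub]
  filter_upwards [eventually_expect_eq_card (F := fun α => ‖expS A (colMap k n cls v) α‖ ^ (2 * t) *
      ‖expS A' (colMap k n cls v') α‖ ^ (2 * t')) (R := R ×ˢ R') (ψ := fun z =>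
    ∑ i, (colMap k n cls v (z.1 i).1 - colMap k n cls v (z.1 i).2) +
    ∑ i, (colMap k n cls v' (z.2 i).1 - colMap k n cls v' (z.2 i).2)) fun α => by
      push_cast
      rw [← Complex.ofReal_pow, ← Complex.ofReal_pow, norm_pow_expS, norm_pow_expS, expS_mul]] with N hN
  rw [hN]
  set T := R'.filter fun z₂ => ∑ i, (mono (fun x => pairDeg k n (e x)) (z₂ i).1 -
    mono (fun x => pairDeg k n (e x)) (z₂ i).2) = 0 with hT
  have hTc : #T = mv t' A' (mono fun x => pairDeg k n (e x)) := by
    rw [mv, hT]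
  rw [← hTc, mul_comm]
  refine le_of_le_of_eq (Nat.cast_le.2 (card_le_mul_card_image_of_maps_to (f := Prod.snd) (t := T) ?_
    (mv t A (mono (pairDeg k n))) ?_)) (by push_cast; ring)
  · intro z hz
    obtain ⟨hz, hz0⟩ := mem_filter.1 hz
    refine mem_filter.2 ⟨(mem_product.1 hz).2, funext fun x => ?_⟩
    refine Eq.trans ?_ (he x ((∑ i, (mono (pairDeg k n) (z.1 i).1 - mono (pairDeg k n) (z.1 i).2)) (e x))
      ((∑ i, (mono (pairDeg k n) (z.2 i).1 - mono (pairDeg k n) (z.2 i).2)) (e x)) fun i hi => ?_)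
    · simp only [Finset.sum_apply, Pi.sub_apply, mono]
    · have := congrFun hz0 i
      rw [Pi.add_apply, hcol, hcol, hi] at this
      exact this
  · intro z₂ _
    refine Finset.eq_empty_or_nonempty _ |>.elim (fun h0 => (card_eq_zero.2 h0).le.trans (Nat.zero_le _)) ?_
    · rintro ⟨z₀, hz₀⟩
      refine le_trans ?_ (card_shift_le t A (mono (pairDeg k n))
        (∑ i, (mono (pairDeg k n) (z₀.1 i).1 - mono (pairDeg k n) (z₀.1 i).2)))
      simp only [mem_filter, mem_product] at hz₀
      refine card_le_card_of_injOn Prod.fst (fun z hz => ?_) fun z hz z' hz' h => ?_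
      · simp only [coe_filter, mem_filter, mem_product, Set.mem_ofPred_eq] at hz ⊢
        refine ⟨hz.1.1.1, funext fun b => ?_⟩
        obtain ⟨i, rfl⟩ := hcls b
        have h1 := congrFun hz.1.2 i
        have h2 := congrFun hz₀.1.2 i
        rw [Pi.add_apply, hcol, hcol] at h1 h2
        rw [hz.2] at h1
        rw [hz₀.2] at h2
        exact mul_left_cancel₀ (hv i) (add_right_cancel (h1.trans h2.symm))
      · simp only [coe_filter, mem_filter, Set.mem_ofPred_eq] at hz hz'
        exact Prod.ext h (hz.2.trans hz'.2.symm)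

open scoped Topology

/-- The values at `x` of the additive forms with coefficients `a j i` and degrees `d i`. -/
def sysVal {R : Type*} [CommRing R] {ι J : Type*} [Fintype J] (d : ι → ℕ) (a : J → ι → ℤ) (x : J → R) (i : ι) : R :=
  ∑ j, (a j i : R) * x j ^ d i

/-- The square part of the Jacobian matrix belonging to columns with coefficients `a` at `w`. -/
def colJac {R : Type*} [CommRing R] {ι : Type*} (d : ι → ℕ) (a : ι → ι → ℤ) (w : ι → R) : Matrix ι ι R :=
  Matrix.of fun i i' => (d i : R) * a i' i * w i' ^ (d i - 1)

/-- Any `card ι` columns are independent on each degree class. -/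
def BlockIndep {ι J : Type} [Fintype ι] (cls : ι → Bool) (a : J → ι → ℤ) : Prop :=
  ∀ (K : Type) [Field K] [CharZero K] (e : ι → J), Function.Injective e → ∀ w : ι → K, ∀ b,
    (∀ i, cls i = b → ∑ i' with cls i' = b, (a (e i') i : K) * w i' = 0) → ∀ i, cls i = b → w i = 0

section
variable {K : Type} [NontriviallyNormedField K]
variable {ι J : Type} [Fintype ι] [DecidableEq ι] [Fintype J] [DecidableEq J]

lemma hasStrictFDerivAt_sysVal (d : ι → ℕ) (a : J → ι → ℤ) (x : J → K) (i : ι) :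
    HasStrictFDerivAt (fun y : J → K => sysVal d a y i)
      (∑ j, ((a j i : K) * (d i * x j ^ (d i - 1))) • ContinuousLinearMap.proj (R := K) (φ := fun _ : J => K) j) x := by
  refine HasStrictFDerivAt.fun_sum fun j _ => ?_
  have h := ((hasStrictFDerivAt_apply (𝕜 := K) (F' := fun _ : J => K) j x).pow (d i)).const_mul (a j i : K)
  refine h.congr_fderiv ?_
  ext y
  simp [mul_assoc]

lemma eventually_exists_zero [CompleteSpace K] {d : ι → ℕ} {a : J → ι → ℤ} {ξ : J → K}
    (hξ : ∀ i, sysVal d a ξ i = 0) {e : ι → J} (he : Function.Injective e)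
    (hdet : (colJac d (a ∘ e) (ξ ∘ e)).det ≠ 0) {U : Set (J → K)} (hU : U ∈ 𝓝 ξ) :
    ∀ᶠ y in 𝓝 ξ, ∃ z ∈ U, (∀ j ∉ Set.range e, z j = y j) ∧ ∀ i, sysVal d a z i = 0 := by
  set Ψ : (J → K) → J → K := fun x => Function.extend e (sysVal d a x) x with hΨ
  have hcase : ∀ j, (∃ i, e i = j) ∨ j ∉ Set.range e := fun j => em _
  set D : J → (J → K) →L[K] K := fun j => if h : ∃ i, e i = j then
    (∑ j', ((a j' h.choose : K) * (d h.choose * ξ j' ^ (d h.choose - 1))) •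
      ContinuousLinearMap.proj (R := K) (φ := fun _ : J => K) j') else ContinuousLinearMap.proj j with hD
  have hDe : ∀ i, D (e i) = ∑ j', ((a j' i : K) * (d i * ξ j' ^ (d i - 1))) •
      ContinuousLinearMap.proj (R := K) (φ := fun _ : J => K) j' := fun i => by
    have h : ∃ i', e i' = e i := ⟨i, rfl⟩
    have hc : h.choose = i := he h.choose_spec
    simp only [hD, dif_pos h]
    rw [hc]
  have hDn : ∀ j ∉ Set.range e, D j = ContinuousLinearMap.proj j := fun j hj => by
    simp only [hD]; exact dif_neg hj
  have hd : HasStrictFDerivAt Ψ (ContinuousLinearMap.pi D) ξ := by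
    refine hasStrictFDerivAt_pi.2 fun j => ?_
    rcases hcase j with ⟨i, rfl⟩ | hj
    · simp only [hΨ, he.extend_apply, hDe]
      exact hasStrictFDerivAt_sysVal d a ξ i
    · simp only [hΨ, Function.extend_apply' _ _ _ hj, hDn j hj]
      exact hasStrictFDerivAt_apply j ξ
  have hinj : Function.Injective (ContinuousLinearMap.pi D : (J → K) →L[K] J → K) := by
    refine (injective_iff_map_eq_zero _).2 fun h hh => ?_
    have hoff : ∀ j ∉ Set.range e, h j = 0 := fun j hj => by
      have : D j h = 0 := congrFun hh j
      rwa [hDn j hj] at this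
    have hw : (colJac d (a ∘ e) (ξ ∘ e)).mulVec (h ∘ e) = 0 := by
      ext i
      have : D (e i) h = 0 := congrFun hh (e i)
      rw [hDe] at this
      simp only [ContinuousLinearMap.sum_apply, ContinuousLinearMap.smul_apply, ContinuousLinearMap.proj_apply,
        smul_eq_mul, Pi.zero_apply] at this
      refine Eq.trans ?_ this
      rw [Matrix.mulVec, dotProduct]
      refine Fintype.sum_of_injective e he _ _ (fun j hj => by rw [hoff j hj, mul_zero]) fun i' => ?_
      simp only [colJac, Matrix.of_apply, Function.comp_apply]
      ring
    have hz := Matrix.eq_zero_of_mulVec_eq_zero hdet hw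
    funext j
    rcases hcase j with ⟨i, rfl⟩ | hj
    · exact congrFun hz i
    · exact hoff j hj
  have hmap := hd.map_nhds_eq_of_surj (LinearMap.range_eq_top.2 (LinearMap.injective_iff_surjective.1 hinj))
  have hcont : Tendsto (fun y : J → K => Function.extend e 0 y) (𝓝 ξ) (𝓝 (Ψ ξ)) := by
    refine tendsto_pi_nhds.2 fun j => ?_
    rcases hcase j with ⟨i, rfl⟩ | hj
    · simp only [hΨ, he.extend_apply, hξ]
      exact tendsto_const_nhds
    · simp only [hΨ, Function.extend_apply' _ _ _ hj]
      exact (continuous_apply j).tendsto ξ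
  have hmem : Ψ '' U ∈ 𝓝 (Ψ ξ) := hmap ▸ image_mem_map hU
  filter_upwards [hcont hmem] with y hy
  obtain ⟨z, hz, hzy⟩ := hy
  refine ⟨z, hz, fun j hj => ?_, fun i => ?_⟩
  · simpa only [hΨ, Function.extend_apply' _ _ _ hj] using congrFun hzy j
  · simpa only [hΨ, he.extend_apply, Pi.zero_apply] using congrFun hzy (e i)

lemma exists_colJac_ne_zero [CharZero K] {k n : ℕ} (hn : 0 < n) (hnk : n < k) {cls : ι → Bool} {a : J → ι → ℤ}
    (ha : BlockIndep cls a) {e : ι → J} (he : Function.Injective e) :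
    ∃ w : ι → K, (colJac (fun i => pairDeg k n (cls i)) (a ∘ e) w).det ≠ 0 := by
  set B : K → Matrix ι ι K := fun T => Matrix.of fun i i' =>
    (pairDeg k n (cls i) : K) * a (e i') i * (bif cls i' then 1 else bif cls i then T ^ (k - n) else 1) with hB
  have hB0 : (B 0).det ≠ 0 := fun h0 => by
    obtain ⟨w, hw, hBw⟩ := Matrix.exists_mulVec_eq_zero_iff.2 h0
    have hd : ∀ i, (pairDeg k n (cls i) : K) ≠ 0 := fun i => by
      cases h : cls i <;> simp [pairDeg] <;> lia
    have hrow : ∀ i, ∑ i', (a (e i') i : K) * (bif cls i' then 1 else bif cls i then (0 : K) ^ (k - n) else 1) *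
        w i' = 0 := fun i => by
      refine (mul_eq_zero.1 (Eq.trans ?_ (congrFun hBw i))).resolve_left (hd i)
      rw [Matrix.mulVec, dotProduct, mul_sum]
      exact sum_congr rfl fun i' _ => by simp only [hB, Matrix.of_apply]; ring
    have h1 : ∀ i, cls i = true → w i = 0 := ha K e he w true fun i hi => by
      rw [← hrow i, sum_filter]
      refine sum_congr rfl fun i' _ => ?_
      cases h : cls i' <;> simp [hi, Nat.sub_ne_zero_of_lt hnk]
    have h2 : ∀ i, cls i = false → w i = 0 := ha K e he w false fun i hi => by
      rw [← hrow i, sum_filter]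
      refine sum_congr rfl fun i' _ => ?_
      cases h : cls i'
      · simp [hi]
      · simp [h1 i' h]
    exact hw (funext fun i => by cases h : cls i; exacts [h2 i h, h1 i h])
  have hcont : Continuous fun T => (B T).det := by
    refine Continuous.matrix_det (continuous_matrix fun i i' => ?_)
    simp only [hB, Matrix.of_apply]
    cases cls i' <;> cases cls i <;> simp <;> fun_prop
  obtain ⟨T, hT, hT0⟩ := (((hcont.tendsto 0).eventually_ne hB0).filter_mono nhdsWithin_le_nhds |>.and
    (self_mem_nhdsWithin (s := {(0 : K)}ᶜ))).exists
  refine ⟨fun i' => bif cls i' then 1 else T, ?_⟩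
  have hfac : colJac (fun i => pairDeg k n (cls i)) (a ∘ e) (fun i' => bif cls i' then 1 else T) =
      Matrix.of fun i i' => (fun i' => bif cls i' then (1 : K) else T ^ (n - 1)) i' * B T i i' := by
    ext i i'
    have hkn : T ^ (k - 1) = T ^ (n - 1) * T ^ (k - n) := by rw [← pow_add]; congr 1; lia
    cases h' : cls i' <;> cases h : cls i <;> simp [colJac, hB, h, h', pairDeg, hkn] <;> ring
  rw [hfac, Matrix.det_mul_row]
  refine mul_ne_zero (prod_ne_zero_iff.2 fun i _ => ?_) hT
  cases cls i
  · exact pow_ne_zero _ hT0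
  · exact one_ne_zero

lemma exists_near_colJac_ne_zero [CharZero K] {d : ι → ℕ} {a : ι → ι → ℤ} {w₀ : ι → K}
    (hw₀ : (colJac d a w₀).det ≠ 0) {V : ι → Set K} {x : ι → K} (hV : ∀ i, V i ∈ 𝓝 (x i)) :
    ∃ w, (∀ i, w i ∈ V i) ∧ (colJac d a w).det ≠ 0 := by
  by_contra! hcon
  set p : MvPolynomial ι K := (Matrix.of fun i i' => MvPolynomial.C ((d i : K) * a i' i) *
    MvPolynomial.X i' ^ (d i - 1)).det with hp
  have heval : ∀ w, MvPolynomial.eval w p = (colJac d a w).det := fun w => by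
    rw [hp, RingHom.map_det]
    congr 1
    ext i i'
    simp [colJac]
  refine hw₀ ?_
  rw [← heval, MvPolynomial.funext_set (p := p) (q := 0) V (fun i => infinite_of_mem_nhds _ (hV i))
    (fun w hw => by rw [heval, hcon w fun i => hw i trivial, map_zero]), map_zero]

lemma exists_colJac_of_rank {d : ι → ℕ} {a : J → ι → ℤ} {ξ : J → K}
    (h : (Matrix.of fun i j => (d i : K) * a j i * ξ j ^ (d i - 1)).rank = Fintype.card ι) :
    ∃ e : ι → J, Function.Injective e ∧ (colJac d (a ∘ e) (ξ ∘ e)).det ≠ 0 := by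
  set A : Matrix ι J K := Matrix.of fun i j => (d i : K) * a j i * ξ j ^ (d i - 1) with hA
  rw [Matrix.rank_eq_finrank_span_cols] at h
  obtain ⟨f, hf, -, hli⟩ := Submodule.exists_fun_fin_finrank_span_eq K (Set.range A.col)
  choose g hg using hf
  set σ : ι ≃ Fin (Module.finrank K (Submodule.span K (Set.range A.col))) := (Fintype.equivFin ι).trans (finCongr h.symm)
  have hli' : LinearIndependent K (fun i => A.col (g (σ i))) := by
    simp only [hg]
    exact hli.comp σ σ.injective
  refine ⟨fun i => g (σ i), fun i i' hii => hli'.injective (by simp only [hii]), fun h0 => ?_⟩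
  obtain ⟨w, hw, hAw⟩ := Matrix.exists_mulVec_eq_zero_iff.2 h0
  refine hw (funext (Fintype.linearIndependent_iff.1 hli' w ?_))
  rw [← hAw]
  ext i
  simp [Matrix.mulVec, dotProduct, colJac, hA, mul_comm]

end

section
variable {K : Type} [NontriviallyNormedField K] [CompleteSpace K] [CharZero K]
variable {ι F G : Type} [Fintype ι] [DecidableEq ι] [Fintype F] [DecidableEq F] [Fintype G] [DecidableEq G]

lemma exists_zero_of_rank {k n : ℕ} (hn : 0 < n) (hnk : n < k) {cls : ι → Bool} {a : F ⊕ G → ι → ℤ}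
    (ha : BlockIndep cls a) (hF : 2 * Fintype.card ι ≤ Fintype.card F) {ξ : F ⊕ G → K}
    (hξ : ∀ i, sysVal (fun i => pairDeg k n (cls i)) a ξ i = 0)
    (hrank : (Matrix.of fun i j => (pairDeg k n (cls i) : K) * a j i * ξ j ^ (pairDeg k n (cls i) - 1)).rank =
      Fintype.card ι) {U : Set (F ⊕ G → K)} (hU : U ∈ 𝓝 ξ) :
    ∃ z ∈ U, (∀ i, sysVal (fun i => pairDeg k n (cls i)) a z i = 0) ∧ ∃ e : ι → F, Function.Injective e ∧
      (colJac (fun i => pairDeg k n (cls i)) (fun i => a (.inl (e i))) (fun i => z (.inl (e i)))).det ≠ 0 := by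
  obtain ⟨e₀, he₀, hdet⟩ := exists_colJac_of_rank hrank
  set X : Finset F := univ.filter fun f => ∀ i, e₀ i ≠ Sum.inl f with hX
  have hXc : Fintype.card ι ≤ #X := by
    have h1 : #(univ.filter fun f : F => ¬ ∀ i, e₀ i ≠ Sum.inl f) ≤ Fintype.card ι := by
      refine card_le_card_of_surjOn (s := univ) (fun i => (e₀ i).elim id fun _ => ((e₀ i).getLeft?.getD
        (Classical.choice (Fintype.card_pos_iff.1 (by
          have : 0 < Fintype.card ι := Fintype.card_pos_iff.2 ⟨i⟩
          lia))))) fun f hf => ?_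
      simp only [coe_filter, Set.mem_ofPred_eq, mem_univ, true_and, not_forall, not_not] at hf
      obtain ⟨i, hi⟩ := hf
      exact ⟨i, by simp, by simp [hi]⟩
    have h2 := card_filter_add_card_filter_not (s := (univ : Finset F)) (fun f => ∀ i, e₀ i ≠ Sum.inl f)
    rw [card_univ] at h2
    lia
  obtain ⟨g⟩ : Nonempty (ι ↪ X) := Function.Embedding.nonempty_of_card_le (by simpa using hXc)
  set e : ι → F := fun i => g i with he
  have heinj : Function.Injective e := fun i i' h => g.injective (Subtype.ext h)
  have hnot : ∀ i, (Sum.inl (e i) : F ⊕ G) ∉ Set.range e₀ := fun i ⟨i', hi'⟩ => (mem_filter.1 (g i).2).2 i' hi'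
  have heinj' : Function.Injective fun i => (Sum.inl (e i) : F ⊕ G) := fun i i' h => heinj (Sum.inl_injective h)
  obtain ⟨w₀, hw₀⟩ := exists_colJac_ne_zero (K := K) hn hnk ha heinj'
  have hev := eventually_exists_zero hξ he₀ hdet hU
  rw [nhds_pi, Filter.eventually_iff, Filter.mem_pi'] at hev
  obtain ⟨I, V, hV, hsub⟩ := hev
  obtain ⟨w, hwV, hw⟩ := exists_near_colJac_ne_zero hw₀ (V := fun i => V (.inl (e i)))
    (x := fun i => ξ (.inl (e i))) fun i => hV _
  set y : F ⊕ G → K := Function.extend (fun i => (Sum.inl (e i) : F ⊕ G)) w ξ with hy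
  have hye : ∀ i, y (.inl (e i)) = w i := fun i => heinj'.extend_apply w ξ i
  obtain ⟨z, hzU, hz, hz0⟩ := hsub (show y ∈ _ from fun j _ => by
    by_cases hj : ∃ i, (Sum.inl (e i) : F ⊕ G) = j
    · obtain ⟨i, rfl⟩ := hj
      rw [hye]; exact hwV i
    · rw [hy, Function.extend_apply' _ _ _ hj]
      exact mem_of_mem_nhds (hV j))
  refine ⟨z, hzU, hz0, e, heinj, ?_⟩
  have : (fun i => z (.inl (e i))) = w := funext fun i => by rw [hz _ (hnot i), hye]
  rw [this]
  exact hw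

end

section
variable {ι F G : Type} [Fintype ι] [DecidableEq ι] [Fintype F] [DecidableEq F] [Fintype G] [DecidableEq G]

lemma map_sysVal {R S J : Type*} [CommRing R] [CommRing S] [Fintype J] (φ : R →+* S) (d : ι → ℕ) (a : J → ι → ℤ)
    (x : J → R) (i : ι) : φ (sysVal d a x i) = sysVal d a (fun j => φ (x j)) i := by
  simp [sysVal]

lemma sysVal_mul {R J : Type*} [CommRing R] [Fintype J] (d : ι → ℕ) (a : J → ι → ℤ) (u : R) (x : J → R) (i : ι) :
    sysVal d a (fun j => u * x j) i = u ^ d i * sysVal d a x i := by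
  rw [sysVal, sysVal, mul_sum]
  exact sum_congr rfl fun j _ => by rw [mul_pow]; ring

lemma det_colJac_mul {R : Type*} [CommRing R] (d : ι → ℕ) (a : ι → ι → ℤ) (u : R) (w : ι → R) :
    (colJac d a fun i => u * w i).det = (∏ i, u ^ (d i - 1)) * (colJac d a w).det := by
  rw [← Matrix.det_mul_column]
  congr 1
  ext i i'
  simp only [colJac, Matrix.of_apply, mul_pow]
  ring

/-- The number of solutions modulo `N` in the variables indexed by `F`, those indexed by `G` being `y`. -/
noncomputable def zcount (d : ι → ℕ) (a : F ⊕ G → ι → ℤ) (N : ℕ) (y : G → ℕ) : ℕ :=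
  Nat.card {x : F → ZMod N // ∀ i, sysVal d a (Sum.elim x fun g => (y g : ZMod N)) i = 0}

lemma zcount_mul_le {M N : ℕ} (hM : 0 < M) (hN : 0 < N) (h : M.Coprime N) (d : ι → ℕ) (a : F ⊕ G → ι → ℤ)
    (y : G → ℕ) : zcount d a M y * zcount d a N y ≤ zcount d a (M * N) y := by
  have : NeZero (M * N) := ⟨(Nat.mul_pos hM hN).ne'⟩
  rw [zcount, zcount, zcount, ← Nat.card_prod]
  set φ := (ZMod.chineseRemainder h).symm
  refine Nat.card_le_card_of_injective (fun x => ⟨fun f => φ (x.1.1 f, x.2.1 f), fun i => ?_⟩) fun x x' hxx => ?_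
  · have h1 := map_sysVal φ.toRingHom d a (Sum.elim (fun f => (x.1.1 f, x.2.1 f)) fun g => (y g : ZMod M × ZMod N)) i
    have h2 : sysVal d a (Sum.elim (fun f => (x.1.1 f, x.2.1 f)) fun g => (y g : ZMod M × ZMod N)) i = 0 := by
      refine Prod.ext ?_ ?_
      · refine (map_sysVal (R := ZMod M × ZMod N) (RingHom.fst (ZMod M) (ZMod N)) d a _ i).trans ((congrArg (fun v => sysVal d a v i) ?_).trans (x.1.2 i))
        funext j; cases j <;> simp
      · refine (map_sysVal (R := ZMod M × ZMod N) (RingHom.snd (ZMod M) (ZMod N)) d a _ i).trans ((congrArg (fun v => sysVal d a v i) ?_).trans (x.2.2 i))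
        funext j; cases j <;> simp
    rw [h2, map_zero] at h1
    rw [h1]
    refine congrArg (fun v => sysVal d a v i) ?_
    funext j; cases j <;> simp
  · have h1 : ∀ f, (x.1.1 f, x.2.1 f) = (x'.1.1 f, x'.2.1 f) := fun f =>
      φ.injective (congrFun (congrArg Subtype.val hxx) f)
    refine Prod.ext (Subtype.ext (funext fun f => (Prod.ext_iff.1 (h1 f)).1))
      (Subtype.ext (funext fun f => (Prod.ext_iff.1 (h1 f)).2))

lemma exists_zcount_pow_ge (p : ℕ) [Fact p.Prime] {k n : ℕ} (hn : 0 < n) (hnk : n < k) {cls : ι → Bool}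
    {a : F ⊕ G → ι → ℤ} (ha : BlockIndep cls a) (hF : 2 * Fintype.card ι ≤ Fintype.card F) {ξ : F ⊕ G → ℚ_[p]}
    (hξ : ∀ i, sysVal (fun i => pairDeg k n (cls i)) a ξ i = 0)
    (hrank : (Matrix.of fun i j => (pairDeg k n (cls i) : ℚ_[p]) * a j i * ξ j ^ (pairDeg k n (cls i) - 1)).rank =
      Fintype.card ι) :
    ∃ L : ℕ, ∃ ρ : G → ℕ, ∃ c : ℝ, 0 < c ∧ ∀ y : G → ℕ, (∀ g, y g ≡ ρ g [MOD p ^ L]) → ∀ l : ℕ,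
      c * ((p : ℝ) ^ l) ^ Fintype.card F ≤
        zcount (fun i => pairDeg k n (cls i)) a (p ^ l) y * ((p : ℝ) ^ l) ^ Fintype.card ι := by
  set d := fun i => pairDeg k n (cls i) with hd
  have hp := (Fact.out : p.Prime)
  obtain ⟨z₀, -, hz₀, e, he, hdet⟩ := exists_zero_of_rank hn hnk ha hF hξ hrank univ_mem
  have hp1 : ‖(p : ℚ_[p])‖ < 1 := Padic.norm_p_lt_one
  obtain ⟨m, hm⟩ : ∃ m : ℕ, ∀ j, ‖(p : ℚ_[p]) ^ m * z₀ j‖ < 1 := by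
    refine (eventually_all.2 fun j => ?_).exists (f := atTop)
    have := ((tendsto_pow_atTop_nhds_zero_of_norm_lt_one hp1).mul_const (z₀ j)).norm
    rw [zero_mul, norm_zero] at this
    exact this.eventually_lt_const one_pos
  set z : F ⊕ G → ℚ_[p] := fun j => (p : ℚ_[p]) ^ m * z₀ j with hz
  have hp0 : (p : ℚ_[p]) ≠ 0 := by exact_mod_cast hp.ne_zero
  have hzz : ∀ i, sysVal d a z i = 0 := fun i => by rw [hz, sysVal_mul, hz₀, mul_zero]
  have hdz : (colJac d (a ∘ fun i => .inl (e i)) (z ∘ fun i => .inl (e i))).det ≠ 0 := by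
    refine ne_of_eq_of_ne (det_colJac_mul d _ _ fun i => z₀ (.inl (e i))) (mul_ne_zero
      (prod_ne_zero_iff.2 fun i _ => pow_ne_zero _ (pow_ne_zero _ hp0)) hdet)
  obtain ⟨δ, hδ, hball⟩ := Metric.eventually_nhds_iff.1 (eventually_exists_zero hzz
    (fun i i' h => he (Sum.inl_injective h)) hdz (Metric.ball_mem_nhds z one_pos))
  obtain ⟨L, hL⟩ := exists_pow_lt_of_lt_one hδ hp1
  set ρ : F ⊕ G → ℕ := fun j => PadicInt.appr ⟨z j, (hm j).le⟩ L with hρ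
  have hnear : ∀ j, ∀ N : ℕ, N ≡ ρ j [MOD p ^ L] → dist (N : ℚ_[p]) (z j) < δ := fun j N hN => by
    rw [dist_comm, dist_eq_norm]
    refine lt_of_le_of_lt ?_ hL
    have h1 : (show ℤ_[p] from ⟨z j, (hm j).le⟩) - N ∈ Ideal.span {(p : ℤ_[p]) ^ L} := by
      have h2 := PadicInt.appr_spec L (show ℤ_[p] from ⟨z j, (hm j).le⟩)
      obtain ⟨c, hc⟩ := Nat.modEq_iff_dvd.1 hN
      have h3 : ((ρ j : ℤ_[p]) - N) ∈ Ideal.span {(p : ℤ_[p]) ^ L} :=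
        Ideal.mem_span_singleton.2 ⟨c, by exact_mod_cast congrArg (Int.cast (R := ℤ_[p])) hc⟩
      have h5 := add_mem h2 h3
      rwa [sub_add_sub_cancel] at h5
    have h4 := (PadicInt.norm_le_pow_iff_mem_span_pow _ _).2 h1
    rw [Padic.norm_p, inv_pow, ← zpow_natCast, ← zpow_neg]
    exact h4
  refine ⟨L, fun g => ρ (.inr g), ((p : ℝ) ^ L) ^ (-(Fintype.card F : ℝ)), ?_, fun y hy l => ?_⟩
  · have : (0 : ℝ) < p := by exact_mod_cast hp.pos
    positivity
  have hex : ∀ t : F → ℕ, ∃ Z : F ⊕ G → ℤ_[p], (∀ i, sysVal d a Z i = 0) ∧ (∀ g, Z (.inr g) = y g) ∧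
      ∀ f, (∀ i, e i ≠ f) → Z (.inl f) = ((ρ (.inl f) + p ^ L * t f : ℕ) : ℤ_[p]) := fun t => by
    obtain ⟨Z, hZ, hZe, hZ0⟩ := @hball (Sum.elim (fun f => ((ρ (.inl f) + p ^ L * t f : ℕ) : ℚ_[p]))
      fun g => (y g : ℚ_[p])) ((dist_pi_lt_iff hδ).2 fun j => by
        rcases j with f | g
        · exact hnear (.inl f) _ (by simp [Nat.ModEq])
        · exact hnear (.inr g) _ (hy g))
    have hZ1 : ∀ j, ‖Z j‖ ≤ 1 := fun j => by
      have h1 := (dist_pi_lt_iff one_pos).1 hZ j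
      rw [dist_eq_norm] at h1
      have h2 := Padic.nonarchimedean (Z j - z j) (z j)
      rw [sub_add_cancel] at h2
      exact h2.trans (max_le h1.le (hm j).le)
    refine ⟨fun j => ⟨Z j, hZ1 j⟩, fun i => Subtype.ext ?_, fun g => Subtype.ext ?_, fun f hf => Subtype.ext ?_⟩
    · exact (map_sysVal PadicInt.Coe.ringHom d a _ i).trans (hZ0 i)
    · simpa using hZe (.inr g) (by simp)
    · simpa using hZe (.inl f) (by simpa using hf)
  choose Z hZ0 hZy hZe using hex
  have hNZ : NeZero (p ^ l) := ⟨pow_ne_zero _ hp.ne_zero⟩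
  have hcard : (p ^ (l - L)) ^ Fintype.card F ≤ zcount d a (p ^ l) y * (p ^ l) ^ Fintype.card ι := by
    have h1 : Nat.card (F → Fin (p ^ (l - L))) = (p ^ (l - L)) ^ Fintype.card F := by simp
    have h2 : Nat.card (ι → ZMod (p ^ l)) = (p ^ l) ^ Fintype.card ι := by simp
    rw [← h1, ← h2, zcount, ← Nat.card_prod]
    refine Nat.card_le_card_of_injective (fun t => (⟨fun f => PadicInt.toZModPow l (Z (fun f => t f) (.inl f)),
      fun i => ?_⟩, fun i => ((t (e i) : ℕ) : ZMod (p ^ l)))) fun t t' htt => ?_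
    · rw [← map_zero (PadicInt.toZModPow l), ← hZ0 (fun f => t f) i, map_sysVal]
      refine congrArg (fun v => sysVal d a v i) ?_
      funext j; cases j <;> simp [hZy]
    · have hlt : ∀ u : Fin (p ^ (l - L)), (u : ℕ) < p ^ l := fun u =>
        u.2.trans_le (Nat.pow_le_pow_right hp.pos (Nat.sub_le _ _))
      obtain ⟨h3, h4⟩ := Prod.ext_iff.1 htt
      funext f
      refine Fin.ext ?_
      by_cases hf : ∃ i, e i = f
      · obtain ⟨i, rfl⟩ := hf
        have h5 := (ZMod.natCast_eq_natCast_iff' _ _ _).1 (congrFun h4 i)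
        rwa [Nat.mod_eq_of_lt (hlt _), Nat.mod_eq_of_lt (hlt _)] at h5
      · have h5 := congrFun (congrArg Subtype.val h3) f
        simp only [hZe _ f (not_exists.1 hf), map_natCast] at h5
        have h6 := Nat.ModEq.add_left_cancel' _ ((ZMod.natCast_eq_natCast_iff _ _ _).1 h5)
        rcases le_or_gt l L with hlL | hlL
        · have h7 : p ^ (l - L) = 1 := by rw [Nat.sub_eq_zero_of_le hlL, pow_zero]
          have h8 := (t f).2
          have h9 := (t' f).2
          lia
        · replace h6 : p ^ L * (t f : ℕ) ≡ p ^ L * t' f [MOD p ^ L * p ^ (l - L)] := by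
            rwa [← pow_add, Nat.add_sub_cancel' hlL.le]
          exact (Nat.ModEq.mul_left_cancel' (pow_ne_zero _ hp.ne_zero) h6).eq_of_lt_of_lt (t f).2 (t' f).2
  have hp' : (0 : ℝ) < p := by exact_mod_cast hp.pos
  have hle : (p : ℝ) ^ l ≤ p ^ L * p ^ (l - L) := by
    rw [← pow_add]; exact pow_le_pow_right₀ (by exact_mod_cast hp.one_le) (by lia)
  refine le_trans ?_ (show (((p ^ (l - L)) ^ Fintype.card F : ℕ) : ℝ) ≤ _ from
    (Nat.cast_le.2 hcard).trans_eq (by push_cast; ring))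
  rw [Real.rpow_neg (by positivity), Real.rpow_natCast, ← inv_pow, ← mul_pow]
  push_cast
  refine pow_le_pow_left₀ (by positivity) ?_ _
  rw [inv_mul_le_iff₀ (by positivity)]
  exact hle

end

section
variable {ι F G : Type} [Fintype ι] [DecidableEq ι] [Fintype F] [DecidableEq F] [Fintype G] [DecidableEq G]

lemma sum_colMap_apply (k n : ℕ) (cls : ι → Bool) (a : F → ι → ℤ) (x : F → ℕ) (i : ι) :
    (∑ f, colMap k n cls (a f) (x f)) i = sysVal (fun i => pairDeg k n (cls i)) a (fun f => (x f : ℤ)) i := by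
  simp [sysVal, colMap]

lemma sysVal_sum_elim {R : Type*} [CommRing R] (d : ι → ℕ) (a : F ⊕ G → ι → ℤ) (x : F → R) (y : G → R) (i : ι) :
    sysVal d a (Sum.elim x y) i = sysVal d (fun f => a (.inl f)) x i + sysVal d (fun g => a (.inr g)) y i := by
  simp [sysVal]

lemma exists_zcount_large {k n : ℕ} (hn : 0 < n) (hnk : n < k) (cls : ι → Bool) {a : F ⊕ G → ι → ℤ} {C₀ : ℝ}
    (hC₀ : 1 ≤ C₀) (ha : ∀ f i, |(a (.inl f) i : ℝ)| ≤ C₀)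
    (hpair : ∀ f f', f ≠ f' → PairIndep cls C₀ (a (.inl f)) (a (.inl f')))
    (hF : 8 * k * (2 * Fintype.card ι + 3) ≤ Fintype.card F) :
    ∃ w : ℕ, ∀ N : ℕ, 0 < N → (∀ p, p.Prime → p ∣ N → w < p) → ∀ y : G → ℕ,
      (1 / 2 : ℝ) * N ^ Fintype.card F ≤
        zcount (fun i => pairDeg k n (cls i)) a N y * N ^ Fintype.card ι := by
  set r := Fintype.card ι with hr
  obtain ⟨C, hC, hfull⟩ := exists_prod_full_le hn hnk (c := 1 / 2) (by norm_num) (by norm_num) cls hC₀ ha hpair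
    (m := 4 * k * (2 * r + 3)) (le_trans (by lia) hF)
  obtain ⟨w, hw⟩ := exists_nat_gt (4 * 16 ^ r * C * 2 ^ Fintype.card F)
  refine ⟨w, fun N hN hNw y => ?_⟩
  have hN' : (1 : ℝ) ≤ N := mod_cast hN
  have hNZ : NeZero N := ⟨hN.ne'⟩
  have hw0 := lt_trans (by positivity) hw
  set P : ℝ := 2 * N ^ 2 with hP
  have hP1 : 1 ≤ P := by nlinarith
  set R : Finset ((F → ℕ) × Unit) := (Fintype.piFinset fun _ : F => Ico (N * N) (2 * (N * N))) ×ˢ {()} with hR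
  set κ : ι → ℤ := fun i => sysVal (fun i => pairDeg k n (cls i)) (fun g => a (.inr g)) (fun g => (y g : ℤ)) i with hκ
  set ψ : (F → ℕ) × Unit → ι → ℤ := fun z => ∑ f, colMap k n cls (a (.inl f)) (z.1 f) + κ with hψ
  set H := expS R ψ with hH
  have hRc : #R = (N * N) ^ Fintype.card F := by
    rw [hR, card_product, Fintype.card_piFinset, prod_const, Nat.card_Ico, card_singleton, mul_one, card_univ]
    congr 1
    lia
  have hnorm : ∀ α, ‖H α‖ = ∏ f, ‖expS (Ico (N * N) (2 * (N * N))) (colMap k n cls (a (.inl f))) α‖ := fun α => by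
    rw [← norm_prod, prod_expS, ← mul_one ‖expS (Fintype.piFinset _) _ α‖, ← norm_ee (dot α κ)]
    have : ee (dot α κ) = expS {()} (fun _ => κ) α := by simp [expS]
    rw [this, ← norm_mul, expS_mul]
  set Gf : (ι → ℝ) → ℝ := fun α => if α ∈ grid ι N ∧ α ≠ 0 then ‖H α‖ * (w / (C * P ^ Fintype.card F)) else 0 with hGf
  have hG : 𝔼 α ∈ grid ι N, Gf α ≤ 2 * 16 ^ r / ∏ _i : ι, (N : ℝ) := by
    refine expect_grid_le (Q := N) (fun _ => hN') (fun _ => le_rfl) hN fun α => ?_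
    by_cases hα : α ∈ grid ι N ∧ α ≠ 0
    · right
      have ht : ∀ i, ∃ t : ℕ, t < N ∧ α i = t / N := fun i => by
        obtain ⟨t, ht, h⟩ := mem_image.1 (Fintype.mem_piFinset.1 hα.1 i)
        exact ⟨t, Finset.mem_range.1 ht, h.symm⟩
      choose t htN ht using ht
      obtain ⟨q, hq, hqN, b, hb, hred⟩ := exists_reducedFrac hN fun i => (t i : ℤ)
      have hq0 : (0 : ℝ) < q := by exact_mod_cast hq
      have hbq : ∀ i, α i - b i / q = 0 := fun i => by
        rw [ht, sub_eq_zero, div_eq_div_iff (by positivity) (by positivity)]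
        exact_mod_cast hb i
      have hq1 : q ≠ 1 := fun h => hα.2 (funext fun i => by
        have h1 := hb i
        rw [h, Nat.cast_one, mul_one] at h1
        rw [ht, Nat.eq_zero_of_dvd_of_lt (by exact_mod_cast Dvd.intro_left _ h1.symm) (htN i)]
        simp)
      have hqw : (w : ℝ) ≤ q := by
        exact_mod_cast (hNw _ (Nat.minFac_prime hq1) ((Nat.minFac_dvd q).trans hqN)).le.trans
            (Nat.minFac_le hq)
      have hqle : (q : ℝ) ≤ N := by exact_mod_cast Nat.le_of_dvd hN hqN
      refine ⟨q, hq, Nat.le_of_dvd hN hqN, b, fun i => by rw [hbq, abs_zero]; exact zero_le_one, ?_⟩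
      have harc : arcDist k n cls P α q b = 0 := sum_eq_zero fun i _ => by rw [hbq, abs_zero, zero_mul]
      have hb := hfull P hP1 (fun _ => N * N) (fun _ => 2 * (N * N)) (fun _ => by push_cast; linarith)
        (fun _ => by lia) (fun _ => by push_cast; linarith) q hq b hred α (by rw [harc]; nlinarith)
      rw [← hnorm, harc, add_zero, mul_one,
        show -(((4 * k * (2 * r + 3) : ℕ) : ℝ) / (4 * k)) = -((2 * r + 3 : ℕ) : ℝ) by
          have : (k : ℝ) ≠ 0 := by exact_mod_cast (by lia : k ≠ 0)
          push_cast; field_simp, Real.rpow_neg hq0.le, Real.rpow_natCast] at hb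
      simp only [hGf, if_pos hα, hbq, abs_zero, zero_mul, sum_const_zero, add_zero, mul_one]
      calc ‖H α‖ * (w / (C * P ^ Fintype.card F))
          ≤ (C * P ^ Fintype.card F * ((q : ℝ) ^ (2 * r + 3))⁻¹) * (q / (C * P ^ Fintype.card F)) := by gcongr
        _ = _ := by
          rw [← hr, show 2 * r + 3 = (2 * r + 2) + 1 by ring, pow_succ]
          field_simp
    · left; simp only [hGf, if_neg hα]; exact le_rfl
  have h0 : (0 : ι → ℝ) ∈ grid ι N := Fintype.mem_piFinset.2 fun i =>
    mem_image.2 ⟨0, Finset.mem_range.2 hN, by simp⟩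
  have hNr : (0 : ℝ) < N ^ r := by positivity
  have hsum : ∑ α ∈ (grid ι N).erase 0, ‖H α‖ ≤ 2 * 16 ^ r * C * P ^ Fintype.card F / w := by
    rw [expect_eq_sum_div_card, card_grid hN, prod_const, card_univ, Nat.cast_pow, ← hr,
      div_le_div_iff_of_pos_right hNr, ← add_sum_erase _ _ h0] at hG
    simp only [hGf, ne_eq, not_true_eq_false, and_false, if_false, zero_add] at hG
    rw [sum_congr rfl fun α hα => if_pos ⟨mem_of_mem_erase hα, ne_of_mem_erase hα⟩, ← sum_mul] at hG
    rw [le_div_iff₀ hw0]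
    have : 0 < C * P ^ Fintype.card F := by positivity
    rw [mul_div_assoc', div_le_iff₀ this] at hG
    linarith
  have hcount := expect_expS hN R ψ
  set Cnt := #{z ∈ R | ∀ i, (N : ℤ) ∣ ψ z i} with hCnt
  have hzc : Cnt ≤ zcount (fun i => pairDeg k n (cls i)) a N y * N ^ Fintype.card F := by
    have h1 : Nat.card (F → Fin N) = N ^ Fintype.card F := by simp
    rw [← h1, zcount, ← Nat.card_prod, hCnt, ← Nat.card_eq_finsetCard]
    refine Nat.card_le_card_of_injective (fun z => (⟨fun f => (z.1.1 f : ZMod N), fun i => ?_⟩,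
      fun f => ⟨(z.1.1 f - N * N) / N, ?_⟩)) fun z z' hzz => ?_
    · have h2 := (ZMod.intCast_zmod_eq_zero_iff_dvd _ _).2 ((mem_filter.1 z.2).2 i)
      have h3 : ψ z.1 i = sysVal (fun i => pairDeg k n (cls i)) a
          (Sum.elim (fun f => (z.1.1 f : ℤ)) fun g => (y g)) i := by
        simp only [hψ]
        rw [Pi.add_apply, sum_colMap_apply, hκ, ← sysVal_sum_elim]
      rw [h3] at h2
      rw [← h2]
      refine Eq.trans (congrArg (fun v => sysVal _ a v i) ?_) (map_sysVal (Int.castRingHom (ZMod N)) _ a _ i).symm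
      funext j; cases j <;> simp
    · have h2 := Finset.mem_Ico.1 (Fintype.mem_piFinset.1 (mem_product.1 (mem_filter.1 z.2).1).1 f)
      rw [Nat.div_lt_iff_lt_mul hN]
      lia
    · refine Subtype.ext (Prod.ext (funext fun f => ?_) rfl)
      obtain ⟨h3, h4⟩ := Prod.ext_iff.1 hzz
      have h6 := congrArg Fin.val (congrFun h4 f)
      have e1 := (Finset.mem_Ico.1 (Fintype.mem_piFinset.1 (mem_product.1 (mem_filter.1 z.2).1).1 f)).1
      have e2 := (Finset.mem_Ico.1 (Fintype.mem_piFinset.1 (mem_product.1 (mem_filter.1 z'.2).1).1 f)).1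
      simp only at h6
      have h7 : ∀ x, N * N ≤ x → x = N * ((x - N * N) / N) + x % N + N * N := fun x hx => by
        have h8 := Nat.div_add_mod (x - N * N) N
        have h9 : (x - N * N) % N = x % N := by
          conv_rhs => rw [← Nat.sub_add_cancel hx, Nat.add_mul_mod_self_left]
        rw [← h9]; lia
      rw [h7 _ e1, h7 _ e2,
          (ZMod.natCast_eq_natCast_iff' _ _ _).1 (congrFun (congrArg Subtype.val h3) f), h6]
  have hmain : ((N * N : ℝ)) ^ Fintype.card F - 2 * 16 ^ r * C * P ^ Fintype.card F / w ≤ Cnt * N ^ r := by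
    rw [expect_eq_sum_div_card, card_grid hN, div_eq_iff (by exact_mod_cast hNr.ne'), ← add_sum_erase _ _ h0] at hcount
    have h1 : H 0 = #R := by simp [hH, expS, dot, ee_zero]
    have h2 : ‖((Cnt : ℂ) * ((N ^ r : ℕ) : ℂ))‖ = Cnt * (N : ℝ) ^ r := by simp
    have h3 : ‖(#R : ℂ)‖ = (N * N) ^ Fintype.card F := by rw [hRc, Complex.norm_natCast]; push_cast; rfl
    rw [← h2, ← hcount, ← h3]
    change _ ≤ ‖H 0 + ∑ α ∈ (grid ι N).erase 0, H α‖
    rw [h1]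
    have h4 := norm_add_le ((#R : ℂ) + ∑ α ∈ (grid ι N).erase 0, H α) (-∑ α ∈ (grid ι N).erase 0, H α)
    rw [add_neg_cancel_right, norm_neg] at h4
    have h5 := norm_sum_le ((grid ι N).erase 0) H
    linarith
  have hNF : (0 : ℝ) < N ^ Fintype.card F := by positivity
  have hfrac : 2 * 16 ^ r * C * P ^ Fintype.card F / w ≤ 1 / 2 * (N * N : ℝ) ^ Fintype.card F := by
    rw [div_le_iff₀ hw0, hP, pow_two, mul_pow 2 ((N : ℝ) * N)]
    nlinarith [mul_lt_mul_of_pos_left hw (mul_pos hNF hNF), mul_pow (N : ℝ) N (Fintype.card F)]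
  have hzc' : (Cnt : ℝ) ≤ zcount (fun i => pairDeg k n (cls i)) a N y * (N : ℝ) ^ Fintype.card F := by
    exact_mod_cast hzc
  refine le_of_mul_le_mul_right ?_ hNF
  have hNN : ((N : ℝ) * N) ^ Fintype.card F = N ^ Fintype.card F * N ^ Fintype.card F := mul_pow _ _ _
  rw [hNN] at hmain hfrac
  calc 1 / 2 * (N : ℝ) ^ Fintype.card F * (N : ℝ) ^ Fintype.card F ≤ Cnt * (N : ℝ) ^ r := by linarith
    _ ≤ zcount (fun i => pairDeg k n (cls i)) a N y * (N : ℝ) ^ Fintype.card F * (N : ℝ) ^ r := by gcongr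
    _ = _ := by ring

lemma exists_zcount_ge {k n : ℕ} (hn : 0 < n) (hnk : n < k) (cls : ι → Bool) {a : F ⊕ G → ι → ℤ} {C₀ : ℝ}
    (hC₀ : 1 ≤ C₀) (ha : ∀ f i, |(a (.inl f) i : ℝ)| ≤ C₀)
    (hpair : ∀ f f', f ≠ f' → PairIndep cls C₀ (a (.inl f)) (a (.inl f')))
    (hF : 8 * k * (2 * Fintype.card ι + 3) ≤ Fintype.card F) (hblock : BlockIndep cls a)
    (hp : ∀ (p : ℕ) [Fact p.Prime], ∃ ξ : F ⊕ G → ℚ_[p],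
      (∀ i, sysVal (fun i => pairDeg k n (cls i)) a ξ i = 0) ∧
      (Matrix.of fun i j => (pairDeg k n (cls i) : ℚ_[p]) * a j i * ξ j ^ (pairDeg k n (cls i) - 1)).rank =
        Fintype.card ι) :
    ∃ W₀ : ℕ, 0 < W₀ ∧ ∃ ρ : G → ℕ, ∃ c : ℝ, 0 < c ∧ ∀ y : G → ℕ, (∀ g, y g ≡ ρ g [MOD W₀]) → ∀ N : ℕ, 0 < N →
      c * (N : ℝ) ^ Fintype.card F ≤
        zcount (fun i => pairDeg k n (cls i)) a N y * N ^ Fintype.card ι := by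
  obtain ⟨w, hw⟩ := exists_zcount_large (G := G) hn hnk cls hC₀ ha hpair hF
  set d := fun i => pairDeg k n (cls i)
  have key : ∀ s : Finset ℕ, (∀ p ∈ s, p.Prime) → ∃ W₀ : ℕ, 0 < W₀ ∧ (∀ p, p.Prime → p ∣ W₀ → p ∈ s) ∧
      ∃ ρ : G → ℕ, ∃ c : ℝ, 0 < c ∧ ∀ y : G → ℕ, (∀ g, y g ≡ ρ g [MOD W₀]) → ∀ N : ℕ, 0 < N →
      (∀ p, p.Prime → p ∣ N → p ∈ s ∨ w < p) →
      c * (N : ℝ) ^ Fintype.card F ≤ zcount d a N y * N ^ Fintype.card ι := by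
    intro s
    induction s using Finset.induction_on with
    | empty =>
      exact fun _ => ⟨1, one_pos, fun p hp h => absurd (Nat.dvd_one.1 h) hp.ne_one, fun _ => 0, 1 / 2, by norm_num,
        fun y _ N hN h => hw N hN (fun p hp hpN => (h p hp hpN).resolve_left (notMem_empty p)) y⟩
    | insert p s hps ih =>
      intro hs
      obtain ⟨W, hW, hWs, ρ, c, hc, h⟩ := ih fun q hq => hs q (mem_insert_of_mem hq)
      have hpp := hs p (mem_insert_self p s)
      have : Fact p.Prime := ⟨hpp⟩
      obtain ⟨ξ, hξ, hrank⟩ := hp p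
      obtain ⟨L, ρ', c', hc', h'⟩ := exists_zcount_pow_ge p hn hnk hblock
        (le_trans (by nlinarith) hF) hξ hrank
      have hcop := Nat.Coprime.pow_right L
        ((Nat.coprime_comm.1 ((Nat.Prime.coprime_iff_not_dvd hpp).2 fun hd => hps (hWs p hpp hd))))
      refine ⟨W * p ^ L, mul_pos hW (pow_pos hpp.pos L), fun q hq hqd => ?_,
        fun g => Nat.chineseRemainder hcop (ρ g) (ρ' g), c * c', mul_pos hc hc', fun y hy N hN hNs => ?_⟩
      · rcases (Nat.Prime.dvd_mul hq).1 hqd with h1 | h1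
        · exact mem_insert_of_mem (hWs q hq h1)
        · rw [(Nat.prime_dvd_prime_iff_eq hq hpp).1 (hq.dvd_of_dvd_pow h1)]
          exact mem_insert_self p s
      · have h1 := h y (fun g => ((hy g).of_mul_right _).trans (Nat.chineseRemainder hcop (ρ g) (ρ' g)).2.1)
          (ordCompl[p] N) (Nat.ordCompl_pos p hN.ne') fun q hq hqN => by
            rcases hNs q hq (hqN.trans (Nat.ordCompl_dvd N p)) with h2 | h2
            · refine Or.inl ((mem_insert.1 h2).resolve_left fun h3 => ?_)
              exact Nat.not_dvd_ordCompl hpp hN.ne' (h3 ▸ hqN)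
            · exact Or.inr h2
        have h2 := h' y (fun g => ((hy g).of_mul_left _).trans (Nat.chineseRemainder hcop (ρ g) (ρ' g)).2.2)
          (N.factorization p)
        have h3 := zcount_mul_le (Nat.ordCompl_pos p hN.ne') (Nat.ordProj_pos N p)
          (Nat.coprime_comm.1 (Nat.coprime_ordCompl hpp hN.ne' |>.pow_left _)) d a y
        rw [mul_comm (ordCompl[p] N), Nat.ordProj_mul_ordCompl_eq_self] at h3
        have hNe : (N : ℝ) = (ordCompl[p] N : ℕ) * p ^ N.factorization p := by
          rw [mul_comm, ← Nat.cast_pow, ← Nat.cast_mul, Nat.ordProj_mul_ordCompl_eq_self]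
        have h3' : (zcount d a (ordCompl[p] N) y : ℝ) * zcount d a (p ^ N.factorization p) y ≤ zcount d a N y := by
          exact_mod_cast h3
        rw [hNe, mul_pow, mul_pow]
        set x := ((ordCompl[p] N : ℕ) : ℝ)
        calc c * c' * (x ^ Fintype.card F * ((p : ℝ) ^ N.factorization p) ^ Fintype.card F)
            = (c * x ^ Fintype.card F) * (c' * (p ^ N.factorization p) ^ Fintype.card F) := by ring
          _ ≤ _ := mul_le_mul h1 h2 (by positivity) (by positivity)
          _ = (zcount d a (ordCompl[p] N) y * zcount d a (p ^ N.factorization p) y : ℝ) *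
              (x ^ Fintype.card ι * ((p : ℝ) ^ N.factorization p) ^ Fintype.card ι) := by ring
          _ ≤ _ := by gcongr
  obtain ⟨W₀, hW₀, -, ρ, c, hc, h⟩ := key ((range (w + 1)).filter Nat.Prime) fun p hp => (mem_filter.1 hp).2
  exact ⟨W₀, hW₀, ρ, c, hc, fun y hy N hN => h y hy N hN fun p hp _ => by grind⟩

end

section
variable {ι F G : Type} [Fintype ι] [DecidableEq ι] [Fintype F] [DecidableEq F] [Fintype G] [DecidableEq G]

lemma abs_sysVal_le {J : Type} [Fintype J] {d : ι → ℕ} {a : J → ι → ℤ} {x z : J → ℝ} {η : ℝ}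
    (hx : ∀ j, 0 ≤ x j ∧ x j ≤ 1) (hz : ∀ j, 0 ≤ z j ∧ z j ≤ 1) (hxz : ∀ j, |x j - z j| ≤ η) {i : ι}
    (h0 : sysVal d a z i = 0) : |sysVal d a x i| ≤ (∑ j, |(a j i : ℝ)|) * d i * η := by
  have hpow : ∀ j, |x j ^ d i - z j ^ d i| ≤ d i * η := fun j => by
    have h := abs_pow_sub_pow_le (x j) (z j) (d i)
    have h1 : max |x j| |z j| ^ (d i - 1) ≤ 1 := pow_le_one₀ (le_max_of_le_left (abs_nonneg _))
      (max_le (by rw [abs_of_nonneg (hx j).1]; exact (hx j).2) (by rw [abs_of_nonneg (hz j).1]; exact (hz j).2))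
    calc _ ≤ _ := h
      _ ≤ η * d i * 1 := by gcongr; exacts [mul_nonneg ((abs_nonneg _).trans (hxz j)) (Nat.cast_nonneg _), hxz j]
      _ = _ := by ring
  rw [← sub_zero (sysVal d a x i), ← h0, sysVal, sysVal, ← sum_sub_distrib, sum_mul, sum_mul]
  refine (abs_sum_le_sum_abs _ _).trans (sum_le_sum fun j _ => ?_)
  rw [← mul_sub, abs_mul, mul_assoc]
  exact mul_le_mul_of_nonneg_left (hpow j) (abs_nonneg _)

/-- A natural number congruent to `ρ` modulo `N` in `[θ, θ + 2 N]`. -/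
noncomputable def residueAbove (N ρ : ℕ) (θ : ℝ) : ℕ := ρ % N + N * ⌈θ / N⌉₊

lemma residueAbove_bounds {N : ℕ} (hN : 0 < N) (ρ : ℕ) {θ : ℝ} (hθ : 0 ≤ θ) :
    θ ≤ residueAbove N ρ θ ∧ residueAbove N ρ θ ≤ θ + 2 * N := by
  have hN' : (0 : ℝ) < N := by exact_mod_cast hN
  have h1 := Nat.le_ceil (θ / N)
  have h2 := Nat.ceil_lt_add_one (div_nonneg hθ hN'.le)
  have h3 : ((ρ % N : ℕ) : ℝ) ≤ N := by exact_mod_cast (Nat.mod_lt _ hN).le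
  rw [div_le_iff₀ hN'] at h1
  rw [← sub_lt_iff_lt_add, lt_div_iff₀ hN'] at h2
  have h4 : (0 : ℝ) ≤ ((ρ % N : ℕ) : ℝ) := Nat.cast_nonneg _
  constructor <;> · rw [residueAbove]; push_cast at *; nlinarith

lemma exists_real_count {k n : ℕ} (hn : 0 < n) (hnk : n < k) {cls : ι → Bool} {a : F ⊕ G → ι → ℤ}
    (hblock : BlockIndep cls a) (hF : 2 * Fintype.card ι ≤ Fintype.card F) {ξ : F ⊕ G → ℝ} (hpos : ∀ j, 0 < ξ j)
    (hξ : ∀ i, sysVal (fun i => pairDeg k n (cls i)) a ξ i = 0)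
    (hrank : (Matrix.of fun i j => (pairDeg k n (cls i) : ℝ) * a j i * ξ j ^ (pairDeg k n (cls i) - 1)).rank =
      Fintype.card ι) :
    ∃ ζ : G → ℝ, (∀ g, 0 < ζ g) ∧ ∃ c δ : ℝ, 0 < c ∧ c ≤ 1 / 4 ∧ 0 < δ ∧ ∀ τ : ℝ, 0 < τ → τ ≤ 1 → ∀ N : ℕ, 0 < N →
      ∀ P : ℝ, 8 * N / (δ * τ) + 4 ≤ P → ∀ y : G → ℕ, (∀ g, |(y g : ℝ) - ζ g * P| ≤ δ * P) → ∀ ρ : F → ℕ,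
      ∃ T ⊆ Fintype.piFinset fun _ : F => Ico ⌈c * P⌉₊ ⌊P⌋₊, (∀ x ∈ T, (∀ f, x f ≡ ρ f [MOD N]) ∧
        ∀ i, |((sysVal (fun i => pairDeg k n (cls i)) a (Sum.elim (fun f => (x f : ℤ)) fun g => (y g : ℤ)) i : ℤ) : ℝ)| ≤
          τ * P ^ pairDeg k n (cls i)) ∧
        (δ / 4 * P / N) ^ Fintype.card F * τ ^ Fintype.card ι ≤ #T := by
  set d := fun i => pairDeg k n (cls i) with hd
  obtain ⟨z₀, hz₀U, hz₀, e, he, hdet₀⟩ := exists_zero_of_rank hn hnk hblock hF hξ hrank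
    (U := {z | ∀ j, 0 < z j}) (by
      simp only [Set.setOf_forall]
      exact (Filter.iInter_mem).2 fun j => (isOpen_lt continuous_const (continuous_apply j)).mem_nhds (hpos j))
  set A : ℝ := 1 + ∑ i, (∑ j, |(a j i : ℝ)|) * d i with hA
  have hAi : ∀ i, (∑ j, |(a j i : ℝ)|) * d i ≤ A := fun i =>
    (single_le_sum (f := fun i => (∑ j, |(a j i : ℝ)|) * (d i : ℝ)) (fun _ _ => by positivity) (mem_univ i)).trans
      (by linarith)
  have hA0 : 0 < A := add_pos_of_pos_of_nonneg one_pos (by positivity)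
  have hz₀' : ∀ j, 0 < z₀ j := hz₀U
  have hB : 0 < 1 + ∑ j, z₀ j := add_pos_of_pos_of_nonneg one_pos (sum_nonneg fun j _ => (hz₀' j).le)
  set u : ℝ := 1 / (4 * (1 + ∑ j, z₀ j)) with hu
  have hu0 : 0 < u := by positivity
  have hζ : ∀ j, 0 < u * z₀ j ∧ u * z₀ j < 1 / 2 := fun j => by
    refine ⟨mul_pos hu0 (hz₀' j), ?_⟩
    have := single_le_sum (fun j _ => (hz₀' j).le) (mem_univ j)
    rw [hu, one_div_mul_eq_div, div_lt_iff₀ (by positivity)]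
    linarith
  obtain ⟨c, ⟨hc0, hc1⟩, hcζ⟩ : ∃ c : ℝ, c ∈ Set.Ioc (0 : ℝ) (1 / 4) ∧ ∀ j, c < u * z₀ j :=
    (Filter.Eventually.and (Ioc_mem_nhdsGT (by norm_num : (0 : ℝ) < 1 / 4)) (eventually_all.2 fun j =>
      mem_nhdsWithin_of_mem_nhds (Iio_mem_nhds (hζ j).1))).exists
  have hev := eventually_exists_zero (d := d) (a := a) (ξ := fun j => u * z₀ j) (e := Sum.inl ∘ e)
    (fun i => by rw [sysVal_mul, hz₀, mul_zero]) (Sum.inl_injective.comp he)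
    (by
      have h := det_colJac_mul d (fun i => a (.inl (e i))) u (fun i => z₀ (.inl (e i)))
      exact fun h0 => mul_ne_zero (prod_ne_zero_iff.2 fun i _ => pow_ne_zero _ hu0.ne') hdet₀ (h.symm.trans h0))
    (U := {z | ∀ j, c < z j ∧ z j < 1 / 2}) (by
      simp only [Set.setOf_forall]
      exact (Filter.iInter_mem).2 fun j => ((isOpen_lt continuous_const (continuous_apply j)).inter
        (isOpen_lt (continuous_apply j) continuous_const)).mem_nhds ⟨hcζ j, (hζ j).2⟩)
  obtain ⟨δ₀, hδ₀, hball⟩ := Metric.eventually_nhds_iff.1 hev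
  have hball' : ∀ v, dist v (fun j => u * z₀ j) < δ₀ → _ := fun v => @hball v
  choose! Z hZU hZe hZ0 using hball'
  obtain ⟨δ, hδ, hδ1, hδ2, hδ3⟩ : ∃ δ : ℝ, 0 < δ ∧ δ < δ₀ ∧ δ ≤ 1 / 4 ∧ δ * A ≤ 1 :=
    ⟨min (δ₀ / 2) (min (1 / 4) (1 / A)), by positivity, (min_le_left _ _).trans_lt (by linarith),
      (min_le_right _ _).trans (min_le_left _ _),
      (le_div_iff₀ hA0).1 ((min_le_right _ _).trans (min_le_right _ _))⟩
  refine ⟨fun g => u * z₀ (.inr g), fun g => (hζ _).1, c, δ, hc0, hc1, hδ, fun τ hτ hτ1 N hN P hP y hy ρ => ?_⟩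
  have hN' : (0 : ℝ) < N := by exact_mod_cast hN
  have hP4 : 4 ≤ P := le_trans (by linarith [show 0 ≤ 8 * N / (δ * τ) by positivity]) hP
  have hP0 : 0 < P := by linarith
  have hPN : 8 * N ≤ δ * τ * P := by
    have : 8 * N / (δ * τ) ≤ P := by linarith
    rw [div_le_iff₀ (by positivity)] at this
    linarith
  set im := univ.image e with him
  set σ : F → ℝ := fun f => if f ∈ im then τ else 1 with hσ
  have hσb : ∀ f, τ ≤ σ f ∧ σ f ≤ 1 := fun f => by
    simp only [hσ]; split_ifs <;> constructor <;> linarith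
  set m : F → ℕ := fun f => ⌊δ * σ f * P / (2 * N)⌋₊ with hm
  set s := Fintype.piFinset fun f => range (m f) with hs
  have hwin : ∀ f, ∀ t < m f, ∀ θ : ℝ, 0 ≤ θ → θ ≤ residueAbove N (ρ f) θ + N * t ∧
      residueAbove N (ρ f) θ + N * t ≤ θ + δ * σ f * P := fun f t ht θ hθ => by
    obtain ⟨h1, h2⟩ := residueAbove_bounds hN (ρ f) hθ
    have h3 : (t : ℝ) ≤ δ * σ f * P / (2 * N) := (Nat.cast_le.2 ht.le).trans
      (Nat.floor_le (by have := (hσb f).1; positivity))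
    rw [le_div_iff₀ (by positivity)] at h3
    have h4 : δ * τ * P ≤ δ * σ f * P := by gcongr; exact (hσb f).1
    have h5 : (0 : ℝ) ≤ N * t := by positivity
    constructor <;> linarith
  set w : (F → ℕ) → F ⊕ G → ℝ := fun t => Sum.elim (fun f => if f ∈ im then u * z₀ (.inl f) else
    (residueAbove N (ρ f) (u * z₀ (.inl f) * P) + N * t f) / P) fun g => y g / P with hw
  have hclose : ∀ t ∈ s, dist (w t) (fun j => u * z₀ j) < δ₀ := fun t ht => by
    refine (dist_pi_lt_iff hδ₀).2 fun j => ?_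
    rcases j with f | g
    · by_cases hf : f ∈ im
      · simp only [hw, Sum.elim_inl, if_pos hf, dist_self]; exact hδ₀
      · have h := hwin f (t f) (Finset.mem_range.1 (Fintype.mem_piFinset.1 ht f)) _
          (mul_pos (hζ (.inl f)).1 hP0).le
        simp only [hw, Sum.elim_inl, if_neg hf, Real.dist_eq]
        simp only [hσ, if_neg hf, mul_one] at h
        rw [div_sub' hP0.ne', abs_div, abs_of_pos hP0, div_lt_iff₀ hP0, abs_lt]
        constructor <;> nlinarith
    · simp only [hw, Sum.elim_inr, Real.dist_eq]
      rw [div_sub' hP0.ne', abs_div, abs_of_pos hP0, div_lt_iff₀ hP0, mul_comm P]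
      exact (hy g).trans_lt (by gcongr)
  set θ : (F → ℕ) → F → ℝ := fun t f => if f ∈ im then Z (w t) (.inl f) * P else u * z₀ (.inl f) * P with hθ
  set x : (F → ℕ) → F → ℕ := fun t f => residueAbove N (ρ f) (θ t f) + N * t f with hx
  have hθb : ∀ t ∈ s, ∀ f, c * P ≤ θ t f ∧ θ t f ≤ 1 / 2 * P := fun t ht f => by
    have h := hZU _ (hclose t ht) (.inl f)
    simp only [hθ]
    split_ifs
    · constructor <;> gcongr <;> linarith
    · constructor <;> gcongr <;> linarith [hcζ (.inl f), (hζ (.inl f)).2]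
  have hxθ : ∀ t ∈ s, ∀ f, θ t f ≤ x t f ∧ (x t f : ℝ) ≤ θ t f + δ * σ f * P := fun t ht f => by
    have h := hwin f (t f) (Finset.mem_range.1 (Fintype.mem_piFinset.1 ht f)) (θ t f)
      ((mul_pos hc0 hP0).le.trans (hθb t ht f).1)
    simp only [hx]; push_cast; exact h
  have hinj : Set.InjOn x s := fun t ht t' ht' h => by
    have h1 : ∀ f, f ∉ im → t f = t' f := fun f hf => by
      have h2 := congrFun h f
      simp only [hx, hθ, if_neg hf] at h2
      exact Nat.eq_of_mul_eq_mul_left hN (by lia)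
    have h2 : w t = w t' := by
      funext j
      rcases j with f | g
      · simp only [hw, Sum.elim_inl]
        split_ifs with hf
        · rfl
        · rw [h1 f hf]
      · rfl
    funext f
    have h3 := congrFun h f
    simp only [hx, hθ, h2] at h3
    exact Nat.eq_of_mul_eq_mul_left hN (by lia)
  refine ⟨s.image x, fun v hv => ?_, fun v hv => ?_, ?_⟩
  · obtain ⟨t, ht, rfl⟩ := mem_image.1 hv
    refine Fintype.mem_piFinset.2 fun f => Finset.mem_Ico.2 ⟨Nat.ceil_le.2 ((hθb t ht f).1.trans (hxθ t ht f).1), ?_⟩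
    refine Nat.lt_of_add_one_le (Nat.le_floor ?_)
    have h1 := (hxθ t ht f).2
    have h2 : δ * σ f * P ≤ 1 / 4 * 1 * P := by
      gcongr
      exact (hσb f).2
    have h3 := (hθb t ht f).2
    push_cast; linarith
  · obtain ⟨t, ht, rfl⟩ := mem_image.1 hv
    refine ⟨fun f => ?_, fun i => ?_⟩
    · simp only [hx, residueAbove, add_assoc, ← mul_add]
      exact (Nat.ModEq.symm (by simp [Nat.ModEq]))
    have hzb : ∀ j, 0 ≤ Z (w t) j ∧ Z (w t) j ≤ 1 := fun j => by
      have h := hZU _ (hclose t ht) j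
      constructor <;> linarith
    have hd' : ∀ j, |Sum.elim (fun f => (x t f : ℝ) / P) (fun g => (y g : ℝ) / P) j - Z (w t) j| ≤ δ * τ := by
      rintro (f | g)
      · by_cases hf : f ∈ im
        · have h := hxθ t ht f
          simp only [hθ, hσ, if_pos hf] at h
          rw [Sum.elim_inl, div_sub' hP0.ne', abs_div, abs_of_pos hP0, div_le_iff₀ hP0, abs_le]
          constructor <;> nlinarith [mul_pos (mul_pos hδ hτ) hP0]
        · have h := hZe _ (hclose t ht) (.inl f) (fun ⟨i, hi⟩ => hf (mem_image.2 ⟨i, mem_univ i, Sum.inl_injective hi⟩))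
          rw [h, Sum.elim_inl]
          simp only [hw, Sum.elim_inl, if_neg hf, hx, hθ]
          push_cast
          rw [sub_self, abs_zero]
          positivity
      · have h := hZe _ (hclose t ht) (.inr g) (fun ⟨i, hi⟩ => by simp at hi)
        rw [h, Sum.elim_inr]
        simp only [hw, Sum.elim_inr, sub_self, abs_zero]
        positivity
    set v : F ⊕ G → ℝ := Sum.elim (fun f => (x t f : ℝ) / P) (fun g => (y g : ℝ) / P) with hv
    have hvb : ∀ j, 0 ≤ v j ∧ v j ≤ 1 := fun j => by
      refine ⟨by rcases j with f | g <;> simp only [hv, Sum.elim_inl, Sum.elim_inr] <;> positivity, ?_⟩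
      have h1 := (abs_le.1 (hd' j)).2
      have h2 := (hZU _ (hclose t ht) j).2
      have h3 : δ * τ ≤ 1 / 4 * 1 := by gcongr
      linarith
    have h := abs_sysVal_le hvb hzb hd' (hZ0 _ (hclose t ht) i)
    have hscale : ((sysVal d a (Sum.elim (fun f => (x t f : ℤ)) fun g => (y g : ℤ)) i : ℤ) : ℝ) =
        P ^ d i * sysVal d a v i := by
      rw [← sysVal_mul]
      refine (map_sysVal (Int.castRingHom ℝ) d a _ i).trans (congrArg (fun v => sysVal d a v i) ?_)
      funext j
      rcases j with f | g <;> simp only [hv, Sum.elim_inl, Sum.elim_inr, mul_div_cancel₀ _ hP0.ne'] <;> simp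
    rw [hscale, abs_mul, abs_of_pos (pow_pos hP0 _), mul_comm τ]
    refine mul_le_mul_of_nonneg_left (h.trans ?_) (by positivity)
    calc _ ≤ A * (δ * τ) := mul_le_mul_of_nonneg_right (hAi i) (by positivity)
      _ = δ * A * τ := by ring
      _ ≤ 1 * τ := by gcongr
      _ = τ := one_mul τ
  · rw [card_image_of_injOn hinj, hs, Fintype.card_piFinset]
    simp only [card_range]
    have h1 : ∏ f, σ f = τ ^ Fintype.card ι := by
      simp only [hσ]
      rw [prod_ite_mem, univ_inter, prod_const, him, card_image_of_injective _ he, card_univ]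
    rw [← h1, ← card_univ (α := F), ← prod_const, ← prod_mul_distrib, Nat.cast_prod]
    refine prod_le_prod (fun f _ => by have := (hσb f).1; positivity) fun f _ => ?_
    have h2 := Nat.sub_one_lt_floor (δ * σ f * P / (2 * N))
    have h3 : δ * τ * P ≤ δ * σ f * P := by gcongr; exact (hσb f).1
    refine le_trans ?_ h2.le
    rw [div_sub_one (by positivity), div_mul_eq_mul_div, div_le_div_iff₀ hN' (by positivity)]
    nlinarith

end

section
variable {ι F G : Type} [Fintype ι] [DecidableEq ι] [Fintype F] [DecidableEq F] [Fintype G] [DecidableEq G]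

open Classical in
/-- Arbitrarily large sets of products in prescribed short intervals and coprime residue classes for which the
minor arcs contribute a negligible amount, uniformly in bounded dilations of the variables indexed by `G`. -/
def HasMinorSaving (k n : ℕ) (cls : ι → Bool) (C₀ : ℝ) (a : F ⊕ G → ι → ℤ) : Prop :=
  ∀ W₀ : ℕ, 0 < W₀ → ∀ η : ℝ, 0 < η → ∃ c C : ℝ, 0 < c ∧ 0 < C ∧ ∀ lam : ℝ, 1 ≤ lam → ∀ U : ℕ, 0 < U → ∀ ε : ℝ,
    0 < ε → ∀ Y₀ : ℝ, ∃ Y ≥ Y₀, ∃ (R : G → Finset (ℕ × ℕ)) (X : G → ℝ) (r : G → ℕ),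
    (∀ g, (R g).Nonempty ∧ c * Y ≤ X g ∧ X g ≤ C * Y ∧ (r g).Coprime W₀ ∧ ∀ z ∈ R g,
      X g ≤ (z.1 * z.2 : ℕ) ∧ ((z.1 * z.2 : ℕ) : ℝ) ≤ (1 + η) * X g ∧ z.1 * z.2 ≡ r g [MOD W₀]) ∧
    ∀ u : G → ℕ, (∀ g, 0 < u g ∧ u g ≤ U) → ∀ l v : F → ℕ, (∀ f, (v f : ℝ) ≤ lam * Y) →
    ∀ᶠ N : ℕ in atTop, 𝔼 α ∈ grid ι N, (if MajorAt k n cls (C₀ * U ^ (2 * k)) (lam * Y) α then 0 else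
      (∏ f, ‖expS (Ico (l f) (v f)) (colMap k n cls (a (.inl f))) α‖) *
      ∏ g, ‖expS (R g) (fun z => colMap k n cls (fun i => a (.inr g) i * u g ^ pairDeg k n (cls i)) (z.1 * z.2)) α‖) ≤
      ε * ((∏ g, #(R g) : ℕ) * (lam * Y) ^ Fintype.card F / ∏ i, (lam * Y) ^ pairDeg k n (cls i))

lemma le_card_filter_of_zcount {d : ι → ℕ} {a : F ⊕ G → ι → ℤ} {N : ℕ} (hN : 0 < N) {I : Finset (F → ℕ)}
    {β : Type} (Ro : Finset β) (y : β → G → ℕ) {V : ι → ℝ} {B B' : ℝ} (hB' : 0 ≤ B')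
    (hB : ∀ z ∈ Ro, B ≤ zcount d a N (y z))
    (hT : ∀ z ∈ Ro, ∀ ρ : F → ℕ, ∃ T ⊆ I, (∀ x ∈ T, (∀ f, x f ≡ ρ f [MOD N]) ∧ ∀ i,
      |((sysVal d a (Sum.elim (fun f => (x f : ℤ)) fun g => (y z g : ℤ)) i : ℤ) : ℝ)| ≤ V i) ∧ B' ≤ #T)
    {p : (F → ℕ) × β → Prop} [DecidablePred p] (hp : ∀ x z, (∀ i,
      (N : ℤ) ∣ sysVal d a (Sum.elim (fun f => (x f : ℤ)) fun g => (y z g : ℤ)) i ∧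
      |((sysVal d a (Sum.elim (fun f => (x f : ℤ)) fun g => (y z g : ℤ)) i : ℤ) : ℝ)| ≤ V i) → p (x, z)) :
    #Ro * (B * B') ≤ #((I ×ˢ Ro).filter p) := by
  classical
  have hNZ : NeZero N := ⟨hN.ne'⟩
  set s : Finset (Σ _ : β, F → ZMod N) := Ro.sigma fun z => univ.filter fun x =>
    ∀ i, sysVal d a (Sum.elim x fun g => (y z g : ZMod N)) i = 0 with hs
  have h1 : #Ro * B ≤ #s := by
    rw [hs, card_sigma, Nat.cast_sum, ← nsmul_eq_mul]
    refine card_nsmul_le_sum _ _ _ fun z hz => (hB z hz).trans_eq ?_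
    rw [zcount, Nat.card_eq_fintype_card, Fintype.card_subtype]
  have h2 : #s * B' ≤ ((#(((I ×ˢ Ro).filter p).filter fun z =>
      (⟨z.2, fun f => (z.1 f : ZMod N)⟩ : Σ _ : β, F → ZMod N) ∈ s) : ℕ) : ℝ) := by
    rw [← sum_card_fiberwise_eq_card_filter, Nat.cast_sum, ← nsmul_eq_mul]
    refine card_nsmul_le_sum _ _ _ fun w hw => ?_
    obtain ⟨hwR, hw0⟩ := mem_sigma.1 hw
    obtain ⟨T, hTI, hTx, hTc⟩ := hT w.1 hwR fun f => (w.2 f).val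
    refine hTc.trans (Nat.cast_le.2 ?_)
    refine card_le_card_of_injOn (fun x => (x, w.1)) (fun x hx => ?_) fun x _ x' _ h => (Prod.ext_iff.1 h).1
    have hres : ∀ f, (x f : ZMod N) = w.2 f := fun f => by
      rw [(ZMod.natCast_eq_natCast_iff _ _ _).2 ((hTx x hx).1 f), ZMod.natCast_zmod_val]
    refine mem_coe.2 (mem_filter.2 ⟨mem_filter.2 ⟨mem_product.2 ⟨hTI hx, hwR⟩, hp _ _ fun i => ⟨?_, (hTx x hx).2 i⟩⟩, ?_⟩)
    · rw [← ZMod.intCast_zmod_eq_zero_iff_dvd, ← (mem_filter.1 hw0).2 i]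
      refine (map_sysVal (Int.castRingHom (ZMod N)) d a _ i).trans (congrArg (fun v => sysVal d a v i) ?_)
      funext j
      rcases j with f | g
      · simpa using hres f
      · simp
    · exact Sigma.ext rfl (heq_of_eq (funext hres))
  calc #Ro * (B * B') = #Ro * B * B' := by ring
    _ ≤ #s * B' := by gcongr
    _ ≤ _ := h2.trans (Nat.cast_le.2 (card_le_card (filter_subset _ _)))

set_option maxHeartbeats 1000000 in
open Classical in
theorem exists_pos_solution {k n : ℕ} (hn : 0 < n) (hnk : n < k) {cls : ι → Bool} {C₀ : ℝ} (hC₀ : 1 ≤ C₀)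
    {a : F ⊕ G → ι → ℤ} (ha : ∀ f i, |(a (.inl f) i : ℝ)| ≤ C₀)
    (hpair : ∀ f f', f ≠ f' → PairIndep cls C₀ (a (.inl f)) (a (.inl f')))
    (hF : 8 * k * (2 * Fintype.card ι + 3) ≤ Fintype.card F) (hblock : BlockIndep cls a)
    (hreal : ∃ ξ : F ⊕ G → ℝ, (∀ j, 0 < ξ j) ∧ (∀ i, sysVal (fun i => pairDeg k n (cls i)) a ξ i = 0) ∧
      (Matrix.of fun i j => (pairDeg k n (cls i) : ℝ) * a j i * ξ j ^ (pairDeg k n (cls i) - 1)).rank = Fintype.card ι)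
    (hp : ∀ (p : ℕ) [Fact p.Prime], ∃ ξ : F ⊕ G → ℚ_[p],
      (∀ i, sysVal (fun i => pairDeg k n (cls i)) a ξ i = 0) ∧
      (Matrix.of fun i j => (pairDeg k n (cls i) : ℚ_[p]) * a j i * ξ j ^ (pairDeg k n (cls i) - 1)).rank =
        Fintype.card ι)
    (hminor : HasMinorSaving k n cls C₀ a) :
    ∃ x : F ⊕ G → ℤ, (∀ j, 0 < x j) ∧ ∀ i, sysVal (fun i => pairDeg k n (cls i)) a x i = 0 := by
  obtain ⟨W₀, hW₀, ρ, cp, hcp, hz⟩ := exists_zcount_ge hn hnk cls hC₀ ha hpair hF hblock hp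
  obtain ⟨ξ, hξ0, hξ, hrank⟩ := hreal
  obtain ⟨ζ, hζ, c, δ, hc, hc1, hδ, hcount⟩ := exists_real_count hn hnk hblock (le_trans (by nlinarith) hF) hξ0 hξ hrank
  set d := fun i => pairDeg k n (cls i) with hd
  set r := Fintype.card ι with hr
  set Fc := Fintype.card F with hFc
  have hζs : ∀ g, ζ g ≤ ∑ g, ζ g := fun g => single_le_sum (fun g _ => (hζ g).le) (mem_univ g)
  have hζ0 : 0 ≤ ∑ g, ζ g := sum_nonneg fun g _ => (hζ g).le
  set η : ℝ := δ / (2 * (1 + ∑ g, ζ g)) with hη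
  have hηζ : ∀ g, η * ζ g ≤ δ / 2 := fun g => by
    rw [hη, div_mul_eq_mul_div, div_le_div_iff₀ (by positivity) two_pos]
    nlinarith [hζs g]
  obtain ⟨c₁, C₁, hc₁, hC₁, hH⟩ := hminor W₀ hW₀ η (by positivity)
  set lam : ℝ := 1 + 4 * W₀ * (1 + η) * C₁ / δ with hlam
  have hlam1 : 1 ≤ lam := le_add_of_nonneg_right (by positivity)
  have hlamδ : 4 * W₀ * (1 + η) * C₁ ≤ δ * lam := by
    have := mul_div_cancel₀ (4 * W₀ * (1 + η) * C₁) hδ.ne'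
    rw [hlam]; linarith
  set U : ℕ := ⌈(∑ g, ζ g) * lam / c₁⌉₊ + 2 * W₀ with hU
  have hU0 : 0 < U := by lia
  have hCU : C₀ ≤ C₀ * U ^ (2 * k) := le_mul_of_one_le_right (by linarith) (one_le_pow₀ (by exact_mod_cast hU0))
  obtain ⟨C, hC, hnear⟩ := exists_card_near_le hn hnk hc (hc1.trans (by norm_num)) cls (hC₀.trans hCU)
    (fun f i => (ha f i).trans hCU) (fun f f' h i => by
      obtain ⟨m, u, u', h1, h2, h3, h4, h5⟩ := hpair f f' h i
      exact ⟨m, u, u', h1, h2.trans hCU, h3.trans hCU, h4.trans hCU, h5⟩) hF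
  set B : ℝ := cp * (δ / 4) ^ Fc / 3 ^ r with hB
  have hB0 : 0 < B := by positivity
  obtain ⟨K, hK⟩ := exists_nat_gt (4 * C / B)
  have hK0 : (0 : ℝ) < K := lt_of_le_of_lt (by positivity) hK
  obtain ⟨τ, hτ, hτ1, hτK⟩ : ∃ τ : ℝ, 0 < τ ∧ τ ≤ 1 ∧ 4 * C * K * τ ≤ B :=
    ⟨min 1 (B / (4 * C * K)), by positivity, min_le_left _ _, by
      rw [mul_comm]; exact (le_div_iff₀ (by positivity)).1 (min_le_right _ _)⟩
  set N := K.factorial with hN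
  have hN0 : 0 < N := Nat.factorial_pos K
  have hN' : (0 : ℝ) < N := by exact_mod_cast hN0
  obtain ⟨Y, hY, R, X, res, hR, hE⟩ := hH lam hlam1 U hU0 (B / 8) (by positivity) (8 * N / (δ * τ) + 4 + N / τ)
  set P := lam * Y with hP
  have hYpos : 0 < Y := lt_of_lt_of_le (by positivity) hY
  have hPY : 8 * N / (δ * τ) + 4 + N / τ ≤ P := hY.trans (le_mul_of_one_le_left hYpos.le hlam1)
  have hA1 : 0 ≤ 8 * N / (δ * τ) := by positivity
  have hA2 : 0 ≤ N / τ := by positivity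
  have hP0 : 0 < P := by linarith
  have hX : ∀ g, 0 < X g := fun g => lt_of_lt_of_le (by positivity) (hR g).2.1
  have hNZ : NeZero W₀ := ⟨hW₀.ne'⟩
  set u : G → ℕ := fun g => residueAbove W₀ (ρ g * (((res g : ZMod W₀)⁻¹).val)) (ζ g * P / X g) with hu
  have hub : ∀ g, ζ g * P / X g ≤ u g ∧ (u g : ℝ) ≤ ζ g * P / X g + 2 * W₀ := fun g =>
    residueAbove_bounds hW₀ _ (by have := hX g; have := hζ g; positivity)
  have huU : ∀ g, 0 < u g ∧ u g ≤ U := fun g => by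
    have := hX g
    have := hζ g
    refine ⟨Nat.cast_pos.1 (lt_of_lt_of_le (by positivity) (hub g).1), Nat.cast_le.1 ((hub g).2.trans (α := ℝ) ?_)⟩
    rw [hU]; push_cast
    gcongr
    refine le_trans ?_ (Nat.le_ceil _)
    rw [div_le_div_iff₀ (hX g) hc₁, hP]
    calc ζ g * (lam * Y) * c₁ = ζ g * lam * (c₁ * Y) := by ring
      _ ≤ _ := by gcongr; exacts [hζs g, (hR g).2.1]
  set y : (G → ℕ × ℕ) → G → ℕ := fun w g => u g * ((w g).1 * (w g).2) with hy
  have hyR : ∀ w ∈ Fintype.piFinset R, (∀ g, y w g ≡ ρ g [MOD W₀]) ∧ ∀ g, |(y w g : ℝ) - ζ g * P| ≤ δ * P := by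
    refine fun w hw => ⟨fun g => ?_, fun g => ?_⟩
    · have h1 := ((hR g).2.2.2.2 _ (Fintype.mem_piFinset.1 hw g)).2.2
      have h2 : u g ≡ ρ g * ((res g : ZMod W₀)⁻¹).val [MOD W₀] := by
        simp [hu, residueAbove, Nat.ModEq]
      refine (h2.mul h1).trans ((ZMod.natCast_eq_natCast_iff _ _ _).1 ?_)
      push_cast
      rw [ZMod.natCast_zmod_val, mul_assoc, mul_comm _ (res g : ZMod W₀), ZMod.coe_mul_inv_eq_one _ (hR g).2.2.2.1, mul_one]
    · obtain ⟨h1, h2, -⟩ := (hR g).2.2.2.2 _ (Fintype.mem_piFinset.1 hw g)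
      obtain ⟨h3, h4⟩ := hub g
      have h5 := (hR g).2.2.1
      rw [div_le_iff₀ (hX g)] at h3
      rw [← sub_le_iff_le_add, le_div_iff₀ (hX g)] at h4
      simp only [hy]; push_cast at h1 h2 ⊢
      set x : ℝ := ((w g).1 : ℝ) * (w g).2
      have h6 : (u g : ℝ) * X g ≤ u g * x := by gcongr
      have h7 : (u g : ℝ) * x ≤ (1 + η) * (u g * X g) := by
        calc (u g : ℝ) * x ≤ u g * ((1 + η) * X g) := by gcongr
          _ = _ := by ring
      have h8 : (1 + η) * (u g * X g) ≤ (1 + η) * (ζ g * P + 2 * W₀ * (C₁ * Y)) := by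
        gcongr
        calc _ ≤ ζ g * P + 2 * W₀ * X g := by linarith
          _ ≤ _ := by gcongr
      have h9 : (1 + η) * (2 * W₀ * (C₁ * Y)) ≤ δ / 2 * P := by
        rw [hP]
        calc _ = 4 * W₀ * (1 + η) * C₁ * Y / 2 := by ring
          _ ≤ δ * lam * Y / 2 := by gcongr
          _ = _ := by ring
      have h10 := mul_le_mul_of_nonneg_right (hηζ g) hP0.le
      rw [abs_le]
      constructor <;> linarith [mul_pos hδ hP0]
  set Ro := Fintype.piFinset R with hRo
  have hRo0 : (0 : ℝ) < #Ro := by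
    rw [hRo, Fintype.card_piFinset]
    exact_mod_cast prod_pos fun g _ => card_pos.2 (hR g).1
  set ψ : (G → ℕ × ℕ) → ι → ℤ := fun w => ∑ g, colMap k n cls (a (.inr g)) (y w g) with hψ
  set l : F → ℕ := fun _ => ⌈c * P⌉₊ with hl
  set v : F → ℕ := fun _ => ⌊P⌋₊ with hv
  have hlv : ⌈c * P⌉₊ ≤ ⌊P⌋₊ := by
    have h1 := Nat.ceil_lt_add_one (mul_pos hc hP0).le
    have h2 := mul_le_mul_of_nonneg_right hc1 hP0.le
    exact Nat.le_floor (h1.le.trans (by linarith))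
  have hval : ∀ x : F → ℕ, ∀ w i, (∑ f, colMap k n cls (a (.inl f)) (x f) + ψ w) i =
      sysVal d a (Sum.elim (fun f => (x f : ℤ)) fun g => (y w g : ℤ)) i := fun x w i => by
    rw [Pi.add_apply, sysVal_sum_elim]
    exact congrArg₂ (· + ·) (sum_colMap_apply ..) (sum_colMap_apply ..)
  set L : ι → ℕ := fun i => ⌊τ * P ^ d i / N⌋₊ with hL
  have hEE : ∀ᶠ N : ℕ in atTop, 𝔼 α ∈ grid ι N, (if MajorAt k n cls (C₀ * U ^ (2 * k)) P α then 0 else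
      (∏ f, ‖expS (Ico (l f) (v f)) (colMap k n cls (a (.inl f))) α‖) * ‖expS Ro ψ α‖) ≤
      B / 8 * (#Ro * P ^ Fc / ∏ i, P ^ d i) := by
    filter_upwards [hE u huU l v fun f => Nat.floor_le hP0.le] with N h
    rw [hRo, Fintype.card_piFinset]
    refine le_trans (le_of_eq (expect_congr rfl fun α _ => ?_)) h
    have hψ' : ψ = fun w => ∑ g, colMap k n cls (fun i => a (.inr g) i * u g ^ pairDeg k n (cls i))
        ((w g).1 * (w g).2) := funext fun w => sum_congr rfl fun g _ => funext fun i => by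
      simp only [colMap, hy]; push_cast; ring
    rw [hψ', ← prod_expS R (fun g z => colMap k n cls (fun i => a (.inr g) i * u g ^ pairDeg k n (cls i)) (z.1 * z.2)),
      norm_prod]
  have hmain := hnear P (by linarith) l v (fun f => Nat.le_ceil _) (fun _ => hlv) (fun f => Nat.floor_le hP0.le)
    Ro ψ K N (by exact_mod_cast hK0) (fun q hq hqK => Nat.dvd_factorial hq hqK) L τ hτ.le (fun i => by
      have h1 := Nat.floor_le (show 0 ≤ τ * P ^ d i / N by positivity)
      rw [le_div_iff₀ hN'] at h1
      linarith) _ hEE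
  by_contra hno
  have hzero : ∀ z ∈ (Fintype.piFinset fun f => Ico (l f) (v f)) ×ˢ Ro,
      ¬ ∑ f, colMap k n cls (a (.inl f)) (z.1 f) + ψ z.2 = 0 := fun z hz h0 => by
    obtain ⟨hzx, hzR⟩ := mem_product.1 hz
    refine hno ⟨Sum.elim (fun f => (z.1 f : ℤ)) fun g => (y z.2 g : ℤ), ?_, fun i => by rw [← hval, h0, Pi.zero_apply]⟩
    rintro (f | g)
    · have h1 := (Finset.mem_Ico.1 (Fintype.mem_piFinset.1 hzx f)).1
      exact Nat.cast_pos.2 (lt_of_lt_of_le (Nat.ceil_pos.2 (mul_pos hc hP0)) h1)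
    · have h1 := ((hR g).2.2.2.2 _ (Fintype.mem_piFinset.1 hzR g)).1
      exact Nat.cast_pos.2 (Nat.mul_pos (huU g).1 (Nat.cast_pos.1 ((hX g).trans_le h1)))
  rw [filter_false_of_mem hzero, card_empty, Nat.cast_zero, zero_add] at hmain
  have hlow : #Ro * (cp * N ^ Fc / N ^ r * ((δ / 4 * P / N) ^ Fc * τ ^ r)) ≤ _ :=
    le_trans (le_card_filter_of_zcount hN0 Ro y (V := fun i => τ * P ^ d i) (by positivity)
      (fun w hw => by rw [div_le_iff₀ (by positivity)]; exact hz (y w) (hyR w hw).1 N hN0)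
      (fun w hw ρ => hcount τ hτ hτ1 N hN0 P (by linarith) (y w) (hyR w hw).2 ρ) fun x w h i => by
        rw [hval]
        refine ⟨(h i).1, ?_⟩
        obtain ⟨⟨t, ht⟩, h2⟩ := h i
        rw [ht, Int.cast_mul, abs_mul, Int.cast_natCast, Nat.abs_cast, mul_comm, ← le_div_iff₀ hN', ← Int.cast_abs,
          ← Int.natCast_natAbs, Int.cast_natCast] at h2
        rw [ht, abs_mul, Nat.abs_cast, ← Int.natCast_natAbs t]
        exact mul_le_mul_of_nonneg_left (Nat.cast_le.2 (Nat.le_floor h2)) (Nat.cast_nonneg _)) hmain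
  have hbox : (#(boxAt L) : ℝ) ≤ (3 * (τ / N)) ^ r * ∏ i, P ^ d i := by
    rw [boxAt, Fintype.card_piFinset, Nat.cast_prod, hr, ← card_univ (α := ι), ← prod_const, ← prod_mul_distrib]
    refine prod_le_prod (fun _ _ => Nat.cast_nonneg _) fun i _ => ?_
    have h1 := Nat.floor_le (show 0 ≤ τ * P ^ d i / N by positivity)
    have h2 : (1 : ℝ) ≤ τ * P ^ d i / N := by
      have h3 : N / τ ≤ P := by linarith
      have h4 : P ≤ P ^ d i := le_self_pow₀ (by linarith) (by simp only [hd, pairDeg]; cases cls i <;> simp <;> lia)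
      rw [div_le_iff₀ hτ] at h3
      rw [le_div_iff₀ hN', one_mul, mul_comm τ]
      exact h3.trans (by gcongr)
    rw [Int.card_Icc, show ((L i : ℤ) + 1 - -(L i : ℤ)).toNat = 2 * L i + 1 by lia]
    push_cast
    calc 2 * (L i : ℝ) + 1 ≤ 3 * (τ * P ^ d i / N) := by linarith
      _ = _ := by ring
  set D := ∏ i, P ^ d i with hD
  have hD0 : 0 < D := prod_pos fun i _ => by positivity
  have h1 : C / K ≤ B / 4 := by
    rw [div_lt_iff₀ hB0] at hK
    rw [div_le_iff₀ hK0]; linarith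
  have h2 : 2 * (B / 8 * (#Ro * P ^ Fc / D)) + C * (1 / K + K * τ) * (#Ro * P ^ Fc / D) ≤
      3 / 4 * B * (#Ro * P ^ Fc / D) := by
    rw [← mul_assoc, ← add_mul]
    refine mul_le_mul_of_nonneg_right ?_ (by positivity)
    have : C * (1 / K + K * τ) = C / K + C * K * τ := by ring
    linarith
  have h3 := hlow.trans (mul_le_mul hbox h2 (by positivity) (by positivity))
  have h4 : (#Ro : ℝ) * (cp * N ^ Fc / N ^ r * ((δ / 4 * P / N) ^ Fc * τ ^ r)) =
      B * (#Ro * P ^ Fc * (3 * (τ / N)) ^ r) := by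
    simp only [hB, div_pow, mul_pow]; field_simp
  have h5 : (3 * (τ / N)) ^ r * D * (3 / 4 * B * (#Ro * P ^ Fc / D)) =
      3 / 4 * (B * (#Ro * P ^ Fc * (3 * (τ / N)) ^ r)) := by field_simp
  rw [h4, h5] at h3
  have h6 : 0 < B * (#Ro * P ^ Fc * (3 * (τ / N)) ^ r) := by positivity
  linarith

end

section MinorSaving

/-- At the scales `Y W`, there are sets of integers in short intervals and prescribed residue classes whose
mean value of order `2 t` is within `Y W ^ Δ` of its conjectured size. -/
def HasGoodSets {κ : Type} [Fintype κ] (d : κ → ℕ) (t : ℕ) (Δ : ℝ) (Y : ℕ → ℝ) : Prop :=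
  ∀ W₀ : ℕ, 0 < W₀ → ∀ η : ℝ, 0 < η → ∃ c C : ℝ, 0 < c ∧ 0 < C ∧ ∀ᶠ W in atTop, ∃ (A : Finset ℕ) (X : ℝ) (r : ℕ),
    A.Nonempty ∧ c * Y W ≤ X ∧ X ≤ C * Y W ∧ r.Coprime W₀ ∧
    (∀ x ∈ A, X ≤ x ∧ (x : ℝ) ≤ (1 + η) * X ∧ x ≡ r [MOD W₀]) ∧
    (mv t A (mono d) : ℝ) * Y W ^ (∑ i, d i) ≤ (#A : ℝ) ^ (2 * t) * Y W ^ Δ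

lemma eventually_exists_good_primes {W₀ : ℕ} (hW₀ : 0 < W₀) {η : ℝ} (hη : 0 < η) :
    ∀ᶠ M : ℕ in atTop, ∃ S ⊆ primesIn M, ∃ (X : ℝ) (r : ℕ), S.Nonempty ∧ (M : ℝ) ^ (79 / 80 : ℝ) ≤ #S ∧
      M ≤ X ∧ X ≤ 4 * M ∧ r.Coprime W₀ ∧ ∀ p ∈ S, X ≤ p ∧ (p : ℝ) ≤ (1 + η) * X ∧ p ≡ r [MOD W₀] := by
  set K : ℕ := W₀ * (⌊Real.logb (1 + η) 4⌋₊ + 1) with hK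
  have h1 := tendsto_natCast_atTop_atTop.eventually
    (eventually_const_mul_rpow_le (a := 79 / 80) (b := 1 - 1 / 160) (by norm_num) (K : ℝ))
  filter_upwards [h1, eventually_rpow_le_card_primesIn (δ := 1 / 160) (by norm_num), eventually_ge_atTop (W₀ + 1)]
    with M hM hc hMW
  have hM0 : (0 : ℝ) < M := Nat.cast_pos.2 (by lia)
  have hne : (primesIn M).Nonempty := by
    rw [← card_pos, ← Nat.cast_pos (α := ℝ)]
    exact (Real.rpow_pos_of_pos hM0 _).trans_le hc
  obtain ⟨S, hS, X, r, hSn, hX, hX', hSx, hcard⟩ := exists_popular (E := 4) hne hW₀ hη (l := M) (by lia)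
    fun x hx => by
      have := (mem_primesIn.1 hx).1
      exact ⟨Nat.cast_le.2 this.1.le, by exact_mod_cast this.2⟩
  refine ⟨S, hS, X, r, hSn, ?_, hX, hX', ?_, fun p hp => ⟨(hSx p hp).1, (hSx p hp).2.1, ?_⟩⟩
  · have hK0 : (0 : ℝ) < K := Nat.cast_pos.2 (by positivity)
    have : ((#(primesIn M) : ℕ) : ℝ) ≤ K * #S := by
      rw [← Nat.cast_mul]; exact Nat.cast_le.2 hcard
    exact le_of_mul_le_mul_left ((hM.trans hc).trans this) hK0
  · obtain ⟨p, hp⟩ := hSn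
    have hpr := mem_primesIn.1 (hS hp)
    have : p.Coprime W₀ := (hpr.2.coprime_iff_not_dvd).2 fun h => absurd (Nat.le_of_dvd hW₀ h) (by lia)
    rw [← (hSx p hp).2.2, Nat.coprime_iff_gcd_eq_one, ← Nat.gcd_rec, Nat.gcd_comm]
    exact this
  · rw [← (hSx p hp).2.2]; exact (Nat.mod_modEq _ _).symm

variable {ι : Type} [Fintype ι] [DecidableEq ι]

lemma PairIndep.mul_pow {cls : ι → Bool} {C : ℝ} (hC : 0 ≤ C) {v v' : ι → ℤ} (h : PairIndep cls C v v') {k n u u' U : ℕ}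
    (hnk : n < k) (hu : 0 < u) (hu' : 0 < u') (hU : u ≤ U) (hU' : u' ≤ U) :
    PairIndep cls (C * U ^ (2 * k)) (fun i => v i * u ^ pairDeg k n (cls i))
      (fun i => v' i * u' ^ pairDeg k n (cls i)) := by
  intro i
  obtain ⟨m, w, w', hm, h1, h2, h3, h4⟩ := h i
  set d := pairDeg k n (cls i) with hd
  have hdk : d ≤ k := by
    rw [hd]; cases cls i <;> simp [pairDeg]; exact hnk.le
  have hU1 : (1 : ℝ) ≤ U := Nat.one_le_cast.2 (hu.trans_le hU)
  have hpow : ∀ x : ℕ, x ≤ U → (x : ℝ) ^ d ≤ U ^ k := fun x hx =>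
    (pow_le_pow_left₀ (Nat.cast_nonneg _) (Nat.cast_le.2 hx) d).trans (pow_le_pow_right₀ hU1 hdk)
  have hUk : (1 : ℝ) ≤ U ^ k := one_le_pow₀ hU1
  have hUU : (U : ℝ) ^ (2 * k) = U ^ k * U ^ k := by ring
  refine ⟨m * (u ^ d * u' ^ d), w * u' ^ d, w' * u ^ d, by positivity, ?_, ?_, ?_, fun i' hi' => ?_⟩
  · push_cast
    rw [abs_mul, abs_of_nonneg (by positivity : (0 : ℝ) ≤ (u : ℝ) ^ d * (u' : ℝ) ^ d), hUU]
    exact mul_le_mul h1 (mul_le_mul (hpow u hU) (hpow u' hU') (by positivity) (by positivity)) (by positivity) hC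
  · push_cast
    rw [abs_mul, abs_of_nonneg (by positivity : (0 : ℝ) ≤ (u' : ℝ) ^ d), hUU]
    exact mul_le_mul h2 ((hpow u' hU').trans (le_mul_of_one_le_right (by positivity) hUk)) (by positivity) hC
  · push_cast
    rw [abs_mul, abs_of_nonneg (by positivity : (0 : ℝ) ≤ (u : ℝ) ^ d), hUU]
    exact mul_le_mul h3 ((hpow u hU).trans (le_mul_of_one_le_right (by positivity) hUk)) (by positivity) hC
  · have := h4 i' hi'
    simp only [hi', ← hd]
    split_ifs at this ⊢ with hc
    · linear_combination ((u : ℤ) ^ d * (u' : ℤ) ^ d) * this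
    · linear_combination ((u : ℤ) ^ d * (u' : ℤ) ^ d) * this

lemma expS_singleton_product {k n : ℕ} {cls : ι → Bool} (v : ι → ℤ) (A : Finset ℕ) (α : ι → ℝ) :
    expS (({1} : Finset ℕ) ×ˢ A) (fun z => colMap k n cls v (z.1 * z.2)) α = expS A (colMap k n cls v) α := by
  simp only [expS, sum_product, sum_singleton, one_mul]

variable {F T₁ T₂ B ι₂ : Type} [Fintype F] [DecidableEq F] [Fintype T₁] [DecidableEq T₁] [Fintype T₂] [DecidableEq T₂]
  [Fintype B] [DecidableEq B] [Fintype ι₂] [DecidableEq ι₂] [Nonempty T₁] [Nonempty T₂]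

lemma prod_le_of_pairwise {x : B → ℝ} {Q Y σ : ℝ} (hQ : 0 < Q) (hY : 0 ≤ Y) (hx : ∀ g, 0 ≤ x g) (hxQ : ∀ g, x g ≤ Q)
    {m : ℕ} (hB : 2 * m ≤ Fintype.card B) (h : ∀ g g', g ≠ g' → x g / Q * (x g' / Q) ≤ Y ^ (-σ)) :
    ∏ g, x g ≤ Q ^ Fintype.card B * Y ^ (-σ * m) := by
  have := prod_le_pow_of_pairwise (x := fun g => x g / Q) (fun g => div_nonneg (hx g) hQ.le) m univ
    (fun g _ => (div_le_one hQ).2 (hxQ g)) (fun g _ g' _ => h g g') (by simpa using hB)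
  rw [prod_div_distrib, prod_const, card_univ, div_le_iff₀ (by positivity), ← Real.rpow_natCast,
    ← Real.rpow_mul hY] at this
  linarith

set_option maxHeartbeats 1000000 in
theorem hasMinorSaving {k n : ℕ} (hn : 0 < n) (hnk : n < k) {cls : ι → Bool} (hcls : Function.Surjective cls)
    (hι : Fintype.card ι ≤ 4) {C₀ : ℝ} (hC₀ : 1 ≤ C₀) (e₂ : ι₂ → Bool) {a : F ⊕ (T₁ ⊕ (T₂ ⊕ B)) → ι → ℤ}
    (ha : ∀ j i, a j i ≠ 0) (hpair : ∀ g g', g ≠ g' → PairIndep cls C₀ (a (.inr g)) (a (.inr g')))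
    (he₂ : ∀ g g', g ≠ g' → ∀ x, ∀ X Y : ℤ, (∀ i, cls i = e₂ x → a g i * X + a g' i * Y = 0) → Y = 0)
    (hD : ∑ i, pairDeg k n (cls i) = k + n + ∑ x, pairDeg k n (e₂ x)) {t₁ t₂ t m : ℕ} (ht : 1 ≤ t)
    (hT₁ : Fintype.card T₁ = 2 * t₁) (hT₂ : Fintype.card T₂ = 2 * t₂) (hB : 2 * m ≤ Fintype.card B) {M : ℕ → ℕ}
    (hM : Tendsto M atTop atTop) {Δ₁ Δ₂ Δ σ : ℝ} (h₁ : HasGoodSets (pairDeg k n) t₁ Δ₁ fun W => (M W : ℝ) ^ 4)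
    (h₂ : HasGoodSets (fun x => pairDeg k n (e₂ x)) t₂ Δ₂ fun W => (M W : ℝ) ^ 4)
    (h₃ : HasGoodSets (pairDeg k n) t Δ fun W => (M W : ℝ) ^ 3)
    (hσ : 0 ≤ 16 * t * σ + 3 * Δ) (hσ' : 16 * t * σ + 3 * Δ < 1 / 80) (hΔ : Δ₁ + Δ₂ < σ * m) :
    HasMinorSaving k n cls C₀ a := by
  intro W₀ hW₀ η hη
  set η' : ℝ := min 1 η / 3 with hη'
  have hη0 : 0 < η' := by positivity
  have hηη : (1 + η') ^ 2 ≤ 1 + η := by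
    have h1 : η' ≤ 1 / 3 := by rw [hη']; linarith [min_le_left 1 η]
    have h2 : η' ≤ η / 3 := by rw [hη']; linarith [min_le_right 1 η]
    nlinarith
  obtain ⟨c₁, D₁, hc₁, hD₁, h₁⟩ := h₁ W₀ hW₀ η hη
  obtain ⟨c₂, D₂, hc₂, hD₂, h₂⟩ := h₂ W₀ hW₀ η hη
  obtain ⟨c₃, D₃, hc₃, hD₃, h₃⟩ := h₃ W₀ hW₀ η' hη0
  refine ⟨min c₁ (min c₂ c₃), max D₁ (max D₂ (4 * D₃)), by positivity, by positivity, fun lam hlam U hU ε hε Y₀ => ?_⟩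
  set CU : ℝ := C₀ * U ^ (2 * k) with hCU
  have hCU1 : 1 ≤ CU := hC₀.trans (le_mul_of_one_le_right (by linarith) (one_le_pow₀ (Nat.one_le_cast.2 hU)))
  have hY : Tendsto (fun M : ℕ => (M : ℝ) ^ 4) atTop atTop :=
    (tendsto_pow_atTop (by norm_num)).comp tendsto_natCast_atTop_atTop
  set E : ℕ := ⌈(1 + η') * D₃⌉₊ + 1 with hE
  obtain ⟨W, ⟨⟨⟨hdec, hY₀⟩, hM1, hmin⟩, S, hSM, XS, rS, hSn, hS79, hXS, hXS', hrS, hSx⟩,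
      ⟨A₁, X₁, r₁, hA₁, hX₁, hX₁', hr₁, hAx₁, hmv₁⟩, ⟨A₂, X₂, r₂, hA₂, hX₂, hX₂', hr₂, hAx₂, hmv₂⟩,
      A, XA, rA, hA, hXA, hXA', hrA, hAx, hmv⟩ := (((hM.eventually
      ((((hY.eventually (eventually_const_mul_rpow_le hΔ
          (Fintype.card T₁ * Fintype.card T₂ * lam ^ (∑ i, pairDeg k n (cls i)) / ε))).and (hY.eventually_ge_atTop Y₀)).and
        ((eventually_ge_atTop 1).and (eventually_mul_le_of_not_majorAt hn hnk cls hι hCU1 hlam ht (E := E)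
          (by lia) hσ hσ'))).and (eventually_exists_good_primes hW₀ hη0))).and (h₁.and (h₂.and h₃)))).exists
  set Y : ℝ := (M W : ℝ) ^ 4 with hYdef
  have hM0 : (1 : ℝ) ≤ M W := Nat.one_le_cast.2 hM1
  have hY1 : 1 ≤ Y := one_le_pow₀ hM0
  have hY0 : 0 < Y := by linarith
  have hYS : Y = M W * (M W : ℝ) ^ 3 := by rw [hYdef]; ring
  have hXA0 : 0 < XA := lt_of_lt_of_le (by positivity) hXA
  have hq : (0 : ℝ) < #S * #A := mul_pos (Nat.cast_pos.2 hSn.card_pos) (Nat.cast_pos.2 hA.card_pos)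
  refine ⟨Y, hY₀, Sum.elim (fun _ => {1} ×ˢ A₁) (Sum.elim (fun _ => {1} ×ˢ A₂) fun _ => S ×ˢ A),
    Sum.elim (fun _ => X₁) (Sum.elim (fun _ => X₂) fun _ => XS * XA),
    Sum.elim (fun _ => r₁) (Sum.elim (fun _ => r₂) fun _ => rS * rA), ?_, fun u hu l v hv => ?_⟩
  · have hmin₁ : min c₁ (min c₂ c₃) * Y ≤ c₁ * Y := mul_le_mul_of_nonneg_right (min_le_left _ _) hY0.le
    have hmin₂ : min c₁ (min c₂ c₃) * Y ≤ c₂ * Y :=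
      mul_le_mul_of_nonneg_right ((min_le_right _ _).trans (min_le_left _ _)) hY0.le
    have hmin₃ : min c₁ (min c₂ c₃) * Y ≤ c₃ * Y :=
      mul_le_mul_of_nonneg_right ((min_le_right _ _).trans (min_le_right _ _)) hY0.le
    have hmax₁ : D₁ * Y ≤ max D₁ (max D₂ (4 * D₃)) * Y := mul_le_mul_of_nonneg_right (le_max_left _ _) hY0.le
    have hmax₂ : D₂ * Y ≤ max D₁ (max D₂ (4 * D₃)) * Y :=
      mul_le_mul_of_nonneg_right ((le_max_left _ _).trans (le_max_right _ _)) hY0.le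
    have hmax₃ : 4 * D₃ * Y ≤ max D₁ (max D₂ (4 * D₃)) * Y :=
      mul_le_mul_of_nonneg_right ((le_max_right _ _).trans (le_max_right _ _)) hY0.le
    rintro (g | g | g)
    · refine ⟨(singleton_nonempty 1).product hA₁, hmin₁.trans hX₁, hX₁'.trans hmax₁, hr₁, fun z hz => ?_⟩
      obtain ⟨hz1, hz2⟩ := mem_product.1 hz
      simpa [mem_singleton.1 hz1] using hAx₁ _ hz2
    · refine ⟨(singleton_nonempty 1).product hA₂, hmin₂.trans hX₂, hX₂'.trans hmax₂, hr₂, fun z hz => ?_⟩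
      obtain ⟨hz1, hz2⟩ := mem_product.1 hz
      simpa [mem_singleton.1 hz1] using hAx₂ _ hz2
    · refine ⟨hSn.product hA, hmin₃.trans ?_, le_trans ?_ hmax₃, hrS.mul_left hrA, fun z hz => ?_⟩
      · rw [hYS, mul_left_comm]; exact mul_le_mul hXS hXA (by positivity) (by linarith)
      · rw [hYS]; exact (mul_le_mul hXS' hXA' hXA0.le (by positivity)).trans (le_of_eq (by ring))
      · obtain ⟨hz1, hz2⟩ := mem_product.1 hz
        obtain ⟨h1, h2, h3⟩ := hSx _ hz1
        obtain ⟨h4, h5, h6⟩ := hAx _ hz2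
        have hXS0 : 0 < XS := by linarith
        push_cast
        refine ⟨mul_le_mul h1 h4 hXA0.le (by positivity), ?_, h3.mul h6⟩
        calc (z.1 * z.2 : ℝ) ≤ (1 + η') * XS * ((1 + η') * XA) := mul_le_mul h2 h5 (by positivity) (by positivity)
          _ = (1 + η') ^ 2 * (XS * XA) := by ring
          _ ≤ _ := mul_le_mul_of_nonneg_right hηη (by positivity)
  set w : T₁ ⊕ (T₂ ⊕ B) → ι → ℤ := fun g i => a (.inr g) i * u g ^ pairDeg k n (cls i) with hw
  have hw0 : ∀ g i, w g i ≠ 0 := fun g i =>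
    mul_ne_zero (ha _ i) (pow_ne_zero _ (by exact_mod_cast (hu g).1.ne'))
  have hwp : ∀ g g', g ≠ g' → PairIndep cls CU (w g) (w g') := fun g g' hg =>
    (hpair g g' hg).mul_pow (by linarith) hnk (hu g).1 (hu g').1 (hu g).2 (hu g').2
  have hmean := fun (j : T₁) (j' : T₂) => eventually_expect_mean_le (k := k) (n := n) (hw0 (.inl j)) (v' := w (.inr (.inl j'))) hcls (e := e₂)
    (fun x X X' h => by
      have : (u (.inr (.inl j')) : ℤ) ^ pairDeg k n (e₂ x) * X' = 0 :=
        he₂ (.inr (.inl j)) (.inr (.inr (.inl j'))) (by simp) x (u (.inl j) ^ pairDeg k n (e₂ x) * X) _ fun i hi => by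
          have := h i hi
          simp only [hw, hi] at this
          linear_combination this
      exact (mul_eq_zero.1 this).resolve_left (pow_ne_zero _ (by exact_mod_cast (hu _).1.ne'))) t₁ t₂ A₁ A₂
  set P : ℝ := lam * Y with hP
  have hP0 : 0 < P := by positivity
  set Kc : ℝ := P ^ Fintype.card F * ((#S * #A : ℝ) ^ Fintype.card B * Y ^ (-σ * m)) with hKc
  have hKc0 : 0 ≤ Kc := by positivity
  filter_upwards [eventually_all.2 fun j => eventually_all.2 (hmean j)] with N hN
  classical
  have hpt : ∀ α, (if MajorAt k n cls CU P α then 0 else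
      (∏ f, ‖expS (Ico (l f) (v f)) (colMap k n cls (a (.inl f))) α‖) *
      ∏ g, ‖expS (Sum.elim (fun _ => {1} ×ˢ A₁) (Sum.elim (fun _ => {1} ×ˢ A₂) fun _ => S ×ˢ A) g)
        (fun z => colMap k n cls (w g) (z.1 * z.2)) α‖) ≤
      Kc * ∑ j, ∑ j', ‖expS A₁ (colMap k n cls (w (.inl j))) α‖ ^ (2 * t₁) *
        ‖expS A₂ (colMap k n cls (w (.inr (.inl j')))) α‖ ^ (2 * t₂) := by
    intro α
    split_ifs with hα
    · positivity
    rw [Fintype.prod_sum_type, Fintype.prod_sum_type]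
    simp only [Sum.elim_inl, Sum.elim_inr, expS_singleton_product]
    have e1 : ∏ f, ‖expS (Ico (l f) (v f)) (colMap k n cls (a (.inl f))) α‖ ≤ P ^ Fintype.card F := by
      refine (prod_le_prod (fun f _ => norm_nonneg _) fun f _ => (norm_expS_le _ _ _).trans (le_trans ?_ (hv f))).trans_eq
        (by rw [prod_const, card_univ])
      exact Nat.cast_le.2 (by simp)
    have e2 : ∏ g : B, ‖expS (S ×ˢ A) (fun z => colMap k n cls (w (.inr (.inr g))) (z.1 * z.2)) α‖ ≤
        (#S * #A : ℝ) ^ Fintype.card B * Y ^ (-σ * m) := by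
      refine prod_le_of_pairwise hq hY0.le (fun g => norm_nonneg _) (fun g => (norm_expS_le _ _ _).trans_eq
        (by rw [card_product]; push_cast; rfl)) hB fun g g' hg => ?_
      refine hmin S hSM A hA hS79 (fun y hy => ?_) hmv P (by nlinarith) ?_ le_rfl _ _ (hwp _ _ (by simpa using hg)) α hα
      · have h1 : (y : ℝ) ≤ (1 + η') * (D₃ * (M W : ℝ) ^ 3) :=
          (hAx y hy).2.1.trans (mul_le_mul_of_nonneg_left hXA' (by positivity))
        have h2 : (1 + η') * D₃ ≤ E := by rw [hE]; push_cast; linarith [Nat.le_ceil ((1 + η') * D₃)]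
        have h3 : (y : ℝ) ≤ E * (M W : ℝ) ^ 3 := by nlinarith [pow_pos (zero_lt_one.trans_le hM0) 3]
        exact_mod_cast h3
      · rw [hP]; nlinarith [mul_pos (zero_lt_one.trans_le hlam) hY0]
    have e3 : (∏ j, ‖expS A₁ (colMap k n cls (w (.inl j))) α‖) * ∏ j, ‖expS A₂ (colMap k n cls (w (.inr (.inl j)))) α‖ ≤
        ∑ j, ∑ j', ‖expS A₁ (colMap k n cls (w (.inl j))) α‖ ^ (2 * t₁) *
          ‖expS A₂ (colMap k n cls (w (.inr (.inl j')))) α‖ ^ (2 * t₂) := by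
      rw [← sum_mul_sum, ← hT₁, ← hT₂]
      gcongr
      · exact prod_le_sum_pow fun _ => norm_nonneg _
      · exact prod_le_sum_pow fun _ => norm_nonneg _
    calc _ = (∏ f, ‖expS (Ico (l f) (v f)) (colMap k n cls (a (.inl f))) α‖) *
          (∏ g : B, ‖expS (S ×ˢ A) (fun z => colMap k n cls (w (.inr (.inr g))) (z.1 * z.2)) α‖) *
          ((∏ j, ‖expS A₁ (colMap k n cls (w (.inl j))) α‖) * ∏ j, ‖expS A₂ (colMap k n cls (w (.inr (.inl j)))) α‖) := by
          ring
      _ ≤ _ := mul_le_mul (mul_le_mul e1 e2 (by positivity) (by positivity)) e3 (by positivity) hKc0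
  refine (expect_le_expect fun α _ => hpt α).trans ?_
  rw [← mul_expect, expect_sum_comm]
  simp_rw [expect_sum_comm]
  refine (mul_le_mul_of_nonneg_left (sum_le_sum fun j _ => sum_le_sum fun j' _ => hN j j') hKc0).trans ?_
  rw [prod_pow_eq_pow_sum, ← mul_div_assoc, le_div_iff₀ (by positivity)]
  simp only [sum_const, card_univ, nsmul_eq_mul, Fintype.prod_sum_type, Sum.elim_inl, Sum.elim_inr, prod_const,
    card_product, card_singleton, one_mul, ← Nat.cast_mul]
  push_cast
  set D := ∑ i, pairDeg k n (cls i) with hDdef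
  have hsplit : P ^ D = lam ^ D * (Y ^ (k + n) * Y ^ (∑ x, pairDeg k n (e₂ x))) := by
    rw [hP, _root_.mul_pow, ← pow_add, ← hD]
  have hk : ∑ i, pairDeg k n i = k + n := by simp [pairDeg]
  rw [hk] at hmv₁
  have hdec' : Fintype.card T₁ * Fintype.card T₂ * lam ^ D * Y ^ (Δ₁ + Δ₂) * Y ^ (-σ * m) ≤ ε := by
    have h0 : (0 : ℝ) < Y ^ (σ * m) := Real.rpow_pos_of_pos hY0 _
    rw [neg_mul, Real.rpow_neg hY0.le, ← div_eq_mul_inv, div_le_iff₀ h0]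
    have := mul_le_mul_of_nonneg_left hdec hε.le
    rwa [← mul_assoc, mul_div_cancel₀ _ hε.ne'] at this
  set Q := (#S * #A : ℝ) ^ Fintype.card B with hQ
  calc _ = P ^ Fintype.card F * Q * (Fintype.card T₁ * Fintype.card T₂ * lam ^ D * Y ^ (-σ * m)) *
        ((mv t₁ A₁ (mono (pairDeg k n)) * Y ^ (k + n)) *
          (mv t₂ A₂ (mono fun x => pairDeg k n (e₂ x)) * Y ^ (∑ x, pairDeg k n (e₂ x)))) := by
        rw [hKc, hsplit]; ring
    _ ≤ P ^ Fintype.card F * Q * (Fintype.card T₁ * Fintype.card T₂ * lam ^ D * Y ^ (-σ * m)) *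
        (((#A₁ : ℝ) ^ (2 * t₁) * Y ^ Δ₁) * ((#A₂ : ℝ) ^ (2 * t₂) * Y ^ Δ₂)) := by
        gcongr
    _ = P ^ Fintype.card F * Q * ((#A₁ : ℝ) ^ (2 * t₁) * (#A₂ : ℝ) ^ (2 * t₂)) *
        (Fintype.card T₁ * Fintype.card T₂ * lam ^ D * Y ^ (Δ₁ + Δ₂) * Y ^ (-σ * m)) := by
        rw [Real.rpow_add hY0]; ring
    _ ≤ P ^ Fintype.card F * Q * ((#A₁ : ℝ) ^ (2 * t₁) * (#A₂ : ℝ) ^ (2 * t₂)) * ε :=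
        mul_le_mul_of_nonneg_left hdec' (by positivity)
    _ = _ := by rw [hT₁, hT₂]; ring

end MinorSaving

lemma hasGoodSets_of_levelBlock {κ : Type} [Fintype κ] [DecidableEq κ] {d : κ → ℕ} {k b ν D t₀ v : ℕ}
    (hLB : LevelBlock d k b ν) (hD : ν + D = k * b) (ht₀ : D + 1 ≤ t₀) (hk : 2 ≤ k) {Δ : ℝ}
    (hΔ : (D + 2 * (t₀ + b * v : ℕ)) * (((k : ℝ) - 1) / k) ^ v < Δ) (hd : ∑ i, d i = D) {Z : ℕ → ℕ}
    (hZ : Tendsto Z atTop atTop) : HasGoodSets d (t₀ + b * v) Δ fun W => (Z W : ℝ) ^ k ^ v := by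
  intro W₀ hW₀ η hη
  obtain ⟨c, C, hc, hC, Z₀, h⟩ := exists_good_set hLB hD ht₀ hk v hΔ hW₀ hη
  refine ⟨c, C, hc, hC, (hZ.eventually_ge_atTop Z₀).mono fun W hW => ?_⟩
  rw [hd]; exact h _ hW

section Concrete

variable {ι J : Type} [Fintype ι] [DecidableEq ι] [Fintype J] [DecidableEq J]

/-- Each class of equations has one or two members; if it has two, all `2 × 2` minors are nonzero. -/
def ClassMinors (cls : ι → Bool) (a : J → ι → ℤ) (b : Bool) (i₁ i₂ : ι) : Prop :=
  (∀ i, cls i = b ↔ i = i₁ ∨ i = i₂) ∧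
    (i₁ ≠ i₂ → ∀ j j', j ≠ j' → a j i₁ * a j' i₂ - a j i₂ * a j' i₁ ≠ 0)

lemma exists_pairIndep {cls : ι → Bool} {a : J → ι → ℤ} (ha : ∀ j i, a j i ≠ 0)
    (h : ∀ b, ∃ i₁ i₂, ClassMinors cls a b i₁ i₂) :
    ∃ C₀ : ℝ, 1 ≤ C₀ ∧ (∀ j i, |(a j i : ℝ)| ≤ C₀) ∧ ∀ j j', j ≠ j' → PairIndep cls C₀ (a j) (a j') := by
  set S : ℝ := 1 + ∑ j, ∑ i, |(a j i : ℝ)| with hS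
  have hS1 : 1 ≤ S := le_add_of_nonneg_right (by positivity)
  have haS : ∀ j i, |(a j i : ℝ)| ≤ S := fun j i => by
    have h1 := single_le_sum (f := fun i => |(a j i : ℝ)|) (fun _ _ => abs_nonneg _) (mem_univ i)
    have h2 := single_le_sum (f := fun j => ∑ i, |(a j i : ℝ)|) (fun _ _ => by positivity) (mem_univ j)
    linarith
  have hSS : S ≤ 2 * S ^ 2 := by nlinarith
  have haC : ∀ j i, |(a j i : ℝ)| ≤ 2 * S ^ 2 := fun j i => (haS j i).trans hSS
  have hdet : ∀ j j' i i', |(a j i : ℝ) * a j' i' - a j i' * a j' i| ≤ 2 * S ^ 2 := fun j j' i i' => by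
    refine (abs_sub _ _).trans ?_
    rw [abs_mul, abs_mul]
    have := mul_le_mul (haS j i) (haS j' i') (abs_nonneg _) (by linarith)
    have := mul_le_mul (haS j i') (haS j' i) (abs_nonneg _) (by linarith)
    linarith
  refine ⟨2 * S ^ 2, hS1.trans hSS, haC, fun j j' hj i => ?_⟩
  obtain ⟨i₁, i₂, hcls, hmin⟩ := h (cls i)
  by_cases h12 : i₁ = i₂
  · subst h12
    refine ⟨a j i, 1, 0, ha j i, haC j i, by simpa using hS1.trans hSS, by simp; positivity, fun i' hi' => ?_⟩
    have h1 := (hcls i').1 hi'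
    have h2 := (hcls i).1 rfl
    rw [or_self] at h1 h2
    subst h1 h2; simp
  · have hne := hmin h12 j j' hj
    rcases (hcls i).1 rfl with rfl | rfl
    · refine ⟨_, a j' i₂, -a j i₂, hne, by push_cast; exact hdet j j' i i₂, haC _ _,
        by push_cast; rw [abs_neg]; exact haC _ _, fun i' hi' => ?_⟩
      rcases (hcls i').1 hi' with rfl | rfl
      · simp; ring
      · rw [if_neg (Ne.symm h12)]; ring
    · refine ⟨_, -a j' i₁, a j i₁, hne, by push_cast; exact hdet j j' i₁ i,
        by push_cast; rw [abs_neg]; exact haC _ _, haC _ _, fun i' hi' => ?_⟩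
      rcases (hcls i').1 hi' with rfl | rfl
      · rw [if_neg h12]; ring
      · simp; ring

lemma blockIndep_of_classMinors {cls : ι → Bool} {a : J → ι → ℤ} (ha : ∀ j i, a j i ≠ 0)
    (h : ∀ b, ∃ i₁ i₂, ClassMinors cls a b i₁ i₂) : BlockIndep cls a := by
  intro K _ _ e he w b hw i hi
  obtain ⟨i₁, i₂, hcls, hmin⟩ := h b
  have hfil : univ.filter (fun i => cls i = b) = {i₁, i₂} := by ext i; simp [hcls]
  rw [hfil] at hw
  by_cases h12 : i₁ = i₂
  · subst h12
    obtain rfl : i = i₁ := by simpa using (hcls i).1 hi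
    have := hw i hi
    simp only [pair_eq_singleton, sum_singleton, mul_eq_zero, Int.cast_eq_zero] at this
    exact this.resolve_left (ha _ _)
  · have hdet : (a (e i₁) i₁ * a (e i₂) i₂ - a (e i₁) i₂ * a (e i₂) i₁ : K) ≠ 0 := by
      exact_mod_cast hmin h12 _ _ (he.ne h12)
    have e1 := hw i₁ ((hcls _).2 (.inl rfl))
    have e2 := hw i₂ ((hcls _).2 (.inr rfl))
    rw [sum_pair h12] at e1 e2
    rcases (hcls i).1 hi with rfl | rfl
    · exact (mul_eq_zero.1 (by linear_combination (a (e i₂) i₂ : K) * e1 - (a (e i₂) i : K) * e2)).resolve_left hdet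
    · exact (mul_eq_zero.1 (by linear_combination (a (e i₁) i₁ : K) * e2 - (a (e i₁) i : K) * e1)).resolve_left hdet

/-- A zero of full rank of the additive system with columns `a`, over the field `K`. -/
def IsNonsingZero {K : Type} [Field K] (d : ι → ℕ) (a : J → ι → ℤ) (ξ : J → K) : Prop :=
  (∀ i, sysVal d a ξ i = 0) ∧
    (Matrix.of fun i j => (d i : K) * a j i * ξ j ^ (d i - 1)).rank = Fintype.card ι

lemma sysVal_comp_equiv {R J' : Type} [CommRing R] [Fintype J'] (d : ι → ℕ) (a : J → ι → ℤ) (ξ : J → R) (e : J' ≃ J) (i : ι) :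
    sysVal d (fun j => a (e j)) (fun j => ξ (e j)) i = sysVal d a ξ i :=
  e.sum_comp fun j => (a j i : R) * ξ j ^ d i

lemma IsNonsingZero.comp_equiv {K J' : Type} [Field K] [Fintype J'] {d : ι → ℕ} {a : J → ι → ℤ} {ξ : J → K}
    (h : IsNonsingZero d a ξ) (e : J' ≃ J) : IsNonsingZero d (fun j => a (e j)) fun j => ξ (e j) := by
  refine ⟨fun i => (sysVal_comp_equiv d a ξ e i).trans (h.1 i), ?_⟩
  rw [← h.2, ← Matrix.rank_submatrix _ (Equiv.refl ι) e]
  rfl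

/-- The arithmetic conditions on the parameters under which the circle method succeeds. -/
theorem exists_pos_solution_of_params {k n : ℕ} (hn : 0 < n) (hnk : n < k) {cls : ι → Bool}
    (hcls : Function.Surjective cls) (hι : Fintype.card ι ≤ 4) {a : J → ι → ℤ} (ha : ∀ j i, a j i ≠ 0)
    (hmin : ∀ b, ∃ i₁ i₂, ClassMinors cls a b i₁ i₂) {ι₂ : Type} [Fintype ι₂] [DecidableEq ι₂] (e₂ : ι₂ → Bool)
    (he₂ : ∀ x, ∃ i₁ i₂, i₁ ≠ i₂ ∧ ClassMinors cls a (e₂ x) i₁ i₂)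
    (hD : ∑ i, pairDeg k n (cls i) = k + n + ∑ x, pairDeg k n (e₂ x)) {t₁ t₂ m : ℕ} (ht₁ : 1 ≤ t₁) (ht₂ : 1 ≤ t₂)
    {M : ℕ → ℕ} (hM : Tendsto M atTop atTop) {Δ σ : ℝ} (h₁ : HasGoodSets (pairDeg k n) t₁ Δ fun W => (M W : ℝ) ^ 4)
    (h₂ : HasGoodSets (fun x => pairDeg k n (e₂ x)) t₂ Δ fun W => (M W : ℝ) ^ 4)
    (h₃ : HasGoodSets (pairDeg k n) t₁ Δ fun W => (M W : ℝ) ^ 3)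
    (hσ : 0 ≤ 16 * t₁ * σ + 3 * Δ) (hσ' : 16 * t₁ * σ + 3 * Δ < 1 / 80) (hΔ : 2 * Δ < σ * m)
    (hs : 8 * k * (2 * Fintype.card ι + 3) + (2 * t₁ + (2 * t₂ + 2 * m)) ≤ Fintype.card J)
    (hreal : ∃ ξ : J → ℝ, (∀ j, 0 < ξ j) ∧ IsNonsingZero (fun i => pairDeg k n (cls i)) a ξ)
    (hp : ∀ (p : ℕ) [Fact p.Prime], ∃ ξ : J → ℚ_[p], IsNonsingZero (fun i => pairDeg k n (cls i)) a ξ) :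
    ∃ x : J → ℤ, (∀ j, 0 < x j) ∧ ∀ i, sysVal (fun i => pairDeg k n (cls i)) a x i = 0 := by
  obtain ⟨C₀, hC₀, haC, hpair⟩ := exists_pairIndep ha hmin
  set f := 8 * k * (2 * Fintype.card ι + 3) with hf
  obtain ⟨b, hb⟩ := Nat.exists_eq_add_of_le hs
  have : Nonempty (Fin (2 * t₁)) := ⟨⟨0, by lia⟩⟩
  have : Nonempty (Fin (2 * t₂)) := ⟨⟨0, by lia⟩⟩
  obtain ⟨e⟩ : Nonempty (Fin f ⊕ (Fin (2 * t₁) ⊕ (Fin (2 * t₂) ⊕ Fin (2 * m + b))) ≃ J) :=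
    Fintype.card_eq.1 (by simp only [Fintype.card_sum, Fintype.card_fin]; lia)
  have hne : ∀ {g g'}, g ≠ g' → e g ≠ e g' := fun h => e.injective.ne h
  obtain ⟨ξ, hξ0, hξ⟩ := hreal
  obtain ⟨x, hx0, hx⟩ := exists_pos_solution (a := fun j => a (e j)) hn hnk hC₀ (fun f i => haC _ i)
    (fun f f' h => hpair _ _ (hne (by simpa using h))) (by simp [hf])
    (blockIndep_of_classMinors (fun j => ha (e j)) fun b => by
      obtain ⟨i₁, i₂, h1, h2⟩ := hmin b
      exact ⟨i₁, i₂, h1, fun h j j' hj => h2 h _ _ (hne hj)⟩)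
    ⟨fun j => ξ (e j), fun j => hξ0 _, hξ.comp_equiv e⟩
    (fun p _ => by
      obtain ⟨ξ, hξ⟩ := hp p
      exact ⟨_, hξ.comp_equiv e⟩)
    (hasMinorSaving hn hnk hcls hι hC₀ e₂ (fun j => ha (e j)) (fun g g' h => hpair _ _ (hne (by simpa using h)))
      (fun g g' hg x X Y h => by
        obtain ⟨i₁, i₂, hi, h1, h2⟩ := he₂ x
        have e1 := h i₁ ((h1 _).2 (.inl rfl))
        have e2 := h i₂ ((h1 _).2 (.inr rfl))
        exact (mul_eq_zero.1 (by linear_combination a (e g) i₁ * e2 - a (e g) i₂ * e1)).resolve_left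
          (h2 hi _ _ (hne hg))) hD ht₁ (m := m) (by simp) (by simp) (by simp) hM h₁ h₂ h₃ hσ hσ' (by linarith))
  refine ⟨fun j => x (e.symm j), fun j => hx0 _, fun i => ?_⟩
  rw [← sysVal_comp_equiv _ _ _ e]
  simpa using hx i

end Concrete

lemma sub_one_div_pow_le {d v : ℕ} (hd : 1 ≤ d) {L C : ℝ} (hL : 0 < L)
    (hv : d * (Real.log d + Real.log L + C) ≤ v) : (((d : ℝ) - 1) / d) ^ v ≤ Real.exp (-C) / (d * L) := by
  have hd0 : (0 : ℝ) < d := Nat.cast_pos.2 hd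
  have h1 : ((d : ℝ) - 1) / d ≤ Real.exp (-(1 / d)) := by
    have := Real.one_sub_le_exp_neg (1 / (d : ℝ))
    rwa [one_sub_div hd0.ne'] at this
  calc _ ≤ Real.exp (-(1 / d)) ^ v :=
        pow_le_pow_left₀ (div_nonneg (sub_nonneg.2 (Nat.one_le_cast.2 hd)) hd0.le) h1 v
    _ = Real.exp (-(v / d)) := by rw [← Real.exp_nat_mul]; congr 1; ring
    _ ≤ Real.exp (-(Real.log d + Real.log L + C)) := by
        rw [Real.exp_le_exp, neg_le_neg_iff, le_div_iff₀ hd0]; linarith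
    _ = _ := by
        rw [← Real.log_mul hd0.ne' hL.ne', neg_add, Real.exp_add, Real.exp_neg, Real.exp_log (by positivity)]
        ring

set_option maxHeartbeats 1000000 in
lemma eventually_exists_params {ε : ℝ} (hε : 0 < ε) : ∀ᶠ k : ℕ in atTop, ∀ n : ℕ, 2 ≤ n → n < k →
    ∃ (v₁ v₂ m : ℕ) (σ μ : ℝ), 0 ≤ 16 * (k + n + 1 + 2 * v₁ : ℕ) * σ + 3 * μ ∧
      16 * (k + n + 1 + 2 * v₁ : ℕ) * σ + 3 * μ < 1 / 80 ∧ 2 * μ < σ * m ∧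
      ((k + n : ℕ) + 2 * (k + n + 1 + 2 * v₁ : ℕ)) * (((k : ℝ) - 1) / k) ^ v₁ < μ ∧
      (k + 2 * (k + 1 + 1 * v₁ : ℕ)) * (((k : ℝ) - 1) / k) ^ v₁ < μ ∧
      (n + 2 * (n + 1 + 1 * v₂ : ℕ)) * (((n : ℝ) - 1) / n) ^ v₂ < μ ∧
      (88 * k + (2 * (k + n + 1 + 2 * v₁) + (2 * (k + 1 + 1 * v₁) + 2 * m)) : ℕ) ≤ (6 + ε) * k * Real.log k ∧
      (88 * k + (2 * (k + n + 1 + 2 * v₁) + (2 * (k + n + 1 + 2 * v₁) + 2 * m)) : ℕ) ≤ (8 + ε) * k * Real.log k ∧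
      (88 * k + (2 * (k + n + 1 + 2 * v₁) + (2 * (n + 1 + 1 * v₂) + 2 * m)) : ℕ) ≤
        (4 + ε) * k * Real.log k + 2 * n * Real.log n := by
  set δ : ℝ := min 1 ε / 8 with hδ
  have hδ0 : 0 < δ := by positivity
  have hδ1 : δ ≤ 1 / 8 := by rw [hδ]; linarith [min_le_left 1 ε]
  have hδε : 8 * δ ≤ ε := by rw [hδ]; linarith [min_le_right 1 ε]
  set μ : ℝ := δ / 40000 with hμ
  have hμ0 : 0 < μ := by positivity
  set C : ℝ := 7 / μ with hC
  have hC0 : 0 < C := by positivity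
  have hexp : 7 * Real.exp (-C) < μ := by
    have h1 := Real.add_one_le_exp C
    have h2 : μ * C = 7 := mul_div_cancel₀ _ hμ0.ne'
    rw [Real.exp_neg, ← div_eq_mul_inv, div_lt_iff₀ (Real.exp_pos C)]
    nlinarith
  have hlog : Tendsto (fun k : ℕ => Real.log k) atTop atTop := Real.tendsto_log_atTop.comp tendsto_natCast_atTop_atTop
  have hll : ∀ᶠ L : ℝ in atTop, Real.log L ≤ δ / 8 * L := by
    filter_upwards [Real.isLittleO_log_id_atTop.bound (show 0 < δ / 8 by positivity), eventually_ge_atTop 1] with L h h1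
    rw [Real.norm_of_nonneg (Real.log_nonneg h1), id, Real.norm_of_nonneg (by linarith)] at h
    exact h
  filter_upwards [hlog.eventually hll, hlog.eventually_ge_atTop 1,
    hlog.eventually_ge_atTop ((88 + 4 * C) * 2 / δ)] with k hk1 hL1 hk2 n hn hnk
  set L := Real.log k with hL
  set ℓ := Real.log L with hℓ
  have hℓ0 : 0 ≤ ℓ := Real.log_nonneg hL1
  have hsm : 88 + 4 * C + 4 * ℓ ≤ δ * L := by
    rw [div_le_iff₀ hδ0] at hk2; linarith
  have hn2 : (2 : ℝ) ≤ n := by exact_mod_cast hn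
  have hnk' : (n : ℝ) + 1 ≤ k := by exact_mod_cast hnk
  have hln0 : 0 ≤ Real.log n := Real.log_nonneg (by linarith)
  have hlnL : Real.log n ≤ L := Real.log_le_log (by linarith) (by linarith)
  set T : ℝ := k * L with hT
  have hkT : (k : ℝ) ≤ T := le_mul_of_one_le_right (by linarith) hL1
  have hksm : k * (88 + 4 * C + 4 * ℓ) ≤ δ * T := by
    rw [hT, mul_left_comm]; exact mul_le_mul_of_nonneg_left hsm (by linarith)
  have hT0 : 0 < T := by linarith
  have hkC : 0 ≤ k * C := by positivity
  have hkℓ : 0 ≤ k * ℓ := by positivity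
  have hnC : n * C ≤ k * C := mul_le_mul_of_nonneg_right (by linarith) hC0.le
  have hnℓ : n * ℓ ≤ k * ℓ := mul_le_mul_of_nonneg_right (by linarith) hℓ0
  set x₁ : ℝ := k * (L + ℓ + C) with hx₁
  set x₂ : ℝ := n * (Real.log n + ℓ + C) with hx₂
  have hv₁ := (Nat.ceil_lt_add_one (show 0 ≤ x₁ by positivity)).le
  have hv₂ := (Nat.ceil_lt_add_one (show 0 ≤ x₂ by positivity)).le
  have hm := Nat.floor_le (show 0 ≤ δ * T by positivity)
  have hm' := (Nat.lt_floor_add_one (δ * T)).le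
  have hρ₁ := sub_one_div_pow_le (d := k) (C := C) (by lia) (by linarith) (Nat.le_ceil x₁)
  have hρ₂ := sub_one_div_pow_le (d := n) (C := C) (by lia) (by linarith) (Nat.le_ceil x₂)
  have hx₁' : x₁ = T + k * ℓ + k * C := by rw [hx₁, hT]; ring
  have hx₂' : x₂ = n * Real.log n + n * ℓ + n * C := by rw [hx₂]; ring
  set v₁ := ⌈x₁⌉₊
  set v₂ := ⌈x₂⌉₊
  set m := ⌊δ * T⌋₊
  have ht₁ : 2 * ((k : ℝ) + n + 1 + 2 * v₁) ≤ 4 * T + δ * T - 80 * k := by linarith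
  have hkey : ∀ {d : ℕ} {x : ℝ} {v : ℕ}, 0 < d → x ≤ 7 * (d * L) →
      (((d : ℝ) - 1) / d) ^ v ≤ Real.exp (-C) / (d * L) → x * (((d : ℝ) - 1) / d) ^ v < μ := fun {d x v} hd hx h => by
    have hd0 : (0 : ℝ) < d := Nat.cast_pos.2 hd
    have hdL : 0 < d * L := by positivity
    have hp : 0 ≤ (((d : ℝ) - 1) / d) ^ v := pow_nonneg (div_nonneg (sub_nonneg.2 (Nat.one_le_cast.2 hd)) hd0.le) v
    refine lt_of_le_of_lt ?_ hexp
    calc _ ≤ 7 * (d * L) * (Real.exp (-C) / (d * L)) := mul_le_mul hx h hp (by positivity)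
      _ = _ := by field_simp
  have hδT : δ * T ≤ T / 8 := by nlinarith
  refine ⟨v₁, v₂, m, 1 / (7680 * T), μ, by positivity, ?_, ?_, hkey (by lia) ?_ hρ₁, hkey (by lia) ?_ hρ₁,
    hkey (by lia) ?_ hρ₂, ?_, ?_, ?_⟩
  · have : 16 * ((k + n + 1 + 2 * v₁ : ℕ) : ℝ) * (1 / (7680 * T)) ≤ 1 / 160 := by
      rw [mul_one_div, div_le_iff₀ (by positivity)]; push_cast; linarith
    linarith
  · rw [one_div_mul_eq_div, lt_div_iff₀ (by positivity), hμ]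
    have : 88 ≤ δ * T := by nlinarith
    linarith
  · push_cast; linarith
  · push_cast; linarith
  · push_cast
    have := mul_le_mul_of_nonneg_left hlnL (by linarith : (0 : ℝ) ≤ n)
    have := mul_le_mul_of_nonneg_left hsm (by linarith : (0 : ℝ) ≤ n)
    have : n * (δ * L) ≤ n * L := mul_le_mul_of_nonneg_left (by nlinarith) (by linarith)
    have : 0 ≤ n * ℓ := by positivity
    have : 0 ≤ n * C := by positivity
    nlinarith
  all_goals
    have := mul_le_mul_of_nonneg_right hδε hT0.le
    push_cast
    rw [mul_assoc _ (k : ℝ), ← hT]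
    linarith

lemma isNonsingZero_sumElim {K : Type} [Field K] {p q s k n : ℕ} {c : Fin p → Fin s → ℤ} {b : Fin q → Fin s → ℤ}
    {x : Fin s → K} (hc : ∀ i, ∑ j, (c i j : K) * x j ^ k = 0) (hb : ∀ i, ∑ j, (b i j : K) * x j ^ n = 0)
    (hr : (Matrix.of fun (i : Fin p ⊕ Fin q) (j : Fin s) => Sum.elim (fun i₁ => (k : K) * (c i₁ j : K) * x j ^ (k - 1))
      (fun i₂ => (n : K) * (b i₂ j : K) * x j ^ (n - 1)) i).rank = p + q) :
    IsNonsingZero (fun i => pairDeg k n (Sum.elim (fun _ => true) (fun _ => false) i))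
      (fun j => Sum.elim (fun i : Fin p => c i j) fun i : Fin q => b i j) x := by
  refine ⟨Sum.rec hc hb, ?_⟩
  rw [Fintype.card_sum, Fintype.card_fin, Fintype.card_fin, ← hr]
  congr 1
  ext (i | i) j <;> rfl

theorem exists_pos_solution_of_blocks {p q s k n : ℕ} (hp : p ≤ 1) (hq : q ≤ 1) (hn : 0 < n) (hnk : n < k)
    {c : Fin (p + 1) → Fin s → ℤ} {b : Fin (q + 1) → Fin s → ℤ} (hc0 : ∀ i j, c i j ≠ 0) (hb0 : ∀ i j, b i j ≠ 0)
    (hc : p = 1 → ∀ j j', j ≠ j' → c 0 j * c (Fin.last p) j' - c 0 j' * c (Fin.last p) j ≠ 0)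
    (hb : q = 1 → ∀ j j', j ≠ j' → b 0 j * b (Fin.last q) j' - b 0 j' * b (Fin.last q) j ≠ 0)
    {ι₂ : Type} [Fintype ι₂] [DecidableEq ι₂] (e₂ : ι₂ → Bool) (he₂ : ∀ x, if e₂ x then p = 1 else q = 1)
    (hD : (p + 1) * k + (q + 1) * n = k + n + ∑ x, pairDeg k n (e₂ x)) {t₁ t₂ m : ℕ} (ht₁ : 1 ≤ t₁) (ht₂ : 1 ≤ t₂)
    {M : ℕ → ℕ} (hM : Tendsto M atTop atTop) {Δ σ : ℝ} (h₁ : HasGoodSets (pairDeg k n) t₁ Δ fun W => (M W : ℝ) ^ 4)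
    (h₂ : HasGoodSets (fun x => pairDeg k n (e₂ x)) t₂ Δ fun W => (M W : ℝ) ^ 4)
    (h₃ : HasGoodSets (pairDeg k n) t₁ Δ fun W => (M W : ℝ) ^ 3)
    (hσ : 0 ≤ 16 * t₁ * σ + 3 * Δ) (hσ' : 16 * t₁ * σ + 3 * Δ < 1 / 80) (hΔ : 2 * Δ < σ * m)
    (hs : 88 * k + (2 * t₁ + (2 * t₂ + 2 * m)) ≤ s)
    (hreal : ∃ x : Fin s → ℝ, (∀ j, 0 < x j) ∧ (∀ i, ∑ j, (c i j : ℝ) * x j ^ k = 0) ∧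
      (∀ i, ∑ j, (b i j : ℝ) * x j ^ n = 0) ∧
      (Matrix.of fun (i : Fin (p + 1) ⊕ Fin (q + 1)) (j : Fin s) =>
        Sum.elim (fun i₁ => (k : ℝ) * (c i₁ j : ℝ) * x j ^ (k - 1))
          (fun i₂ => (n : ℝ) * (b i₂ j : ℝ) * x j ^ (n - 1)) i).rank = p + 1 + (q + 1))
    (hpadic : ∀ (l : ℕ) [Fact l.Prime], ∃ x : Fin s → ℚ_[l], (∀ i, ∑ j, (c i j : ℚ_[l]) * x j ^ k = 0) ∧
      (∀ i, ∑ j, (b i j : ℚ_[l]) * x j ^ n = 0) ∧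
      (Matrix.of fun (i : Fin (p + 1) ⊕ Fin (q + 1)) (j : Fin s) =>
        Sum.elim (fun i₁ => (k : ℚ_[l]) * (c i₁ j : ℚ_[l]) * x j ^ (k - 1))
          (fun i₂ => (n : ℚ_[l]) * (b i₂ j : ℚ_[l]) * x j ^ (n - 1)) i).rank = p + 1 + (q + 1)) :
    ∃ x : Fin s → ℤ, (∀ j, 0 < x j) ∧ (∀ i, ∑ j, c i j * x j ^ k = 0) ∧ ∀ i, ∑ j, b i j * x j ^ n = 0 := by
  set cls : Fin (p + 1) ⊕ Fin (q + 1) → Bool := Sum.elim (fun _ => true) fun _ => false with hcls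
  set a : Fin s → Fin (p + 1) ⊕ Fin (q + 1) → ℤ := fun j => Sum.elim (fun i => c i j) fun i => b i j with ha
  have hfin : ∀ {r : ℕ}, r ≤ 1 → ∀ i : Fin (r + 1), i = 0 ∨ i = Fin.last r := fun {r} hr i => by
    simp only [Fin.ext_iff, Fin.val_last, Fin.val_zero]; lia
  have hlast : ∀ {r : ℕ}, r ≤ 1 → ((0 : Fin (r + 1)) ≠ Fin.last r ↔ r = 1) := fun {r} hr => by
    simp only [ne_eq, Fin.ext_iff, Fin.val_last, Fin.val_zero]; lia
  have htrue : ClassMinors cls a true (.inl 0) (.inl (Fin.last p)) :=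
    ⟨by simpa [hcls] using hfin hp, fun h j j' hj => by
      have := hc ((hlast hp).1 (by simpa using h)) j j' hj
      simp only [ha, Sum.elim_inl]; rwa [mul_comm (c (Fin.last p) j)]⟩
  have hfalse : ClassMinors cls a false (.inr 0) (.inr (Fin.last q)) :=
    ⟨by simpa [hcls] using hfin hq, fun h j j' hj => by
      have := hb ((hlast hq).1 (by simpa using h)) j j' hj
      simp only [ha, Sum.elim_inr]; rwa [mul_comm (b (Fin.last q) j)]⟩
  obtain ⟨x, hx0, hx⟩ := exists_pos_solution_of_params (cls := cls) (a := a) hn hnk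
    (fun b => by cases b; exacts [⟨.inr 0, rfl⟩, ⟨.inl 0, rfl⟩]) (by simp only [Fintype.card_sum, Fintype.card_fin]; lia)
    (fun j => Sum.rec (fun i => hc0 i j) fun i => hb0 i j)
    (fun b => by cases b; exacts [⟨_, _, hfalse⟩, ⟨_, _, htrue⟩]) e₂
    (fun x => by
      have := he₂ x
      cases h : e₂ x
      · exact ⟨_, _, by simpa using (hlast hq).2 (by simpa [h] using this), hfalse⟩
      · exact ⟨_, _, by simpa using (hlast hp).2 (by simpa [h] using this), htrue⟩)
    (by rw [← hD]; simp [hcls, pairDeg]) ht₁ ht₂ hM h₁ h₂ h₃ hσ hσ' hΔ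
    (by simp only [Fintype.card_sum, Fintype.card_fin]; nlinarith)
    (by
      obtain ⟨x, h1, h2, h3, h4⟩ := hreal
      exact ⟨x, h1, isNonsingZero_sumElim h2 h3 h4⟩)
    (fun l _ => by
      obtain ⟨x, h2, h3, h4⟩ := hpadic l
      exact ⟨x, isNonsingZero_sumElim h2 h3 h4⟩)
  exact ⟨x, hx0, fun i => hx (.inl i), fun i => hx (.inr i)⟩

/-- Corollary 1.3 of Brandes–Parsell, the bounds
`G*(k,k,n) ≤ (6+o(1))k log k`, `G*(k,k,n,n) ≤ (8+o(1))k log k` and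
`G*(k,n,n) ≤ (4+o(1))k log k + 2n log n`: for every `ε > 0` and all large `k`,
highly non-singular systems of the indicated shapes with non-singular positive
real solutions and non-singular `p`-adic solutions for all `p` have solutions
in positive integers, provided `s` exceeds the stated bound. -/
theorem statement5 (ε : ℝ) (hε : 0 < ε) :
    ∃ k₀ : ℕ, ∀ k : ℕ, k₀ ≤ k → ∀ n : ℕ, 2 ≤ n → n < k →
    -- (i) two degree-k equations, one degree-n equation, s ≥ (6+ε) k log k
    ((∀ s : ℕ, ((6 + ε) * (k : ℝ) * Real.log k ≤ (s : ℝ)) →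
      ∀ (c : Fin 2 → Fin s → ℤ) (b : Fin s → ℤ),
      (∀ i j, c i j ≠ 0) → (∀ j, b j ≠ 0) →
      (∀ j₁ j₂ : Fin s, j₁ ≠ j₂ → c 0 j₁ * c 1 j₂ - c 0 j₂ * c 1 j₁ ≠ 0) →
      (∃ x : Fin s → ℝ, (∀ j, 0 < x j) ∧
        (∀ i : Fin 2, ∑ j, (c i j : ℝ) * x j ^ k = 0) ∧ (∑ j, (b j : ℝ) * x j ^ n = 0) ∧
        (Matrix.of fun (i : Fin 2 ⊕ Fin 1) (j : Fin s) =>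
          Sum.elim (fun i₁ : Fin 2 => (k : ℝ) * (c i₁ j : ℝ) * x j ^ (k - 1))
            (fun _ : Fin 1 => (n : ℝ) * (b j : ℝ) * x j ^ (n - 1)) i).rank = 3) →
      (∀ (p : ℕ) [Fact p.Prime], ∃ x : Fin s → ℚ_[p],
        (∀ i : Fin 2, ∑ j, (c i j : ℚ_[p]) * x j ^ k = 0) ∧
        (∑ j, (b j : ℚ_[p]) * x j ^ n = 0) ∧
        (Matrix.of fun (i : Fin 2 ⊕ Fin 1) (j : Fin s) =>
          Sum.elim (fun i₁ : Fin 2 => (k : ℚ_[p]) * (c i₁ j : ℚ_[p]) * x j ^ (k - 1))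
            (fun _ : Fin 1 => (n : ℚ_[p]) * (b j : ℚ_[p]) * x j ^ (n - 1)) i).rank = 3) →
      ∃ x : Fin s → ℤ, (∀ j, 0 < x j) ∧
        (∀ i : Fin 2, ∑ j, c i j * x j ^ k = 0) ∧ (∑ j, b j * x j ^ n = 0)))
    ∧
    -- (ii) two degree-k equations, two degree-n equations, s ≥ (8+ε) k log k
    (∀ s : ℕ, ((8 + ε) * (k : ℝ) * Real.log k ≤ (s : ℝ)) →
      ∀ (c : Fin 2 → Fin s → ℤ) (b : Fin 2 → Fin s → ℤ),
      (∀ i j, c i j ≠ 0) → (∀ i j, b i j ≠ 0) →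
      (∀ j₁ j₂ : Fin s, j₁ ≠ j₂ → c 0 j₁ * c 1 j₂ - c 0 j₂ * c 1 j₁ ≠ 0) →
      (∀ j₁ j₂ : Fin s, j₁ ≠ j₂ → b 0 j₁ * b 1 j₂ - b 0 j₂ * b 1 j₁ ≠ 0) →
      (∃ x : Fin s → ℝ, (∀ j, 0 < x j) ∧
        (∀ i : Fin 2, ∑ j, (c i j : ℝ) * x j ^ k = 0) ∧
        (∀ i : Fin 2, ∑ j, (b i j : ℝ) * x j ^ n = 0) ∧
        (Matrix.of fun (i : Fin 2 ⊕ Fin 2) (j : Fin s) =>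
          Sum.elim (fun i₁ : Fin 2 => (k : ℝ) * (c i₁ j : ℝ) * x j ^ (k - 1))
            (fun i₂ : Fin 2 => (n : ℝ) * (b i₂ j : ℝ) * x j ^ (n - 1)) i).rank = 4) →
      (∀ (p : ℕ) [Fact p.Prime], ∃ x : Fin s → ℚ_[p],
        (∀ i : Fin 2, ∑ j, (c i j : ℚ_[p]) * x j ^ k = 0) ∧
        (∀ i : Fin 2, ∑ j, (b i j : ℚ_[p]) * x j ^ n = 0) ∧
        (Matrix.of fun (i : Fin 2 ⊕ Fin 2) (j : Fin s) =>
          Sum.elim (fun i₁ : Fin 2 => (k : ℚ_[p]) * (c i₁ j : ℚ_[p]) * x j ^ (k - 1))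
            (fun i₂ : Fin 2 => (n : ℚ_[p]) * (b i₂ j : ℚ_[p]) * x j ^ (n - 1)) i).rank = 4) →
      ∃ x : Fin s → ℤ, (∀ j, 0 < x j) ∧
        (∀ i : Fin 2, ∑ j, c i j * x j ^ k = 0) ∧ (∀ i : Fin 2, ∑ j, b i j * x j ^ n = 0))
    ∧
    -- (iii) one degree-k equation, two degree-n equations, s ≥ (4+ε) k log k + 2 n log n
    (∀ s : ℕ, ((4 + ε) * (k : ℝ) * Real.log k + 2 * (n : ℝ) * Real.log n ≤ (s : ℝ)) →
      ∀ (b : Fin s → ℤ) (c : Fin 2 → Fin s → ℤ),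
      (∀ j, b j ≠ 0) → (∀ i j, c i j ≠ 0) →
      (∀ j₁ j₂ : Fin s, j₁ ≠ j₂ → c 0 j₁ * c 1 j₂ - c 0 j₂ * c 1 j₁ ≠ 0) →
      (∃ x : Fin s → ℝ, (∀ j, 0 < x j) ∧
        (∑ j, (b j : ℝ) * x j ^ k = 0) ∧
        (∀ i : Fin 2, ∑ j, (c i j : ℝ) * x j ^ n = 0) ∧
        (Matrix.of fun (i : Fin 1 ⊕ Fin 2) (j : Fin s) =>
          Sum.elim (fun _ : Fin 1 => (k : ℝ) * (b j : ℝ) * x j ^ (k - 1))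
            (fun i₂ : Fin 2 => (n : ℝ) * (c i₂ j : ℝ) * x j ^ (n - 1)) i).rank = 3) →
      (∀ (p : ℕ) [Fact p.Prime], ∃ x : Fin s → ℚ_[p],
        (∑ j, (b j : ℚ_[p]) * x j ^ k = 0) ∧
        (∀ i : Fin 2, ∑ j, (c i j : ℚ_[p]) * x j ^ n = 0) ∧
        (Matrix.of fun (i : Fin 1 ⊕ Fin 2) (j : Fin s) =>
          Sum.elim (fun _ : Fin 1 => (k : ℚ_[p]) * (b j : ℚ_[p]) * x j ^ (k - 1))
            (fun i₂ : Fin 2 => (n : ℚ_[p]) * (c i₂ j : ℚ_[p]) * x j ^ (n - 1)) i).rank = 3) →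
      ∃ x : Fin s → ℤ, (∀ j, 0 < x j) ∧
        (∑ j, b j * x j ^ k = 0) ∧ (∀ i : Fin 2, ∑ j, c i j * x j ^ n = 0)) := by
  obtain ⟨k₀, hk₀⟩ := eventually_atTop.1 (eventually_exists_params hε)
  refine ⟨k₀, fun k hk n hn hnk => ?_⟩
  obtain ⟨v₁, v₂, m, σ, μ, hσ, hσ', hm, hμ₁, hμ₂, hμ₃, hs₁, hs₂, hs₃⟩ := hk₀ k hk n hn hnk
  have hn0 : 0 < n := by lia
  have hk2 : 2 ≤ k := by lia
  have hpow : ∀ {e : ℕ}, e ≠ 0 → Tendsto (fun W : ℕ => W ^ e) atTop atTop := fun he => tendsto_pow_atTop he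
  have hM := hpow (e := k ^ v₁ * n ^ v₂) (by positivity)
  have hscale : ∀ (l : ℕ), (fun W : ℕ => (((W ^ (l * n ^ v₂) : ℕ) : ℝ)) ^ k ^ v₁) =
      fun W : ℕ => ((W ^ (k ^ v₁ * n ^ v₂) : ℕ) : ℝ) ^ l := fun l => by
    funext W; push_cast; rw [← pow_mul, ← pow_mul]; congr 1; ring
  have hscale' : (fun W : ℕ => (((W ^ (4 * k ^ v₁) : ℕ) : ℝ)) ^ n ^ v₂) =
      fun W : ℕ => ((W ^ (k ^ v₁ * n ^ v₂) : ℕ) : ℝ) ^ 4 := by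
    funext W; push_cast; rw [← pow_mul, ← pow_mul]; congr 1; ring
  have hpair : ∀ l, l ≠ 0 → HasGoodSets (pairDeg k n) (k + n + 1 + 2 * v₁) μ
      fun W : ℕ => ((W ^ (k ^ v₁ * n ^ v₂) : ℕ) : ℝ) ^ l := fun l hl => by
    rw [← hscale l]
    exact hasGoodSets_of_levelBlock (levelBlock_pair hn0 hnk) (by lia) le_rfl hk2 hμ₁ (by simp [pairDeg])
      (hpow (by positivity))
  have hsingle := hasGoodSets_of_levelBlock (levelBlock_single (d := k) (by lia)) (by lia) le_rfl hk2 hμ₂ (by simp)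
    (hpow (e := 4 * n ^ v₂) (by positivity))
  have hsingle' := hasGoodSets_of_levelBlock (levelBlock_single hn0) (by lia) le_rfl hn hμ₃ (by simp)
    (hpow (e := 4 * k ^ v₁) (by positivity))
  rw [hscale] at hsingle
  rw [hscale'] at hsingle'
  refine ⟨fun s hs c b hc hb hcm hreal hp => ?_, fun s hs c b hc hb hcm hbm hreal hp => ?_,
    fun s hs b c hb hc hcm hreal hp => ?_⟩
  · obtain ⟨x, hx0, hx, hx'⟩ := exists_pos_solution_of_blocks (c := c) (b := fun _ => b) le_rfl zero_le_one hn0 hnk hc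
      (fun _ => hb) (fun _ => hcm) (by simp) (fun _ : Unit => true) (by simp) (by simp [pairDeg]; ring) (by lia) (by lia) hM
      (hpair 4 (by simp)) hsingle (hpair 3 (by simp)) hσ hσ' hm (by exact_mod_cast hs₁.trans hs)
      (by
        obtain ⟨x, h1, h2, h3, h4⟩ := hreal
        exact ⟨x, h1, h2, fun _ => h3, h4⟩)
      (fun l _ => by
        obtain ⟨x, h2, h3, h4⟩ := hp l
        exact ⟨x, h2, fun _ => h3, h4⟩)
    exact ⟨x, hx0, hx, hx' 0⟩
  · exact exists_pos_solution_of_blocks le_rfl le_rfl hn0 hnk hc hb (fun _ => hcm) (fun _ => hbm) id (by simp)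
      (by simp [pairDeg]; ring) (by lia) (by lia) hM (hpair 4 (by simp)) (hpair 4 (by simp)) (hpair 3 (by simp)) hσ hσ' hm
      (by exact_mod_cast hs₂.trans hs) hreal hp
  · obtain ⟨x, hx0, hx, hx'⟩ := exists_pos_solution_of_blocks (c := fun _ => b) (b := c) zero_le_one le_rfl hn0 hnk
      (fun _ => hb) hc (by simp) (fun _ => hcm) (fun _ : Unit => false) (by simp) (by simp [pairDeg]; ring) (by lia) (by lia)
      hM (hpair 4 (by simp)) hsingle' (hpair 3 (by simp)) hσ hσ' hm (by exact_mod_cast hs₃.trans hs)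
      (by
        obtain ⟨x, h1, h2, h3, h4⟩ := hreal
        exact ⟨x, h1, fun _ => h2, h3, h4⟩)
      (fun l _ => by
        obtain ⟨x, h2, h3, h4⟩ := hp l
        exact ⟨x, fun _ => h2, h3, h4⟩)
    exact ⟨x, hx0, hx 0, hx'⟩
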